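/- There is a choice of a standard index-m form φ_{2,m} for every positive integer m such that, setting Φ_{2,m} := φ_{2,m} − A_{2,m} and Φ⁰_{2,m} := ∑_{d ≥ 1, d² | m} μ(d)·(Φ_{2,m/d²}|U_d) (equivalently, Φ_{2,m}(τ,z) = ∑_{d ≥ 1, d² | m} Φ⁰_{2,m/d²}(τ, dz) for all m), every Φ⁰_{2,m} has optimal growth, i.e. C_{Φ⁰_{2,m}}(Δ,ℓ) = 0 for all Δ < −1, and is primitive, i.e. Φ⁰_{2,m}|u_p = 0 for every prime p with p² | m. -/

import Mathlib

noncomputable section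

open Complex Filter Topology MeasureTheory
open scoped Classical

/-- `ee x = e^{2πix}`. -/
def ee (x : ℂ) : ℂ := Complex.exp (2 * (Real.pi : ℂ) * Complex.I * x)

/-- The index-`m` elliptic transformation law on `ℍ × ℂ`. -/
def EllipticLaw (m : ℕ) (φ : ℂ → ℂ → ℂ) : Prop :=
  ∀ τ : ℂ, 0 < τ.im → ∀ z : ℂ, ∀ lam mu : ℤ,
    φ τ (z + (lam : ℂ) * τ + (mu : ℂ)) =
      ee (-(m : ℂ) * ((lam : ℂ) ^ 2 * τ + 2 * (lam : ℂ) * z)) * φ τ z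

/-- The weight-`k` index-`m` modular transformation law on `ℍ × ℂ`. -/
def ModularLaw (k : ℤ) (m : ℕ) (φ : ℂ → ℂ → ℂ) : Prop :=
  ∀ τ : ℂ, 0 < τ.im → ∀ z : ℂ, ∀ a b c d : ℤ, a * d - b * c = 1 →
    φ (((a : ℂ) * τ + (b : ℂ)) / ((c : ℂ) * τ + (d : ℂ))) (z / ((c : ℂ) * τ + (d : ℂ))) =
      ((c : ℂ) * τ + (d : ℂ)) ^ k *
        ee ((m : ℂ) * (c : ℂ) * z ^ 2 / ((c : ℂ) * τ + (d : ℂ))) * φ τ z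

/-- The theta function `θ_{m,ℓ}(τ,z) = ∑_{r ≡ ℓ (mod 2m)} q^{r²/4m} y^r`. -/
def jTheta (m : ℕ) (l : ℤ) (τ z : ℂ) : ℂ :=
  ∑' n : ℤ, ee (((l : ℂ) + 2 * (m : ℂ) * (n : ℂ)) ^ 2 / (4 * (m : ℂ)) * τ +
      ((l : ℂ) + 2 * (m : ℂ) * (n : ℂ)) * z)

/-- The point `z_s = ατ + β` for `s = (α,β) ∈ ℚ²`. -/
def zpt (s : ℚ × ℚ) (τ : ℂ) : ℂ := (s.1 : ℚ) * τ + (s.2 : ℚ)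

/-- The Appell–Lerch sum `A_{2,m}(τ,z) = ∑_{s∈ℤ} q^{ms²+s}·y^{2ms+1}/(1-q^s y)²`. -/
def A2sum (m : ℕ) (τ z : ℂ) : ℂ :=
  ∑' s : ℤ, ee (((m : ℂ) * (s : ℂ) ^ 2 + (s : ℂ)) * τ + (2 * (m : ℂ) * (s : ℂ) + 1) * z) /
      (1 - ee ((s : ℂ) * τ + z)) ^ 2

/-- A standard index-`m` form: a function on `ℍ × ℂ` satisfying the weight-2 index-`m`
modular law and the index-`m` elliptic law, holomorphic away from `z ∈ ℤτ + ℤ`, and such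
that `z ↦ φ(τ,z) - (2πiz)^{-2}` extends holomorphically across `z = 0`. -/
def IsStandardForm (m : ℕ) (φ : ℂ → ℂ → ℂ) : Prop :=
  ModularLaw 2 m φ ∧ EllipticLaw m φ ∧
  (∀ τ : ℂ, 0 < τ.im → ∀ z : ℂ, (∀ lam mu : ℤ, z ≠ (lam : ℂ) * τ + (mu : ℂ)) →
    DifferentiableAt ℂ (fun p : ℂ × ℂ => φ p.1 p.2) (τ, z)) ∧
  (∀ τ : ℂ, 0 < τ.im → ∃ g : ℂ → ℂ, AnalyticAt ℂ g 0 ∧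
    ∀ᶠ z in 𝓝[≠] (0 : ℂ), φ τ z - 1 / (2 * (Real.pi : ℂ) * Complex.I * z) ^ 2 = g z)

/-- `C` is the Fourier coefficient data of the finite part `Φ = φ - A_{2,m}` of the
standard index-`m` form `φ`. -/
def IsFinitePartCoeffs (m : ℕ) (φ : ℂ → ℂ → ℂ) (C : ℤ → ℤ → ℂ) : Prop :=
  (∀ Δ l : ℤ, C Δ (l + 2 * (m : ℤ)) = C Δ l) ∧
  (∀ Δ l : ℤ, ¬ (4 * (m : ℤ)) ∣ (Δ + l ^ 2) → C Δ l = 0) ∧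
  (∀ τ : ℂ, 0 < τ.im → ∀ z : ℂ, (∀ lam mu : ℤ, z ≠ (lam : ℂ) * τ + (mu : ℂ)) →
    HasSum (fun p : ℤ × ℤ => C (4 * (m : ℤ) * p.1 - p.2 ^ 2) p.2 *
      ee ((p.1 : ℂ) * τ + (p.2 : ℂ) * z)) (φ τ z - A2sum m τ z))

/-- The coefficients of the primitive form
`Φ⁰_{2,m} = ∑_{d² ∣ m} μ(d)·(Φ_{2,m/d²}|U_d)`, built from a family `Cfam` where `Cfam m'`
is the finite-part coefficient data of a standard index-`m'` form: at the level of
`C(Δ,ℓ)`-coefficients, `C_{Φ|U_d}(Δ,ℓ) = C_Φ(Δ/d², ℓ/d)` if `d ∣ ℓ` and `d² ∣ Δ`, else 0. -/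
def primC0 (m : ℕ) (Cfam : ℕ → ℤ → ℤ → ℂ) : ℤ → ℤ → ℂ :=
  fun Δ l => ∑ d ∈ m.divisors,
    if d ^ 2 ∣ m ∧ (d : ℤ) ∣ l ∧ ((d : ℤ)) ^ 2 ∣ Δ then
      ((ArithmeticFunction.moebius d : ℤ) : ℂ) *
        Cfam (m / d ^ 2) (Δ / (d : ℤ) ^ 2) (l / (d : ℤ))
    else 0

open Finset (range sum_congr mul_sum mem_range sum_mul sum_eq_zero sum_range_succ mem_filter sum_comm Icc mem_Icc sum_add_distrib sum_eq_single sum_range_succ' mem_erase mem_product sum_range sum_range_reflect sum_sub_distrib sum_const card_range add_sum_erase sum_insert sum_const_zero finite_toSet univ sum_filter disjoint_insert_right mem_insert HasAntidiagonal mem_coe coe_filter mem_toList)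
open Int (mul_ediv_cancel_left toNat_of_nonneg natCast_dvd_natCast induction_on divModEquiv cast_natCast cast_smul_eq_zsmul even_or_odd' eq_ofNat_of_zero_le emod_nonneg emod_lt_of_pos neg_ediv_of_dvd eq_zero_of_abs_lt_dvd mul_ediv_cancel abs_lt_one_iff)
open Function (Injective comp comp_def)
open Real (exp_pos pi_pos exp_le_exp pi_ne_zero add_one_le_exp exp_lt_one_iff lt_sqrt norm_eq_abs one_le_exp)
open Metric (ball isOpen_ball mem_ball_self mem_ball ball_mem_nhds)
open Submodule (smul_mem span span_le subset_span mem_sup_right mem_sup_left)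
open Nat (cast_zero Coprime prime_iff_prime_int cast_one le_of_dvd mem_primeFactors mem_divisors succ_eq_add_one strong_induction_on abs_cast div_eq_of_eq_mul_left cast_add coprime_primes exists_eq_succ_of_ne_zero reduceAdd reduceSub prime_two isCoprime_iff_coprime eq_of_mul_eq_mul_left cast_succ cast_sub ModEq mod_eq_of_lt pos_of_dvd_of_pos)
open ZMod (intCast_zmod_eq_zero_iff_dvd val_lt natCast_val cast_id' val_cast_of_lt)
open ArithmeticFunction (moebius)
open List (mem_cons_self mem_cons_of_mem)
open PowerSeries (coeff_mk coeff_mul coeff_X_pow_mul)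
open Matrix (det_fin_two)
open Set (Iic uIcc mem_univ mem_setOf_eq)
variable {m d p q M E : ℕ} {τ z w : ℂ} {c : ℤ × ℤ → ℂ} {C : ℤ → ℤ → ℂ} {f g : ℂ → ℂ → ℂ} {r k N l n a b qi : ℤ} {L : List ℕ} {Gf : (ℤ → ℤ → ℂ) →ₗ[ℂ] ℂ} {v : ℤ → ℂ} {P : Set (ℤ → ℂ)} {Q : (ℤ × ℤ → ℂ) → Prop} {F : ℕ → ℤ → ℤ → ℂ}
lemma ee_add (x y : ℂ) : ee (x + y) = ee x * ee y := by
  unfold ee; rw [← exp_add]; ring_nf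
lemma ee_zero : ee 0 = 1 := by simp [ee]
lemma ee_int (n : ℤ) : ee n = 1 := by
  unfold ee; rw [exp_eq_one_iff]; exact ⟨n, by ring⟩
lemma ee_ne (x : ℂ) : ee x ≠ 0 := Complex.exp_ne_zero _
lemma ee_neg (x : ℂ) : ee (-x) = (ee x)⁻¹ := by
  unfold ee; rw [← exp_neg]; ring_nf
lemma ee_add_int (x : ℂ) (n : ℤ) : ee (x + n) = ee x := by rw [ee_add, ee_int, mul_one]
lemma ee_congr {x y : ℂ} (n : ℤ) (h : x = y + n) : ee x = ee y := by rw [h, ee_add_int]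
lemma ee_pow (x : ℂ) (n : ℕ) : ee x ^ n = ee (n * x) := by
  unfold ee; rw [← Complex.exp_nat_mul]; ring_nf
lemma ee_zpow (x : ℂ) (n : ℤ) : ee x ^ n = ee (n * x) := by
  unfold ee; rw [← Complex.exp_int_mul]; ring_nf
lemma norm_ee (x : ℂ) : ‖ee x‖ = Real.exp (-(2 * Real.pi * x.im)) := by
  unfold ee; rw [Complex.norm_exp]; congr 1
  simp [Complex.mul_re, Complex.mul_im]
lemma differentiable_ee : Differentiable ℂ ee := by unfold ee; fun_prop
lemma hasDerivAt_ee (x : ℂ) : HasDerivAt ee (2 * Real.pi * I * ee x) x := by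
  unfold ee
  have := ((hasDerivAt_id x).const_mul (2 * (Real.pi : ℂ) * I)).cexp
  simpa [mul_comm] using this
def mon (p : ℤ × ℤ) (τ z : ℂ) : ℂ := ee (p.1 * τ + p.2 * z)
def fser (c : ℤ × ℤ → ℂ) (τ z : ℂ) : ℂ := ∑' p : ℤ × ℤ, c p * mon p τ z
def Conv (c : ℤ × ℤ → ℂ) : Prop :=
  ∀ τ : ℂ, 0 < τ.im → ∀ z : ℂ, Summable (fun p : ℤ × ℤ => c p * mon p τ z)
lemma Conv.hasSum (h : Conv c) (hτ : 0 < τ.im) (z : ℂ) :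
    HasSum (fun p : ℤ × ℤ => c p * mon p τ z) (fser c τ z) := (h τ hτ z).hasSum
lemma norm_mon (p : ℤ × ℤ) (τ z : ℂ) :
    ‖mon p τ z‖ = Real.exp (-(2 * Real.pi * (p.1 * τ.im + p.2 * z.im))) := by
  unfold mon; rw [norm_ee]; simp
lemma exp_abs_le (x y : ℝ) : Real.exp (|x| + |y|) ≤
    Real.exp (x + y) + Real.exp (x - y) + Real.exp (-x + y) + Real.exp (-x - y) := by
  have h1 := exp_pos (x + y)
  have h2 := exp_pos (x - y)
  have h3 := exp_pos (-x + y)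
  have h4 := exp_pos (-x - y)
  rcases abs_cases x with ⟨hx, _⟩ | ⟨hx, _⟩ <;> rcases abs_cases y with ⟨hy, _⟩ | ⟨hy, _⟩ <;>
    rw [hx, hy] <;> simp only [sub_eq_add_neg] at * <;> linarith
lemma Conv.bound (h : Conv c) {τ₀ : ℂ} (hτ : 0 < τ₀.im) (z₀ : ℂ) :
    ∃ ε : ℝ, 0 < ε ∧ ∃ u : ℤ × ℤ → ℝ, Summable u ∧ (∀ w : ℂ × ℂ, dist w (τ₀, z₀) < ε → 0 < w.1.im) ∧
      ∀ w : ℂ × ℂ, dist w (τ₀, z₀) < ε → ∀ p : ℤ × ℤ,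
        ‖c p‖ * (1 + |(p.1 : ℝ)| + |(p.2 : ℝ)|) * ‖mon p w.1 w.2‖ ≤ u p := by
  obtain ⟨ε, hε, hε4⟩ : ∃ ε : ℝ, 0 < ε ∧ 4 * ε = τ₀.im := ⟨τ₀.im / 4, by linarith, by ring⟩
  have hpi := pi_pos
  set K : ℝ := 1 + 1 / (2 * Real.pi * ε) with hK
  have hK0 : 0 < K := by positivity
  have hc : ∀ s t : ℝ, |s| ≤ 2 * ε → Summable (fun p : ℤ × ℤ =>
      ‖c p * mon p (τ₀ + s * I) (z₀ + t * I)‖) := by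
    intro s t hs
    refine (h _ ?_ _).norm
    simp; have := neg_abs_le s; linarith
  have a1 : |2 * ε| ≤ 2 * ε := (abs_of_pos (by linarith)).le
  have a2 : |-(2 * ε)| ≤ 2 * ε := by rw [abs_neg]; exact a1
  refine ⟨ε, hε, fun p => K * (‖c p * mon p (τ₀ + (2*ε:ℝ) * I) (z₀ + (2*ε:ℝ) * I)‖ +
    ‖c p * mon p (τ₀ + (2*ε:ℝ) * I) (z₀ + (-(2*ε):ℝ) * I)‖ +
    ‖c p * mon p (τ₀ + (-(2*ε):ℝ) * I) (z₀ + (2*ε:ℝ) * I)‖ +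
    ‖c p * mon p (τ₀ + (-(2*ε):ℝ) * I) (z₀ + (-(2*ε):ℝ) * I)‖), ?_, ?_, ?_⟩
  · exact ((((hc _ _ a1).add (hc _ _ a1)).add (hc _ _ a2)).add (hc _ _ a2)).mul_left K
  · intro w hw
    have h1 : dist w.1 τ₀ < ε := lt_of_le_of_lt (le_max_left _ _) hw
    have h2 : |(w.1 - τ₀).im| ≤ dist w.1 τ₀ := by rw [dist_eq_norm]; exact abs_im_le_norm _
    rw [sub_im] at h2
    have := (abs_le.1 h2).1
    linarith
  · intro w hw p
    have h1 : dist w.1 τ₀ < ε := lt_of_le_of_lt (le_max_left _ _) hw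
    have h1' : dist w.2 z₀ < ε := lt_of_le_of_lt (le_max_right _ _) hw
    have h2 : |(w.1 - τ₀).im| ≤ ε := by
      rw [dist_eq_norm] at h1; exact (abs_im_le_norm _).trans h1.le
    have h2' : |(w.2 - z₀).im| ≤ ε := by
      rw [dist_eq_norm] at h1'; exact (abs_im_le_norm _).trans h1'.le
    rw [sub_im] at h2 h2'
    simp only [norm_mul, norm_mon]
    set A : ℝ := (p.1 : ℝ)
    set B : ℝ := (p.2 : ℝ)
    set E0 : ℝ := Real.exp (-(2 * Real.pi * (A * τ₀.im + B * z₀.im)))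
    have e1 : Real.exp (-(2 * Real.pi * (A * w.1.im + B * w.2.im))) ≤
        E0 * Real.exp (2 * Real.pi * ε * (|A| + |B|)) := by
      rw [← Real.exp_add]; apply exp_le_exp.2
      have k1 : -(A * (w.1.im - τ₀.im)) ≤ |A| * ε := by
        refine (neg_le_abs _).trans ?_
        rw [abs_mul]; exact mul_le_mul_of_nonneg_left h2 (abs_nonneg _)
      have k2 : -(B * (w.2.im - z₀.im)) ≤ |B| * ε := by
        refine (neg_le_abs _).trans ?_
        rw [abs_mul]; exact mul_le_mul_of_nonneg_left h2' (abs_nonneg _)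
      nlinarith
    have e2 : 1 + |A| + |B| ≤ K * Real.exp (2 * Real.pi * ε * (|A| + |B|)) := by
      have hx : 0 ≤ 2 * Real.pi * ε * (|A| + |B|) := by positivity
      have := add_one_le_exp (2 * Real.pi * ε * (|A| + |B|))
      have h3 : |A| + |B| ≤ 1 / (2 * Real.pi * ε) * Real.exp (2 * Real.pi * ε * (|A| + |B|)) := by
        rw [div_mul_eq_mul_div, le_div_iff₀ (by positivity)]; nlinarith
      rw [hK, add_mul]; linarith
    have e3 := exp_abs_le (4 * Real.pi * ε * A) (4 * Real.pi * ε * B)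
    have e4 : Real.exp (2 * Real.pi * ε * (|A| + |B|)) * Real.exp (2 * Real.pi * ε * (|A| + |B|)) =
        Real.exp (|4 * Real.pi * ε * A| + |4 * Real.pi * ε * B|) := by
      rw [← Real.exp_add, abs_mul, abs_mul _ B, abs_of_pos (by positivity : 0 < 4 * Real.pi * ε)]
      congr 1; ring
    have q : ∀ s t : ℝ, Real.exp (-(2 * Real.pi * (A * (τ₀ + (s:ℂ) * I).im + B * (z₀ + (t:ℂ) * I).im)))
        = E0 * Real.exp (-(2 * Real.pi) * (A * s + B * t)) := by
      intro s t; rw [← Real.exp_add]; congr 1; simp; ring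
    rw [q, q, q, q]
    calc ‖c p‖ * (1 + |A| + |B|) * Real.exp (-(2 * Real.pi * (A * w.1.im + B * w.2.im)))
        ≤ ‖c p‖ * (K * Real.exp (2 * Real.pi * ε * (|A| + |B|))) *
          (E0 * Real.exp (2 * Real.pi * ε * (|A| + |B|))) := by gcongr
      _ = K * ‖c p‖ * E0 * Real.exp (|4 * Real.pi * ε * A| + |4 * Real.pi * ε * B|) := by
          rw [← e4]; ring
      _ ≤ K * ‖c p‖ * E0 * _ := by
          apply mul_le_mul_of_nonneg_left e3; positivity
      _ = _ := by
          ring_nf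
lemma Conv.differentiableAt (h : Conv c) {τ₀ : ℂ} (hτ : 0 < τ₀.im) (z₀ : ℂ) :
    DifferentiableAt ℂ (fun w : ℂ × ℂ => fser c w.1 w.2) (τ₀, z₀) := by
  obtain ⟨ε, hε, u, hu, hpos, hb⟩ := h.bound hτ z₀
  let f' : ℤ × ℤ → ℂ × ℂ → (ℂ × ℂ →L[ℂ] ℂ) := fun p w =>
    (c p * (2 * Real.pi * I * mon p w.1 w.2)) •
      ((p.1 : ℂ) • ContinuousLinearMap.fst ℂ ℂ ℂ + (p.2 : ℂ) • ContinuousLinearMap.snd ℂ ℂ ℂ)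
  have key := hasFDerivAt_tsum_of_isPreconnected (𝕜 := ℂ) (E := ℂ × ℂ) (F := ℂ)
    (f := fun (p : ℤ × ℤ) w => c p * mon p w.1 w.2) (f' := f')
    (u := fun p => 2 * Real.pi * u p) (s := ball (τ₀, z₀) ε) (x₀ := (τ₀, z₀))
    (x := (τ₀, z₀)) (hu.mul_left _) isOpen_ball
    ((convex_ball (τ₀, z₀) ε).isPreconnected) ?_ ?_ (mem_ball_self hε)
    (h _ hτ _) (mem_ball_self hε)
  · exact key.differentiableAt
  · intro p w _
    have h1 : HasFDerivAt (fun w : ℂ × ℂ => (p.1 : ℂ) * w.1 + (p.2 : ℂ) * w.2)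
        ((p.1 : ℂ) • ContinuousLinearMap.fst ℂ ℂ ℂ + (p.2 : ℂ) • ContinuousLinearMap.snd ℂ ℂ ℂ) w :=
      (hasFDerivAt_fst.const_mul _).add (hasFDerivAt_snd.const_mul _)
    have h2 := ((hasDerivAt_ee _).comp_hasFDerivAt w h1).const_mul (c p)
    simp only [smul_smul] at h2
    exact h2
  · intro p w hw
    have := hb w (mem_ball.1 hw) p
    have hn : ‖((p.1 : ℂ) • ContinuousLinearMap.fst ℂ ℂ ℂ + (p.2 : ℂ) • ContinuousLinearMap.snd ℂ ℂ ℂ)‖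
        ≤ 1 + |(p.1 : ℝ)| + |(p.2 : ℝ)| := by
      refine (norm_add_le _ _).trans ?_
      rw [norm_smul, norm_smul]
      have h1 := ContinuousLinearMap.norm_fst_le ℂ ℂ ℂ
      have h2 := ContinuousLinearMap.norm_snd_le ℂ ℂ ℂ
      simp only [norm_intCast]
      have := mul_le_mul_of_nonneg_left h1 (abs_nonneg (p.1 : ℝ))
      have := mul_le_mul_of_nonneg_left h2 (abs_nonneg (p.2 : ℝ))
      linarith
    simp only [f', norm_smul, norm_mul]
    have e : ‖(2:ℂ)‖ * ‖(Real.pi : ℂ)‖ * ‖I‖ = 2 * Real.pi := by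
      simp [abs_of_pos pi_pos]
    rw [e]
    calc _ ≤ ‖c p‖ * (2 * Real.pi * ‖mon p w.1 w.2‖) * (1 + |(p.1 : ℝ)| + |(p.2 : ℝ)|) := by gcongr
      _ = 2 * Real.pi * (‖c p‖ * (1 + |(p.1 : ℝ)| + |(p.2 : ℝ)|) * ‖mon p w.1 w.2‖) := by ring
      _ ≤ _ := by gcongr
lemma coeff_integral {c : ℤ → ℂ} {F : ℝ → ℂ} 
    (h : ∀ u : ℝ, HasSum (fun k : ℤ => c k * ee (k * (w + u))) (F u)) (k : ℤ) :
    c k = ∫ u in (0:ℝ)..1, F u * ee (-k * (w + u)) := by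
  have hs : Summable fun j : ℤ => ‖c j * ee (j * w)‖ := by
    have := (h 0).summable.norm; simpa using this
  have hn : ∀ (j : ℤ) (u : ℝ), ‖c j * ee (j * (w + u))‖ = ‖c j * ee (j * w)‖ := by
    intro j u; rw [norm_mul, norm_mul, norm_ee, norm_ee]; simp
  have hF : ∀ u : ℝ, HasSum (fun j : ℤ => c j * ee (j * (w + u)) * ee (-k * (w + u)))
      (F u * ee (-k * (w + u))) := fun u => (h u).mul_right _
  have hcont : ∀ j : ℤ, Continuous fun u : ℝ => c j * ee (j * (w + u)) * ee (-k * (w + u)) := by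
    intro j; have := differentiable_ee.continuous; fun_prop
  have key := intervalIntegral.hasSum_integral_of_dominated_convergence (a := 0) (b := 1)
    (μ := volume) (F := fun (j : ℤ) (u : ℝ) => c j * ee (j * (w + u)) * ee (-k * (w + u)))
    (f := fun u => F u * ee (-k * (w + u)))
    (fun j _ => ‖c j * ee (j * w)‖ * ‖ee (-k * w)‖)
    (fun j => (hcont j).aestronglyMeasurable) ?_ ?_ ?_ ?_
  · refine HasSum.unique ?_ key
    have : ∀ j : ℤ, (∫ u in (0:ℝ)..1, c j * ee (j * (w + u)) * ee (-k * (w + u))) =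
        if j = k then c k else 0 := by
      intro j
      split_ifs with hj
      · subst hj
        have : ∀ u : ℝ, c j * ee (j * (w + u)) * ee (-j * (w + u)) = c j := by
          intro u; rw [mul_assoc, ← ee_add]; ring_nf; rw [ee_zero, mul_one]
        simp only [this]; simp
      · have e1 : ∀ u : ℝ, c j * ee (j * (w + u)) * ee (-k * (w + u)) =
            c j * ee ((j - k) * w) * exp ((2 * Real.pi * I * (j - k)) * u) := by
          intro u
          rw [mul_assoc, ← ee_add, mul_assoc]; congr 1
          have : exp ((2 * Real.pi * I * (j - k)) * u) = ee ((j - k) * u) := by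
            unfold ee; ring_nf
          rw [this, ← ee_add]; congr 1; ring
        have hjk : (j : ℂ) - k ≠ 0 := sub_ne_zero.2 (by exact_mod_cast hj)
        have h0 : (2 * Real.pi * I * ((j : ℂ) - k)) ≠ 0 := by
          have : (Real.pi : ℂ) ≠ 0 := by exact_mod_cast pi_ne_zero
          simp [this, hjk]
        simp only [e1]
        rw [intervalIntegral.integral_const_mul, integral_exp_mul_complex h0]
        have : exp (2 * Real.pi * I * ((j : ℂ) - k) * (1 : ℝ)) = 1 := by
          have := ee_int (j - k); unfold ee at this; push_cast at this; simpa using this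
        rw [this]; simp
    simp only [this]
    exact hasSum_ite_eq k (c k)
  · intro j
    refine Eventually.of_forall fun u _ => ?_
    rw [norm_mul, hn]
    have : ‖ee (-k * (w + u))‖ = ‖ee (-k * w)‖ := by rw [norm_ee, norm_ee]; simp
    rw [this]
  · exact Eventually.of_forall fun u _ => hs.mul_right _
  · simp
  · exact Eventually.of_forall fun u _ => hF u
lemma coeff_unique {c d : ℤ → ℂ} {F : ℝ → ℂ} 
    (h : ∀ u : ℝ, HasSum (fun k : ℤ => c k * ee (k * (w + u))) (F u))
    (h' : ∀ u : ℝ, HasSum (fun k : ℤ => d k * ee (k * (w + u))) (F u)) : c = d := by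
  funext k; rw [coeff_integral h, coeff_integral h']
def SLaw (k : ℤ) (m : ℕ) (f : ℂ → ℂ → ℂ) : Prop :=
  ∀ τ : ℂ, 0 < τ.im → ∀ z : ℂ, f (-1 / τ) (z / τ) = τ ^ k * ee (m * z ^ 2 / τ) * f τ z
def TLaw (f : ℂ → ℂ → ℂ) : Prop := ∀ τ : ℂ, 0 < τ.im → ∀ z : ℂ, f (τ + 1) z = f τ z
lemma ne_of_im (h : 0 < τ.im) : τ ≠ 0 := by rintro rfl; simp at h
lemma den_ne (h : 0 < τ.im) {c d : ℤ} (hcd : ¬ (c = 0 ∧ d = 0)) : (c : ℂ) * τ + d ≠ 0 := by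
  intro h0
  have h1 := congrArg im h0
  have h2 := congrArg re h0
  simp at h1 h2
  have hc : c = 0 := by
    rcases h1 with h1 | h1
    · exact h1
    · exact absurd h1 h.ne'
  subst hc; simp at h2; exact hcd ⟨rfl, h2⟩
lemma mob_im (h : 0 < τ.im) {c d : ℤ} (hd : a * d - b * c = 1) :
    0 < (((a : ℂ) * τ + b) / ((c : ℂ) * τ + d)).im := by
  have hne : (c : ℂ) * τ + d ≠ 0 := den_ne h (by rintro ⟨rfl, rfl⟩; simp at hd)
  have hN := normSq_pos.2 hne
  have hd' : (a : ℝ) * d - b * c = 1 := by exact_mod_cast hd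
  rw [div_im]
  have : (((a:ℂ) * τ + b).im * ((c:ℂ) * τ + d).re / normSq ((c:ℂ) * τ + d) -
      ((a:ℂ) * τ + b).re * ((c:ℂ) * τ + d).im / normSq ((c:ℂ) * τ + d)) =
      τ.im / normSq ((c:ℂ) * τ + d) := by
    rw [← sub_div]; congr 1; simp; linear_combination τ.im * hd'
  rw [this]; positivity
lemma neg_inv_im (h : 0 < τ.im) : 0 < (-1 / τ).im := by
  have := mob_im h (a := 0) (b := -1) (c := 1) (d := 0) (by norm_num)
  simpa using this
def MLaw (k : ℤ) (m : ℕ) (f : ℂ → ℂ → ℂ) (a b c d : ℤ) : Prop :=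
  ∀ τ : ℂ, 0 < τ.im → ∀ z : ℂ,
    f (((a : ℂ) * τ + (b : ℂ)) / ((c : ℂ) * τ + (d : ℂ))) (z / ((c : ℂ) * τ + (d : ℂ))) =
      ((c : ℂ) * τ + (d : ℂ)) ^ k * ee ((m : ℂ) * (c : ℂ) * z ^ 2 / ((c : ℂ) * τ + (d : ℂ))) * f τ z
lemma MLaw.mul {c d a' b' c' d' : ℤ} (hg : MLaw k m f a b c d)
    (hh : MLaw k m f a' b' c' d') (e : a * d - b * c = 1) (e' : a' * d' - b' * c' = 1) :
    MLaw k m f (a * a' + b * c') (a * b' + b * d') (c * a' + d * c') (c * b' + d * d') := by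
  intro τ hτ z
  have h1 := hh τ hτ z
  have him := mob_im hτ e'
  have hd : (c' : ℂ) * τ + d' ≠ 0 := den_ne hτ (by rintro ⟨rfl, rfl⟩; simp at e')
  have h2 := hg _ him (z / (c' * τ + d'))
  rw [h1] at h2
  have hd2 := den_ne him (c := c) (d := d) (by rintro ⟨rfl, rfl⟩; simp at e)
  have dh' : (a' : ℂ) * d' - b' * c' = 1 := by exact_mod_cast e'
  push_cast
  have hprod : ((c:ℂ) * a' + d * c') * τ + (c * b' + d * d') =
      (c * ((a' * τ + b') / (c' * τ + d')) + d) * (c' * τ + d') := by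
    field_simp; ring
  have ht : (((a:ℂ) * a' + b * c') * τ + (a * b' + b * d')) =
      (a * ((a' * τ + b') / (c' * τ + d')) + b) * (c' * τ + d') := by
    field_simp; ring
  rw [hprod, ht, mul_div_mul_right _ _ hd, mul_comm (c * (((a':ℂ) * τ + b') / (c' * τ + d')) + d),
    ← div_div, h2, mul_zpow]
  have : ee (m * (c * a' + d * c') * z ^ 2 / ((c' * τ + d') * (c * ((a' * τ + b') / (c' * τ + d')) + d))) =
    ee (m * c * (z / (c' * τ + d')) ^ 2 / (c * ((a' * τ + b') / (c' * τ + d')) + d)) *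
      ee (m * c' * z ^ 2 / (c' * τ + d')) := by
    rw [← ee_add]; congr 1
    have hE' : ((c:ℂ) * ((a' * τ + b') / (c' * τ + d')) + d) * (c' * τ + d') = c * (a' * τ + b') + d * (c' * τ + d') := by
      rw [add_mul, mul_assoc, div_mul_cancel₀ _ hd]
    have h5 : (a':ℂ) * (c' * τ + d') - c' * (a' * τ + b') = 1 := by linear_combination dh'
    generalize (c:ℂ) * ((a' * τ + b') / (c' * τ + d')) + d = E at *
    generalize (c':ℂ) * τ + d' = D at *
    generalize (a':ℂ) * τ + b' = A at *
    field_simp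
    linear_combination m * z ^ 2 * (-(c':ℂ)) * hE' + m * z ^ 2 * c * h5
  rw [this]; ring
lemma MLaw.inv {c d : ℤ} (hg : MLaw k m f a b c d)
    (e : a * d - b * c = 1) : MLaw k m f d (-b) (-c) a := by
  intro τ hτ z
  have e' : d * a - (-b) * (-c) = 1 := by linarith
  have hi := mob_im hτ e'
  have hd : ((-c : ℤ) : ℂ) * τ + a ≠ 0 := den_ne hτ (by rintro ⟨h1, rfl⟩; simp at h1; simp [h1] at e)
  have h1 := hg _ hi (z / (((-c : ℤ) : ℂ) * τ + a))
  have dg : (a : ℂ) * d - b * c = 1 := by exact_mod_cast e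
  push_cast at *
  have e1 : (c:ℂ) * ((d * τ + -b) / (-c * τ + a)) + d = 1 / (-c * τ + a) := by
    rw [mul_div_assoc', div_add' _ _ _ hd, div_left_inj' hd]; linear_combination dg
  have e2 : (a:ℂ) * ((d * τ + -b) / (-c * τ + a)) + b = τ / (-c * τ + a) := by
    rw [mul_div_assoc', div_add' _ _ _ hd, div_left_inj' hd]; linear_combination τ * dg
  rw [e1, e2] at h1
  generalize -(c:ℂ) * τ + a = D at *
  rw [div_div_div_cancel_right₀ hd, div_one, div_div, mul_one_div_cancel hd, div_one] at h1
  rw [h1]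
  have : ee (m * -c * z ^ 2 / D) * ee (m * c * (z / D) ^ 2 / (1 / D)) = 1 := by
    rw [← ee_add, ee_congr 0, ee_zero]; field_simp; push_cast; ring
  have h3 : D ^ k * (1 / D) ^ k = 1 := by rw [← mul_zpow, mul_one_div_cancel hd, one_zpow]
  linear_combination (-f ((d * τ + -b) / D) (z / D)) * (this * (D ^ k * (1 / D) ^ k) + h3)
lemma modular_of_ST (hS : SLaw k m f) (hT : TLaw f) :
    ModularLaw k m f := by
  have hdet : ∀ g : Matrix.SpecialLinearGroup (Fin 2) ℤ, g 0 0 * g 1 1 - g 0 1 * g 1 0 = 1 := by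
    intro g; have := g.det_coe; rwa [det_fin_two] at this
  have hall : ∀ g : Matrix.SpecialLinearGroup (Fin 2) ℤ, MLaw k m f (g 0 0) (g 0 1) (g 1 0) (g 1 1) := by
    intro g
    have hg : g ∈ Subgroup.closure {ModularGroup.S, ModularGroup.T} := by
      simp [SpecialLinearGroup.SL2Z_generators]
    induction hg using Subgroup.closure_induction with
    | mem x hx =>
      rcases hx with rfl | rfl
      · intro τ hτ z
        have := hS τ hτ z
        simpa [ModularGroup.S] using this
      · intro τ hτ z
        have := hT τ hτ z
        simpa [ModularGroup.T, ee_zero] using this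
    | one => intro τ _ z; simp [ee_zero]
    | mul x y _ _ hx hy =>
      have := hx.mul hy (hdet x) (hdet y)
      simpa [Matrix.SpecialLinearGroup.coe_mul, Matrix.mul_apply, Fin.sum_univ_two] using this
    | inv x _ hx =>
      have := hx.inv (hdet x)
      simpa [Matrix.SpecialLinearGroup.SL2_inv_expl] using this
  intro τ hτ z a b c d hd
  have := hall ⟨!![a, b; c, d], by rw [det_fin_two]; simpa using hd⟩ τ hτ z
  simpa using this
structure SymC (m : ℕ) (c : ℤ × ℤ → ℂ) : Prop where
  conv : Conv c
  ell : ∀ n r : ℤ, c (n + r + m, r + 2 * m) = c (n, r)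
  even : ∀ n r : ℤ, c (n, -r) = c (n, r)
  low : ∃ n0 : ℤ, ∀ n r : ℤ, n < n0 → c (n, r) = 0
structure IsJ (k : ℤ) (m : ℕ) (c : ℤ × ℤ → ℂ) : Prop extends SymC m c where
  S : SLaw k m (fser c)
lemma Conv.add {d : ℤ × ℤ → ℂ} (hc : Conv c) (hd : Conv d) : Conv (c + d) := fun τ hτ z => by
  simpa [add_mul] using (hc τ hτ z).add (hd τ hτ z)
lemma Conv.smul (hc : Conv c) (a : ℂ) : Conv (a • c) := fun τ hτ z => by
  simpa [mul_assoc] using (hc τ hτ z).mul_left a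
lemma fser_add {d : ℤ × ℤ → ℂ} (hc : Conv c) (hd : Conv d) (hτ : 0 < τ.im) (z : ℂ) :
    fser (c + d) τ z = fser c τ z + fser d τ z := by
  unfold fser; rw [← (hc τ hτ z).tsum_add (hd τ hτ z)]; simp [add_mul]
lemma fser_smul (a : ℂ) (τ z : ℂ) : fser (a • c) τ z = a * fser c τ z := by
  unfold fser; rw [← tsum_mul_left]; simp [mul_assoc]
lemma SymC.add {d : ℤ × ℤ → ℂ} (hc : SymC m c) (hd : SymC m d) : SymC m (c + d) where
  conv := hc.conv.add hd.conv
  ell n r := by simp [hc.ell, hd.ell]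
  even n r := by simp [hc.even, hd.even]
  low := by
    obtain ⟨a, ha⟩ := hc.low; obtain ⟨b, hb⟩ := hd.low
    exact ⟨min a b, fun n r h => by
      simp [ha n r (lt_of_lt_of_le h (min_le_left _ _)), hb n r (lt_of_lt_of_le h (min_le_right _ _))]⟩
lemma SymC.smul (hc : SymC m c) (a : ℂ) : SymC m (a • c) where
  conv := hc.conv.smul a
  ell n r := by simp [hc.ell]
  even n r := by simp [hc.even]
  low := by obtain ⟨b, hb⟩ := hc.low; exact ⟨b, fun n r h => by simp [hb n r h]⟩
lemma SymC.zero (m : ℕ) : SymC m 0 :=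
  ⟨fun τ _ z => by simp [summable_zero], fun _ _ => rfl, fun _ _ => rfl, 0, fun _ _ _ => rfl⟩
lemma IsJ.add {d : ℤ × ℤ → ℂ} (hc : IsJ k m c) (hd : IsJ k m d) :
    IsJ k m (c + d) := ⟨hc.toSymC.add hd.toSymC, fun τ hτ z => by
  rw [fser_add hc.conv hd.conv (neg_inv_im hτ), fser_add hc.conv hd.conv hτ, hc.S τ hτ, hd.S τ hτ]; ring⟩
lemma IsJ.smul (hc : IsJ k m c) (a : ℂ) :
    IsJ k m (a • c) := ⟨hc.toSymC.smul a, fun τ hτ z => by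
  rw [fser_smul, fser_smul, hc.S τ hτ]; ring⟩
lemma IsJ.zero (k : ℤ) (m : ℕ) : IsJ k m 0 := ⟨SymC.zero m, fun τ hτ z => by simp [fser]⟩
def cmul (c d : ℤ × ℤ → ℂ) : ℤ × ℤ → ℂ := fun p => ∑' a, c a * d (p - a)
lemma mon_mul (p q : ℤ × ℤ) (τ z : ℂ) : mon p τ z * mon q τ z = mon (p + q) τ z := by
  unfold mon; rw [← ee_add]; congr 1; push_cast [Prod.fst_add, Prod.snd_add]; ring
lemma mon_ne (p : ℤ × ℤ) (τ z : ℂ) : mon p τ z ≠ 0 := ee_ne _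
def cmulEquiv : (ℤ × ℤ) × (ℤ × ℤ) ≃ (ℤ × ℤ) × (ℤ × ℤ) where
  toFun x := (x.2, x.1 - x.2)
  invFun y := (y.1 + y.2, y.1)
  left_inv x := by simp
  right_inv y := by simp
lemma cmul_aux {d : ℤ × ℤ → ℂ} (hc : Conv c) (hd : Conv d) (hτ : 0 < τ.im) (z : ℂ) :
    HasSum (fun x : (ℤ × ℤ) × (ℤ × ℤ) => c x.2 * d (x.1 - x.2) * mon x.1 τ z) (fser c τ z * fser d τ z) := by
  have hs := summable_mul_of_summable_norm (f := fun p => c p * mon p τ z)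
    (g := fun p => d p * mon p τ z) (hc τ hτ z).norm (hd τ hτ z).norm
  have h1 := (hc.hasSum hτ z).mul (hd.hasSum hτ z) hs
  rw [← cmulEquiv.hasSum_iff] at h1
  refine Eq.mp (congrArg (fun f => HasSum f _) (funext fun x => ?_)) h1
  have : mon x.1 τ z = mon x.2 τ z * mon (x.1 - x.2) τ z := by rw [mon_mul]; congr 1; abel
  simp only [comp, cmulEquiv, Equiv.coe_fn_mk]
  rw [this]; ring
lemma cmul_summable {d : ℤ × ℤ → ℂ} (hc : Conv c) (hd : Conv d) (p : ℤ × ℤ) :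
    Summable (fun a => c a * d (p - a)) := by
  have := (cmul_aux hc hd (τ := I) (by simp) 0).summable.prod_factor p
  exact (summable_mul_right_iff (mon_ne p I 0)).1 this
lemma cmul_hasSum {d : ℤ × ℤ → ℂ} (hc : Conv c) (hd : Conv d) (hτ : 0 < τ.im) (z : ℂ) :
    HasSum (fun p => cmul c d p * mon p τ z) (fser c τ z * fser d τ z) :=
  (cmul_aux hc hd hτ z).prod_fiberwise fun p => ((cmul_summable hc hd p).hasSum.mul_right _)
lemma Conv.mul {d : ℤ × ℤ → ℂ} (hc : Conv c) (hd : Conv d) : Conv (cmul c d) :=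
  fun _ hτ z => (cmul_hasSum hc hd hτ z).summable
lemma fser_mul {d : ℤ × ℤ → ℂ} (hc : Conv c) (hd : Conv d) (hτ : 0 < τ.im) (z : ℂ) :
    fser (cmul c d) τ z = fser c τ z * fser d τ z := (cmul_hasSum hc hd hτ z).tsum_eq
def shiftE (m : ℤ) : ℤ × ℤ ≃ ℤ × ℤ where
  toFun a := (a.1 + a.2 + m, a.2 + 2 * m)
  invFun a := (a.1 - a.2 + m, a.2 - 2 * m)
  left_inv a := by ext <;> simp; ring
  right_inv a := by ext <;> simp; ring
def negE : ℤ × ℤ ≃ ℤ × ℤ where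
  toFun a := (a.1, -a.2)
  invFun a := (a.1, -a.2)
  left_inv a := by simp
  right_inv a := by simp
lemma SymC.mul {m' : ℕ} {d : ℤ × ℤ → ℂ} (hc : SymC m c) (hd : SymC m' d) : SymC (m + m') (cmul c d) where
  conv := hc.conv.mul hd.conv
  ell n r := by
    unfold cmul
    rw [← (shiftE m).tsum_eq]
    refine tsum_congr fun a => ?_
    have h1 : c (shiftE m a) = c a := hc.ell a.1 a.2
    have h2 : ((n + r + ((m + m' : ℕ) : ℤ), r + 2 * ((m + m' : ℕ) : ℤ)) - shiftE m a : ℤ × ℤ) =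
        ((n - a.1) + (r - a.2) + (m' : ℤ), (r - a.2) + 2 * (m' : ℤ)) := by
      ext <;> simp [shiftE] <;> ring
    rw [h1, h2, hd.ell]; rfl
  even n r := by
    unfold cmul
    rw [← negE.tsum_eq]
    refine tsum_congr fun a => ?_
    have h1 : c (negE a) = c a := hc.even a.1 a.2
    have h2 : ((n, -r) - negE a : ℤ × ℤ) = (n - a.1, -(r - a.2)) := by ext <;> simp [negE]; ring
    rw [h1, h2, hd.even]; rfl
  low := by
    obtain ⟨a, ha⟩ := hc.low; obtain ⟨b, hb⟩ := hd.low
    refine ⟨a + b, fun n r h => ?_⟩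
    unfold cmul
    refine (tsum_congr fun x => ?_).trans tsum_zero
    by_cases hx : x.1 < a
    · rw [show x = (x.1, x.2) from rfl, ha _ _ hx, zero_mul]
    · rw [show (n, r) - x = (n - x.1, r - x.2) from rfl, hb _ _ (by omega), mul_zero]
lemma IsJ.mul {k' : ℤ} {m' : ℕ} {d : ℤ × ℤ → ℂ} (hc : IsJ k m c) (hd : IsJ k' m' d) :
    IsJ (k + k') (m + m') (cmul c d) := ⟨hc.toSymC.mul hd.toSymC, fun τ hτ z => by
  rw [fser_mul hc.conv hd.conv (neg_inv_im hτ), fser_mul hc.conv hd.conv hτ, hc.S τ hτ, hd.S τ hτ,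
    zpow_add₀ (ne_of_im hτ), show ((m + m' : ℕ) : ℂ) * z ^ 2 / τ = m * z ^ 2 / τ + m' * z ^ 2 / τ by
      push_cast; ring, ee_add]; ring⟩
lemma ell_gen (h : ∀ n r : ℤ, c (n + r + m, r + 2 * m) = c (n, r)) (t : ℤ) :
    ∀ n r : ℤ, c (n + t * r + m * t ^ 2, r + 2 * m * t) = c (n, r) := by
  induction t using induction_on with
  | zero => intro n r; simp
  | succ i ih =>
    intro n r
    rw [← ih n r, ← h (n + i * r + _)]; congr 2 <;> ring
  | pred i ih =>
    intro n r
    rw [← ih n r, ← h (n + (- (i:ℤ) - 1) * r + _)]; congr 2 <;> ring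
lemma fser_T : TLaw (fser c) := fun τ _ z => by
  unfold fser
  refine tsum_congr fun p => ?_
  congr 1
  exact ee_congr p.1 (by ring)
lemma IsJ.modular (h : IsJ k m c) : ModularLaw k m (fser c) :=
  modular_of_ST h.S fser_T
lemma fser_elliptic (h : ∀ n r : ℤ, c (n + r + m, r + 2 * m) = c (n, r)) :
    EllipticLaw m (fser c) := by
  intro τ _ z t u
  let e : ℤ × ℤ ≃ ℤ × ℤ :=
    { toFun := fun a => (a.1 + t * a.2 + m * t ^ 2, a.2 + 2 * m * t)
      invFun := fun a => (a.1 - t * a.2 + m * t ^ 2, a.2 - 2 * m * t)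
      left_inv := fun a => by ext <;> simp; ring
      right_inv := fun a => by ext <;> simp; ring }
  unfold fser
  rw [← tsum_mul_left, ← e.tsum_eq (fun p => ee _ * _)]
  refine tsum_congr fun p => ?_
  rw [show c (e p) = c p from ell_gen h t p.1 p.2, mul_left_comm]
  congr 1
  unfold mon
  rw [← ee_add]
  refine ee_congr (p.2 * u) ?_
  simp only [e, Equiv.coe_fn_mk]; push_cast; ring
def CInt (c : ℤ × ℤ → ℂ) : Prop := ∀ p, ∃ k : ℤ, c p = k
lemma int_of_hasSum {ι : Type*} {f : ι → ℂ} {s : ℂ} (hf : ∀ i, ∃ k : ℤ, f i = k) (h : HasSum f s) :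
    ∃ k : ℤ, s = k := by
  have hcl : IsClosed (Set.range ((↑) : ℤ → ℂ)) := Complex.isClosed_range_intCast
  have : s ∈ Set.range ((↑) : ℤ → ℂ) := by
    refine hcl.mem_of_tendsto h (Eventually.of_forall fun t => ?_)
    choose g hg using hf
    exact ⟨∑ i ∈ t, g i, by push_cast; exact sum_congr rfl fun i _ => (hg i).symm⟩
  obtain ⟨k, hk⟩ := this; exact ⟨k, hk.symm⟩
lemma CInt.mul {d : ℤ × ℤ → ℂ} (hc : CInt c) (hd : CInt d) (hc' : Conv c) (hd' : Conv d) :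
    CInt (cmul c d) := fun p => int_of_hasSum (fun a => by
      obtain ⟨x, hx⟩ := hc a; obtain ⟨y, hy⟩ := hd (p - a)
      exact ⟨x * y, by rw [hx, hy]; push_cast; rfl⟩) (cmul_summable hc' hd' p).hasSum
structure Lead (n0 r0 : ℤ) (c : ℤ × ℤ → ℂ) : Prop where
  z1 : ∀ n r, n < n0 → c (n, r) = 0
  z2 : ∀ r, r0 < |r| → c (n0, r) = 0
  one : c (n0, r0) = 1
lemma Lead.mul {n' r' : ℤ} {d : ℤ × ℤ → ℂ} (hc : Lead n r c) (hd : Lead n' r' d) :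
    Lead (n + n') (r + r') (cmul c d) where
  z1 k s h := by
    unfold cmul
    refine (tsum_congr fun x => ?_).trans tsum_zero
    by_cases hx : x.1 < n
    · rw [show x = (x.1, x.2) from rfl, hc.z1 _ _ hx, zero_mul]
    · rw [show (k, s) - x = (k - x.1, s - x.2) from rfl, hd.z1 _ _ (by omega), mul_zero]
  z2 s h := by
    unfold cmul
    refine (tsum_congr fun x => ?_).trans tsum_zero
    rw [show (n + n', s) - x = (n + n' - x.1, s - x.2) from rfl]
    rcases lt_trichotomy x.1 n with hx | hx | hx
    · rw [show x = (x.1, x.2) from rfl, hc.z1 _ _ hx, zero_mul]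
    · by_cases h2 : r < |x.2|
      · rw [show x = (n, x.2) from Prod.ext hx rfl, hc.z2 _ h2, zero_mul]
      · rw [show n + n' - x.1 = n' by omega, hd.z2, mul_zero]
        have := abs_add_le (s - x.2) x.2
        simp only [sub_add_cancel] at this; omega
    · rw [hd.z1 _ _ (by omega), mul_zero]
  one := by
    unfold cmul
    rw [tsum_eq_single (n, r), hc.one, one_mul]
    · rw [show ((n + n', r + r') - (n, r) : ℤ × ℤ) = (n', r') by ext <;> simp, hd.one]
    · intro x hx
      rw [show (n + n', r + r') - x = (n + n' - x.1, r + r' - x.2) from rfl]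
      rcases lt_trichotomy x.1 n with h1 | h1 | h1
      · rw [show x = (x.1, x.2) from rfl, hc.z1 _ _ h1, zero_mul]
      · by_cases h2 : r < |x.2|
        · rw [show x = (n, x.2) from Prod.ext h1 rfl, hc.z2 _ h2, zero_mul]
        · have h3 : x.2 ≠ r := fun h => hx (Prod.ext h1 h)
          rw [show n + n' - x.1 = n' by omega, hd.z2, mul_zero]
          have := le_abs_self x.2
          exact lt_of_lt_of_le (by omega) (le_abs_self _)
      · rw [hd.z1 _ _ (by omega), mul_zero]
lemma sum_ee (hd : 0 < d) (r : ℤ) :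
    ∑ μ ∈ range d, ee (r * μ / d) = if (d : ℤ) ∣ r then (d : ℂ) else 0 := by
  have hd' : (d : ℂ) ≠ 0 := by exact_mod_cast hd.ne'
  split_ifs with h
  · obtain ⟨k, rfl⟩ := h
    rw [sum_congr rfl (g := fun _ => (1 : ℂ))]
    · simp
    · intro μ _
      rw [← ee_int (k * μ)]; congr 1; push_cast; field_simp
  · have h1 : ∀ μ : ℕ, ee (r * μ / d) = ee (r / d) ^ μ := fun μ => by rw [ee_pow]; congr 1; ring
    simp_rw [h1]
    have hne : ee (r / d) ≠ 1 := by
      intro h2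
      unfold ee at h2
      obtain ⟨k, hk⟩ := exp_eq_one_iff.1 h2
      apply h
      refine ⟨k, ?_⟩
      have h3 : (2 * (Real.pi : ℂ) * I) ≠ 0 := by simp [pi_ne_zero]
      have h4 : (r : ℂ) / d = k := mul_left_cancel₀ h3 (by rw [hk]; ring)
      rw [div_eq_iff hd'] at h4
      exact_mod_cast h4.trans (mul_comm _ _)
    rw [geom_sum_eq hne, ee_pow, mul_div_cancel₀ _ hd', ee_int]; simp
lemma SymC.disc (hm : 0 < m) (h : SymC m c) :
    ∃ B : ℤ, ∀ n r : ℤ, 4 * m * n - r ^ 2 < B → c (n, r) = 0 := by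
  obtain ⟨n0, h0⟩ := h.low
  have hm' : (0 : ℤ) < m := by exact_mod_cast hm
  refine ⟨4 * m * n0 - 4 * m ^ 2, fun n r hr => ?_⟩
  have h1 := ell_gen h.ell (-(r / (2 * m))) n r
  rw [← h1]; apply h0
  have h2 := Int.emod_add_mul_ediv r (2 * m)
  have h3 := emod_nonneg r (show (2 * m : ℤ) ≠ 0 by omega)
  have h4 := emod_lt_of_pos r (show (0 : ℤ) < 2 * m by omega)
  set t := r / (2 * m)
  set s := r % (2 * m)
  have h5 : 4 * (m : ℤ) * (n + -t * r + m * (-t) ^ 2) = 4 * m * n - r ^ 2 + s ^ 2 := by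
    rw [← h2]; ring
  have h6 : s ^ 2 ≤ 4 * m ^ 2 := by nlinarith
  have h7 : 4 * (m : ℤ) * (n + -t * r + m * (-t) ^ 2) < 4 * m * n0 := by linarith
  exact lt_of_mul_lt_mul_left h7 (by positivity)
lemma sum_per_neg (F : ℤ → ℂ) (hF : ∀ j, F (j + d) = F j) :
    ∑ j ∈ range d, F (-j) = ∑ j ∈ range d, F j := by
  have h2 : ∑ j ∈ range d, F (-j) = ∑ j ∈ range d, (fun i : ℕ => F (i + 1)) (d - 1 - j) := by
    refine sum_congr rfl fun j hj => ?_
    have := mem_range.1 hj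
    rw [← hF]; simp only; congr 1; push_cast [show 1 ≤ d by omega, show j ≤ d - 1 by omega]; ring
  rw [h2, sum_range_reflect (fun i : ℕ => F (i + 1))]
  have h3 := sum_range_succ (fun i : ℕ => F i) d
  rw [sum_range_succ'] at h3
  have h4 := hF 0
  simp only [zero_add, cast_zero, cast_add, cast_one] at h3 h4
  rw [h4] at h3
  exact add_right_cancel h3
def Uc (d : ℕ) (c : ℤ × ℤ → ℂ) : ℤ × ℤ → ℂ := fun p => if (d : ℤ) ∣ p.2 then c (p.1, p.2 / d) else 0
def uc (m d : ℕ) (c : ℤ × ℤ → ℂ) : ℤ × ℤ → ℂ := fun p =>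
  ∑ j ∈ range d, c (p.1 + p.2 * j + m * j ^ 2, d * (p.2 + 2 * m * j))
def Vc (q : ℕ) (c : ℤ × ℤ → ℂ) : ℤ × ℤ → ℂ := fun p =>
  c (q * p.1, p.2) + q * (if (q : ℤ) ∣ p.1 ∧ (q : ℤ) ∣ p.2 then c (p.1 / q, p.2 / q) else 0)
lemma hasSum_reindex {c' : ℤ × ℤ → ℂ} {τ' z' : ℂ} {s : ℂ} (i : ℤ × ℤ → ℤ × ℤ)
    (hi : Injective i) (h0 : ∀ p, p ∉ Set.range i → c' p = 0)
    (h1 : ∀ p, c' (i p) = c p) (h2 : ∀ p, mon (i p) τ' z' = mon p τ z)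
    (h : HasSum (fun p => c p * mon p τ z) s) : HasSum (fun p => c' p * mon p τ' z') s := by
  rw [← hi.hasSum_iff]
  · have : ((fun p => c' p * mon p τ' z') ∘ i) = fun p => c p * mon p τ z := by
      funext p; simp [h1, h2]
    rwa [this]
  · intro p hp; simp [h0 p hp]
lemma Uc_hasSum (hd : 0 < d) (hc : Conv c) (hτ : 0 < τ.im) (z : ℂ) :
    HasSum (fun p => Uc d c p * mon p τ z) (fser c τ (d * z)) := by
  have hd' : (d : ℤ) ≠ 0 := by exact_mod_cast hd.ne'
  refine hasSum_reindex (fun p => (p.1, d * p.2)) ?_ ?_ ?_ ?_ (hc.hasSum hτ _)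
  · intro p q h; simp only [Prod.mk.injEq] at h
    exact Prod.ext h.1 (mul_left_cancel₀ hd' h.2)
  · intro p hp; unfold Uc; rw [if_neg]
    rintro ⟨k, hk⟩; exact hp ⟨(p.1, k), Prod.ext rfl hk.symm⟩
  · intro p; simp only [Uc, dvd_mul_right, if_true, mul_ediv_cancel_left _ hd']
  · intro p; unfold mon; congr 1; push_cast; ring
lemma SymC.U (hd : 0 < d) (h : SymC m c) : SymC (m * d ^ 2) (Uc d c) where
  conv _ hτ z := (Uc_hasSum hd h.conv hτ z).summable
  ell n r := by
    have hd' : (d : ℤ) ≠ 0 := by exact_mod_cast hd.ne'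
    unfold Uc
    by_cases hr : (d : ℤ) ∣ r
    · obtain ⟨s, rfl⟩ := hr
      have := ell_gen h.ell d n s
      simp only [dvd_mul_right, if_true, mul_ediv_cancel_left _ hd']
      rw [if_pos ⟨s + 2 * m * d, by push_cast; ring⟩, ← this]
      rw [show (d : ℤ) * s + 2 * ((m * d ^ 2 : ℕ) : ℤ) = d * (s + 2 * m * d) by push_cast; ring,
          mul_ediv_cancel_left _ hd']
      push_cast; rfl
    · rw [if_neg, if_neg hr]
      intro h'; exact hr ((Int.dvd_add_left (Dvd.intro (2 * m * d) (by push_cast; ring))).1 h')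
  even n r := by
    unfold Uc
    by_cases hr : (d : ℤ) ∣ r
    · simp only [dvd_neg, hr, if_true]; rw [neg_ediv_of_dvd hr, h.even]
    · simp [hr]
  low := by
    obtain ⟨a, ha⟩ := h.low
    exact ⟨a, fun n r hn => by unfold Uc; split_ifs <;> simp [ha _ _ hn]⟩
lemma IsJ.U (hd : 0 < d) (h : IsJ k m c) : IsJ k (m * d ^ 2) (Uc d c) where
  toSymC := h.toSymC.U hd
  S τ hτ z := by
    have e1 := (Uc_hasSum hd h.conv (neg_inv_im hτ) (z / τ)).tsum_eq
    have e2 := (Uc_hasSum hd h.conv hτ z).tsum_eq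
    unfold fser at e1 e2 ⊢
    rw [e1, e2]
    have := h.S τ hτ (d * z)
    unfold fser at this
    rw [show (d : ℂ) * (z / τ) = d * z / τ by ring, this]
    congr 3; push_cast; ring
lemma uc_hasSum_aux (hd : 0 < d) (m : ℕ) (hc : Conv c) (hτ : 0 < τ.im) (z : ℂ)
    (l : ℤ) : HasSum (fun p : ℤ × ℤ => c (p.1 + p.2 * l + m * l ^ 2, d * (p.2 + 2 * m * l)) * mon p τ z)
      (∑ μ ∈ range d, 1 / d * (ee (m * (l ^ 2 * τ - 2 * l * z)) * fser c τ ((z - l * τ + μ) / d))) := by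
  have hd' : (d : ℤ) ≠ 0 := by exact_mod_cast hd.ne'
  have hdc : (d : ℂ) ≠ 0 := by exact_mod_cast hd.ne'
  have h1 : HasSum (fun p : ℤ × ℤ => ∑ μ ∈ range d, 1 / d * (ee (m * (l ^ 2 * τ - 2 * l * z)) *
      (c p * mon p τ ((z - l * τ + μ) / d)))) (∑ μ ∈ range d, 1 / d *
      (ee (m * (l ^ 2 * τ - 2 * l * z)) * fser c τ ((z - l * τ + μ) / d))) :=
    hasSum_sum fun μ _ => ((hc.hasSum hτ _).mul_left _).mul_left _
  let i : ℤ × ℤ → ℤ × ℤ := fun p => (p.1 + p.2 * l + m * l ^ 2, d * (p.2 + 2 * m * l))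
  have hi : Injective i := by
    rintro ⟨p1, p2⟩ ⟨q1, q2⟩ h; simp only [i, Prod.mk.injEq] at h
    have h2 : p2 = q2 := by have := mul_left_cancel₀ hd' h.2; linarith
    subst h2; have := h.1; ext <;> simp; linarith
  have h3 : ∀ p : ℤ × ℤ, ∑ μ ∈ range d, 1 / d * (ee (m * (l ^ 2 * τ - 2 * l * z)) *
      (c p * mon p τ ((z - l * τ + μ) / d))) = (if (d : ℤ) ∣ p.2 then c p else 0) *
      (ee (m * (l ^ 2 * τ - 2 * l * z)) * mon p τ ((z - l * τ) / d)) := by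
    intro p
    have h4 : ∀ μ : ℕ, mon p τ ((z - l * τ + μ) / d) = mon p τ ((z - l * τ) / d) * ee (p.2 * μ / d) := by
      intro μ; unfold mon; rw [← ee_add]; congr 1; ring
    simp_rw [h4]
    have h5 := sum_ee hd p.2
    calc _ = 1 / d * (c p * (ee (m * (l ^ 2 * τ - 2 * l * z)) * mon p τ ((z - l * τ) / d))) *
          ∑ μ ∈ range d, ee (p.2 * μ / d) := by
            rw [mul_sum]; refine sum_congr rfl fun μ _ => by ring
      _ = _ := by rw [h5]; split_ifs <;> simp; field_simp
  simp_rw [h3] at h1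
  rw [← hi.hasSum_iff] at h1
  · convert h1 using 1
    funext p
    simp only [comp, i, dvd_mul_right, if_true]
    congr 1
    unfold mon; rw [← ee_add]; congr 1; push_cast; field_simp; ring
  · rintro p hp
    rw [if_neg, zero_mul]
    rintro ⟨k, hk⟩
    refine hp ⟨(p.1 - (k - 2 * m * l) * l - m * l ^ 2, k - 2 * m * l), ?_⟩
    ext <;> simp [i, hk]
    ring
lemma uc_hasSum (hd : 0 < d) (m : ℕ) (hc : Conv c) (hτ : 0 < τ.im) (z : ℂ) :
    HasSum (fun p => uc m d c p * mon p τ z) (∑ l ∈ range d, ∑ μ ∈ range d,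
      1 / d * (ee (m * ((l : ℤ) ^ 2 * τ - 2 * (l : ℤ) * z)) * fser c τ ((z - (l : ℤ) * τ + μ) / d))) := by
  simp only [uc, sum_mul]
  exact hasSum_sum fun l _ => uc_hasSum_aux hd m hc hτ z l
lemma SymC.uper (h : SymC (m * d ^ 2) c) (n r j : ℤ) :
    c (n + r * (j + d) + m * (j + d) ^ 2, d * (r + 2 * m * (j + d))) =
      c (n + r * j + m * j ^ 2, d * (r + 2 * m * j)) := by
  rw [← h.ell (n + r * j + _)]; congr 2 <;> push_cast <;> ring
lemma SymC.u (hm : 0 < m) (hd : 0 < d) (h : SymC (m * d ^ 2) c) : SymC m (uc m d c) where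
  conv _ hτ z := (uc_hasSum hd m h.conv hτ z).summable
  ell n r := by
    have h3 := sum_range_succ (fun j : ℕ => c (n + r * j + m * j ^ 2, d * (r + 2 * m * j))) d
    rw [sum_range_succ'] at h3
    have h4 := h.uper n r 0
    simp only [zero_add] at h4
    rw [h4] at h3
    simp only [cast_zero] at h3
    have h5 := add_right_cancel h3
    unfold uc; simp only; rw [← h5]
    refine sum_congr rfl fun j _ => ?_
    congr 2 <;> push_cast <;> ring
  even n r := by
    unfold uc; simp only
    rw [← sum_per_neg (fun j : ℤ => c (n + r * j + m * j ^ 2, d * (r + 2 * m * j))) (h.uper n r)]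
    refine sum_congr rfl fun j _ => ?_
    rw [← h.even]; congr 2 <;> ring
  low := by
    obtain ⟨B, hB⟩ := h.disc (by positivity)
    refine ⟨min B 0, fun n r hn => sum_eq_zero fun j _ => hB _ _ ?_⟩
    have h1 : n < B := lt_of_lt_of_le hn (min_le_left _ _)
    have h2 : n < 0 := lt_of_lt_of_le hn (min_le_right _ _)
    have h3 : (1 : ℤ) ≤ m * d ^ 2 := by exact_mod_cast Nat.succ_le_of_lt (by positivity : 0 < m * d ^ 2)
    have h4 : (d : ℤ) ^ 2 * r ^ 2 ≥ 0 := by positivity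
    push_cast
    nlinarith
lemma SLaw_u (hd : 0 < d) (hS : SLaw k (m * d ^ 2) f) (hE : EllipticLaw (m * d ^ 2) f) :
    SLaw k m (fun τ z => ∑ l ∈ range d, ∑ μ ∈ range d,
      1 / d * (ee (m * ((l : ℤ) ^ 2 * τ - 2 * (l : ℤ) * z)) * f τ ((z - (l : ℤ) * τ + μ) / d))) := fun τ hτ z => by
    simp only
    have hd' : (d : ℂ) ≠ 0 := by exact_mod_cast hd.ne'
    have hτ' := ne_of_im hτ
    let s : ℤ → ℤ → ℂ := fun l μ => ee (m * (l ^ 2 * τ - 2 * l * z)) * f τ ((z - l * τ + μ) / d)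
    have hs : ∀ l μ, s (l + d) μ = s l μ := by
      intro l μ
      have := hE τ hτ ((z - l * τ + μ) / d) (-1) 0
      simp only [s]
      rw [show (z - ((l + d : ℤ) : ℂ) * τ + μ) / d = (z - l * τ + μ) / d + ((-1 : ℤ) : ℂ) * τ + ((0 : ℤ) : ℂ) by
        push_cast; field_simp; ring, this, ← mul_assoc, ← ee_add]
      congr 1
      refine ee_congr (2 * m * d * μ) ?_
      push_cast; field_simp; ring
    have key : ∀ l μ : ℕ, ee (m * ((l : ℤ) ^ 2 * (-1 / τ) - 2 * (l : ℤ) * (z / τ))) *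
        f (-1 / τ) ((z / τ - (l : ℤ) * (-1 / τ) + μ) / d) =
        τ ^ k * ee (m * z ^ 2 / τ) * s (-μ) l := by
      intro l μ
      have := hS τ hτ ((z + μ * τ + l) / d)
      rw [show (z / τ - (l : ℤ) * (-1 / τ) + μ) / d = (z + μ * τ + l) / d / τ by push_cast; field_simp; ring, this]
      simp only [s]
      rw [show (z - ((-μ : ℤ) : ℂ) * τ + ((l : ℤ) : ℂ)) / d = (z + μ * τ + l) / d by push_cast; ring]
      rw [show ∀ a b c d e f : ℂ, a * (b * c * d) = b * e * (f * d) ↔ (b * d) * (a * c) = (b * d) * (e * f) by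
        intros; constructor <;> intro h <;> linear_combination h]
      congr 1
      rw [← ee_add, ← ee_add]
      refine ee_congr (2 * m * l * μ) ?_
      push_cast; field_simp; ring
    simp_rw [key, ← mul_sum]
    rw [sum_comm]
    rw [sum_per_neg (fun μ => ∑ l ∈ range d, s μ l)]
    · simp only [s, cast_natCast, ← mul_sum]; ring
    · intro j; exact sum_congr rfl fun l _ => hs _ _
lemma IsJ.u (hm : 0 < m) (hd : 0 < d) (h : IsJ k (m * d ^ 2) c) : IsJ k m (uc m d c) where
  toSymC := h.toSymC.u hm hd
  S τ hτ z := by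
    rw [show fser (uc m d c) = fun τ z => ∑' p, uc m d c p * mon p τ z from rfl]
    simp only
    rw [(uc_hasSum hd m h.conv (neg_inv_im hτ) (z / τ)).tsum_eq, (uc_hasSum hd m h.conv hτ z).tsum_eq]
    exact SLaw_u hd h.S (fser_elliptic h.ell) τ hτ z
lemma Vc_hasSum (hq : 0 < q) (hc : Conv c) (hτ : 0 < τ.im) (z : ℂ) :
    HasSum (fun p => Vc q c p * mon p τ z)
      (∑ b ∈ range q, 1 / q * fser c ((τ + b) / q) z + q * fser c (q * τ) (q * z)) := by
  have hq' : (q : ℤ) ≠ 0 := by exact_mod_cast hq.ne'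
  have hqc : (q : ℂ) ≠ 0 := by exact_mod_cast hq.ne'
  have hqr : (0 : ℝ) < q := by exact_mod_cast hq
  have him : ∀ b : ℕ, 0 < ((τ + b) / q).im := fun b => by
    rw [div_natCast_im]; simp; positivity
  have him2 : 0 < (q * τ).im := by simp; positivity
  simp only [Vc, add_mul]
  refine HasSum.add ?_ ?_
  · have h1 : HasSum (fun p : ℤ × ℤ => ∑ b ∈ range q, 1 / q * (c p * mon p ((τ + b) / q) z))
      (∑ b ∈ range q, 1 / q * fser c ((τ + b) / q) z) :=
      hasSum_sum fun b _ => (hc.hasSum (him b) _).mul_left _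
    have h3 : ∀ p : ℤ × ℤ, ∑ b ∈ range q, 1 / q * (c p * mon p ((τ + b) / q) z) =
        (if (q : ℤ) ∣ p.1 then c p else 0) * mon p (τ / q) z := by
      intro p
      have h4 : ∀ μ : ℕ, mon p ((τ + μ) / q) z = mon p (τ / q) z * ee (p.1 * μ / q) := by
        intro μ; unfold mon; rw [← ee_add]; congr 1; ring
      simp_rw [h4]
      have h5 := sum_ee hq p.1
      calc _ = 1 / q * (c p * mon p (τ / q) z) * ∑ μ ∈ range q, ee (p.1 * μ / q) := by
              rw [mul_sum]; refine sum_congr rfl fun μ _ => by ring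
        _ = _ := by rw [h5]; split_ifs <;> simp; field_simp
    simp_rw [h3] at h1
    have hi : Injective (fun p : ℤ × ℤ => ((q : ℤ) * p.1, p.2)) := by
      intro p q h; simp only [Prod.mk.injEq] at h
      exact Prod.ext (mul_left_cancel₀ hq' h.1) h.2
    rw [← hi.hasSum_iff] at h1
    · convert h1 using 1
      funext p
      simp only [comp, dvd_mul_right, if_true]
      congr 1
      unfold mon; congr 1; push_cast; field_simp
    · rintro p hp
      rw [if_neg, zero_mul]
      rintro ⟨k, hk⟩
      exact hp ⟨(k, p.2), Prod.ext hk.symm rfl⟩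
  · simp only [mul_assoc]
    refine HasSum.mul_left _ ?_
    refine hasSum_reindex (fun p => (q * p.1, q * p.2)) ?_ ?_ ?_ ?_ (hc.hasSum him2 _)
    · intro p q h; simp only [Prod.mk.injEq] at h
      exact Prod.ext (mul_left_cancel₀ hq' h.1) (mul_left_cancel₀ hq' h.2)
    · intro p hp; rw [if_neg]
      rintro ⟨⟨k, hk⟩, ⟨j, hj⟩⟩; exact hp ⟨(k, j), Prod.ext hk.symm hj.symm⟩
    · intro p; simp only [dvd_mul_right, and_self, if_true, mul_ediv_cancel_left _ hq']
    · intro p; unfold mon; congr 1; push_cast; ring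
lemma IsJ.V (hq : q.Prime) (h : IsJ 2 m c) : IsJ 2 (m * q) (Vc q c) where
  conv _ hτ z := (Vc_hasSum hq.pos h.conv hτ z).summable
  ell n r := by
    have hq' : (q : ℤ) ≠ 0 := by exact_mod_cast hq.ne_zero
    unfold Vc
    congr 1
    · rw [← ell_gen h.ell q (q * n) r]; congr 2 <;> push_cast <;> ring
    · congr 1
      by_cases h1 : (q : ℤ) ∣ n ∧ (q : ℤ) ∣ r
      · obtain ⟨⟨a, rfl⟩, ⟨b, rfl⟩⟩ := h1
        have e1 : (q : ℤ) * a + q * b + ((m * q : ℕ) : ℤ) = q * (a + b + m) := by push_cast; ring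
        have e2 : (q : ℤ) * b + 2 * ((m * q : ℕ) : ℤ) = q * (b + 2 * m) := by push_cast; ring
        rw [e1, e2]
        simp only [mul_ediv_cancel_left _ hq', dvd_mul_right, and_self, if_true, h.ell]
      · rw [if_neg, if_neg h1]
        rintro ⟨⟨x, hx⟩, ⟨y, hy⟩⟩
        push_cast at hx hy
        exact h1 ⟨⟨x - y + m, by linear_combination hx - hy⟩, ⟨y - 2 * m, by linear_combination hy⟩⟩
  even n r := by
    unfold Vc; simp only [h.even, dvd_neg]
    congr 2
    by_cases h1 : (q : ℤ) ∣ n ∧ (q : ℤ) ∣ r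
    · rw [if_pos h1, if_pos h1, neg_ediv_of_dvd h1.2, h.even]
    · simp [h1]
  low := by
    obtain ⟨a, ha⟩ := h.low
    have hq' : (0 : ℤ) < q := by exact_mod_cast hq.pos
    refine ⟨q * min a 0, fun n r hn => ?_⟩
    have h1 : (q : ℤ) * min a 0 ≤ 0 := mul_nonpos_of_nonneg_of_nonpos hq'.le (min_le_right _ _)
    have h2 : n < min a 0 := by nlinarith [min_le_right a 0]
    unfold Vc
    rw [ha _ _ (by nlinarith [min_le_right a 0, min_le_left a 0])]
    split_ifs with h3
    · obtain ⟨⟨x, rfl⟩, _⟩ := h3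
      rw [mul_ediv_cancel_left _ hq'.ne', ha]; · simp
      exact lt_of_lt_of_le (lt_of_mul_lt_mul_left hn hq'.le) (min_le_left _ _)
    · simp
  S τ hτ z := by
    rw [show fser (Vc q c) = fun τ z => ∑' p, Vc q c p * mon p τ z from rfl]
    simp only
    rw [(Vc_hasSum hq.pos h.conv (neg_inv_im hτ) (z / τ)).tsum_eq, (Vc_hasSum hq.pos h.conv hτ z).tsum_eq]
    have hqc : (q : ℂ) ≠ 0 := by exact_mod_cast hq.ne_zero
    have hqr : (0 : ℝ) < q := by exact_mod_cast hq.pos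
    have hτ' := ne_of_im hτ
    have him : ∀ b : ℕ, 0 < ((τ + b) / q).im := fun b => by
      rw [div_natCast_im]; simp; positivity
    have him2 : 0 < (q * τ).im := by simp; positivity
    have : Fact q.Prime := ⟨hq⟩
    have e0 := h.S (q * τ) him2 (q * z)
    have e1 := h.S ((τ + (0 : ℕ)) / q) (him 0) z
    have hr : range q = insert 0 ((range q).erase 0) := by
      rw [Finset.insert_erase]; simp [hq.pos]
    have e2 : ∑ b ∈ (range q).erase 0, 1 / q * fser c ((-1 / τ + b) / q) (z / τ) =
        ∑ b ∈ (range q).erase 0, 1 / q * (τ ^ 2 * ee ((m * q : ℕ) * z ^ 2 / τ) * fser c ((τ + b) / q) z) := by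
      let g : ℕ → ℕ := fun b => (-(b : ZMod q)⁻¹).val
      have hne : ∀ b ∈ (range q).erase 0, (b : ZMod q) ≠ 0 := by
        intro b hb
        simp only [mem_erase, mem_range] at hb
        rw [Ne, ZMod.natCast_eq_zero_iff]
        exact fun hd => absurd (le_of_dvd (by omega) hd) (by omega)
      have hg : ∀ b ∈ (range q).erase 0, g b ∈ (range q).erase 0 := by
        intro b hb
        simp only [mem_erase, mem_range]
        refine ⟨?_, val_lt _⟩
        simp only [g, Ne, ZMod.val_eq_zero, neg_eq_zero, inv_eq_zero]
        exact hne b hb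
      have hgg : ∀ b ∈ (range q).erase 0, g (g b) = b := by
        intro b hb
        simp only [g, natCast_val, cast_id', id, inv_neg, neg_neg, inv_inv]
        exact val_cast_of_lt (by simpa using (mem_erase.1 hb).2)
      refine Finset.sum_nbij' g g hg hg hgg hgg fun b hb => ?_
      congr 1
      have hd : (q : ℤ) ∣ 1 + b * g b := by
        rw [← intCast_zmod_eq_zero_iff_dvd]
        simp only [g]; push_cast
        simp only [natCast_val, cast_id', id]
        rw [mul_neg, mul_inv_cancel₀ (hne b hb)]; simp
      obtain ⟨x, hx⟩ := hd
      have hx' : (1 : ℂ) + b * g b = q * x := by exact_mod_cast hx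
      have e3 := h.modular ((τ + g b) / q) (him _) z b (-x) q (-(g b)) (by linarith)
      have hden : ((q : ℤ) : ℂ) * ((τ + g b) / q) + ((-(g b : ℤ) : ℤ) : ℂ) = τ := by
        push_cast; field_simp; ring
      rw [hden] at e3
      rw [show (-1 / τ + (b : ℂ)) / q = (((b : ℤ) : ℂ) * ((τ + g b) / q) + ((-x : ℤ) : ℂ)) / τ by
        push_cast; field_simp; linear_combination -hx', e3]
      push_cast; rfl
    have e4 : fser c (q * (-1 / τ)) (q * (z / τ)) = (τ / q) ^ 2 * ee ((m * q : ℕ) * z ^ 2 / τ) * fser c ((τ + (0 : ℕ)) / q) z := by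
      simp only [cast_zero, add_zero] at e1 ⊢
      rw [show (q : ℂ) * (-1 / τ) = -1 / (τ / q) by field_simp,
        show (q : ℂ) * (z / τ) = z / (τ / q) by field_simp, e1]
      congr 2
      congr 1; push_cast; field_simp
    have e5 : fser c ((-1 / τ + (0 : ℕ)) / q) (z / τ) = (q * τ) ^ 2 * ee ((m * q : ℕ) * z ^ 2 / τ) * fser c (q * τ) (q * z) := by
      simp only [cast_zero, add_zero]
      rw [show (-1 / τ) / (q : ℂ) = -1 / (q * τ) by field_simp,
        show z / τ = q * z / (q * τ) by field_simp, e0]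
      congr 2
      congr 1; push_cast; field_simp
    rw [hr, sum_insert (by simp), sum_insert (by simp), e2, e4, e5, ← mul_sum, ← mul_sum, ← mul_sum]
    rw [show τ ^ (2 : ℤ) = τ ^ 2 by norm_cast]
    field_simp; ring
def ofC (m : ℕ) (C : ℤ → ℤ → ℂ) : ℤ × ℤ → ℂ := fun p => C (4 * m * p.1 - p.2 ^ 2) p.2
def toC (m : ℕ) (c : ℤ × ℤ → ℂ) : ℤ → ℤ → ℂ := fun D l =>
  if (4 * m : ℤ) ∣ D + l ^ 2 then c ((D + l ^ 2) / (4 * m), l) else 0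
def PolyC (m : ℕ) : Submodule ℂ (ℤ → ℤ → ℂ) where
  carrier := {C | (∀ D l, C D (l + 2 * m) = C D l) ∧ (∀ D l, C D (-l) = C D l) ∧
    (∀ D l : ℤ, ¬ (4 * m : ℤ) ∣ D + l ^ 2 → C D l = 0) ∧ ∃ B : ℤ, ∀ D l, D < B → C D l = 0}
  add_mem' := by
    rintro C C' ⟨h1, h2, h3, B, h4⟩ ⟨h1', h2', h3', B', h4'⟩
    refine ⟨fun D l => by simp [h1, h1'], fun D l => by simp [h2, h2'], fun D l h => by simp [h3 D l h, h3' D l h],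
      min B B', fun D l h => ?_⟩
    simp [h4 D l (lt_of_lt_of_le h (min_le_left _ _)), h4' D l (lt_of_lt_of_le h (min_le_right _ _))]
  zero_mem' := ⟨fun _ _ => rfl, fun _ _ => rfl, fun _ _ _ => rfl, 0, fun _ _ _ => rfl⟩
  smul_mem' := by
    rintro a C ⟨h1, h2, h3, B, h4⟩
    exact ⟨fun D l => by simp [h1], fun D l => by simp [h2], fun D l h => by simp [h3 D l h], B,
      fun D l h => by simp [h4 D l h]⟩
lemma per_gen (h1 : ∀ D l, C D (l + 2 * m) = C D l) (D l t : ℤ) :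
    C D (l + 2 * m * t) = C D l := by
  induction t using induction_on with
  | zero => simp
  | succ i ih => rw [← ih, ← h1 D (l + 2 * m * i)]; congr 1; ring
  | pred i ih => rw [← ih, ← h1 D (l + 2 * m * (-i - 1))]; congr 1; ring
lemma per_congr (h1 : ∀ D l, C D (l + 2 * m) = C D l) {D l' : ℤ} 
    (h : (2 * m : ℤ) ∣ l - l') : C D l = C D l' := by
  obtain ⟨t, ht⟩ := h
  rw [show l = l' + 2 * m * t by linarith, per_gen h1]
lemma ofC_add (m : ℕ) (C C' : ℤ → ℤ → ℂ) : ofC m (C + C') = ofC m C + ofC m C' := rfl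
lemma ofC_toC (hm : 0 < m) (c : ℤ × ℤ → ℂ) : ofC m (toC m c) = c := by
  funext ⟨n, r⟩
  have : (4 * m : ℤ) ≠ 0 := by positivity
  simp [ofC, toC, mul_ediv_cancel_left _ this]
lemma toC_mem (hm : 0 < m) (hc : SymC m c) : toC m c ∈ PolyC m := by
  have hm' : (4 * m : ℤ) ≠ 0 := by positivity
  refine ⟨fun D l => ?_, fun D l => ?_, fun D l h => ?_, ?_⟩
  · unfold toC
    have e : D + (l + 2 * m) ^ 2 = (D + l ^ 2) + 4 * m * (l + m) := by ring
    rw [e]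
    by_cases h : (4 * m : ℤ) ∣ D + l ^ 2
    · rw [if_pos h, if_pos (dvd_add h (dvd_mul_right _ _)), Int.add_mul_ediv_left _ _ hm', ← add_assoc, hc.ell]
    · rw [if_neg h, if_neg]
      exact fun h' => h ((Int.dvd_add_left (dvd_mul_right _ _)).1 h')
  · simp [toC, hc.even]
  · simp [toC, h]
  · obtain ⟨B, hB⟩ := hc.disc hm
    refine ⟨B, fun D l h => ?_⟩
    unfold toC; split_ifs with h1
    · apply hB; rw [Int.mul_ediv_cancel' h1]; linarith
    · rfl
def Jm (m : ℕ) : Submodule ℂ (ℤ → ℤ → ℂ) where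
  carrier := {C | C ∈ PolyC m ∧ IsJ 2 m (ofC m C)}
  add_mem' := fun h h' => ⟨add_mem h.1 h'.1, h.2.add h'.2⟩
  zero_mem' := ⟨zero_mem _, IsJ.zero 2 m⟩
  smul_mem' := fun a _ h => ⟨smul_mem _ a h.1, h.2.smul a⟩
lemma toC_Jm (hm : 0 < m) (hc : IsJ 2 m c) : toC m c ∈ Jm m :=
  ⟨toC_mem hm hc.toSymC, by rwa [ofC_toC hm]⟩
def M0 (m : ℕ) : Submodule ℂ (ℤ → ℤ → ℂ) where
  carrier := {C | C ∈ PolyC m ∧ ∃ j ∈ Jm m, ∀ D l : ℤ, D < 0 → C D l = j D l}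
  add_mem' := by
    rintro C C' ⟨h, j, hj, e⟩ ⟨h', j', hj', e'⟩
    exact ⟨add_mem h h', j + j', add_mem hj hj', fun D l hD => by simp [e D l hD, e' D l hD]⟩
  zero_mem' := ⟨zero_mem _, 0, zero_mem _, fun _ _ _ => rfl⟩
  smul_mem' := by
    rintro a C ⟨h, j, hj, e⟩
    exact ⟨smul_mem _ a h, a • j, smul_mem _ a hj, fun D l hD => by simp [e D l hD]⟩
def chi (q : ℕ) (D : ℤ) : ℂ := (∑ t ∈ range q, if (q : ℤ) ∣ t ^ 2 + D then (1 : ℂ) else 0) - 1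
def Tq (q : ℕ) (qi : ℤ) : (ℤ → ℤ → ℂ) →ₗ[ℂ] (ℤ → ℤ → ℂ) where
  toFun C := fun D l => C (q ^ 2 * D) (q * l) + chi q D * C D l +
    q * (if (q : ℤ) ^ 2 ∣ D then C (D / q ^ 2) (qi * l) else 0)
  map_add' C C' := by funext D l; simp only [Pi.add_apply]; split_ifs <;> ring
  map_smul' a C := by funext D l; simp only [Pi.smul_apply, smul_eq_mul, RingHom.id_apply]; split_ifs <;> ring
lemma sum_range_zmod [NeZero q] (F : ZMod q → ℂ) :
    ∑ j ∈ range q, F j = ∑ x : ZMod q, F x := by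
  refine Finset.sum_bij' (fun j _ => (j : ZMod q)) (fun x _ => x.val) ?_ ?_ ?_ ?_ ?_
  · simp
  · intro x _; simpa using val_lt x
  · intro j hj; exact val_cast_of_lt (by simpa using hj)
  · intro x _; simp
  · simp
lemma sum_affine (hq : q.Prime) (ha : ¬ (q : ℤ) ∣ a) (F : ZMod q → ℂ) :
    ∑ j ∈ range q, F ((a * j + b : ℤ) : ZMod q) = ∑ j ∈ range q, F j := by
  have : Fact q.Prime := ⟨hq⟩
  have ha' : (a : ZMod q) ≠ 0 := fun h => ha ((intCast_zmod_eq_zero_iff_dvd a q).1 h)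
  rw [sum_range_zmod]
  have h1 : ∑ j ∈ range q, F ((a * j + b : ℤ) : ZMod q) = ∑ x : ZMod q, F ((a : ZMod q) * x + (b : ZMod q)) := by
    rw [← sum_range_zmod (fun x : ZMod q => F ((a : ZMod q) * x + (b : ZMod q)))]; push_cast; rfl
  rw [h1]
  exact Fintype.sum_bijective (fun x => (a : ZMod q) * x + b)
    ((Equiv.addRight (b : ZMod q)).bijective.comp (mulLeft_bijective₀ _ ha')) _ _ (fun _ => rfl)
lemma uVV_eq (hq : q.Prime) (hqm : ¬ q ∣ 2 * m) (hqi : (2 * m : ℤ) ∣ q * qi - 1)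
    (hC : C ∈ PolyC m) :
    ofC m (Tq q qi C) = (1 / q : ℂ) • uc m q (Vc q (Vc q (ofC m C))) + (-(q + 1) : ℂ) • ofC m C := by
  obtain ⟨h1, h2, h3, -⟩ := hC
  have hq0 : (q : ℤ) ≠ 0 := by exact_mod_cast hq.ne_zero
  have hqc : (q : ℂ) ≠ 0 := by exact_mod_cast hq.ne_zero
  have hpr : Prime (q : ℤ) := prime_iff_prime_int.1 hq
  have hqm' : ¬ (q : ℤ) ∣ 2 * m := by exact_mod_cast hqm
  have hq4 : ¬ (q : ℤ) ∣ 4 * m := fun h => hqm' (by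
    rcases hpr.dvd_or_dvd (show (q : ℤ) ∣ 2 * (2 * m) by rwa [← mul_assoc]) with h | h
    · exact dvd_mul_of_dvd_left h _
    · exact h)
  have hcop : IsCoprime ((q : ℤ) ^ 2) (4 * m) := ((hpr.coprime_iff_not_dvd).2 hq4).pow_left
  funext ⟨n, r⟩
  simp only [Pi.add_apply, Pi.smul_apply, smul_eq_mul, uc]
  set D : ℤ := 4 * m * n - r ^ 2 with hD
  have key : ∀ j : ℕ, Vc q (Vc q (ofC m C)) (n + r * j + m * j ^ 2, q * (r + 2 * m * j)) =
      C (q ^ 2 * D) (q * r) + q * C D r + q * ((if (q : ℤ) ∣ (2 * m * j + r) ^ 2 + D then 1 else 0) * C D r)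
      + q ^ 2 * (if (q : ℤ) ∣ 2 * m * j + r then (if (q : ℤ) ^ 2 ∣ D then C (D / q ^ 2) (qi * r) else 0) else 0) := by
    intro j
    set n' := n + r * j + m * j ^ 2
    set r' := r + 2 * m * j
    have hD' : 4 * m * n' - r' ^ 2 = D := by simp only [n', r', hD]; ring
    have e1 : C (q ^ 2 * D) (q * r') = C (q ^ 2 * D) (q * r) := per_congr h1 ⟨q * j, by simp only [r']; ring⟩
    have e2 : C D r' = C D r := per_congr h1 ⟨j, by simp only [r']; ring⟩
    have e3 : ((q : ℤ) ∣ (2 * m * j + r) ^ 2 + D) ↔ (q : ℤ) ∣ n' := by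
      rw [show (2 * m * j + r) ^ 2 + D = 4 * m * n' by simp only [n', hD]; ring]
      exact ⟨fun h => (hpr.dvd_or_dvd h).resolve_left hq4, fun h => dvd_mul_of_dvd_right h _⟩
    rw [show 2 * (m : ℤ) * j + r = r' by simp only [r']; ring] at e3 ⊢
    simp only [Vc, ofC, dvd_mul_right, and_true, true_and, mul_ediv_cancel_left _ hq0, e3]
    rw [show 4 * (m : ℤ) * (q * (q * n')) - (q * r') ^ 2 = q ^ 2 * D by rw [← hD']; ring, e1, hD', e2]
    by_cases hn : (q : ℤ) ∣ n'
    · obtain ⟨k, hk⟩ := hn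
      have e4 : ((q : ℤ) ∣ k ∧ (q : ℤ) ∣ r') ↔ (q : ℤ) ∣ r' ∧ (q : ℤ) ^ 2 ∣ D := by
        constructor
        · rintro ⟨⟨a, ha⟩, ⟨b, hb⟩⟩
          exact ⟨⟨b, hb⟩, ⟨4 * m * a - b ^ 2, by rw [← hD', hk, ha, hb]; ring⟩⟩
        · rintro ⟨⟨b, hb⟩, ⟨a, ha⟩⟩
          refine ⟨?_, ⟨b, hb⟩⟩
          have : (q : ℤ) ^ 2 ∣ 4 * m * n' := ⟨a + b ^ 2, by
            rw [show 4 * (m : ℤ) * n' = D + r' ^ 2 by linarith, ha, hb]; ring⟩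
          have h5 := hcop.dvd_of_dvd_mul_left this
          rw [hk, pow_two] at h5
          exact Int.dvd_of_mul_dvd_mul_left hq0 h5
      have hn : (q : ℤ) ∣ n' := ⟨k, hk⟩
      have hkk : n' / q = k := by rw [hk, mul_ediv_cancel_left _ hq0]
      have hn3 : (q : ℤ) * n' / q = n' := mul_ediv_cancel_left _ hq0
      have hk3 : (q : ℤ) * k = n' := hk.symm
      simp only [hn, if_true, hkk, hn3, hk3, hD', e2, e4]
      by_cases h6 : (q : ℤ) ∣ r' ∧ (q : ℤ) ^ 2 ∣ D
      · rw [if_pos h6, if_pos h6.1, if_pos h6.2]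
        obtain ⟨⟨a, ha⟩, ⟨b, hb⟩⟩ := e4.2 h6
        have e5 : 4 * m * (k / q) - (r' / q) ^ 2 = D / q ^ 2 := by
          rw [← hD', hk, ha, hb, mul_ediv_cancel_left _ hq0, mul_ediv_cancel_left _ hq0,
            show 4 * (m : ℤ) * (q * (q * a)) - (q * b) ^ 2 = q ^ 2 * (4 * m * a - b ^ 2) by ring,
            mul_ediv_cancel_left _ (pow_ne_zero 2 hq0)]
        have e6 : C (D / q ^ 2) (r' / q) = C (D / q ^ 2) (qi * r) := by
          refine per_congr h1 ?_
          obtain ⟨t, ht⟩ := hqi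
          rw [hb, mul_ediv_cancel_left _ hq0]
          refine ⟨qi * j - b * t, ?_⟩
          have : r = q * b - 2 * m * j := by rw [← hb]; simp only [r']; ring
          rw [this]; linear_combination (-b) * ht
        rw [e5, e6]; ring
      · rw [if_neg h6]
        by_cases h7 : (q : ℤ) ∣ r'
        · rw [if_pos h7, if_neg (fun h8 => h6 ⟨h7, h8⟩)]; ring
        · rw [if_neg h7]; ring
    · have h8 : (q : ℤ) ∣ r' → ¬ (q : ℤ) ^ 2 ∣ D := by
        rintro ⟨b, hb⟩ ⟨a, ha⟩
        have : (q : ℤ) ^ 2 ∣ 4 * m * n' := ⟨a + b ^ 2, by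
            rw [show 4 * (m : ℤ) * n' = D + r' ^ 2 by linarith, ha, hb]; ring⟩
        exact hn ((dvd_pow_self _ two_ne_zero).trans (hcop.dvd_of_dvd_mul_left this))
      by_cases h7 : (q : ℤ) ∣ r'
      · simp [hn, h7, h8 h7]
      · simp [hn, h7]
  simp_rw [key]
  simp only [sum_add_distrib, ← mul_sum, ← sum_mul, sum_const, card_range, nsmul_eq_mul]
  have s1 : ∑ j ∈ range q, (if (q : ℤ) ∣ (2 * m * j + r) ^ 2 + D then (1 : ℂ) else 0) = chi q D + 1 := by
    have := sum_affine hq hqm' (b := r) (fun x : ZMod q => if x ^ 2 + (D : ZMod q) = 0 then (1 : ℂ) else 0)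
    unfold chi; rw [sub_add_cancel]
    convert this using 3 with j _ j _
    · rw [← intCast_zmod_eq_zero_iff_dvd]; push_cast; rfl
    · rw [← intCast_zmod_eq_zero_iff_dvd]; push_cast; rfl
  have s2 : ∀ K : ℂ, ∑ j ∈ range q, (if (q : ℤ) ∣ 2 * m * j + r then K else 0) = K := by
    intro K
    have hf : Fact q.Prime := ⟨hq⟩
    have := sum_affine hq hqm' (b := r) (fun x : ZMod q => if x = 0 then K else 0)
    rw [sum_range_zmod (fun x : ZMod q => if x = 0 then K else 0), Finset.sum_ite_eq'] at this
    simp only [Finset.mem_univ, if_true] at this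
    rw [← this]
    refine sum_congr rfl fun j _ => ?_
    congr 1
    rw [← intCast_zmod_eq_zero_iff_dvd]
  rw [s1, s2]
  simp only [ofC, Tq, LinearMap.coe_mk, AddHom.coe_mk, ← hD]
  field_simp; ring
lemma Tq_Poly (hq : q.Prime) (hqm : ¬ q ∣ 2 * m) (hqi : (2 * m : ℤ) ∣ q * qi - 1)
    (hC : C ∈ PolyC m) : Tq q qi C ∈ PolyC m := by
  obtain ⟨h1, h2, h3, B, h4⟩ := hC
  have hq0 : (0 : ℤ) < q := by exact_mod_cast hq.pos
  have hpr : Prime (q : ℤ) := prime_iff_prime_int.1 hq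
  have hqm' : ¬ (q : ℤ) ∣ 2 * m := by exact_mod_cast hqm
  have hq4 : ¬ (q : ℤ) ∣ 4 * m := fun h => hqm' (by
    rcases hpr.dvd_or_dvd (show (q : ℤ) ∣ 2 * (2 * m) by rwa [← mul_assoc]) with h | h
    · exact dvd_mul_of_dvd_left h _
    · exact h)
  have hcop : IsCoprime ((4 * m : ℤ)) (q ^ 2) := ((hpr.coprime_iff_not_dvd).2 hq4).pow_left.symm
  refine ⟨fun D l => ?_, fun D l => ?_, fun D l h => ?_, q ^ 2 * min B 0, fun D l h => ?_⟩ <;>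
    simp only [Tq, LinearMap.coe_mk, AddHom.coe_mk]
  · rw [h1, per_congr h1 (l := q * (l + 2 * m)) (l' := q * l) ⟨q, by ring⟩]
    congr 2
    split_ifs
    · exact per_congr h1 ⟨qi, by ring⟩
    · rfl
  · simp only [mul_neg, h2]
  · rw [h3 D l h, h3 (q ^ 2 * D) (q * l)]
    · split_ifs with h5
      · rw [h3]; · simp
        obtain ⟨E, rfl⟩ := h5
        rw [mul_ediv_cancel_left _ (pow_ne_zero 2 hq0.ne')]
        intro h6; apply h
        obtain ⟨t, ht⟩ := hqi
        obtain ⟨s, hs⟩ := h6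
        refine ⟨q ^ 2 * s - (t * (1 + m * t)) * l ^ 2, ?_⟩
        have e : ((q : ℤ) * qi) ^ 2 = 1 + 4 * m * (t * (1 + m * t)) := by
          rw [show (q : ℤ) * qi = 1 + 2 * m * t by linarith]; ring
        linear_combination (q : ℤ) ^ 2 * hs - l ^ 2 * e
      · simp
    · intro h6; apply h
      rw [show (q : ℤ) ^ 2 * D + (q * l) ^ 2 = q ^ 2 * (D + l ^ 2) by ring] at h6
      exact hcop.dvd_of_dvd_mul_left h6
  · have hb : min B 0 ≤ B := min_le_left _ _
    have hb0 : min B 0 ≤ 0 := min_le_right _ _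
    have hq2 : (1 : ℤ) ≤ q ^ 2 := by nlinarith
    have hD0 : D < 0 := by nlinarith
    have hDB : D < min B 0 := by nlinarith
    rw [h4 _ _ (by nlinarith), h4 D l (by linarith)]
    split_ifs with h5
    · obtain ⟨E, rfl⟩ := h5
      rw [mul_ediv_cancel_left _ (pow_ne_zero 2 hq0.ne'), h4 E]; · simp
      exact lt_of_lt_of_le (lt_of_mul_lt_mul_left h (by positivity)) hb
    · simp
lemma Tq_Jm (hm : 0 < m) (hq : q.Prime) (hqm : ¬ q ∣ 2 * m) (hqi : (2 * m : ℤ) ∣ q * qi - 1)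
    (hC : C ∈ Jm m) : Tq q qi C ∈ Jm m := by
  refine ⟨Tq_Poly hq hqm hqi hC.1, ?_⟩
  rw [uVV_eq hq hqm hqi hC.1]
  have h1 : IsJ 2 (m * q ^ 2) (Vc q (Vc q (ofC m C))) := by
    rw [pow_two, ← mul_assoc]; exact (hC.2.V hq).V hq
  exact ((h1.u hm hq.pos).smul _).add (hC.2.smul _)
lemma Tq_M0 (hm : 0 < m) (hq : q.Prime) (hqm : ¬ q ∣ 2 * m) (hqi : (2 * m : ℤ) ∣ q * qi - 1)
    (hC : C ∈ M0 m) : Tq q qi C ∈ M0 m := by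
  obtain ⟨h, j, hj, e⟩ := hC
  have hq0 : (0 : ℤ) < q := by exact_mod_cast hq.pos
  refine ⟨Tq_Poly hq hqm hqi h, Tq q qi j, Tq_Jm hm hq hqm hqi hj, fun D l hD => ?_⟩
  simp only [Tq, LinearMap.coe_mk, AddHom.coe_mk]
  rw [e D l hD, e (q ^ 2 * D) _ (by nlinarith [sq_nonneg (q : ℤ), pow_pos hq0 2])]
  split_ifs with h5
  · obtain ⟨E, rfl⟩ := h5
    rw [mul_ediv_cancel_left _ (pow_ne_zero 2 hq0.ne'), e E]
    by_contra h6; have := pow_pos hq0 2; nlinarith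
  · rfl
def hat (m : ℕ) (N r : ℤ) : ℤ → ℤ → ℂ := fun D l =>
  if D = -N ∧ ((2 * m : ℤ) ∣ l - r ∨ (2 * m : ℤ) ∣ l + r) then 1 else 0
lemma hat_cond (h : (4 * m : ℤ) ∣ N - r ^ 2) (hl : (2 * m : ℤ) ∣ l - r ∨ (2 * m : ℤ) ∣ l + r) :
    (4 * m : ℤ) ∣ -N + l ^ 2 := by
  obtain ⟨a, ha⟩ := h
  rcases hl with ⟨t, ht⟩ | ⟨t, ht⟩
  · exact ⟨-a + r * t + m * t ^ 2, by rw [show l = r + 2 * m * t by linarith, show N = r ^ 2 + 4 * m * a by linarith]; ring⟩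
  · exact ⟨-a - r * t + m * t ^ 2, by rw [show l = -r + 2 * m * t by linarith, show N = r ^ 2 + 4 * m * a by linarith]; ring⟩
lemma hat_mem (h : (4 * m : ℤ) ∣ N - r ^ 2) : hat m N r ∈ PolyC m := by
  refine ⟨fun D l => ?_, fun D l => ?_, fun D l h' => ?_, -N, fun D l h' => ?_⟩
  · unfold hat
    rw [show l + 2 * (m : ℤ) - r = (l - r) + 2 * m by ring, show l + 2 * (m : ℤ) + r = (l + r) + 2 * m by ring]
    simp
  · unfold hat
    rw [show -l - r = -(l + r) by ring, show -l + r = -(l - r) by ring]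
    simp only [dvd_neg, or_comm]
  · unfold hat; rw [if_neg]; rintro ⟨rfl, h2⟩; exact h' (hat_cond h h2)
  · unfold hat; rw [if_neg]; rintro ⟨rfl, h2⟩; exact lt_irrefl _ h'
lemma hat_congr {r' : ℤ} (h : (2 * m : ℤ) ∣ r - r') : hat m N r = hat m N r' := by
  obtain ⟨t, ht⟩ := h
  obtain rfl : r = r' + 2 * m * t := by linarith
  funext D l
  unfold hat
  rw [show l - (r' + 2 * (m : ℤ) * t) = l - r' + 2 * m * (-t) by ring,
    show l + (r' + 2 * (m : ℤ) * t) = l + r' + 2 * m * t by ring]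
  simp only [Int.dvd_add_left (dvd_mul_right _ _)]
lemma IsCoprime.dvd_mul_left' (h : IsCoprime a b) (n : ℤ) : a ∣ b * n ↔ a ∣ n :=
  ⟨fun h' => h.dvd_of_dvd_mul_left h', fun h' => dvd_mul_of_dvd_right h' _⟩
lemma Tq_hat (hq : q.Prime) (hqi : (2 * m : ℤ) ∣ q * qi - 1) (N r : ℤ) :
    Tq q qi (hat m N r) = (if (q : ℤ) ^ 2 ∣ N then hat m (N / q ^ 2) (qi * r) else 0) + chi q (-N) • hat m N r +
      (q : ℂ) • hat m (q ^ 2 * N) (q * r) := by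
  have hq0 : (0 : ℤ) < q := by exact_mod_cast hq.pos
  have hq2 : (q : ℤ) ^ 2 ≠ 0 := pow_ne_zero 2 hq0.ne'
  have hcop : IsCoprime (2 * m : ℤ) q := by
    obtain ⟨t, ht⟩ := hqi; exact ⟨-t, qi, by linear_combination ht⟩
  have hcop' : IsCoprime (2 * m : ℤ) qi := by
    obtain ⟨t, ht⟩ := hqi; exact ⟨-t, q, by linear_combination ht⟩
  have hqi' : ∀ x : ℤ, (2 * m : ℤ) ∣ q * qi * x - x := fun x => by
    rw [show q * qi * x - x = (q * qi - 1) * x by ring]; exact dvd_mul_of_dvd_left hqi _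
  -- key dvd equivalences
  have k1 : ∀ l s : ℤ, ((2 * m : ℤ) ∣ q * l - s) ↔ (2 * m : ℤ) ∣ l - qi * s := by
    intro l s
    rw [← hcop'.dvd_mul_left' (q * l - s), show qi * (q * l - s) = (l - qi * s) + (q * qi * l - l) by ring,
      Int.dvd_add_left (hqi' l)]
  have k2 : ∀ l s : ℤ, ((2 * m : ℤ) ∣ qi * l - s) ↔ (2 * m : ℤ) ∣ l - q * s := by
    intro l s
    rw [← hcop.dvd_mul_left' (qi * l - s), show q * (qi * l - s) = (l - q * s) + (q * qi * l - l) by ring,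
      Int.dvd_add_left (hqi' l)]
  funext D l
  simp only [Tq, LinearMap.coe_mk, AddHom.coe_mk, Pi.add_apply, Pi.smul_apply, smul_eq_mul]
  congr 1
  congr 1
  · split_ifs with h
    · obtain ⟨E, rfl⟩ := h
      rw [mul_ediv_cancel_left _ hq2]
      unfold hat
      have k3 := k1 l (-r)
      rw [sub_neg_eq_add, mul_neg, sub_neg_eq_add] at k3
      simp only [k1, k3,
        show q ^ 2 * D = -(q ^ 2 * E) ↔ D = -E from ⟨fun h => mul_left_cancel₀ hq2 (by linarith), fun h => by rw [h]; ring⟩]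
    · unfold hat; rw [if_neg]; · rfl
      rintro ⟨h1, -⟩; exact h ⟨-D, by linarith⟩
  · unfold hat
    by_cases h : D = -N
    · rw [h]
    · simp [h]
  · congr 1
    split_ifs with h
    · obtain ⟨E, rfl⟩ := h
      rw [mul_ediv_cancel_left _ hq2]
      unfold hat
      have k3 := k2 l (-r)
      rw [sub_neg_eq_add, mul_neg, sub_neg_eq_add] at k3
      simp only [k2, k3,
        show q ^ 2 * E = -(q ^ 2 * N) ↔ E = -N from ⟨fun h => mul_left_cancel₀ hq2 (by linarith), fun h => by rw [h]; ring⟩]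
    · unfold hat; rw [if_neg]
      rintro ⟨h1, -⟩; exact h ⟨-N, by linarith⟩
def Ep (m p : ℕ) : (ℤ → ℤ → ℂ) →ₗ[ℂ] (ℤ → ℤ → ℂ) where
  toFun C := fun D l => if (p : ℤ) ∣ l then (1 / p : ℂ) * ∑ j ∈ range p, C D (l + (2 * m / p : ℤ) * j) else 0
  map_add' C C' := by
    funext D l; simp only [Pi.add_apply, sum_add_distrib]; split_ifs <;> ring
  map_smul' a C := by
    funext D l; simp only [Pi.smul_apply, smul_eq_mul, RingHom.id_apply, ← mul_sum]; split_ifs <;> ring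
lemma Ep_apply (m p : ℕ) (C : ℤ → ℤ → ℂ) (D l : ℤ) : Ep m p C D l =
    if (p : ℤ) ∣ l then (1 / p : ℂ) * ∑ j ∈ range p, C D (l + (2 * m / p : ℤ) * j) else 0 := rfl
lemma two_div (hp : p.Prime) (h : p ^ 2 ∣ m) :
    ∃ k : ℕ, m = k * p ^ 2 ∧ (2 * m / p : ℤ) = 2 * k * p := by
  obtain ⟨k, rfl⟩ := h
  refine ⟨k, by ring, ?_⟩
  have : (p : ℤ) ≠ 0 := by exact_mod_cast hp.ne_zero
  rw [show (2 * ((p ^ 2 * k : ℕ) : ℤ)) = p * (2 * k * p) by push_cast; ring, mul_ediv_cancel_left _ this]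
lemma sum_shift (hp : p.Prime) (h : p ^ 2 ∣ m) 
    (h1 : ∀ D l, C D (l + 2 * m) = C D l) (D l : ℤ) (i : ℤ) :
    ∑ j ∈ range p, C D (l + (2 * m / p : ℤ) * i + (2 * m / p : ℤ) * j) =
      ∑ j ∈ range p, C D (l + (2 * m / p : ℤ) * j) := by
  obtain ⟨k, rfl, hk⟩ := two_div hp h
  rw [hk]
  have key : ∀ l, ∑ j ∈ range p, C D (l + 2 * k * p + 2 * k * p * j) =
      ∑ j ∈ range p, C D (l + 2 * k * p * j) := by
    intro l
    have := sum_range_succ (fun j : ℕ => C D (l + 2 * k * p * j)) p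
    rw [sum_range_succ'] at this
    have e : C D (l + 2 * k * p * p) = C D (l + 2 * k * p * (0 : ℕ)) := by
      rw [← h1 D (l + 2 * k * p * (0 : ℕ))]; congr 1; push_cast; ring
    rw [e] at this
    have := add_right_cancel this
    rw [← this]; refine sum_congr rfl fun j _ => ?_
    congr 1; push_cast; ring
  induction i using induction_on with
  | zero => simp
  | succ i ih =>
    rw [← ih, ← key (l + 2 * k * p * i)]; refine sum_congr rfl fun j _ => ?_
    congr 1; ring
  | pred i ih =>
    rw [← ih, ← key]; refine sum_congr rfl fun j _ => ?_
    congr 1; ring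
lemma Ep_Poly (hp : p.Prime) (h : p ^ 2 ∣ m) (hC : C ∈ PolyC m) :
    Ep m p C ∈ PolyC m := by
  have hC' := hC
  obtain ⟨h1, h2, h3, B, h4⟩ := hC
  have hs := fun D l i => sum_shift hp h h1 D l i
  obtain ⟨k, hm, hk⟩ := two_div hp h
  refine ⟨fun D l => ?_, fun D l => ?_, fun D l h' => ?_, B, fun D l h' => ?_⟩ <;> simp only [Ep_apply]
  · have : (p : ℤ) ∣ 2 * m := ⟨2 * k * p, by rw [hm]; push_cast; ring⟩
    simp only [Int.dvd_add_left this]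
    split_ifs
    · congr 1; refine sum_congr rfl fun j _ => ?_
      rw [← h1 D (l + _)]; congr 1; ring
    · rfl
  · simp only [dvd_neg]
    split_ifs
    · congr 1
      rw [← hs D l (-p + 1), ← sum_range_reflect]
      refine sum_congr rfl fun j hj => ?_
      rw [← h2]; congr 1
      have : j + 1 ≤ p := by simpa using hj
      have : ((p - 1 - j : ℕ) : ℤ) = p - 1 - j := by omega
      rw [this]; ring
    · rfl
  · split_ifs with h5
    · rw [sum_eq_zero, mul_zero]
      intro j _; apply h3
      intro h6; apply h'
      obtain ⟨a, ha⟩ := h5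
      obtain ⟨b, hb⟩ := h6
      refine ⟨b - (a * j + k * j ^ 2), ?_⟩
      rw [hk] at hb
      subst hm; push_cast at hb ⊢
      rw [ha] at hb ⊢
      linear_combination hb
    · rfl
  · split_ifs
    · rw [sum_eq_zero, mul_zero]; intro j _; exact h4 _ _ h'
    · rfl
lemma Ep_idem (hp : p.Prime) (h : p ^ 2 ∣ m) (hC : C ∈ PolyC m) :
    Ep m p (Ep m p C) = Ep m p C := by
  funext D l
  have hpc : (p : ℂ) ≠ 0 := by exact_mod_cast hp.ne_zero
  rw [Ep_apply, Ep_apply]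
  split_ifs with h5
  · have : ∀ j ∈ range p, Ep m p C D (l + (2 * m / p : ℤ) * j) = Ep m p C D l := by
      intro j _
      obtain ⟨k, hm, hk⟩ := two_div hp h
      rw [Ep_apply, Ep_apply, if_pos h5, if_pos, sum_shift hp h hC.1]
      rw [hk]; exact dvd_add h5 ⟨2 * k * j, by ring⟩
    rw [sum_congr rfl this, sum_const, card_range, Ep_apply, if_pos h5, nsmul_eq_mul]
    field_simp
  · rfl
lemma Ep_comm (hp : p.Prime) (h : p ^ 2 ∣ m) (hq : q.Prime) (h' : q ^ 2 ∣ m) (C : ℤ → ℤ → ℂ) :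
    Ep m p (Ep m q C) = Ep m q (Ep m p C) := by
  rcases eq_or_ne p q with rfl | hne
  · rfl
  have key : ∀ {p q : ℕ}, p.Prime → q.Prime → p ≠ q → p ^ 2 ∣ m → q ^ 2 ∣ m → (q : ℤ) ∣ (2 * m / p : ℤ) := by
    intro p q hp hq hne h h'
    obtain ⟨k, rfl, hk⟩ := two_div hp h
    have : q ^ 2 ∣ k := Coprime.dvd_of_dvd_mul_right
      (Coprime.pow 2 2 ((coprime_primes hq hp).2 hne.symm)) h'
    rw [hk]
    obtain ⟨t, rfl⟩ := this
    exact ⟨2 * q * t * p, by push_cast; ring⟩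
  funext D l
  have k1 := key hp hq hne h h'
  have k2 := key hq hp hne.symm h' h
  simp only [Ep_apply, Int.dvd_add_left (dvd_mul_of_dvd_left k1 _), Int.dvd_add_left (dvd_mul_of_dvd_left k2 _)]
  by_cases a : (p : ℤ) ∣ l <;> by_cases b : (q : ℤ) ∣ l <;> simp only [a, b, if_true, if_false, sum_const_zero, mul_zero]
  simp only [← mul_sum]
  rw [sum_comm]
  rw [← mul_assoc, ← mul_assoc, mul_comm (1 / (p : ℂ))]
  congr 1
  refine sum_congr rfl fun j _ => sum_congr rfl fun i _ => ?_
  congr 1; ring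
lemma ofC_Ep (hp : p.Prime) {k : ℕ} (hm : m = k * p ^ 2) (C : ℤ → ℤ → ℂ) :
    ofC m (Ep m p C) = (1 / p : ℂ) • Uc p (uc k p (ofC m C)) := by
  have hp0 : (p : ℤ) ≠ 0 := by exact_mod_cast hp.ne_zero
  funext ⟨n, r⟩
  have hk : (2 * m / p : ℤ) = 2 * k * p := by
    rw [hm, show (2 * ((k * p ^ 2 : ℕ) : ℤ)) = p * (2 * k * p) by push_cast; ring, mul_ediv_cancel_left _ hp0]
  simp only [ofC, Ep_apply, Pi.smul_apply, smul_eq_mul, Uc, uc]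
  split_ifs with h
  · congr 1
    refine sum_congr rfl fun j _ => ?_
    obtain ⟨s, rfl⟩ := h
    rw [mul_ediv_cancel_left _ hp0, hk]
    congr 1
    · rw [hm]; push_cast; ring
    · ring
  · simp
lemma Ep_Jm (hm0 : 0 < m) (hp : p.Prime) (h : p ^ 2 ∣ m) (hC : C ∈ Jm m) :
    Ep m p C ∈ Jm m := by
  obtain ⟨k, hm, hk⟩ := two_div hp h
  have hk0 : 0 < k := by rcases Nat.eq_zero_or_pos k with rfl | h; · simp at hm; omega
                         · exact h
  refine ⟨Ep_Poly hp h hC.1, ?_⟩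
  rw [ofC_Ep hp hm]
  have := hC.2
  subst hm
  exact ((this.u hk0 hp.pos).U hp.pos).smul _
def piE (m : ℕ) : List ℕ → ((ℤ → ℤ → ℂ) →ₗ[ℂ] (ℤ → ℤ → ℂ))
  | [] => LinearMap.id
  | p :: L => (LinearMap.id - Ep m p) ∘ₗ piE m L
lemma piE_cons (m p : ℕ) (L : List ℕ) (C : ℤ → ℤ → ℂ) : piE m (p :: L) C = piE m L C - Ep m p (piE m L C) := rfl
def GoodL (m : ℕ) (L : List ℕ) : Prop := ∀ p ∈ L, p.Prime ∧ p ^ 2 ∣ m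
lemma GoodL.tail (h : GoodL m (p :: L)) : GoodL m L := fun q hq => h q (mem_cons_of_mem _ hq)
lemma piE_Poly (h : GoodL m L) (hC : C ∈ PolyC m) : piE m L C ∈ PolyC m := by
  induction L with
  | nil => exact hC
  | cons p L ih =>
    have := h p mem_cons_self
    exact sub_mem (ih h.tail) (Ep_Poly this.1 this.2 (ih h.tail))
lemma piE_comm (hq : q.Prime) (h' : q ^ 2 ∣ m) (h : GoodL m L) (C : ℤ → ℤ → ℂ) :
    Ep m q (piE m L C) = piE m L (Ep m q C) := by
  induction L with
  | nil => rfl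
  | cons p L ih =>
    have := h p mem_cons_self
    rw [piE_cons, piE_cons, map_sub, Ep_comm hq h' this.1 this.2, ih h.tail]
lemma Ep_piE (h : GoodL m L) (hC : C ∈ PolyC m) (hq : q ∈ L) :
    Ep m q (piE m L C) = 0 := by
  induction L with
  | nil => simp at hq
  | cons p L ih =>
    have hp := h p mem_cons_self
    have hq' := h q hq
    rw [piE_cons, map_sub]
    rcases List.mem_cons.1 hq with rfl | hq
    · rw [Ep_idem hp.1 hp.2 (piE_Poly h.tail hC), sub_self]
    · rw [Ep_comm hq'.1 hq'.2 hp.1 hp.2, ih h.tail hq, map_zero, sub_zero]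
lemma piE_sub (hm : 0 < m) (h : GoodL m L) (hE : ∀ p ∈ L, Ep m p C ∈ Jm m) :
    piE m L C - C ∈ Jm m := by
  induction L with
  | nil => simp [piE]
  | cons p L ih =>
    have hp := h p mem_cons_self
    have h1 := ih h.tail (fun q hq => hE q (mem_cons_of_mem _ hq))
    rw [piE_cons, show piE m L C - Ep m p (piE m L C) - C = (piE m L C - C) - Ep m p (piE m L C - C) - Ep m p C by
      rw [map_sub]; abel]
    exact sub_mem (sub_mem h1 (Ep_Jm hm hp.1 hp.2 h1)) (hE p mem_cons_self)
lemma piE_van {B : ℤ} (hC : ∀ D l, D < B → C D l = 0) (D l : ℤ) (hD : D < B) :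
    piE m L C D l = 0 := by
  induction L generalizing l with
  | nil => exact hC D l hD
  | cons p L ih =>
    rw [piE_cons]; simp only [Pi.sub_apply, Ep_apply, ih, sum_const_zero, mul_zero, ite_self, sub_zero]
lemma dvd_of_eq_z {c : ℤ} (h : a ∣ b) (e : c = b) : a ∣ c := e ▸ h
lemma lattice_zero {Q : Type*} [AddCommGroup Q] [Module ℂ Q] (T : Q →ₗ[ℂ] Q) (q : ℕ) (hq : 2 ≤ q) (y : ℕ → Q)
    (h0 : y 0 = 0) (hT : ∀ k, T (y (k + 1)) = (q : ℂ) • y (k + 2) + y k)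
    (L : Submodule ℤ Q) (hL : L.FG) (hy : ∀ k, y k ∈ L) (k : ℕ) : y k = 0 := by
  set Y : Submodule ℤ Q := span ℤ (Set.range y) with hY
  have hYL : Y ≤ L := span_le.2 (by rintro _ ⟨k, rfl⟩; exact hy k)
  have hfg : Y.FG := Submodule.FG.of_le hL hYL
  have hyY : ∀ k, y k ∈ Y := fun k => subset_span ⟨k, rfl⟩
  set I : Ideal ℤ := Ideal.span {(q : ℤ)}
  have hqI : ∀ x ∈ Y, (q : ℂ) • x ∈ I • Y := fun x hx => by
    rw [show (q : ℂ) • x = (q : ℤ) • x by rw [← cast_smul_eq_zsmul ℂ]; simp]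
    exact Submodule.smul_mem_smul (Ideal.subset_span rfl) hx
  have hIY : I • Y ≤ Y := Submodule.smul_le_right
  -- T preserves
  set TZ : Q →ₗ[ℤ] Q := T.toAddMonoidHom.toIntLinearMap
  have hTZ : ∀ x, TZ x = T x := fun _ => rfl
  have hTY : ∀ x ∈ Y, T x ∈ Y := by
    have : Y ≤ Y.comap TZ := by
      refine span_le.2 ?_
      rintro _ ⟨k, rfl⟩
      change T (y k) ∈ Y
      rcases k with _ | k
      · rw [h0, map_zero]; exact zero_mem _
      · rw [hT]; exact add_mem (hIY (hqI _ (hyY _))) (hyY _)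
    exact fun x hx => this hx
  have hTI : ∀ x ∈ I • Y, T x ∈ I • Y := by
    intro x hx
    refine Submodule.smul_induction_on hx (fun r hr n hn => ?_) (fun a b ha hb => ?_)
    · rw [← hTZ, map_smul]; exact Submodule.smul_mem_smul hr (hTY n hn)
    · rw [map_add]; exact add_mem ha hb
  have e1 : ∀ j k, (T ^ j) (y (k + j)) - y k ∈ I • Y := by
    intro j
    induction j with
    | zero => intro k; simp
    | succ j ih =>
      intro k
      have h1 : (T ^ (j + 1)) (y (k + (j + 1))) = T ((T ^ j) (y (k + 1 + j))) := by
        rw [pow_succ', show k + (j + 1) = k + 1 + j by ring]; rfl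
      have h2 := hTI _ (ih (k + 1))
      rw [map_sub, hT] at h2
      rw [h1]
      have h3 := add_mem h2 (hqI _ (hyY (k + 2)))
      convert h3 using 1; abel
  have hTpI : ∀ j, ∀ x ∈ I • Y, (T ^ j) x ∈ I • Y := by
    intro j; induction j with
    | zero => intro x hx; simpa using hx
    | succ j ih => intro x hx; rw [pow_succ']; exact hTI _ (ih x hx)
  have e2 : ∀ i j, i ≤ j → (T ^ j) (y i) ∈ I • Y := by
    intro i j hij
    obtain ⟨d, rfl⟩ := Nat.exists_eq_add_of_le hij
    have := e1 i 0
    rw [h0, sub_zero, zero_add] at this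
    rw [add_comm, pow_add]; exact hTpI _ _ this
  obtain ⟨K, hK⟩ : ∃ K, Y ≤ span ℤ (y '' Iic K) := by
    obtain ⟨t, ht1, ht2⟩ := Submodule.fg_span_iff_fg_span_finset_subset _ |>.1 hfg
    have : ∀ x ∈ t, ∃ k, y k = x := fun x hx => ht1 hx
    choose! g hg using this
    refine ⟨t.sup g, ?_⟩
    rw [hY, ht2]
    exact Submodule.span_mono fun x hx => ⟨g x, Finset.le_sup (f := g) hx, hg x hx⟩
  have hle : Y ≤ I • Y := by
    refine span_le.2 ?_
    rintro _ ⟨k, rfl⟩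
    have h1 := e1 K k
    have h2 : ∀ x ∈ Y, (T ^ K) x ∈ I • Y := by
      have : span ℤ (y '' Iic K) ≤ (I • Y).comap ((T ^ K).toAddMonoidHom.toIntLinearMap) := by
        refine span_le.2 ?_
        rintro _ ⟨i, hi, rfl⟩
        exact e2 i K hi
      exact fun x hx => this (hK hx)
    have := sub_mem (h2 _ (hyY (k + K))) h1
    rwa [sub_sub_cancel] at this
  obtain ⟨r, hr, hr'⟩ := Submodule.exists_sub_one_mem_and_smul_eq_zero_of_fg_of_le_smul I Y hfg hle
  have hr0 : r ≠ 0 := by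
    rintro rfl
    have := (Ideal.mem_span_singleton.1 hr)
    have h3 : (q : ℤ) ∣ 1 := by rw [← dvd_neg]; simpa using this
    have := Int.le_of_dvd one_pos h3
    omega
  have := hr' _ (hyY k)
  rw [← cast_smul_eq_zsmul ℂ] at this
  exact (smul_eq_zero.1 this).resolve_left (by exact_mod_cast hr0)
lemma rep_unique {m r' : ℤ} (hm : 0 < m) (h0 : 0 ≤ r) (h1 : r ≤ m) (h0' : 0 ≤ r') (h1' : r' ≤ m)
    (h : 2 * m ∣ l - r ∨ 2 * m ∣ l + r) (h' : 2 * m ∣ l - r' ∨ 2 * m ∣ l + r') : r = r' := by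
  have small : ∀ x : ℤ, 2 * m ∣ x → -(2 * m) < x → x < 2 * m → x = 0 := by
    intro x hx h1 h2
    exact eq_zero_of_abs_lt_dvd hx (abs_lt.2 ⟨h1, h2⟩)
  have A : 2 * m ∣ r - r' ∨ 2 * m ∣ r + r' := by
    rcases h with h | h <;> rcases h' with h' | h'
    · left; have := dvd_sub h' h; exact dvd_of_eq_z this (by ring)
    · right; have := dvd_sub h' h; exact dvd_of_eq_z this (by ring)
    · right; have := dvd_sub h h'; exact dvd_of_eq_z this (by ring)
    · left; have := dvd_sub h h'; exact dvd_of_eq_z this (by ring)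
  rcases A with A | A
  · have := small _ A (by omega) (by omega); omega
  · rcases (show r + r' < 2 * m ∨ (r = m ∧ r' = m) by omega) with h | h
    · have := small _ A (by omega) h; omega
    · omega
lemma rep_exists {m : ℤ} (hm : 0 < m) (l : ℤ) : ∃ r, 0 ≤ r ∧ r ≤ m ∧ (2 * m ∣ l - r ∨ 2 * m ∣ l + r) := by
  have h1 := emod_nonneg l (show 2 * m ≠ 0 by omega)
  have h2 := emod_lt_of_pos l (show 0 < 2 * m by omega)
  have h3 : 2 * m ∣ l - l % (2 * m) := Int.dvd_self_sub_emod
  by_cases h : l % (2 * m) ≤ m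
  · exact ⟨_, h1, h, Or.inl h3⟩
  · refine ⟨2 * m - l % (2 * m), by omega, by omega, Or.inr ?_⟩
    have := dvd_add h3 (dvd_refl (2 * m)); exact dvd_of_eq_z this (by ring)
lemma poly_rep (hC : C ∈ PolyC m) 
    (h : (2 * m : ℤ) ∣ l - r ∨ (2 * m : ℤ) ∣ l + r) (D : ℤ) : C D l = C D r := by
  rcases h with h | h
  · exact per_congr hC.1 h
  · rw [← hC.2.1 D r]; exact per_congr hC.1 (by simpa using h)
lemma decomp (hm : 0 < m) (hC : C ∈ PolyC m) {B : ℤ} (hB : ∀ D l, D < -B → C D l = 0) :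
    C - ∑ x ∈ Icc 1 B ×ˢ Icc (0 : ℤ) m, C (-x.1) x.2 • hat m x.1 x.2 ∈ M0 m := by
  have hm' : (0 : ℤ) < m := by exact_mod_cast hm
  refine ⟨sub_mem hC (Submodule.sum_mem _ fun x _ => ?_), 0, zero_mem _, fun D l hD => ?_⟩
  · by_cases h : (4 * m : ℤ) ∣ x.1 - x.2 ^ 2
    · exact smul_mem _ _ (hat_mem h)
    · rw [hC.2.2.1 (-x.1) x.2, zero_smul]; · exact zero_mem _
      intro h'; apply h; rw [← dvd_neg]; exact dvd_of_eq_z h' (by ring)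
  · obtain ⟨r, hr0, hr1, hr⟩ := rep_exists hm' l
    simp only [Pi.sub_apply, Finset.sum_apply, Pi.smul_apply, smul_eq_mul, Pi.zero_apply]
    rw [sum_eq_single (-D, r)]
    · simp only [neg_neg, hat, true_and, hr, if_true, mul_one]
      rw [poly_rep hC hr, sub_self]
    · rintro ⟨N, s⟩ hx hne
      simp only [mem_product, mem_Icc] at hx
      simp only [hat]; rw [if_neg, mul_zero]
      rintro ⟨h1, h2⟩
      apply hne
      rw [rep_unique hm' hr0 hr1 hx.2.1 hx.2.2 hr h2, h1, neg_neg]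
    · intro h
      simp only [mem_product, mem_Icc, not_and] at h
      rw [neg_neg, hB D r, zero_mul]
      by_contra h5
      exact h ⟨by omega, by omega⟩ hr0 hr1
def LF (m : ℕ) : Prop := ∃ n1 : ℤ, ∀ n ≥ n1, ∀ r : ℤ, 0 ≤ r → r ≤ m → ∃ c, IsJ 2 m c ∧ CInt c ∧ Lead (-n) r c
abbrev Qm (m : ℕ) := (ℤ → ℤ → ℂ) ⧸ M0 m
def hq (m : ℕ) (N r : ℤ) : Qm m := (M0 m).mkQ (hat m N r)
lemma hq_zero (h : (4 * m : ℤ) ∣ N - r ^ 2) (hN : N ≤ 0) : hq m N r = 0 := by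
  refine (Submodule.Quotient.mk_eq_zero _).2 ⟨hat_mem h, 0, zero_mem _, fun D l hD => ?_⟩
  simp only [hat]; rw [if_neg]; · rfl
  rintro ⟨h1, -⟩; omega
lemma hq_congr {r' : ℤ} (h : (2 * m : ℤ) ∣ r - r') : hq m N r = hq m N r' := by
  unfold hq; rw [hat_congr h]
lemma hq_neg (m : ℕ) (N r : ℤ) : hq m N (-r) = hq m N r := by
  unfold hq; congr 1; funext D l; simp only [hat, sub_neg_eq_add, ← sub_eq_add_neg, or_comm]
lemma lattice_fg (hm : 0 < m) (hLF : LF m) :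
    ∃ L : Submodule ℤ (Qm m), L.FG ∧ ∀ N r : ℤ, (4 * m : ℤ) ∣ N - r ^ 2 → hq m N r ∈ L := by
  have hm' : (0 : ℤ) < m := by exact_mod_cast hm
  obtain ⟨n1, hn1⟩ := hLF
  set S : Finset (ℤ × ℤ) := Icc (-m : ℤ) n1 ×ˢ Icc (0 : ℤ) m
  set L : Submodule ℤ (Qm m) := span ℤ ((fun x : ℤ × ℤ => hq m (x.2 ^ 2 + 4 * m * x.1) x.2) '' S)
  have key : ∀ k : ℕ, ∀ n r : ℤ, 0 ≤ r → r ≤ m → n * (m + 1) + r < k - m * (m + 1) → hq m (r ^ 2 + 4 * m * n) r ∈ L := by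
    intro k
    induction k with
    | zero =>
      intro n r h0 h1 h2
      have h3 : n < -m := by push_cast at h2; nlinarith
      rw [hq_zero ⟨n, by ring⟩]; · exact zero_mem _
      nlinarith
    | succ k ih =>
      intro n r h0 h1 h2
      by_cases h3 : n < n1
      · by_cases h3' : -m ≤ n
        · exact subset_span ⟨(n, r), by simp [S]; omega, rfl⟩
        · rw [hq_zero ⟨n, by ring⟩]; · exact zero_mem _
          nlinarith
      obtain ⟨c, hc, hci, hl⟩ := hn1 n (by omega) r h0 h1
      have hJ := toC_Jm hm hc
      have hP := hJ.1
      set N0 := r ^ 2 + 4 * m * n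
      by_cases hN0 : N0 ≤ 0
      · rw [hq_zero ⟨n, by simp only [N0]; ring⟩ hN0]; exact zero_mem _
      obtain ⟨B, hB⟩ := hP.2.2.2
      have hd := decomp hm hP (B := max (-B) N0) (fun D l h => hB D l (by have := le_max_left (-B) N0; omega))
      set T := Icc 1 (max (-B) N0) ×ˢ Icc (0 : ℤ) m
      have hcM : toC m c ∈ M0 m := ⟨hP, _, hJ, fun _ _ _ => rfl⟩
      have hs := sub_mem hcM hd
      rw [sub_sub_cancel, ← Submodule.Quotient.mk_eq_zero] at hs
      change (M0 m).mkQ _ = 0 at hs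
      rw [map_sum] at hs
      simp only [map_smul] at hs
      have hmem : (N0, r) ∈ T := by
        simp only [T, mem_product, mem_Icc]
        have := le_max_right (-B) N0
        omega
      rw [← add_sum_erase _ _ hmem] at hs
      have h4m : (4 * m : ℤ) ≠ 0 := by positivity
      have hval : ∀ n' r' : ℤ, toC m c (-(r' ^ 2 + 4 * m * n')) r' = c (-n', r') := by
        intro n' r'
        have := congrFun (ofC_toC hm c) (-n', r')
        rw [← this]; simp only [ofC]; congr 1; ring
      simp only [N0, hval, hl.one, one_smul] at hs
      change hq m N0 r ∈ L
      rw [show hq m N0 r = _ from eq_neg_of_add_eq_zero_left hs]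
      refine neg_mem (Submodule.sum_mem _ ?_)
      rintro ⟨N, s⟩ hx
      rw [mem_erase] at hx
      obtain ⟨hne, hx⟩ := hx
      simp only [T, mem_product, mem_Icc] at hx
      change toC m c (-N) s • hq m N s ∈ L
      by_cases hdv : (4 * m : ℤ) ∣ N - s ^ 2
      · obtain ⟨n', hn'⟩ := hdv
        obtain rfl : N = s ^ 2 + 4 * m * n' := by linarith
        rw [hval]
        obtain ⟨a, ha⟩ := hci (-n', s)
        by_cases hz : c (-n', s) = 0
        · rw [hz, zero_smul]; exact zero_mem _
        have hle : n' < n ∨ (n' = n ∧ s < r) := by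
          by_contra hcon
          rcases lt_trichotomy n' n with h | h | h
          · exact hcon (Or.inl h)
          · have h6 : r ≤ s := by by_contra h7; exact hcon (Or.inr ⟨h, by omega⟩)
            rcases h6.lt_or_eq with h7 | h7
            · apply hz; rw [h]; exact hl.z2 s (lt_of_lt_of_le h7 (le_abs_self _))
            · exact hne (by rw [h, ← h7])
          · exact hz (hl.z1 _ _ (by omega))
        rw [ha, cast_smul_eq_zsmul]
        refine smul_mem _ _ (ih n' s hx.2.1 hx.2.2 ?_)
        push_cast at h2
        rcases hle with h | ⟨rfl, h⟩
        · nlinarith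
        · omega
      · rw [hP.2.2.1 (-N) s, zero_smul]; · exact zero_mem _
        intro h'; apply hdv; rw [← dvd_neg]; exact dvd_of_eq_z h' (by ring)
  refine ⟨L, Submodule.fg_span ((finite_toSet S).image _), fun N r h => ?_⟩
  obtain ⟨s, hs0, hs1, hs⟩ := rep_exists hm' r
  have e1 : hq m N r = hq m N s := by
    rcases hs with hs | hs
    · exact hq_congr hs
    · rw [← hq_neg m N s]; exact hq_congr (by simpa using hs)
  have e2 : (4 * m : ℤ) ∣ N - s ^ 2 := by
    have := hat_cond h (l := s) (by
      rcases hs with hs | hs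
      · left; rw [← dvd_neg]; simpa using hs
      · right; rwa [add_comm])
    rw [← dvd_neg]; exact dvd_of_eq_z this (by ring)
  obtain ⟨n, hn⟩ := e2
  rw [e1, show N = s ^ 2 + 4 * m * n by linarith]
  refine key (n * (m + 1) + s + 1 + m * (m + 1)).toNat n s hs0 hs1 ?_
  have := Int.self_le_toNat (n * (m + 1) + s + 1 + m * (m + 1))
  omega
lemma chi_eq (hq : q.Prime) (hq2 : q ≠ 2) (D : ℤ) : ∃ e : ℤ, chi q D = e ∧
    ((q : ℤ) ∣ D → e = 0) ∧ (¬ (q : ℤ) ∣ D → e ^ 2 = 1) := by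
  have : Fact q.Prime := ⟨hq⟩
  have hc : ringChar (ZMod q) ≠ 2 := by rwa [ZMod.ringChar_zmod_n]
  refine ⟨quadraticChar (ZMod q) (-(D : ZMod q)), ?_, fun h => ?_, fun h => ?_⟩
  · have h1 := quadraticChar_card_sqrts hc (-(D : ZMod q))
    have h2 := sum_range_zmod (q := q) (fun x : ZMod q => if x ^ 2 = -(D : ZMod q) then (1 : ℂ) else 0)
    have h3 : (univ.filter fun x : ZMod q => x ^ 2 = -(D : ZMod q)) = {x : ZMod q | x ^ 2 = -(D : ZMod q)}.toFinset := by
      ext; simp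
    have h4 : (((univ.filter fun x : ZMod q => x ^ 2 = -(D : ZMod q)).card : ℤ) : ℂ) = (quadraticChar (ZMod q) (-(D : ZMod q)) + 1 : ℤ) := by
      rw [h3, ← h1]
    unfold chi
    have h5 : ∑ t ∈ range q, (if (q : ℤ) ∣ t ^ 2 + D then (1 : ℂ) else 0) = ∑ j ∈ range q, if ((j : ZMod q)) ^ 2 = -(D : ZMod q) then (1 : ℂ) else 0 := by
      refine sum_congr rfl fun t _ => ?_
      congr 1
      rw [← intCast_zmod_eq_zero_iff_dvd, eq_neg_iff_add_eq_zero]; push_cast; rfl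
    rw [h5, h2, Finset.sum_boole]
    push_cast at h4
    rw [h4]; ring
  · rw [(intCast_zmod_eq_zero_iff_dvd D q).2 h]; simp
  · exact quadraticChar_sq_one (by rw [neg_ne_zero]; exact fun h' => h ((intCast_zmod_eq_zero_iff_dvd D q).1 h'))
def unitSpan (m : ℕ) : Submodule ℂ (Qm m) :=
  span ℂ {x | ∃ l : ℤ, IsCoprime l (2 * m) ∧ (4 * m : ℤ) ∣ 1 - l ^ 2 ∧ x = hq m 1 l}
lemma hq_unit (hm : 0 < m) (hLF : LF m) (k : ℕ) : ∀ N l : ℤ, N < k → (4 * m : ℤ) ∣ N - l ^ 2 → IsCoprime l (2 * m) →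
    hq m N l ∈ unitSpan m := by
  obtain ⟨L, hL, hmem⟩ := lattice_fg hm hLF
  induction k with
  | zero => intro N l h h1 _; rw [hq_zero h1 (by push_cast at h; omega)]; exact zero_mem _
  | succ k ih =>
    intro N l hN h1 hl
    rcases lt_trichotomy N 1 with h2 | rfl | h2
    · rw [hq_zero h1 (by omega)]; exact zero_mem _
    · exact subset_span ⟨l, hl, h1, rfl⟩
    set q : ℕ := N.natAbs.minFac
    have hq' : q.Prime := Nat.minFac_prime (by omega)
    have hqN : (q : ℤ) ∣ N := Int.natCast_dvd.2 (Nat.minFac_dvd _)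
    have hpr : Prime (q : ℤ) := prime_iff_prime_int.1 hq'
    have hq0 : (q : ℤ) ≠ 0 := by exact_mod_cast hq'.ne_zero
    have hqpos : (0 : ℤ) < q := by exact_mod_cast hq'.pos
    have hcop : IsCoprime (q : ℤ) (2 * m) := by
      have : IsCoprime N (2 * m) := by
        obtain ⟨t, ht⟩ := h1
        have h5 : N = l ^ 2 + (2 * m) * (2 * t) := by linarith
        rw [h5]; exact (hl.pow_left (m := 2)).add_mul_left_left _
      exact this.of_isCoprime_of_dvd_left hqN
    have hqm : ¬ q ∣ 2 * m := fun h => by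
      have : (q : ℤ) ∣ 2 * m := by exact_mod_cast h
      exact hpr.not_isUnit (hcop.isUnit_of_dvd' dvd_rfl this)
    have hq2 : q ≠ 2 := by intro h; rw [h] at hqm; exact hqm (dvd_mul_right _ _)
    have hcop4 : IsCoprime (q : ℤ) (4 * m) := by
      rw [show (4 * m : ℤ) = 2 * (2 * m) by ring]
      exact (hcop.of_isCoprime_of_dvd_right (dvd_mul_right _ _)).mul_right hcop
    obtain ⟨qi, hqi4⟩ : ∃ qi : ℤ, (4 * m : ℤ) ∣ q * qi - 1 := by
      obtain ⟨a, b, hab⟩ := hcop4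
      exact ⟨a, -b, by linear_combination hab⟩
    have hqi : (2 * m : ℤ) ∣ q * qi - 1 := dvd_trans ⟨2, by ring⟩ hqi4
    have hfin : FiniteMultiplicity ((q : ℤ) ^ 2) N := by
      refine Int.finiteMultiplicity_iff.2 ⟨?_, by omega⟩
      rw [Int.natAbs_pow, Int.natAbs_natCast]
      have := hq'.two_le; nlinarith
    obtain ⟨N0, hN0, hnd⟩ := hfin.exists_eq_pow_mul_and_not_dvd
    set e := multiplicity ((q : ℤ) ^ 2) N
    set l0 := qi ^ e * l
    have hpow4 : ∀ e : ℕ, (4 * m : ℤ) ∣ (q : ℤ) ^ e * qi ^ e - 1 := fun e => by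
      rw [← mul_pow]; exact hqi4.trans (sub_one_dvd_pow_sub_one _ _)
    have hc0 : (4 * m : ℤ) ∣ N0 - l0 ^ 2 := by
      have hc : IsCoprime (4 * m : ℤ) (((q : ℤ) ^ 2) ^ e) := (hcop4.symm.pow_right (n := 2)).pow_right
      refine hc.dvd_of_dvd_mul_left ?_
      have h7 : (4 * m : ℤ) ∣ (q ^ e * qi ^ e - 1) * ((q ^ e * qi ^ e + 1) * l ^ 2) := dvd_mul_of_dvd_left (hpow4 e) _
      refine dvd_of_eq_z (dvd_sub h1 h7) ?_
      rw [mul_sub, ← hN0]; simp only [l0]; ring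
    set x : ℕ → Qm m := fun j => hq m (((q : ℤ) ^ 2) ^ j * N0) (q ^ j * l0) with hx
    have hxL : ∀ j, x j ∈ L := fun j => hmem _ _ (dvd_of_eq_z (dvd_mul_of_dvd_right hc0 (((q : ℤ) ^ 2) ^ j)) (by ring))
    have hxe : x e = hq m N l := by
      simp only [hx]; rw [← hN0]
      refine hq_congr ?_
      have := dvd_mul_of_dvd_left ((Dvd.intro_left 2 (by ring : (2:ℤ) * (2 * m) = 4 * m)).trans (hpow4 e)) l
      exact dvd_of_eq_z this (by simp only [l0]; ring)
    set T := (M0 m).mapQ (M0 m) (Tq q qi) (fun C hC => Tq_M0 hm hq' hqm hqi hC)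
    have hT : ∀ N r, T (hq m N r) = (if (q : ℤ) ^ 2 ∣ N then hq m (N / q ^ 2) (qi * r) else 0) + chi q (-N) • hq m N r +
      (q : ℂ) • hq m (q ^ 2 * N) (q * r) := by
      intro N r
      change (M0 m).mkQ (Tq q qi (hat m N r)) = _
      rw [Tq_hat hq' hqi, map_add, map_add, map_smul, map_smul]
      congr 2
      split_ifs <;> simp [hq]
    obtain ⟨χ, hχ, hχ0, hχ1⟩ := chi_eq hq' hq2 (-N0)
    have hT0 : T (x 0) = (χ : ℂ) • x 0 + (q : ℂ) • x 1 := by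
      simp only [hx, pow_zero, one_mul, pow_one]
      rw [hT, if_neg hnd, hχ, zero_add]
    have hT1 : ∀ j, T (x (j + 1)) = (q : ℂ) • x (j + 2) + x j := by
      intro j
      simp only [hx]
      have hz : chi q (-(((q : ℤ) ^ 2) ^ (j + 1) * N0)) = 0 := by
        obtain ⟨χ, hχ, hχ0, -⟩ := chi_eq hq' hq2 (-(((q : ℤ) ^ 2) ^ (j + 1) * N0))
        rw [hχ, hχ0]; · simp
        rw [dvd_neg]; exact ⟨q * ((q : ℤ) ^ 2) ^ j * N0, by ring⟩
      rw [hT, hz, if_pos ⟨((q : ℤ) ^ 2) ^ j * N0, by ring⟩, zero_smul, add_zero, add_comm]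
      congr 1
      · congr 2 <;> ring
      · rw [show ((q : ℤ) ^ 2) ^ (j + 1) * N0 = q ^ 2 * (((q : ℤ) ^ 2) ^ j * N0) by ring,
          mul_ediv_cancel_left _ (pow_ne_zero 2 hq0)]
        refine hq_congr (dvd_of_eq_z (dvd_mul_of_dvd_left hqi (q ^ j * l0)) (by ring))
    by_cases hd : (q : ℤ) ∣ N0
    · have hχ' : χ = 0 := hχ0 (dvd_neg.2 hd)
      have := lattice_zero T q hq'.two_le (fun k => if k = 0 then 0 else x (k - 1)) (by simp) (fun k => ?_) L hL
        (fun k => by split_ifs; exacts [zero_mem _, hxL _]) (e + 1)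
      · simp only [Nat.add_eq_zero_iff, one_ne_zero, and_false, if_false, Nat.add_sub_cancel] at this
        rw [← hxe, this]; exact zero_mem _
      · rcases k with _ | k
        · simp [hT0, hχ']
        · simp [hT1]
    · have hχ' : (χ : ℂ) ^ 2 = 1 := by exact_mod_cast hχ1 (fun h => hd (by simpa using h))
      have hrec := lattice_zero T q hq'.two_le (fun k => if k = 0 then 0 else x k - (χ : ℂ) • x (k - 1)) (by simp) (fun k => ?_) L hL
        (fun k => by
          split_ifs
          · exact zero_mem _
          · rw [cast_smul_eq_zsmul]; exact sub_mem (hxL _) (smul_mem _ _ (hxL _)))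
      · have he : e ≠ 0 := by
          intro h; rw [h, pow_zero, one_mul] at hN0; exact hd (hN0 ▸ hqN)
        have h8 := hrec e
        simp only [he, if_false] at h8
        obtain ⟨f, hf⟩ := exists_eq_succ_of_ne_zero he
        rw [← hxe, sub_eq_zero.1 h8, hf]
        refine smul_mem _ _ (ih _ _ ?_ ?_ ?_)
        · have h9 : N = q ^ 2 * (((q : ℤ) ^ 2) ^ f * N0) := by rw [hN0, hf, succ_eq_add_one]; ring
          have h10 : 0 < ((q : ℤ) ^ 2) ^ f * N0 := by
            by_contra h; nlinarith [pow_pos hqpos 2]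
          have h11 : (4 : ℤ) ≤ q ^ 2 := by have : (2 : ℤ) ≤ q := by exact_mod_cast hq'.two_le
                                           nlinarith
          simp only [succ_eq_add_one, Nat.add_sub_cancel]
          push_cast at hN; nlinarith
        · simp only [succ_eq_add_one, Nat.add_sub_cancel]
          exact dvd_of_eq_z (dvd_mul_of_dvd_right hc0 (((q : ℤ) ^ 2) ^ f)) (by ring)
        · have : IsCoprime qi (2 * m : ℤ) := by
            obtain ⟨t, ht⟩ := hqi; exact ⟨q, -t, by linear_combination ht⟩
          exact (hcop.pow_left).mul_left ((this.pow_left).mul_left hl)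
      · rcases k with _ | _ | k
        · simp only [hT1 0, hT0, zero_add, one_ne_zero, if_false, if_true, Nat.sub_self, map_sub, map_smul, reduceAdd, reduceSub, OfNat.ofNat_ne_zero]
          have h12 : (χ : ℂ) • (χ : ℂ) • x 0 = x 0 := by rw [smul_smul, ← pow_two, hχ', one_smul]
          rw [smul_add, h12]; module
        · simp only [hT1 0, hT1 1, zero_add, one_ne_zero, if_false, if_true, Nat.sub_self, map_sub, map_smul, reduceAdd, reduceSub, OfNat.ofNat_ne_zero]
          module
        · simp only [show k + 1 + 1 + 1 ≠ 0 by omega, show k + 1 + 1 + 2 ≠ 0 by omega, show k + 1 + 1 ≠ 0 by omega, if_false, map_sub, map_smul,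
            show k + 1 + 1 + 1 - 1 = k + 1 + 1 by omega, show k + 1 + 1 + 2 - 1 = k + 1 + 1 + 1 by omega, show k + 1 + 1 - 1 = k + 1 by omega, hT1]
          module
def er (d : ℕ) (x : ℤ) : ℂ := ee (x / d)
lemma er_add (d : ℕ) (x y : ℤ) : er d (x + y) = er d x * er d y := by
  unfold er; rw [← ee_add]; push_cast; ring_nf
lemma er_ne (d : ℕ) (x : ℤ) : er d x ≠ 0 := ee_ne _
lemma er_congr (hd : 0 < d) {x y : ℤ} (h : (d : ℤ) ∣ x - y) : er d x = er d y := by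
  have hd' : (d : ℂ) ≠ 0 := by exact_mod_cast hd.ne'
  obtain ⟨t, ht⟩ := h
  refine ee_congr t ?_
  rw [show x = y + d * t by linarith]; push_cast; field_simp
lemma er_mul {k : ℕ} (hk : 0 < k) (x : ℤ) : er (k * d) (k * x) = er d x := by
  have hk' : (k : ℂ) ≠ 0 := by exact_mod_cast hk.ne'
  unfold er; congr 1; push_cast; rw [mul_div_mul_left _ _ hk']
lemma sum_er (hd : 0 < d) (r : ℤ) :
    ∑ j ∈ range d, er d (r * j) = if (d : ℤ) ∣ r then (d : ℂ) else 0 := by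
  rw [← sum_ee hd r]; simp [er]
lemma sum_per_shift (F : ℤ → ℂ) (hF : ∀ j, F (j + d) = F j) (s : ℤ) :
    ∑ j ∈ range d, F (j + s) = ∑ j ∈ range d, F j := by
  have one : ∀ G : ℤ → ℂ, (∀ j, G (j + d) = G j) → ∑ j ∈ range d, G (j + 1) = ∑ j ∈ range d, G j := by
    intro G hG
    have h3 := sum_range_succ (fun i : ℕ => G i) d
    rw [sum_range_succ'] at h3
    have h4 := hG 0
    simp only [zero_add, cast_zero, cast_add, cast_one] at h3 h4
    rw [h4] at h3
    exact add_right_cancel h3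
  induction s using induction_on with
  | zero => simp
  | succ i ih =>
    rw [← ih, ← one (fun j => F (j + i)) (fun j => by rw [← hF (j + i)]; congr 1; ring)]
    refine sum_congr rfl fun j _ => ?_
    congr 1; ring
  | pred i ih =>
    rw [← ih, ← one (fun j => F (j + (-i - 1))) (fun j => by rw [← hF (j + (-i - 1))]; congr 1; ring)]
    refine sum_congr rfl fun j _ => ?_
    congr 1; ring
lemma sum_mult (hM : 0 < M) (F : ℤ → ℂ) :
    ∑ y ∈ range (E * M), (if (M : ℤ) ∣ y then F y else 0) = ∑ k ∈ range E, F (k * M) := by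
  rw [← sum_filter]
  refine (Finset.sum_bij (fun k _ => k * M) ?_ ?_ ?_ ?_).symm
  · intro k hk
    simp only [mem_filter, mem_range] at hk ⊢
    exact ⟨Nat.mul_lt_mul_of_pos_right hk hM, ⟨k, by push_cast; ring⟩⟩
  · intro a _ b _ h; exact Nat.eq_of_mul_eq_mul_right hM h
  · intro y hy
    simp only [mem_filter, mem_range] at hy
    obtain ⟨k, hk⟩ := natCast_dvd_natCast.1 hy.2
    refine ⟨k, ?_, by rw [hk]; ring⟩
    rw [mem_range]; rw [hk, mul_comm E] at hy; exact lt_of_mul_lt_mul_left hy.1 (Nat.zero_le _)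
  · intro k _; push_cast; rfl
lemma sum_class (hM : 0 < M) (F : ℤ → ℂ) (hF : ∀ j, F (j + (E * M : ℕ)) = F j) (l : ℤ) :
    ∑ y ∈ range (E * M), (if (M : ℤ) ∣ y - l then F y else 0) = ∑ k ∈ range E, F (l + k * M) := by
  rw [← sum_per_shift (fun y : ℤ => if (M : ℤ) ∣ y - l then F y else 0) (fun j => ?_) l]
  · simp only [add_sub_cancel_right]
    rw [sum_mult hM (fun y => F (y + l))]
    simp only [add_comm]
  · rw [hF]
    simp only [show j + ((E * M : ℕ) : ℤ) - l = (j - l) + M * E by push_cast; ring, Int.dvd_add_left (dvd_mul_right _ _)]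
def Tv (m : ℕ) (a : ℤ) (v : ℤ → ℂ) : ℤ → ℂ := fun l => er (4 * m) (a * l ^ 2) * v l
def Sv (m : ℕ) (v : ℤ → ℂ) : ℤ → ℂ := fun x => ∑ y ∈ range (2 * m), er (4 * m) (2 * x * y) * v y
lemma Sv_inj (hm : 0 < m) (hp : ∀ l, v (l + 2 * m) = v l) (h : ∀ x, Sv m v x = 0) (l : ℤ) : v l = 0 := by
  have h1 : ∑ x ∈ range (2 * m), er (4 * m) (-2 * x * l) * Sv m v x = 0 := by simp [h]
  simp only [Sv, mul_sum] at h1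
  rw [sum_comm] at h1
  have h2 : ∀ y : ℕ, ∑ x ∈ range (2 * m), er (4 * m) (-2 * x * l) * (er (4 * m) (2 * x * y) * v y) =
      if ((2 * m : ℕ) : ℤ) ∣ y - l then (2 * m : ℂ) * v y else 0 := by
    intro y
    have := sum_er (d := 2 * m) (by omega) (y - l)
    simp only [← mul_assoc, ← er_add, ← sum_mul]
    have e : ∀ x : ℕ, er (4 * m) (-2 * x * l + 2 * x * y) = er (2 * m) ((y - l) * x) := fun x => by
      rw [← er_mul (d := 2 * m) two_pos, show 2 * (2 * m) = 4 * m by ring]; congr 1; push_cast; ring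
    simp only [e, this]
    split_ifs <;> simp
  simp only [h2] at h1
  have h3 := sum_class (E := 1) (M := 2 * m) (by omega) (fun y => (2 * m : ℂ) * v y) (fun j => by
    rw [← hp j]; push_cast; ring_nf) l
  simp only [one_mul] at h3
  rw [h3] at h1
  simpa [hm.ne'] using h1
lemma kernel {F M' : ℕ} (hm : 0 < m) (h2 : 2 * m = E * M) (h4 : 4 * m = F * M') (f1 : F ∣ 2 * E) (f2 : F ∣ E ^ 2)
    (f3 : E ∣ F) (ha : (M' : ℤ) ∣ a) (ha' : (F : ℤ) ∣ a - 1) (r : ℤ) :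
    ∑ x ∈ range (2 * m), er (4 * m) (a * x ^ 2 + 2 * x * r) =
      if (M : ℤ) ∣ r then (∑ x ∈ range (2 * m), er (4 * m) (a * x ^ 2)) * er (4 * m) (-a * r ^ 2) else 0 := by
  have h4m : 0 < 4 * m := by omega
  have hE : 0 < E := Nat.pos_of_ne_zero (by rintro rfl; omega)
  obtain ⟨b, rfl⟩ := ha
  obtain ⟨s1, f1⟩ := f1
  obtain ⟨s2, f2⟩ := f2
  obtain ⟨s3, f3⟩ := f3
  obtain ⟨s4, ha'⟩ := ha'
  have h2' : (2 * m : ℤ) = E * M := by exact_mod_cast h2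
  have h4' : (4 * m : ℤ) = F * M' := by exact_mod_cast h4
  have f1' : (2 * E : ℤ) = F * s1 := by exact_mod_cast f1
  have f2' : (E ^ 2 : ℤ) = F * s2 := by exact_mod_cast f2
  have f3' : (F : ℤ) = E * s3 := by exact_mod_cast f3
  have hper : ∀ r j : ℤ, er (4 * m) (M' * b * (j + (2 * m : ℕ)) ^ 2 + 2 * (j + (2 * m : ℕ)) * r) = er (4 * m) (M' * b * j ^ 2 + 2 * j * r) :=
    fun r j => er_congr h4m ⟨M' * b * (j + m) + r, by push_cast; ring⟩
  split_ifs with h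
  · obtain ⟨k, rfl⟩ := h
    rw [← sum_per_shift (fun x : ℤ => er (4 * m) (M' * b * x ^ 2)) (fun j => by simpa using hper 0 j) (M' * b * (M * k)), sum_mul]
    refine sum_congr rfl fun x _ => ?_
    rw [← er_add]
    refine er_congr h4m ⟨-(s4 * s3 * (M' * b + 1) * x * k) - b * s4 * (M' * b + 1) * M ^ 2 * k ^ 2, ?_⟩
    push_cast
    linear_combination (-(M' * b + 1) * (2 * x * M * k + M' * b * (M * k) ^ 2)) * ha' - s4 * (M' * b + 1) * 2 * x * M * k * f3' +
      (2 * s4 * s3 * (M' * b + 1) * x * k) * h2' + (b * s4 * (M' * b + 1) * M ^ 2 * k ^ 2) * h4'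
  · have key := sum_per_shift (fun x : ℤ => er (4 * m) (M' * b * x ^ 2 + 2 * x * r)) (hper r) E
    have e : ∀ x : ℤ, er (4 * m) (M' * b * (x + E) ^ 2 + 2 * (x + E) * r) = er (4 * m) (2 * E * r) * er (4 * m) (M' * b * x ^ 2 + 2 * x * r) := by
      intro x
      rw [← er_add]
      refine er_congr h4m ⟨b * (s1 * x + s2), ?_⟩
      push_cast
      linear_combination (M' * b * x) * f1' + (M' * b) * f2' - b * (s1 * x + s2) * h4'
    simp only [e, ← mul_sum] at key
    have hne : er (4 * m) (2 * E * r) ≠ 1 := by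
      intro h1
      apply h
      rw [show er (4 * m) (2 * E * r) = er M r by
        rw [← er_mul (d := M) (show 0 < 2 * E by omega), show 2 * E * M = 4 * m by rw [mul_assoc, ← h2]; ring]; push_cast; rfl] at h1
      have hM : 0 < M := Nat.pos_of_ne_zero (by rintro rfl; omega)
      unfold er ee at h1
      obtain ⟨n, hn⟩ := exp_eq_one_iff.1 h1
      refine ⟨n, ?_⟩
      have hMc : (M : ℂ) ≠ 0 := by exact_mod_cast hM.ne'
      have hpi : (2 * (Real.pi : ℂ) * I) ≠ 0 := by simp [pi_ne_zero]
      have h5 : (r : ℂ) / M = n := mul_left_cancel₀ hpi (by rw [hn]; ring)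
      rw [div_eq_iff hMc] at h5
      have : r = n * M := by exact_mod_cast h5
      rw [this]; ring
    have : (er (4 * m) (2 * E * r) - 1) * ∑ x ∈ range (2 * m), er (4 * m) (M' * b * x ^ 2 + 2 * x * r) = 0 := by
      rw [sub_mul, key, one_mul, sub_self]
    exact (mul_eq_zero.1 this).resolve_left (sub_ne_zero.2 hne)
lemma STSv {F M' : ℕ} (hm : 0 < m) (h2 : 2 * m = E * M) (h4 : 4 * m = F * M') (f1 : F ∣ 2 * E) (f2 : F ∣ E ^ 2)
    (f3 : E ∣ F) (ha : (M' : ℤ) ∣ a) (ha' : (F : ℤ) ∣ a - 1) (hp : ∀ l, v (l + 2 * m) = v l)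
    (he : ∀ l, v (-l) = v l) (l : ℤ) :
    Sv m (Tv m a (Sv m (Tv m a v))) l = (∑ x ∈ range (2 * m), er (4 * m) (a * x ^ 2)) * er (4 * m) (-a * l ^ 2) *
      ∑ k ∈ range E, er (4 * m) (2 * a * l * (l + k * M)) * v (l + k * M) := by
  have h4m : 0 < 4 * m := by omega
  have hM : 0 < M := Nat.pos_of_ne_zero (by rintro rfl; omega)
  have e1 : Sv m (Tv m a (Sv m (Tv m a v))) l = ∑ y ∈ range (2 * m),
      (∑ x ∈ range (2 * m), er (4 * m) (a * x ^ 2 + 2 * x * (l + y))) * (er (4 * m) (a * y ^ 2) * v y) := by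
    simp only [Sv, Tv, mul_sum, sum_mul]
    rw [sum_comm]
    refine sum_congr rfl fun y _ => sum_congr rfl fun x _ => ?_
    rw [show a * (x : ℤ) ^ 2 + 2 * x * (l + y) = 2 * l * x + a * x ^ 2 + 2 * x * y by ring, er_add, er_add]; ring
  rw [e1]
  simp only [kernel hm h2 h4 f1 f2 f3 ha ha']
  set K := ∑ x ∈ range (2 * m), er (4 * m) (a * x ^ 2)
  have e2 : ∀ y : ℤ, (if (M : ℤ) ∣ l + y then K * er (4 * m) (-a * (l + y) ^ 2) else 0) * (er (4 * m) (a * y ^ 2) * v y) =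
      (fun y : ℤ => if (M : ℤ) ∣ y - l then K * er (4 * m) (-a * l ^ 2) * (er (4 * m) (2 * a * l * y) * v y) else 0) (-y) := by
    intro y
    simp only [show -y - l = -(l + y) by ring, dvd_neg, he]
    split_ifs
    · rw [show K * er (4 * m) (-a * (l + y) ^ 2) * (er (4 * m) (a * y ^ 2) * v y) = K * (er (4 * m) (-a * (l + y) ^ 2) * er (4 * m) (a * y ^ 2)) * v y by ring,
        ← er_add, show -a * (l + y) ^ 2 + a * y ^ 2 = -a * l ^ 2 + 2 * a * l * -y by ring, er_add]; ring
    · ring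
  have hG : ∀ j : ℤ, er (4 * m) (2 * a * l * (j + (2 * m : ℕ))) * v (j + (2 * m : ℕ)) = er (4 * m) (2 * a * l * j) * v j := by
    intro j
    rw [show j + ((2 * m : ℕ) : ℤ) = j + 2 * m by push_cast; ring, hp]
    congr 1
    exact er_congr h4m ⟨a * l, by push_cast; ring⟩
  rw [sum_congr rfl (fun (y : ℕ) _ => e2 y), sum_per_neg (fun y : ℤ => if (M : ℤ) ∣ y - l then K * er (4 * m) (-a * l ^ 2) * (er (4 * m) (2 * a * l * y) * v y) else 0), h2, sum_class hM (fun y : ℤ => K * er (4 * m) (-a * l ^ 2) * (er (4 * m) (2 * a * l * y) * v y)), mul_sum]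
  · intro j; rw [← h2, hG]
  · intro j
    rw [hG]
    simp only [h2, show j + ((E * M : ℕ) : ℤ) - l = (j - l) + M * E by push_cast; ring, Int.dvd_add_left (dvd_mul_right _ _)]
structure RepSet (m : ℕ) (P : Set (ℤ → ℂ)) : Prop where
  per : ∀ v ∈ P, ∀ l, v (l + 2 * m) = v l
  even : ∀ v ∈ P, ∀ l, v (-l) = v l
  hT : ∀ v ∈ P, Tv m 1 v ∈ P
  hS : ∀ v ∈ P, Sv m v ∈ P
  unit : ∀ v ∈ P, ∀ l : ℤ, IsCoprime l (2 * m) → v l = 0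
  prim : ∀ v ∈ P, ∀ p : ℕ, p.Prime → ∀ k : ℕ, m = k * p ^ 2 → ∀ l : ℤ, (p : ℤ) ∣ l →
    ∑ j ∈ range p, v (l + 2 * k * p * j) = 0
lemma RepSet.Ta (h : RepSet m P) (hv : v ∈ P) (a : ℕ) : Tv m a v ∈ P := by
  induction a with
  | zero => convert hv using 1; funext l; simp [Tv, er, ee_zero]
  | succ a ih =>
    convert h.hT _ ih using 1; funext l; simp only [Tv, ← mul_assoc, ← er_add]; congr 2; push_cast; ring
lemma RepSet.avg (hm : 0 < m) (h : RepSet m P) {e : ℕ} (hp : p.Prime)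
    (h2 : 2 * m = p ^ (e + 1) * M) (hpM : ¬ p ∣ M) (hl : (p : ℤ) ∣ l)
    (hvan : ∀ w ∈ P, ∀ k : ℤ, ¬ (p : ℤ) ∣ l + k * M → w (l + k * M) = 0) (hv : v ∈ P) :
    (p : ℂ) * v l = ∑ j ∈ range p, v (l + j * (p ^ e * M)) := by
  have hpr : Prime (p : ℤ) := prime_iff_prime_int.1 hp
  have hp0 : 0 < p := hp.pos
  have hM0 : 0 < M := Nat.pos_of_ne_zero (by rintro rfl; omega)
  have h4m : 0 < 4 * m := by omega
  set E := p ^ (e + 1) with hE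
  have hE0 : 0 < E := pow_pos hp0 _
  obtain ⟨F, M', h4, f1, f2, f3, hcop⟩ : ∃ F M' : ℕ, 4 * m = F * M' ∧ F ∣ 2 * E ∧ F ∣ E ^ 2 ∧ E ∣ F ∧ Coprime F M' := by
    by_cases h2p : p = 2
    · refine ⟨2 * E, M, by rw [mul_assoc, ← h2]; ring, dvd_rfl, ?_, dvd_mul_left _ _, ?_⟩
      · rw [pow_two]; exact Nat.mul_dvd_mul_right (by rw [hE, h2p]; exact dvd_pow_self _ (by omega)) _
      · rw [show 2 * E = p ^ (e + 2) by rw [hE, h2p]; ring]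
        exact Coprime.pow_left _ ((Nat.Prime.coprime_iff_not_dvd hp).2 hpM)
    · refine ⟨E, 2 * M, by rw [show E * (2 * M) = 2 * (E * M) by ring, ← h2]; ring, dvd_mul_left _ _, dvd_pow_self _ two_ne_zero, dvd_rfl, ?_⟩
      refine Coprime.pow_left _ ((Nat.Prime.coprime_iff_not_dvd hp).2 fun h => ?_)
      rcases (Nat.Prime.dvd_mul hp).1 h with h | h
      · exact h2p ((Nat.prime_dvd_prime_iff_eq hp prime_two).1 h)
      · exact hpM h
  obtain ⟨a, ha, ha'⟩ : ∃ a : ℕ, (M' : ℤ) ∣ a ∧ (F : ℤ) ∣ (a : ℤ) - 1 := by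
    obtain ⟨u, w, huw⟩ := isCoprime_iff_coprime.2 hcop
    have hz : ((w * M' % (4 * m : ℕ)).toNat : ℤ) = w * M' - (4 * m : ℕ) * (w * M' / (4 * m : ℕ)) := by
      rw [toNat_of_nonneg (emod_nonneg _ (by exact_mod_cast h4m.ne')), Int.emod_def]
    refine ⟨(w * M' % (4 * m : ℕ)).toNat, ?_, ?_⟩
    · rw [hz, h4]; exact ⟨w - F * (w * M' / (F * M' : ℕ)), by push_cast; ring⟩
    · rw [hz, h4]; exact ⟨-u - M' * (w * M' / (F * M' : ℕ)), by push_cast; linear_combination huw⟩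
  have hpE : (p : ℤ) ∣ F := dvd_trans (by exact_mod_cast (dvd_pow_self p (by omega : e + 1 ≠ 0))) (natCast_dvd_natCast.2 f3)
  have hpa : ¬ (p : ℤ) ∣ a := fun h' => hpr.not_isUnit (isUnit_of_dvd_one (by
    have := dvd_sub h' (hpE.trans ha'); simpa using this))
  have hpM' : ¬ (p : ℤ) ∣ M := fun h' => hpM (natCast_dvd_natCast.1 h')
  have hST := fun l => STSv hm h2 h4 f1 f2 f3 ha ha' (h.per v hv) (h.even v hv) l
  by_cases hK : (∑ x ∈ range (2 * m), er (4 * m) (a * x ^ 2)) = 0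
  · have hz : ∀ l, v l = 0 := by
      have z0 : ∀ l, Sv m (Tv m a (Sv m (Tv m a v))) l = 0 := fun l => by rw [hST, hK]; ring
      have m1 := h.hS _ (h.Ta hv a)
      have z1 := Sv_inj hm (h.per _ (h.Ta m1 a)) z0
      have z2 : ∀ l, Sv m (Tv m a v) l = 0 := fun l => (mul_eq_zero.1 (z1 l)).resolve_left (er_ne _ _)
      have z3 := Sv_inj hm (h.per _ (h.Ta hv a)) z2
      exact fun l => (mul_eq_zero.1 (z3 l)).resolve_left (er_ne _ _)
    simp [hz]
  have hper : ∀ l t : ℤ, v (l + 2 * m * t) = v l := by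
    intro l t
    induction t using induction_on with
    | zero => simp
    | succ i ih => rw [← ih, ← h.per v hv (l + 2 * m * i)]; congr 1; ring
    | pred i ih => rw [← ih, ← h.per v hv (l + 2 * m * (-i - 1))]; congr 1; ring
  have h2' : (2 * m : ℤ) = E * M := by exact_mod_cast h2
  have h4E : 4 * m = 2 * M * E := by linarith
  have key : ∀ k1 : ℤ, ¬ (p : ℤ) ∣ l + k1 * M → ∑ k ∈ range E, er E (a * (l + k1 * M) * k) * v (l + k * M) = 0 := by
    intro k1 hk1
    have h5 := hvan _ (h.hS _ (h.Ta (h.hS _ (h.Ta hv a)) a)) k1 hk1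
    rw [hST] at h5
    have h6 := (mul_eq_zero.1 h5).resolve_left (mul_ne_zero hK (er_ne _ _))
    set l1 := l + k1 * M with hl1
    have h7 := sum_per_shift (d := E) (fun k : ℤ => er (4 * m) (2 * a * l1 * (l + k * M)) * v (l + k * M)) (fun j => by
      rw [show l + (j + E) * M = l + j * M + 2 * m * 1 by rw [h2']; ring, hper]
      congr 1
      exact er_congr h4m ⟨a * l1, by push_cast; ring⟩) k1
    have h8 : ∀ k : ℕ, l + (k + k1) * M = l1 + k * M := fun k => by rw [hl1]; ring
    simp only [h8] at h7
    rw [h6] at h7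
    have h9 : ∀ k : ℕ, er (4 * m) (2 * a * l1 * (l + k * M)) * v (l + k * M) = er (4 * m) (2 * a * l1 * l) * (er E (a * l1 * k) * v (l + k * M)) := by
      intro k
      rw [← er_mul (d := E) (show 0 < 2 * M by omega) (a * l1 * k), ← h4E, ← mul_assoc, ← er_add]
      congr 2; push_cast; ring
    simp only [h9, ← mul_sum] at h7
    exact (mul_eq_zero.1 h7.symm).resolve_left (er_ne _ _)
  have tot : ∑ k1 ∈ range E, (if (p : ℤ) ∣ k1 then 0 else ∑ k ∈ range E, er E (a * (l + k1 * M) * k) * v (l + k * M)) = 0 := by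
    refine sum_eq_zero fun k1 _ => ?_
    split_ifs with h5
    · rfl
    · refine key k1 fun h6 => ?_
      have h7 := (dvd_sub h6 hl); rw [add_sub_cancel_left] at h7
      exact (hpr.dvd_or_dvd h7).elim h5 hpM'
  have i1 : ∀ k : ℕ, ∑ k1 ∈ range E, er E (a * (l + k1 * M) * k) = if (E : ℤ) ∣ k then (E : ℂ) else 0 := by
    intro k
    have h5 := sum_er hE0 (a * M * k)
    have h6 : ((E : ℤ) ∣ a * M * k) ↔ (E : ℤ) ∣ k := by
      have : IsCoprime (E : ℤ) (a * M) := by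
        rw [hE]; push_cast
        exact IsCoprime.pow_left (((hpr.coprime_iff_not_dvd).2 hpa).mul_right ((hpr.coprime_iff_not_dvd).2 hpM'))
      exact ⟨fun h => this.dvd_of_dvd_mul_left h, fun h => dvd_mul_of_dvd_right h _⟩
    simp only [h6] at h5
    have h7 : ∀ k1 : ℕ, er E (a * (l + k1 * M) * k) = er E (a * l * k) * er E (a * M * k * k1) := fun k1 => by
      rw [← er_add]; congr 1; ring
    simp only [h7, ← mul_sum, h5]
    split_ifs with h8
    · rw [er_congr hE0 (y := 0) (by rw [sub_zero]; exact dvd_mul_of_dvd_right h8 _)]; simp [er, ee_zero]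
    · ring
  have hpe0 : 0 < p ^ e := pow_pos hp0 _
  have i2 : ∀ k : ℕ, ∑ k1 ∈ range E, (if (p : ℤ) ∣ k1 then er E (a * (l + k1 * M) * k) else 0) = if ((p ^ e : ℕ) : ℤ) ∣ k then ((p ^ e : ℕ) : ℂ) else 0 := by
    intro k
    rw [show E = p ^ e * p from pow_succ _ _, sum_mult hp0 (fun k1 => er (p ^ e * p) (a * (l + k1 * M) * k))]
    have h5 := sum_er hpe0 (a * M * k)
    have h6 : (((p ^ e : ℕ) : ℤ) ∣ a * M * k) ↔ ((p ^ e : ℕ) : ℤ) ∣ k := by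
      have : IsCoprime ((p ^ e : ℕ) : ℤ) (a * M) := by
        push_cast
        exact IsCoprime.pow_left (((hpr.coprime_iff_not_dvd).2 hpa).mul_right ((hpr.coprime_iff_not_dvd).2 hpM'))
      exact ⟨fun h => this.dvd_of_dvd_mul_left h, fun h => dvd_mul_of_dvd_right h _⟩
    simp only [h6] at h5
    have h7 : ∀ t : ℕ, er (p ^ e * p) (a * (l + (t : ℤ) * p * M) * k) = er (p ^ e * p) (a * l * k) * er (p ^ e) (a * M * k * t) := fun t => by
      rw [← er_mul hp0 (a * M * k * t), mul_comm p (p ^ e), ← er_add]; congr 1; ring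
    simp only [h7, ← mul_sum, h5]
    split_ifs with h8
    · obtain ⟨s, hs⟩ := h8
      obtain ⟨l', rfl⟩ := hl
      rw [er_congr (by positivity) (y := 0) ⟨a * l' * s, by rw [hs]; push_cast; ring⟩]; simp [er, ee_zero]
    · ring
  have tot2 : ∑ k ∈ range E, ((if (E : ℤ) ∣ k then (E : ℂ) else 0) - (if ((p ^ e : ℕ) : ℤ) ∣ k then ((p ^ e : ℕ) : ℂ) else 0)) * v (l + k * M) = 0 := by
    refine Eq.trans ?_ tot
    have : ∀ k1 : ℕ, (if (p : ℤ) ∣ k1 then 0 else ∑ k ∈ range E, er E (a * (l + k1 * M) * k) * v (l + k * M)) =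
        ∑ k ∈ range E, (er E (a * (l + k1 * M) * k) - if (p : ℤ) ∣ k1 then er E (a * (l + k1 * M) * k) else 0) * v (l + k * M) := by
      intro k1; split_ifs <;> simp
    simp only [this]
    rw [sum_comm]
    refine sum_congr rfl fun k _ => ?_
    rw [← sum_mul, sum_sub_distrib, i1, i2]
  simp only [sub_mul, sum_sub_distrib, ite_mul, zero_mul] at tot2
  have s1 := sum_mult (E := 1) hE0 (fun k : ℤ => (E : ℂ) * v (l + k * M))
  have s2 := sum_mult (E := p) hpe0 (fun k : ℤ => ((p ^ e : ℕ) : ℂ) * v (l + k * M))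
  rw [one_mul] at s1
  rw [show p * p ^ e = E by rw [hE]; ring] at s2
  rw [s1, s2] at tot2
  simp only [Finset.range_one, Finset.sum_singleton, cast_zero, zero_mul, add_zero, ← mul_sum] at tot2
  have hpc : ((p ^ e : ℕ) : ℂ) ≠ 0 := by exact_mod_cast hpe0.ne'
  refine mul_left_cancel₀ hpc ?_
  have h9 : (E : ℂ) = ((p ^ e : ℕ) : ℂ) * p := by rw [hE]; push_cast; ring
  rw [h9] at tot2
  rw [← mul_assoc, sub_eq_zero.1 tot2]
  congr 1; refine sum_congr rfl fun j _ => ?_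
  congr 1; push_cast; ring
lemma RepSet.step (hm : 0 < m) (h : RepSet m P) {e : ℕ} (hp : p.Prime)
    (h2 : 2 * m = p ^ (e + 1) * M) (hpM : ¬ p ∣ M) (hl : (p : ℤ) ∣ l)
    (hvan : ∀ w ∈ P, ∀ k : ℤ, ¬ (p : ℤ) ∣ l + k * M → w (l + k * M) = 0) (hv : v ∈ P) : v l = 0 := by
  have hA := fun w hw => h.avg hm hp h2 hpM hl hvan (v := w) hw
  have hpr : Prime (p : ℤ) := prime_iff_prime_int.1 hp
  have hpc : (p : ℂ) ≠ 0 := by exact_mod_cast hp.ne_zero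
  have hM : ¬ (p : ℤ) ∣ M := fun h' => hpM (natCast_dvd_natCast.1 h')
  by_cases hpm : p ^ 2 ∣ m
  · obtain ⟨k, hk⟩ := hpm
    have h5 := h.prim v hv p hp k (by rw [hk]; ring) l hl
    have h6 : p ^ e * M = 2 * k * p := by
      refine eq_of_mul_eq_mul_left hp.pos ?_
      rw [show p * (p ^ e * M) = p ^ (e + 1) * M by ring, ← h2, hk]; ring
    have h6' : ((p : ℤ) ^ e * M) = 2 * k * p := by exact_mod_cast h6
    have h7 := hA v hv
    rw [h6'] at h7
    rw [show ∑ j ∈ range p, v (l + (j : ℤ) * (2 * k * p)) = ∑ j ∈ range p, v (l + 2 * k * p * j) from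
      sum_congr rfl fun j _ => by congr 1; ring, h5] at h7
    exact (mul_eq_zero.1 h7).resolve_left hpc
  rcases Nat.eq_zero_or_pos e with rfl | he
  · have h7 := hA v hv
    rw [sum_eq_single 0] at h7
    · simp only [cast_zero, zero_mul, add_zero] at h7
      have h8 : ((p : ℂ) - 1) * v l = 0 := by rw [sub_mul, h7, one_mul, sub_self]
      refine (mul_eq_zero.1 h8).resolve_left (sub_ne_zero.2 ?_)
      exact_mod_cast hp.one_lt.ne'
    · intro j hj hj0
      rw [pow_zero, one_mul]
      refine hvan v hv j fun h8 => ?_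
      have h9 := dvd_sub h8 hl; rw [add_sub_cancel_left] at h9
      rcases hpr.dvd_or_dvd h9 with h10 | h10
      · have := le_of_dvd (Nat.pos_of_ne_zero hj0) (natCast_dvd_natCast.1 h10)
        have := mem_range.1 hj; omega
      · exact hM h10
    · intro h8; exact absurd (mem_range.2 hp.pos) h8
  · -- p = 2
    have hp2 : p = 2 := by
      by_contra hne
      apply hpm
      have : p ^ 2 ∣ 2 * m := h2 ▸ dvd_mul_of_dvd_left (pow_dvd_pow p (by omega)) _
      exact (Coprime.pow_left 2 ((coprime_primes hp prime_two).2 hne)).dvd_of_dvd_mul_left this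
    subst hp2
    have he1 : e = 1 := by
      by_contra hne
      obtain ⟨f, rfl⟩ : ∃ f, e = f + 2 := ⟨e - 2, by omega⟩
      exact hpm ⟨2 ^ f * M, by have : 2 ^ (f + 2 + 1) * M = 2 * (2 ^ 2 * (2 ^ f * M)) := by ring
                               omega⟩
    subst he1
    have hmM : m = 2 * M := by omega
    obtain ⟨s, hs⟩ := hl
    have hMo : ∃ t : ℤ, (M : ℤ) = 2 * t + 1 := by
      rcases even_or_odd' (M : ℤ) with ⟨t, ht | ht⟩
      · exact absurd ⟨t, ht⟩ hM
      · exact ⟨t, ht⟩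
    obtain ⟨t, ht⟩ := hMo
    have h7 := hA v hv
    have h8 := hA _ (h.hT v hv)
    simp only [sum_range_succ, Finset.sum_range_zero, cast_zero, cast_one, zero_mul, one_mul, add_zero, zero_add, Tv] at h7 h8
    have h9 : er (4 * m) ((l + (2 : ℕ) ^ 1 * M) ^ 2) = - er (4 * m) (l ^ 2) := by
      rw [er_congr (show 0 < 4 * m by omega) (y := l ^ 2 + 2 * m) ⟨s + t, by push_cast [hmM, hs]; linear_combination 4 * M * ht⟩, er_add,
        show er (4 * m) (2 * m) = -1 from ?_]
      · ring
      · unfold er ee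
        have : (m : ℂ) ≠ 0 := by exact_mod_cast hm.ne'
        rw [← exp_pi_mul_I]; congr 1; push_cast; field_simp; ring
    rw [h9] at h8
    have h10 : er (4 * m) (l ^ 2) * v l = 0 := by
      push_cast at h7 h8
      linear_combination (1 / 2) * h8 - (-(1 / 2)) * er (4 * m) (l ^ 2) * h7
    exact (mul_eq_zero.1 h10).resolve_left (er_ne _ _)
lemma RepSet.zero (hm : 0 < m) (h : RepSet m P) : ∀ v ∈ P, ∀ l, v l = 0 := by
  have main : ∀ (S R : Finset ℕ), S ∪ R = (2 * m).primeFactors → Disjoint S R → ∀ v ∈ P, ∀ l : ℤ, (∀ p ∈ S, ¬ (p : ℤ) ∣ l) → v l = 0 := by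
    intro S R
    induction R using Finset.induction_on generalizing S with
    | empty =>
      intro hS _ v hv l hl
      refine h.unit v hv l ?_
      rw [Finset.union_empty] at hS
      rw [Int.isCoprime_iff_gcd_eq_one]
      by_contra hne
      obtain ⟨p, hp, hpd⟩ := Nat.exists_prime_and_dvd hne
      have h1 : (p : ℤ) ∣ l := (natCast_dvd_natCast.2 hpd).trans (Int.gcd_dvd_left ..)
      have h2 : (p : ℤ) ∣ 2 * m := (natCast_dvd_natCast.2 hpd).trans (Int.gcd_dvd_right ..)
      exact hl p (by rw [hS]; exact mem_primeFactors.2 ⟨hp, by exact_mod_cast h2, by omega⟩) h1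
    | insert p R hpR ih =>
      intro hS hd v hv l hl
      have hdis : Disjoint (insert p S) R := by
        rw [Finset.disjoint_insert_left]; exact ⟨hpR, (disjoint_insert_right.1 hd).2⟩
      have ih' := ih (insert p S) (by rw [← hS]; ext; simp) hdis
      have hpm : p ∈ (2 * m).primeFactors := by rw [← hS]; simp
      obtain ⟨hp, hp2, -⟩ := mem_primeFactors.1 hpm
      by_cases hpl : (p : ℤ) ∣ l
      · obtain ⟨e, M, hM, hE⟩ := Nat.exists_eq_pow_mul_and_not_dvd (show 2 * m ≠ 0 by omega) p hp.ne_one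
        obtain ⟨e, rfl⟩ : ∃ f, e = f + 1 := exists_eq_succ_of_ne_zero (by
          rintro rfl; rw [pow_zero, one_mul] at hE; exact hM (hE ▸ hp2))
        refine h.step hm hp hE hM hpl (fun w hw k hk => ih' w hw _ fun r hr => ?_) hv
        rcases mem_insert.1 hr with rfl | hr'
        · exact hk
        · intro hdiv
          have hrp : r ∈ (2 * m).primeFactors := by rw [← hS]; simp [hr']
          obtain ⟨hr1, hr2, -⟩ := mem_primeFactors.1 hrp
          have hne : r ≠ p := fun h5 => (disjoint_insert_right.1 hd).1 (h5 ▸ hr')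
          have hrM : r ∣ M := by
            rw [hE] at hr2
            rcases (Nat.Prime.dvd_mul hr1).1 hr2 with h5 | h5
            · exact absurd ((Nat.prime_dvd_prime_iff_eq hr1 hp).1 (hr1.dvd_of_dvd_pow h5)) hne
            · exact h5
          refine hl r hr' ?_
          have := dvd_sub hdiv (dvd_mul_of_dvd_right (natCast_dvd_natCast.2 hrM) k)
          rwa [add_sub_cancel_right] at this
      · refine ih' v hv l fun r hr => ?_
        rcases mem_insert.1 hr with rfl | hr
        · exact hpl
        · exact hl r hr
  intro v hv l
  exact main ∅ (2 * m).primeFactors (by simp) (by simp) v hv l (by simp)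
lemma split_hasSum (hM : 0 < M) {f : ℤ → ℂ} {s : ℂ} (h : HasSum f s) {g : ℕ → ℂ} 
    (hg : ∀ k : ℕ, HasSum (fun n : ℤ => f (k + M * n)) (g k)) : s = ∑ k ∈ range M, g k := by
  haveI : NeZero M := ⟨hM.ne'⟩
  have h1 := (divModEquiv M).symm.hasSum_iff.2 h
  have h2 := ((Equiv.prodComm (Fin M) ℤ).hasSum_iff.2 h1)
  have h3 := h2.prod_fiberwise (g := fun k : Fin M => g k) (fun k => by
    refine (hg k).congr_fun ?_
    intro n
    simp [divModEquiv, add_comm, mul_comm])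
  rw [sum_range]
  exact h3.unique (hasSum_fintype _)
lemma jTheta_eq (hm : 0 < m) (l : ℤ) (τ z : ℂ) (n : ℤ) :
    ee (((l : ℂ) + 2 * (m : ℂ) * (n : ℂ)) ^ 2 / (4 * (m : ℂ)) * τ + ((l : ℂ) + 2 * (m : ℂ) * (n : ℂ)) * z) =
    ee (l ^ 2 / (4 * m) * τ + l * z) * jacobiTheta₂_term n (2 * m * z + l * τ) (2 * m * τ) := by
  have : (m : ℂ) ≠ 0 := by exact_mod_cast hm.ne'
  unfold ee jacobiTheta₂_term; rw [← exp_add]; congr 1; field_simp; ring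
lemma im_mul_nat (hm : 0 < m) (hτ : 0 < τ.im) : 0 < (2 * m * τ).im := by
  have : (0 : ℝ) < 2 * m := by positivity
  rw [show (2 * m * τ : ℂ) = ((2 * m : ℝ) : ℂ) * τ by push_cast; ring, Complex.im_ofReal_mul]; positivity
lemma jTheta_hasSum (hm : 0 < m) (l : ℤ) (hτ : 0 < τ.im) (z : ℂ) :
    HasSum (fun n : ℤ => ee (((l : ℂ) + 2 * (m : ℂ) * (n : ℂ)) ^ 2 / (4 * (m : ℂ)) * τ +
      ((l : ℂ) + 2 * (m : ℂ) * (n : ℂ)) * z)) (jTheta m l τ z) := by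
  refine Summable.hasSum ?_
  simp only [jTheta_eq hm]
  exact ((hasSum_jacobiTheta₂_term _ (im_mul_nat hm hτ)).summable).mul_left _
lemma jTheta_jac (hm : 0 < m) (l : ℤ) (τ z : ℂ) :
    jTheta m l τ z = ee (l ^ 2 / (4 * m) * τ + l * z) * jacobiTheta₂ (2 * m * z + l * τ) (2 * m * τ) := by
  unfold jTheta jacobiTheta₂
  simp only [jTheta_eq hm, tsum_mul_left]
def tfac (m : ℕ) (τ : ℂ) : ℂ := (-I * (τ / (2 * m))) ^ (1 / 2 : ℂ)
lemma tfac_ne (hm : 0 < m) (hτ : 0 < τ.im) : tfac m τ ≠ 0 := by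
  have : (m : ℂ) ≠ 0 := by exact_mod_cast hm.ne'
  unfold tfac
  rw [Complex.cpow_ne_zero_iff_of_exponent_ne_zero (by norm_num)]
  simp [this, ne_of_im hτ]
lemma tfac_sq (m : ℕ) (τ : ℂ) : tfac m τ ^ 2 = -I * (τ / (2 * m)) := by
  unfold tfac; rw [← Complex.cpow_nat_mul]; norm_num
lemma jTheta_S (hm : 0 < m) (l : ℤ) (hτ : 0 < τ.im) (z : ℂ) :
    jTheta m l (-1 / τ) (z / τ) = tfac m τ * ee (m * z ^ 2 / τ) *
      ∑ k ∈ range (2 * m), ee (-(l * k) / (2 * m)) * jTheta m k τ z := by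
  have hmc : (m : ℂ) ≠ 0 := by exact_mod_cast hm.ne'
  have hτ0 := ne_of_im hτ
  have him : 0 < (τ / (2 * m)).im := by
    rw [show (τ / (2 * m) : ℂ) = τ / ((2 * m : ℝ) : ℂ) by push_cast; ring, Complex.div_ofReal_im]; positivity
  have e1 : jacobiTheta₂ (z - l / (2 * m)) (τ / (2 * m)) =
      ∑ k ∈ range (2 * m), ee (-(l * k) / (2 * m)) * jTheta m k τ z := by
    refine split_hasSum (by omega) (hasSum_jacobiTheta₂_term _ him) fun k => ?_
    refine ((jTheta_hasSum hm k hτ z).mul_left (ee (-(l * k) / (2 * m)))).congr_fun fun n => ?_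
    rw [← ee_add]
    unfold jacobiTheta₂_term
    rw [show cexp (2 * Real.pi * I * ((k + (2 * m : ℕ) * n : ℤ) : ℂ) * (z - l / (2 * m)) + Real.pi * I * ((k + (2 * m : ℕ) * n : ℤ) : ℂ) ^ 2 * (τ / (2 * m))) =
      ee (((k + (2 * m : ℕ) * n : ℤ) : ℂ) * (z - l / (2 * m)) + ((k + (2 * m : ℕ) * n : ℤ) : ℂ) ^ 2 * (τ / (4 * m))) by
        unfold ee; congr 1; field_simp; ring]
    refine ee_congr (-(l * n)) ?_
    push_cast; field_simp; ring
  have e2 := jacobiTheta₂_functional_equation (z - l / (2 * m)) (τ / (2 * m))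
  have hs : tfac m τ ≠ 0 := tfac_ne hm hτ
  rw [← e1, e2, jTheta_jac hm]
  rw [show (z - l / (2 * m)) / (τ / (2 * m)) = 2 * m * (z / τ) + l * (-1 / τ) by field_simp; ring,
    show -1 / (τ / (2 * m)) = 2 * m * (-1 / τ) by field_simp]
  change _ = tfac m τ * ee (m * z ^ 2 / τ) * (1 / tfac m τ * _ * _)
  rw [show tfac m τ * ee (m * z ^ 2 / τ) * (1 / tfac m τ * cexp (-Real.pi * I * (z - l / (2 * m)) ^ 2 / (τ / (2 * m))) *
    jacobiTheta₂ (2 * m * (z / τ) + l * (-1 / τ)) (2 * m * (-1 / τ))) = ee (m * z ^ 2 / τ) * cexp (-Real.pi * I * (z - l / (2 * m)) ^ 2 / (τ / (2 * m))) *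
    jacobiTheta₂ (2 * m * (z / τ) + l * (-1 / τ)) (2 * m * (-1 / τ)) by field_simp]
  congr 1
  unfold ee; rw [← exp_add]; congr 1; field_simp; ring
def EX (m : ℕ) (Q : (ℤ × ℤ → ℂ) → Prop) (f : ℂ → ℂ → ℂ) : Prop :=
  ∃ c, SymC m c ∧ CInt c ∧ Q c ∧ ∀ τ : ℂ, 0 < τ.im → ∀ z, fser c τ z = f τ z
def Low (N : ℤ) (c : ℤ × ℤ → ℂ) : Prop := ∀ n r : ℤ, n < N → c (n, r) = 0
lemma Low.mul {N' : ℤ} {d : ℤ × ℤ → ℂ} (hc : Low N c) (hd : Low N' d) : Low (N + N') (cmul c d) := by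
  intro n r h
  refine (tsum_congr fun x => ?_).trans tsum_zero
  by_cases h1 : x.1 < N
  · rw [show c x = 0 from hc _ _ h1, zero_mul]
  · rw [show d ((n, r) - x) = 0 from hd _ _ (by simp only [Prod.mk_sub_mk, Prod.fst_sub]; linarith), mul_zero]
lemma EX.congr (h : EX m Q f)
    (hfg : ∀ τ : ℂ, 0 < τ.im → ∀ z, f τ z = g τ z) : EX m Q g := by
  obtain ⟨c, h1, h2, h3, h4⟩ := h
  exact ⟨c, h1, h2, h3, fun τ hτ z => (h4 τ hτ z).trans (hfg τ hτ z)⟩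
lemma EX.mono {Q' : (ℤ × ℤ → ℂ) → Prop} (h : EX m Q f) (hQ : ∀ c, Q c → Q' c) : EX m Q' f := by
  obtain ⟨c, h1, h2, h3, h4⟩ := h
  exact ⟨c, h1, h2, hQ c h3, h4⟩
lemma EX.add {Q' Q'' : (ℤ × ℤ → ℂ) → Prop} (h : EX m Q f) (h' : EX m Q' g) (k : ℤ)
    (hQ : ∀ c d : ℤ × ℤ → ℂ, Q c → Q' d → Q'' (c + (k : ℂ) • d)) : EX m Q'' (fun τ z => f τ z + k * g τ z) := by
  obtain ⟨c, h1, h2, h3, h4⟩ := h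
  obtain ⟨d, i1, i2, i3, i4⟩ := h'
  refine ⟨c + (k : ℂ) • d, h1.add (i1.smul _), fun p => ?_, hQ c d h3 i3, fun τ hτ z => ?_⟩
  · obtain ⟨x, hx⟩ := h2 p; obtain ⟨y, hy⟩ := i2 p
    exact ⟨x + k * y, by simp [hx, hy]⟩
  · rw [fser_add h1.conv (i1.conv.smul _) hτ, fser_smul, h4 τ hτ, i4 τ hτ]
lemma EX.mul {m' : ℕ} {Q' Q'' : (ℤ × ℤ → ℂ) → Prop} (h : EX m Q f) (h' : EX m' Q' g)
    (hQ : ∀ c d : ℤ × ℤ → ℂ, Q c → Q' d → Q'' (cmul c d)) : EX (m + m') Q'' (fun τ z => f τ z * g τ z) := by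
  obtain ⟨c, h1, h2, h3, h4⟩ := h
  obtain ⟨d, i1, i2, i3, i4⟩ := h'
  exact ⟨cmul c d, h1.mul i1, CInt.mul h2 i2 h1.conv i1.conv, hQ c d h3 i3, fun τ hτ z => by
    rw [fser_mul h1.conv i1.conv hτ, h4 τ hτ, i4 τ hτ]⟩
abbrev EI (m : ℕ) (N : ℤ) (f : ℂ → ℂ → ℂ) : Prop := EX m (Low N) f
abbrev EL (m : ℕ) (n r : ℤ) (f : ℂ → ℂ → ℂ) : Prop := EX m (Lead n r) f
lemma EI.le {N' : ℤ} (h : EI m N f) (hN : N' ≤ N) : EI m N' f :=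
  h.mono fun _ hc n r hn => hc n r (by linarith)
lemma EL.low (h : EL m n r f) : EI m n f := h.mono fun _ hc => hc.z1
lemma EI.add (h : EI m N f) (h' : EI m N g) (k : ℤ) :
    EI m N (fun τ z => f τ z + k * g τ z) :=
  EX.add h h' k fun c d hc hd n r hn => by simp [hc n r hn, hd n r hn]
lemma EI.mul {m' : ℕ} {N' : ℤ} (h : EI m N f) (h' : EI m' N' g) :
    EI (m + m') (N + N') (fun τ z => f τ z * g τ z) := EX.mul h h' fun _ _ => Low.mul
lemma EL.mul {m' : ℕ} {n' r' : ℤ} (h : EL m n r f) (h' : EL m' n' r' g) :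
    EL (m + m') (n + n') (r + r') (fun τ z => f τ z * g τ z) := EX.mul h h' fun _ _ => Lead.mul
lemma EL.addLow (h : EL m n r f) (h' : EI m N g) (hN : n < N) (k : ℤ) :
    EL m n r (fun τ z => f τ z + k * g τ z) :=
  EX.add h h' k fun c d hc hd => ⟨fun a b hn => by simp [hc.z1 a b hn, hd a b (by linarith)],
    fun b hb => by simp [hc.z2 b hb, hd n b hN], by simp [hc.one, hd n r hN]⟩
lemma EL.addLead {r' : ℤ} (h : EL m n r f) (h' : EL m n r' g) (h0 : 0 ≤ r') (hN : r' < r) (k : ℤ) :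
    EL m n r (fun τ z => f τ z + k * g τ z) :=
  EX.add h h' k fun c d hc hd => ⟨fun a b hn => by simp [hc.z1 a b hn, hd.z1 a b hn],
    fun b hb => by simp [hc.z2 b hb, hd.z2 b (by linarith)], by
      simp [hc.one, hd.z2 r (by rw [abs_of_nonneg] <;> linarith)]⟩
lemma EL.sub0 (h : EL 0 0 0 f) (h' : EL 0 0 0 g) : EI 0 1 (fun τ z => f τ z + (-1 : ℤ) * g τ z) :=
  EX.add h h' (-1) fun c d hc hd n r hn => by
    rcases lt_or_eq_of_le (show n ≤ 0 by omega) with h1 | rfl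
    · simp [hc.z1 n r h1, hd.z1 n r h1]
    · rcases eq_or_ne r 0 with rfl | h2
      · simp [hc.one, hd.one]
      · simp [hc.z2 r (abs_pos.2 h2), hd.z2 r (abs_pos.2 h2)]
lemma inj_form {ι : Type*} {i : ι → ℤ × ℤ} (hi : Injective i) (h1 : ∀ k, c (i k) = 1)
    (h0 : ∀ p, p ∉ Set.range i → c p = 0) 
    (h : ∀ τ : ℂ, 0 < τ.im → ∀ z, HasSum (fun k => mon (i k) τ z) (f τ z)) :
    Conv c ∧ CInt c ∧ ∀ τ : ℂ, 0 < τ.im → ∀ z, fser c τ z = f τ z := by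
  have h2 : ∀ τ : ℂ, 0 < τ.im → ∀ z, HasSum (fun p => c p * mon p τ z) (f τ z) := by
    intro τ hτ z
    rw [← hi.hasSum_iff (fun p hp => by simp [h0 p hp])]
    simpa [comp_def, h1] using h τ hτ z
  refine ⟨fun τ hτ z => (h2 τ hτ z).summable, fun p => ?_, fun τ hτ z => (h2 τ hτ z).tsum_eq⟩
  by_cases hp : p ∈ Set.range i
  · obtain ⟨k, rfl⟩ := hp; exact ⟨1, by simp [h1]⟩
  · exact ⟨0, by simp [h0 p hp]⟩
lemma EL_q (n : ℤ) : EL 0 n 0 (fun τ _ => ee (n * τ)) := by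
  obtain ⟨h1, h2, h3⟩ := inj_form (i := fun _ : Unit => ((n, 0) : ℤ × ℤ)) (fun _ _ _ => rfl)
    (c := fun p => if p = (n, 0) then 1 else 0) (by simp) (by intro p hp; simp at hp; simp; exact hp)
    (f := fun τ _ => ee (n * τ)) (fun τ hτ z => by simpa [mon] using hasSum_unique (fun _ : Unit => ee (n * τ)))
  refine ⟨_, ⟨h1, ?_, ?_, n, ?_⟩, h2, ⟨?_, ?_, by simp⟩, h3⟩
  · intro a r; simp only [Prod.mk.injEq]; congr 1; simp; intro h; simp [h]
  · intro a r; simp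
  · intro a r h; simp; intro h'; omega
  · intro a r h; simp; intro h'; omega
  · intro r h; simp; rintro rfl; simp at h
lemma EL_one : EL 0 0 0 (fun _ _ => 1) := (EL_q 0).congr fun τ _ z => by simp [ee_zero]
lemma EL.pow (h : EL m n r f) (k : ℕ) :
    EL (k * m) (k * n) (k * r) (fun τ z => f τ z ^ k) := by
  induction k with
  | zero => simpa using EL_one
  | succ k ih =>
    have := ih.mul h
    simp only [pow_succ, cast_succ, add_mul, one_mul, Nat.add_mul]
    exact this
lemma EL.pow0 (h : EL 0 0 0 f) (k : ℕ) : EL 0 0 0 (fun τ z => f τ z ^ k) := by simpa using h.pow k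
lemma norm_q_lt (hτ : 0 < τ.im) : ‖ee τ‖ < 1 := by
  rw [norm_ee, exp_lt_one_iff]; nlinarith [pi_pos, mul_pos pi_pos hτ]
lemma EL_nat {g : ℕ → ℕ} (hg : StrictMono g) (h0 : g 0 = 0) : EL 0 0 0 (fun τ _ => ∑' k : ℕ, ee (g k * τ)) := by
  have hi : Injective (fun k : ℕ => (((g k : ℕ) : ℤ), (0 : ℤ))) := fun a b hab => hg.injective (by simpa using hab)
  have hs : ∀ τ : ℂ, 0 < τ.im → HasSum (fun k : ℕ => ee (g k * τ)) (∑' k : ℕ, ee (g k * τ)) := by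
    intro τ hτ
    refine Summable.hasSum ?_
    have hn := norm_q_lt hτ
    refine (summable_geometric_of_lt_one (norm_nonneg _) hn).of_norm_bounded fun k => ?_
    rw [← ee_pow, norm_pow]
    exact pow_le_pow_of_le_one (norm_nonneg _) hn.le (hg.id_le k)
  obtain ⟨h1, h2, h3⟩ := inj_form hi (c := fun p => if p ∈ Set.range (fun k : ℕ => (((g k : ℕ) : ℤ), (0 : ℤ))) then 1 else 0) (by simp)
    (by intro p hp; simp only [if_neg hp]) (f := fun τ _ => ∑' k : ℕ, ee (g k * τ)) (fun τ hτ z => by simpa [mon] using hs τ hτ)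
  refine ⟨_, ⟨h1, ?_, ?_, 0, ?_⟩, h2, ⟨?_, ?_, ?_⟩, h3⟩
  · intro n r; simp only [Set.mem_range, Prod.mk.injEq]; congr 1; simp; rintro rfl; simp
  · intro n r; simp only [Set.mem_range, Prod.mk.injEq]; congr 1; simp; intro _ _; exact eq_comm
  · intro n r h; simp; intro k hk; omega
  · intro n r h; simp; intro k hk; omega
  · intro r h; simp; intro k hk; rintro rfl; simp at h
  · simp; exact ⟨0, h0⟩
def tX (τ z : ℂ) : ℂ := jTheta 1 0 τ z
def tY (τ z : ℂ) : ℂ := jTheta 1 1 τ z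
def tA (τ : ℂ) : ℂ := tX τ 0
def tB (τ : ℂ) : ℂ := tY τ 0
def tU (τ z : ℂ) : ℂ := ee (-τ / 4) * tY τ z
def tP (τ : ℂ) : ℂ := ∑' k : ℕ, ee (((k ^ 2 + k : ℕ) : ℂ) * τ)
lemma EL_tX : EL 1 0 0 tX := by
  obtain ⟨h1, h2, h3⟩ := inj_form (i := fun k : ℤ => (k ^ 2, 2 * k)) (fun a b h => by simp at h; exact h.2)
    (c := fun p => if 4 * p.1 = p.2 ^ 2 then 1 else 0) (fun k => if_pos (by ring))
    (fun p hp => if_neg fun h => hp (by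
      obtain ⟨k, hk | hk⟩ := even_or_odd' p.2
      · exact ⟨k, by rw [hk] at h; ext <;> simp <;> nlinarith⟩
      · rw [hk] at h; ring_nf at h; omega))
    (f := tX) (fun τ hτ z => (jTheta_hasSum one_pos 0 hτ z).congr_fun fun k => by
      unfold mon; congr 1; push_cast; ring)
  refine ⟨_, ⟨h1, ?_, ?_, 0, ?_⟩, h2, ⟨?_, ?_, by simp⟩, h3⟩
  · intro n r; simp only; congr 1; simp only [eq_iff_iff]; push_cast; constructor <;> intro h <;> nlinarith
  · intro n r; simp
  · intro n r h; simp; nlinarith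
  · intro n r h; simp; nlinarith
  · intro r h; simp; intro h'; rw [pow_eq_zero_iff two_ne_zero |>.1 h'.symm] at h; simp at h
lemma EL_tU : EL 1 0 1 tU := by
  obtain ⟨h1, h2, h3⟩ := inj_form (i := fun k : ℤ => (k ^ 2 + k, 2 * k + 1)) (fun a b h => by simp at h; exact h.2)
    (c := fun p => if 4 * p.1 + 1 = p.2 ^ 2 then 1 else 0) (fun k => if_pos (by ring))
    (fun p hp => if_neg fun h => hp (by
      obtain ⟨k, hk | hk⟩ := even_or_odd' p.2
      · rw [hk] at h; ring_nf at h; omega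
      · exact ⟨k, by rw [hk] at h; ext <;> simp <;> nlinarith⟩))
    (f := tU) (fun τ hτ z => ((jTheta_hasSum one_pos 1 hτ z).mul_left (ee (-τ / 4))).congr_fun fun k => by
      unfold mon; rw [← ee_add]; congr 1; push_cast; ring)
  refine ⟨_, ⟨h1, ?_, ?_, 0, ?_⟩, h2, ⟨?_, ?_, by simp⟩, h3⟩
  · intro n r; simp only; congr 1; simp only [eq_iff_iff]; push_cast; constructor <;> intro h <;> nlinarith
  · intro n r; simp
  · intro n r h; simp; nlinarith
  · intro n r h; simp; nlinarith
  · intro r h; simp; intro h'; have : 1 < |r| ^ 2 := by nlinarith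
    rw [sq_abs] at this; omega
lemma EL_tP : EL 0 0 0 (fun τ _ => tP τ) :=
  EL_nat (g := fun k => k ^ 2 + k) (fun a b h => by simp only; nlinarith) rfl
lemma sq_hasSum {g : ℕ → ℕ} (hg : StrictMono g) (hτ : 0 < τ.im) :
    HasSum (fun k : ℕ => ee (g k * τ)) (∑' k : ℕ, ee (g k * τ)) := by
  refine Summable.hasSum ((summable_geometric_of_lt_one (norm_nonneg _) (norm_q_lt hτ)).of_norm_bounded fun k => ?_)
  rw [← ee_pow, norm_pow]
  exact pow_le_pow_of_le_one (norm_nonneg _) (norm_q_lt hτ).le (hg.id_le k)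
lemma tB_eq (hτ : 0 < τ.im) : tB τ = 2 * ee (τ / 4) * tP τ := by
  have hs := (sq_hasSum (g := fun k => k ^ 2 + k) (fun a b h => by simp only; nlinarith) hτ).mul_left (ee (τ / 4))
  have := HasSum.of_nat_of_neg_add_one (f := fun k : ℤ => ee (τ / 4) * ee ((k ^ 2 + k) * τ)) (by simpa using hs)
    (hs.congr_fun fun k => by congr 2; push_cast; ring)
  refine ((jTheta_hasSum one_pos 1 hτ 0).unique (this.congr_fun fun k => ?_)).trans (by unfold tP; push_cast; ring)
  rw [← ee_add]; congr 1; push_cast; ring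
lemma EL_tA : EL 0 0 0 (fun τ _ => tA τ) := by
  have h := EL_nat (g := fun k => k ^ 2) (fun a b h => by simp only; nlinarith) rfl
  refine (h.addLow (h.sub0 EL_one) (by norm_num) 1).congr fun τ hτ z => ?_
  have hs := (sq_hasSum (g := fun k => k ^ 2) (fun a b h => by simp only; nlinarith) hτ)
  have := HasSum.of_nat_of_neg (f := fun k : ℤ => ee (k ^ 2 * τ)) (by simpa using hs) (by simpa using hs)
  refine Eq.symm (((jTheta_hasSum one_pos 0 hτ 0).unique (this.congr_fun fun k => ?_)).trans ?_)
  · congr 1; push_cast; ring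
  · simp [ee_zero]; ring
def tt (τ : ℂ) : ℂ := tfac 1 τ
lemma tt4 (τ : ℂ) : tt τ ^ 4 = -τ ^ 2 / 4 := by
  have := tfac_sq 1 τ
  unfold tt; rw [show (4 : ℕ) = 2 * 2 from rfl, pow_mul, this]
  push_cast; linear_combination τ ^ 2 / 4 * I_sq
lemma tX_S (hτ : 0 < τ.im) (z : ℂ) : tX (-1 / τ) (z / τ) = tt τ * ee (z ^ 2 / τ) * (tX τ z + tY τ z) := by
  unfold tX tY tt; rw [jTheta_S one_pos 0 hτ]; simp [sum_range_succ, ee_zero]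
lemma tY_S (hτ : 0 < τ.im) (z : ℂ) : tY (-1 / τ) (z / τ) = tt τ * ee (z ^ 2 / τ) * (tX τ z - tY τ z) := by
  unfold tX tY tt; rw [jTheta_S one_pos 1 hτ]; simp [sum_range_succ, ee_zero]
  left; unfold ee
  rw [show 2 * (Real.pi : ℂ) * I * (-1 / 2) = -(Real.pi * I) by ring, exp_neg, exp_pi_mul_I]; norm_num; ring
lemma tA_S (hτ : 0 < τ.im) : tA (-1 / τ) = tt τ * (tA τ + tB τ) := by
  have := tX_S hτ 0; simpa [ee_zero, tA, tB] using this
lemma tB_S (hτ : 0 < τ.im) : tB (-1 / τ) = tt τ * (tA τ - tB τ) := by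
  have := tY_S hτ 0; simpa [ee_zero, tA, tB] using this
def dD (τ : ℂ) : ℂ := tA τ ^ 4 * tB τ ^ 4 * (tA τ ^ 4 - tB τ ^ 4) ^ 4 / 16
def dE4 (τ : ℂ) : ℂ := tA τ ^ 8 + 14 * tA τ ^ 4 * tB τ ^ 4 + tB τ ^ 8
def dE6 (τ : ℂ) : ℂ := tA τ ^ 12 - 33 * tA τ ^ 8 * tB τ ^ 4 - 33 * tA τ ^ 4 * tB τ ^ 8 + tB τ ^ 12
def dE (τ z : ℂ) : ℂ := (tA τ ^ 7 + 7 * tA τ ^ 3 * tB τ ^ 4) * tX τ z + (7 * tA τ ^ 4 * tB τ ^ 3 + tB τ ^ 7) * tY τ z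
def dF (τ z : ℂ) : ℂ := tA τ ^ 3 * tB τ ^ 3 * (tA τ ^ 4 - tB τ ^ 4) ^ 3 / 8 * (tA τ * tY τ z - tB τ * tX τ z)
def dX (τ z : ℂ) : ℂ := (tB τ * (5 * tA τ ^ 4 - tB τ ^ 4) * tX τ z + tA τ * (tA τ ^ 4 - 5 * tB τ ^ 4) * tY τ z) /
  (6 * (tA τ * tB τ * (tA τ ^ 4 - tB τ ^ 4)))
lemma dD_S (hτ : 0 < τ.im) : dD (-1 / τ) = τ ^ 12 * dD τ := by
  unfold dD; rw [tA_S hτ, tB_S hτ]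
  have h : tt τ ^ 24 = τ ^ 12 / 4096 := by rw [show (24 : ℕ) = 4 * 6 from rfl, pow_mul, tt4]; ring
  linear_combination ((tA τ + tB τ) ^ 4 * (tA τ - tB τ) ^ 4 * ((tA τ + tB τ) ^ 4 - (tA τ - tB τ) ^ 4) ^ 4 / 16) * h
lemma dE4_S (hτ : 0 < τ.im) : dE4 (-1 / τ) = τ ^ 4 * dE4 τ := by
  unfold dE4; rw [tA_S hτ, tB_S hτ]
  have h : tt τ ^ 8 = τ ^ 4 / 16 := by rw [show (8 : ℕ) = 4 * 2 from rfl, pow_mul, tt4]; ring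
  linear_combination ((tA τ + tB τ) ^ 8 + 14 * (tA τ + tB τ) ^ 4 * (tA τ - tB τ) ^ 4 + (tA τ - tB τ) ^ 8) * h
lemma dE6_S (hτ : 0 < τ.im) : dE6 (-1 / τ) = τ ^ 6 * dE6 τ := by
  unfold dE6; rw [tA_S hτ, tB_S hτ]
  have h : tt τ ^ 12 = - τ ^ 6 / 64 := by rw [show (12 : ℕ) = 4 * 3 from rfl, pow_mul, tt4]; ring
  linear_combination ((tA τ + tB τ) ^ 12 - 33 * (tA τ + tB τ) ^ 8 * (tA τ - tB τ) ^ 4 - 33 * (tA τ + tB τ) ^ 4 * (tA τ - tB τ) ^ 8 + (tA τ - tB τ) ^ 12) * h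
lemma dE_S (hτ : 0 < τ.im) (z : ℂ) : dE (-1 / τ) (z / τ) = τ ^ 4 * ee (z ^ 2 / τ) * dE τ z := by
  unfold dE; rw [tA_S hτ, tB_S hτ, tX_S hτ, tY_S hτ]
  have h : tt τ ^ 8 = τ ^ 4 / 16 := by rw [show (8 : ℕ) = 4 * 2 from rfl, pow_mul, tt4]; ring
  generalize tA τ = a, tB τ = b, tX τ z = x, tY τ z = y, ee (z ^ 2 / τ) = e
  linear_combination (e * (((a + b) ^ 7 + 7 * (a + b) ^ 3 * (a - b) ^ 4) * (x + y) + (7 * (a + b) ^ 4 * (a - b) ^ 3 + (a - b) ^ 7) * (x - y))) * h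
lemma dF_S (hτ : 0 < τ.im) (z : ℂ) : dF (-1 / τ) (z / τ) = τ ^ 10 * ee (z ^ 2 / τ) * dF τ z := by
  unfold dF; rw [tA_S hτ, tB_S hτ, tX_S hτ, tY_S hτ]
  have h : tt τ ^ 20 = - τ ^ 10 / 1024 := by rw [show (20 : ℕ) = 4 * 5 from rfl, pow_mul, tt4]; ring
  generalize tA τ = a, tB τ = b, tX τ z = x, tY τ z = y, ee (z ^ 2 / τ) = e
  linear_combination (e * ((a + b) ^ 3 * (a - b) ^ 3 * ((a + b) ^ 4 - (a - b) ^ 4) ^ 3 / 8 * ((a + b) * (x - y) - (a - b) * (x + y)))) * h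
lemma dX_S (hτ : 0 < τ.im) (hD : dD τ ≠ 0) (hD' : dD (-1 / τ) ≠ 0) (z : ℂ) : dX (-1 / τ) (z / τ) = ee (z ^ 2 / τ) * dX τ z := by
  have key : ∀ σ : ℂ, dD σ ≠ 0 → 6 * (tA σ * tB σ * (tA σ ^ 4 - tB σ ^ 4)) ≠ 0 := by
    intro σ h h'
    apply h; unfold dD
    linear_combination (tA σ ^ 3 * tB σ ^ 3 * (tA σ ^ 4 - tB σ ^ 4) ^ 3 / 96) * h'
  have h1 := key _ hD
  have h2 := key _ hD'
  unfold dX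
  rw [div_eq_iff h2, mul_comm (ee _), div_mul_eq_mul_div, div_mul_eq_mul_div, eq_div_iff h1]
  rw [tA_S hτ, tB_S hτ, tX_S hτ, tY_S hτ]
  ring
lemma SymC.z0 (h : SymC 0 c) (n : ℤ) (hr : r ≠ 0) : c (n, r) = 0 := by
  obtain ⟨n0, h0⟩ := h.low
  have h1 := ell_gen h.ell (-(|n| + |n0| + 1) * r) n r
  rw [← h1]; apply h0
  have h2 : 1 ≤ r ^ 2 := by have := sq_nonneg r; have : r ^ 2 ≠ 0 := pow_ne_zero _ hr; omega
  have h3 := neg_abs_le n0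
  have h4 := le_abs_self n
  have h5 : 0 ≤ |n| + |n0| + 1 := by positivity
  simp; nlinarith
lemma ee_surj {q : ℂ} (h0 : q ≠ 0) (h1 : ‖q‖ < 1) : ∃ τ : ℂ, 0 < τ.im ∧ ee τ = q := by
  have hpi : (2 * (Real.pi : ℂ) * I) ≠ 0 := by simp [pi_ne_zero]
  have h : ee (Complex.log q / (2 * Real.pi * I)) = q := by
    unfold ee; rw [mul_div_cancel₀ _ hpi, Complex.exp_log h0]
  refine ⟨_, ?_, h⟩
  have := congrArg norm h
  rw [norm_ee] at this
  rw [← this, exp_lt_one_iff] at h1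
  have := pi_pos
  by_contra h2; push_neg at h2
  nlinarith [mul_nonneg this.le (sub_nonneg.2 h2)]
def cN (a : ℕ → ℂ) : ℤ × ℤ → ℂ := fun p => if p.2 = 0 ∧ 0 ≤ p.1 then a p.1.toNat else 0
def PS (a : ℕ → ℂ) : Prop := ∀ q : ℂ, ‖q‖ < 1 → Summable (fun n => a n * q ^ n)
def psv (a : ℕ → ℂ) (q : ℂ) : ℂ := ∑' n, a n * q ^ n
lemma natInj : Injective (fun k : ℕ => ((k : ℤ), (0 : ℤ))) := fun a b h => by simpa using h
lemma cN_off (a : ℕ → ℂ) (p : ℤ × ℤ) (hp : p ∉ Set.range (fun k : ℕ => ((k : ℤ), (0 : ℤ)))) : cN a p = 0 :=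
  if_neg fun h => hp ⟨p.1.toNat, by ext <;> simp [h.1, h.2]⟩
lemma cN_on (a : ℕ → ℂ) (n : ℕ) : cN a ((n : ℤ), 0) = a n := by simp [cN]
lemma cN_sum {a : ℕ → ℂ} (h : PS a) (hτ : 0 < τ.im) (z : ℂ) :
    HasSum (fun p => cN a p * mon p τ z) (psv a (ee τ)) := by
  rw [← natInj.hasSum_iff (fun p hp => by rw [cN_off a p hp, zero_mul])]
  refine (h _ (norm_q_lt hτ)).hasSum.congr_fun fun k => ?_
  simp [comp_def, cN_on, mon, ee_pow]
lemma cN_conv {a : ℕ → ℂ} (h : PS a) : Conv (cN a) := fun _ hτ z => (cN_sum h hτ z).summable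
lemma cN_fser {a : ℕ → ℂ} (h : PS a) (hτ : 0 < τ.im) (z : ℂ) : fser (cN a) τ z = psv a (ee τ) := (cN_sum h hτ z).tsum_eq
lemma cN_low (a : ℕ → ℂ) : Low 0 (cN a) := fun n r h => if_neg fun h' => by simp at h'; omega
lemma cN_symm {a : ℕ → ℂ} (h : PS a) : SymC 0 (cN a) where
  conv := cN_conv h
  ell n r := by unfold cN; by_cases hr : r = 0 <;> simp [hr]
  even n r := by simp [cN]
  low := ⟨0, cN_low a⟩
lemma SymC.eq_cN (h : SymC 0 c) (hl : Low 0 c) : c = cN (fun n => c (n, 0)) := by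
  funext p; unfold cN
  split_ifs with h1
  · simp only [toNat_of_nonneg h1.2]; rw [← h1.1]
  · obtain ⟨n, r⟩ := p
    by_cases hr : r = 0
    · exact hl _ _ (by simp [hr] at h1; exact h1)
    · exact h.z0 n hr
lemma SymC.ps (h : SymC 0 c) (hl : Low 0 c) : PS (fun n => c (n, 0)) := by
  intro q hq
  rcases eq_or_ne q 0 with rfl | h0
  · refine summable_of_ne_finset_zero (s := {0}) fun n hn => ?_
    simp at hn; simp [hn]
  · obtain ⟨τ, hτ, rfl⟩ := ee_surj h0 hq
    have h1 := h.conv τ hτ 0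
    refine (h1.comp_injective natInj).congr fun k => ?_
    simp [mon, ee_pow]
lemma PS.hasFP {a : ℕ → ℂ} (h : PS a) : DifferentiableOn ℂ (psv a) (ball 0 1) := by
  intro q hq
  obtain ⟨r, hr1, hr2⟩ := exists_between (mem_ball_zero_iff.1 hq)
  have hr0 : 0 ≤ r := (norm_nonneg _).trans hr1.le
  have hs : Summable (fun n => ‖a n‖ * r ^ n) := by
    have := (h (r : ℂ) (by simpa [abs_of_nonneg hr0] using hr2)).norm
    simpa [abs_of_nonneg hr0] using this
  have := differentiableOn_tsum_of_summable_norm (F := fun n (q : ℂ) => a n * q ^ n) (U := ball (0 : ℂ) r) hs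
    (fun i => by fun_prop) isOpen_ball (fun i w hw => by
      rw [norm_mul, norm_pow]; gcongr; exact (mem_ball_zero_iff.1 hw).le)
  exact (this.differentiableAt (isOpen_ball.mem_nhds (by simpa using hr1))).differentiableWithinAt
lemma ps_of_diff {F : ℂ → ℂ} (h : DifferentiableOn ℂ F (ball 0 1)) :
    ∃ a, PS a ∧ ∀ q : ℂ, ‖q‖ < 1 → psv a q = F q := by
  have key : ∀ q : ℂ, ‖q‖ < 1 → HasSum (fun n : ℕ => ((n.factorial : ℂ)⁻¹ * iteratedDeriv n F 0) * q ^ n) (F q) := fun q hq => by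
    have := Complex.hasSum_taylorSeries_on_ball h (mem_ball_zero_iff.2 hq)
    refine this.congr_fun fun n => ?_
    simp; ring
  exact ⟨_, fun q hq => (key q hq).summable, fun q hq => (key q hq).tsum_eq⟩
lemma psv_zero (a : ℕ → ℂ) : psv a 0 = a 0 := by
  unfold psv; rw [tsum_eq_single 0 (by intro n hn; simp [hn])]; simp
lemma EL.disc (h : EL 0 0 0 f) : ∃ a : ℕ → ℂ, PS a ∧ a 0 = 1 ∧ (∀ n, ∃ k : ℤ, a n = k) ∧
    ∀ τ : ℂ, 0 < τ.im → ∀ z, f τ z = psv a (ee τ) := by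
  obtain ⟨c, h1, h2, h3, h4⟩ := h
  refine ⟨_, h1.ps h3.z1, h3.one, fun n => h2 _, fun τ hτ z => ?_⟩
  rw [← cN_fser (h1.ps h3.z1) hτ z, ← h1.eq_cN h3.z1, h4 τ hτ]
lemma coeff_unique2 {d : ℤ × ℤ → ℂ} (hc : SymC 0 c) (hd : SymC 0 d)
    (h : ∀ τ : ℂ, 0 < τ.im → fser c τ 0 = fser d τ 0) : c = d := by
  have key : ∀ c : ℤ × ℤ → ℂ, SymC 0 c → ∀ u : ℝ, HasSum (fun k : ℤ => c (k, 0) * ee (k * (I + u))) (fser c (I + u) 0) := by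
    intro c hc u
    have := hc.conv.hasSum (τ := I + u) (by simp) 0
    rw [← (show Injective (fun k : ℤ => (k, (0 : ℤ))) from fun a b h => by simpa using h).hasSum_iff] at this
    · refine this.congr_fun fun k => by simp [mon]
    · rintro ⟨n, r⟩ hp
      rw [hc.z0 n (by rintro rfl; exact hp ⟨n, rfl⟩), zero_mul]
  have h1 := coeff_unique (key c hc) (fun u => by rw [h _ (by simp)]; exact key d hd u)
  funext ⟨n, r⟩
  by_cases hr : r = 0
  · subst hr; exact congrFun h1 n
  · rw [hc.z0 n hr, hd.z0 n hr]
lemma EL.inv (h : EL 0 0 0 f) (hne : ∀ τ : ℂ, 0 < τ.im → ∀ z, f τ z ≠ 0) : EL 0 0 0 (fun τ z => (f τ z)⁻¹) := by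
  obtain ⟨a, ha, ha0, hai, hf⟩ := h.disc
  have hF : ∀ q ∈ ball (0 : ℂ) 1, psv a q ≠ 0 := by
    intro q hq
    rcases eq_or_ne q 0 with rfl | h0
    · rw [psv_zero, ha0]; exact one_ne_zero
    · obtain ⟨τ, hτ, rfl⟩ := ee_surj h0 (mem_ball_zero_iff.1 hq)
      rw [← hf τ hτ 0]; exact hne τ hτ 0
  obtain ⟨b, hb, hbF⟩ := ps_of_diff (ha.hasFP.inv hF)
  have hb0 : b 0 = 1 := by rw [← psv_zero b, hbF 0 (by simp)]; simp [psv_zero, ha0]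
  have hrec : ∀ n, ∑ k ∈ range (n + 1), a (n - k) * b k = if n = 0 then 1 else 0 := by
    have h1 : cmul (cN b) (cN a) = cN (fun n => if n = 0 then 1 else 0) := by
      have hd : PS (fun n => if n = 0 then (1 : ℂ) else 0) := fun q hq => summable_of_ne_finset_zero (s := {0}) fun n hn => by
        simp at hn; simp [hn]
      refine coeff_unique2 ((cN_symm hb).mul (cN_symm ha)) (cN_symm hd) fun τ hτ => ?_
      rw [fser_mul (cN_conv hb) (cN_conv ha) hτ, cN_fser ha hτ, cN_fser hb hτ, cN_fser hd hτ, hbF _ (norm_q_lt hτ)]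
      have := hF (ee τ) (mem_ball_zero_iff.2 (norm_q_lt hτ))
      simp only [Pi.inv_apply]
      rw [inv_mul_cancel₀ this]
      unfold psv; rw [tsum_eq_single 0 (by intro n hn; simp [hn])]; simp
    intro n
    have h2 := congrFun h1 ((n : ℤ), 0)
    rw [cN_on] at h2
    rw [← h2]; unfold cmul
    rw [← natInj.tsum_eq, tsum_eq_sum (s := range (n + 1))]
    · refine sum_congr rfl fun k hk => ?_
      have : ((n : ℤ), (0 : ℤ)) - ((k : ℤ), 0) = (((n - k : ℕ) : ℤ), 0) := by
        simp at hk; rw [cast_sub (by omega)]; simp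
      rw [cN_on, this, cN_on, mul_comm]
    · intro k hk
      rw [show cN a (((n : ℤ), (0 : ℤ)) - ((k : ℤ), 0)) = 0 from cN_low a _ _ (by simp at hk ⊢; omega), mul_zero]
    · intro p hp
      by_contra hp'
      exact hp (by simp only [cN_off b p hp', zero_mul])
  have hbi : ∀ n, ∃ k : ℤ, b n = k := by
    intro n
    induction n using strong_induction_on with
    | _ n ih =>
      rcases Nat.eq_zero_or_pos n with rfl | hn
      · exact ⟨1, by simp [hb0]⟩
      · have := hrec n
        rw [sum_range_succ, Nat.sub_self, ha0, one_mul, if_neg hn.ne'] at this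
        choose! B hB using ih
        choose A hA using hai
        refine ⟨-∑ k ∈ range n, A (n - k) * B k, ?_⟩
        push_cast
        rw [eq_neg_iff_add_eq_zero, add_comm, ← this]; congr 1
        exact sum_congr rfl fun k hk => by rw [hA, hB k (mem_range.1 hk)]
  refine ⟨cN b, cN_symm hb, fun p => ?_, ⟨cN_low b, fun r hr => if_neg ?_, by simpa using (cN_on b 0).trans hb0⟩, fun τ hτ z => ?_⟩
  · unfold cN; split_ifs
    · exact hbi _
    · exact ⟨0, by simp⟩
  · rintro ⟨h1, -⟩; simp only at h1; subst h1; simp at hr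
  · rw [cN_fser hb hτ, hbF _ (norm_q_lt hτ)]; simp only [hf τ hτ, Pi.inv_apply]
def dP (τ : ℂ) : ℂ := tA τ * tP τ * (tA τ ^ 4 - 16 * (ee τ * tP τ ^ 4))
lemma EL_dP : EL 0 0 0 (fun τ _ => dP τ) := by
  have h1 : EI 0 1 (fun τ _ => ee τ * tP τ ^ 4) := by
    simpa using ((EL_q 1).low.mul (EL_tP.pow0 4).low)
  exact ((EL_tA.mul EL_tP).mul ((EL_tA.pow0 4).addLow h1 one_pos (-16))).congr fun τ _ z => by
    unfold dP; push_cast; ring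
lemma tB4 (hτ : 0 < τ.im) : tB τ ^ 4 = 16 * (ee τ * tP τ ^ 4) := by
  rw [tB_eq hτ, mul_pow, mul_pow, ee_pow]
  rw [show ((4 : ℕ) : ℂ) * (τ / 4) = τ by push_cast; ring]; ring
lemma dD_eq (hτ : 0 < τ.im) : dD τ = ee τ * dP τ ^ 4 := by
  unfold dD dP; rw [tB4 hτ]; ring
lemma ee_one : ee (1 : ℂ) = 1 := by simpa using ee_int 1
open UpperHalfPlane CongruenceSubgroup ModularForm MatrixGroups in
lemma dD_ne (hτ : 0 < τ.im) : dD τ ≠ 0 := by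
  obtain ⟨a, ha, ha0, -, hf⟩ := EL_dP.disc
  have hD : ∀ τ : ℂ, 0 < τ.im → dD τ = ee τ * psv a (ee τ) ^ 4 := fun τ hτ => by rw [dD_eq hτ, hf τ hτ 0]
  let Δ : ℍ → ℂ := fun z => dD z
  have hS : Δ ∣[(12 : ℤ)] ModularGroup.S = Δ := by
    ext z
    rw [SL_slash_apply, UpperHalfPlane.modular_S_smul]
    have h1 := dD_S z.2
    have h2 : (z : ℂ) ≠ 0 := ne_of_im z.2
    rw [ModularGroup.denom_S]
    change dD (-(z : ℂ))⁻¹ * _ = dD z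
    rw [show (-(z : ℂ))⁻¹ = -1 / z by rw [inv_neg]; ring, h1, zpow_neg, mul_right_comm]
    rw [show (z : ℂ) ^ (12 : ℤ) = (z : ℂ) ^ (12 : ℕ) from by norm_cast, mul_inv_cancel₀ (pow_ne_zero _ h2), one_mul]
  have hT : Δ ∣[(12 : ℤ)] ModularGroup.T = Δ := by
    ext z
    rw [SL_slash_apply, UpperHalfPlane.modular_T_smul]
    have h2 : ((1 : ℝ) + (z : ℂ)).im = (z : ℂ).im := by simp
    have : dD ((1 : ℝ) + z) = dD z := by
      rw [hD _ (h2 ▸ z.2), hD _ z.2, ee_add]; simp [ee_one]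
    have h3 : denom (ModularGroup.T : SL(2, ℤ)) z = 1 := by rw [ModularGroup.denom_apply]; simp [ModularGroup.T]
    rw [h3, one_zpow, mul_one]
    exact this
  have hz : UpperHalfPlane.IsZeroAtImInfty Δ := by
    have hc : ContinuousAt (fun q : ℂ => q * psv a q ^ 4) 0 :=
      continuousAt_id.mul (((ha.hasFP.differentiableAt (isOpen_ball.mem_nhds (by simp))).continuousAt).pow 4)
    have he : Tendsto (fun z : ℍ => ee z) UpperHalfPlane.atImInfty (𝓝 0) := by
      rw [tendsto_zero_iff_norm_tendsto_zero]
      simp only [norm_ee]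
      refine Real.tendsto_exp_neg_atTop_nhds_zero.comp ?_
      exact tendsto_comap.const_mul_atTop (by positivity)
    have := hc.tendsto.comp he
    simp only [zero_mul] at this
    exact this.congr fun z => (hD z z.2).symm
  let f : CuspForm 𝒮ℒ 12 :=
    { toFun := Δ
      slash_action_eq' := fun A hA => by
        obtain ⟨A, rfl⟩ := hA
        exact SlashInvariantForm.slash_action_generators_SL2Z hS hT A
      holo' := by
        rw [UpperHalfPlane.mdifferentiable_iff]
        have : DifferentiableOn ℂ (fun τ : ℂ => ee τ * psv a (ee τ) ^ 4) {z | 0 < z.im} := by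
          intro τ hτ
          have h1 : DifferentiableAt ℂ (psv a) (ee τ) :=
            ha.hasFP.differentiableAt (isOpen_ball.mem_nhds (mem_ball_zero_iff.2 (norm_q_lt hτ)))
          have h2 : DifferentiableAt ℂ ee τ := differentiable_ee.differentiableAt
          exact (h2.mul ((h1.comp τ h2).pow 4)).differentiableWithinAt
        refine this.congr fun z hz => ?_
        simp only [comp, Δ, ofComplex_apply_of_im_pos hz]
        exact hD z hz
      zero_at_cusps' := fun hc => by
        rw [Subgroup.IsArithmetic.isCusp_iff_isCusp_SL2Z] at hc
        rw [OnePoint.isZeroAt_iff_forall_SL2Z hc]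
        intro γ _
        rw [SlashInvariantForm.slash_action_generators_SL2Z hS hT]
        exact hz }
  obtain ⟨c, hc⟩ := CuspForm.exists_smul_discriminant_of_weight_eq_twelve f
  have hval : ∀ z : ℍ, dD z = c * ModularForm.discriminant z := fun z => (DFunLike.congr_fun hc z).symm
  have hc0 : c ≠ 0 := by
    rintro rfl
    have h0 : ∀ q ∈ ball (0 : ℂ) 1, q ≠ 0 → psv a q = 0 := by
      intro q hq h0
      obtain ⟨τ, hτ, rfl⟩ := ee_surj h0 (mem_ball_zero_iff.1 hq)
      have := hval ⟨τ, hτ⟩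
      rw [zero_mul] at this
      have h3 : ee τ * psv a (ee τ) ^ 4 = 0 := (hD τ hτ).symm.trans this
      simpa [ee_ne] using h3
    have hcont : ContinuousAt (psv a) 0 := (ha.hasFP.differentiableAt (isOpen_ball.mem_nhds (by simp))).continuousAt
    have h1 : Tendsto (psv a) (𝓝[≠] 0) (𝓝 1) := by
      have := hcont.tendsto.mono_left (nhdsWithin_le_nhds (s := {0}ᶜ)); rwa [psv_zero, ha0] at this
    have h2 : Tendsto (psv a) (𝓝[≠] 0) (𝓝 0) := by
      refine tendsto_const_nhds.congr' ?_
      filter_upwards [self_mem_nhdsWithin, mem_nhdsWithin_of_mem_nhds (ball_mem_nhds (0 : ℂ) one_pos)] with q h h'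
      exact (h0 q h' h).symm
    exact one_ne_zero (tendsto_nhds_unique h1 h2)
  rw [show dD τ = _ from hval ⟨τ, hτ⟩]
  exact mul_ne_zero hc0 (ModularForm.discriminant_ne_zero _)
lemma dP_ne (hτ : 0 < τ.im) : dP τ ≠ 0 := fun h => dD_ne hτ (by rw [dD_eq hτ, h]; simp)
lemma tBY (hτ : 0 < τ.im) (z : ℂ) : ∃ e : ℂ, e ≠ 0 ∧ e ^ 4 = ee τ ∧ tB τ = 2 * e * tP τ ∧ tY τ z = e * tU τ z := by
  refine ⟨ee (τ / 4), ee_ne _, ?_, tB_eq hτ, ?_⟩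
  · rw [ee_pow]; congr 1; push_cast; ring
  · unfold tU; rw [← mul_assoc, ← ee_add, show τ / 4 + -τ / 4 = 0 by ring, ee_zero, one_mul]
def GJ (k : ℤ) (m : ℕ) (n r : ℤ) (f : ℂ → ℂ → ℂ) : Prop := EL m n r f ∧ SLaw k m f
lemma GJ.mul {k' : ℤ} {m' : ℕ} {n' r' : ℤ} (h : GJ k m n r f) (h' : GJ k' m' n' r' g) :
    GJ (k + k') (m + m') (n + n') (r + r') (fun τ z => f τ z * g τ z) := ⟨h.1.mul h'.1, fun τ hτ z => by
  simp only []; rw [h.2 τ hτ, h'.2 τ hτ, zpow_add₀ (ne_of_im hτ), show ((m + m' : ℕ) : ℂ) * z ^ 2 / τ = m * z ^ 2 / τ + m' * z ^ 2 / τ by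
      push_cast; ring, ee_add]; ring⟩
lemma GJ.pow (h : GJ k m n r f) (j : ℕ) :
    GJ (j * k) (j * m) (j * n) (j * r) (fun τ z => f τ z ^ j) := by
  induction j with
  | zero => exact ⟨h.1.pow 0, fun τ hτ z => by simp [ee_zero]⟩
  | succ k ih =>
    have := ih.mul h
    simp only [pow_succ, cast_succ, add_mul, one_mul, Nat.add_mul]
    exact this
lemma GJ.ex (h : GJ k m n r f) : ∃ c, IsJ k m c ∧ CInt c ∧ Lead n r c ∧
    ∀ τ : ℂ, 0 < τ.im → ∀ z, fser c τ z = f τ z := by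
  obtain ⟨⟨c, h1, h2, h3, h4⟩, hS⟩ := h
  exact ⟨c, ⟨h1, fun τ hτ z => by rw [h4 _ (neg_inv_im hτ), h4 τ hτ, hS τ hτ]⟩, h2, h3, h4⟩
lemma qP4 (k : ℕ) : EI 0 1 (fun τ _ => ee τ * tP τ ^ k) := by
  simpa using ((EL_q 1).low.mul (EL_tP.pow0 k).low)
lemma GJ_E4 : GJ 4 0 0 0 (fun τ _ => dE4 τ) := by
  refine ⟨?_, fun τ hτ z => by simp only [dE4_S hτ]; simp [ee_zero]⟩
  have h1 : EI 0 1 (fun τ _ => tA τ ^ 4 * (ee τ * tP τ ^ 4)) := by simpa using (EL_tA.pow0 4).low.mul (qP4 4)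
  have h2 : EI 0 1 (fun τ _ => (ee τ * tP τ ^ 4) * (ee τ * tP τ ^ 4)) := ((qP4 4).mul (qP4 4)).le (by norm_num)
  exact (((EL_tA.pow0 8).addLow h1 one_pos 224).addLow h2 one_pos 256).congr fun τ hτ z => by
    unfold dE4; rw [show tB τ ^ 8 = tB τ ^ 4 * tB τ ^ 4 by ring, tB4 hτ]; push_cast; ring
lemma GJ_E6 : GJ 6 0 0 0 (fun τ _ => dE6 τ) := by
  refine ⟨?_, fun τ hτ z => by simp only [dE6_S hτ]; simp [ee_zero]⟩
  have h1 : EI 0 1 (fun τ _ => tA τ ^ 8 * (ee τ * tP τ ^ 4)) := by simpa using (EL_tA.pow0 8).low.mul (qP4 4)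
  have h0 : EI 0 1 (fun τ _ => tA τ ^ 4 * (ee τ * tP τ ^ 4)) := by simpa using (EL_tA.pow0 4).low.mul (qP4 4)
  have h2 : EI 0 1 (fun τ _ => tA τ ^ 4 * (ee τ * tP τ ^ 4) * (ee τ * tP τ ^ 4)) := (h0.mul (qP4 4)).le (by norm_num)
  have h3 : EI 0 1 (fun τ _ => (ee τ * tP τ ^ 4) * (ee τ * tP τ ^ 4) * (ee τ * tP τ ^ 4)) :=
    (((qP4 4).mul (qP4 4)).mul (qP4 4)).le (by norm_num)
  exact ((((EL_tA.pow0 12).addLow h1 one_pos (-528)).addLow h2 one_pos (-8448)).addLow h3 one_pos 4096).congr fun τ hτ z => by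
    unfold dE6; rw [show tB τ ^ 8 = tB τ ^ 4 * tB τ ^ 4 by ring, show tB τ ^ 12 = tB τ ^ 4 * tB τ ^ 4 * tB τ ^ 4 by ring, tB4 hτ]
    push_cast; ring
lemma GJ_D : GJ 12 0 1 0 (fun τ _ => dD τ) := by
  refine ⟨?_, fun τ hτ z => by simp only [dD_S hτ]; simp [ee_zero]⟩
  exact ((EL_q 1).mul (EL_dP.pow0 4)).congr fun τ hτ z => by rw [dD_eq hτ]; simp
lemma GJ_Di : GJ (-12) 0 (-1) 0 (fun τ _ => (dD τ)⁻¹) := by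
  refine ⟨?_, fun τ hτ z => ?_⟩
  · have h := (EL_q (-1)).mul ((EL_dP.inv fun τ hτ _ => dP_ne hτ).pow0 4)
    simp only [add_zero] at h
    refine h.congr fun τ hτ z => ?_
    rw [dD_eq hτ, mul_inv, inv_pow, ← ee_neg]; simp
  · simp only [dD_S hτ]; rw [mul_inv]; simp [ee_zero, zpow_neg]
lemma GJ_EE : GJ 4 1 0 0 dE := by
  refine ⟨?_, fun τ hτ z => by rw [dE_S hτ]; simp⟩
  have h1 : EI 1 1 (fun τ z => tA τ ^ 3 * (ee τ * tP τ ^ 4) * tX τ z) := by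
    simpa using ((EL_tA.pow0 3).low.mul (qP4 4)).mul EL_tX.low
  have h2 : EI 1 1 (fun τ z => tA τ ^ 4 * (ee τ * tP τ ^ 3) * tU τ z) := by
    simpa using ((EL_tA.pow0 4).low.mul (qP4 3)).mul EL_tU.low
  have h3 : EI 1 1 (fun τ z => (ee τ * tP τ ^ 4) * (ee τ * tP τ ^ 3) * tU τ z) := by
    exact EI.le (by simpa using ((qP4 4).mul (qP4 3)).mul EL_tU.low) (show (1 : ℤ) ≤ 2 by norm_num)
  have h0 : EL 1 0 0 (fun τ z => tA τ ^ 7 * tX τ z) := by simpa using (EL_tA.pow0 7).mul EL_tX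
  exact (((h0.addLow h1 one_pos 112).addLow h2 one_pos 56).addLow h3 one_pos 128).congr fun τ hτ z => by
    obtain ⟨e, -, he, hB, hY⟩ := tBY hτ z
    unfold dE; rw [hB, hY, ← he]; push_cast; ring
lemma GJ_F : GJ 10 1 1 1 dF := by
  refine ⟨?_, fun τ hτ z => by rw [dF_S hτ]; simp⟩
  have h1 : EL 1 0 1 (fun τ z => tA τ * tU τ z) := by simpa using EL_tA.mul EL_tU
  have h2 : EL 1 0 0 (fun τ z => tP τ * tX τ z) := by simpa using EL_tP.mul EL_tX
  have := ((EL_q 1).mul (EL_dP.pow0 3)).mul (h1.addLead h2 le_rfl one_pos (-2))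
  simp only [zero_add, add_zero] at this
  exact this.congr fun τ hτ z => by
    obtain ⟨e, -, he, hB, hY⟩ := tBY hτ z
    unfold dF dP; rw [hB, hY]; simp only [Int.cast_one, one_mul]; rw [← he]; push_cast; ring
lemma dX_ex : ∃ c, IsJ 0 1 c ∧ Low 0 c ∧ ∀ τ : ℂ, 0 < τ.im → ∀ z, fser c τ z = dX τ z := by
  have hPi := (EL_dP.inv fun τ hτ _ => dP_ne hτ)
  have h1 : EI 1 0 (fun τ z => tP τ * (tA τ ^ 4 + (0 : ℤ) * (ee τ * tP τ ^ 4)) * tX τ z) := by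
    simpa using (EL_tP.low.mul ((EL_tA.pow0 4).addLow (qP4 4) one_pos 0).low).mul EL_tX.low
  have h2 : EI 1 0 (fun τ z => tP τ * (ee τ * tP τ ^ 4) * tX τ z) :=
    EI.le (by simpa using (EL_tP.low.mul (qP4 4)).mul EL_tX.low) (show (0 : ℤ) ≤ 1 by norm_num)
  have h3 : EI 1 0 (fun τ z => tA τ * (tA τ ^ 4 + (-80 : ℤ) * (ee τ * tP τ ^ 4)) * tU τ z) := by
    have := (EL_tA.low.mul ((EL_tA.pow0 4).addLow (qP4 4) one_pos (-80)).low).mul EL_tU.low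
    simp only [zero_add, add_zero] at this; exact this
  have h4 := hPi.low.mul ((h3.add h1 10).add h2 (-32))
  simp only [zero_add, add_zero] at h4
  obtain ⟨c, i1, -, i3, i4⟩ := h4
  have hf : ∀ τ : ℂ, 0 < τ.im → ∀ z, fser ((1 / 12 : ℂ) • c) τ z = dX τ z := by
    intro τ hτ z
    rw [fser_smul, i4 τ hτ]
    obtain ⟨e, he0, he, hB, hY⟩ := tBY hτ z
    have hP := dP_ne hτ
    have h6 : 6 * (tA τ * tB τ * (tA τ ^ 4 - tB τ ^ 4)) = 12 * e * dP τ := by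
      unfold dP; rw [← he, hB]; ring
    unfold dX; rw [h6, hB, hY, eq_div_iff (by simp [he0, hP])]
    field_simp
    rw [← he]; push_cast; ring
  refine ⟨(1 / 12 : ℂ) • c, ⟨i1.smul _, fun τ hτ z => ?_⟩, fun n r h => by simp [i3 n r h], hf⟩
  rw [hf _ (neg_inv_im hτ), hf τ hτ, dX_S hτ (dD_ne hτ) (dD_ne (neg_inv_im hτ))]; simp
lemma dX_zero (hτ : 0 < τ.im) : dX τ 0 = 1 := by
  have h : 6 * (tA τ * tB τ * (tA τ ^ 4 - tB τ ^ 4)) ≠ 0 := fun h' => dD_ne hτ (by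
    unfold dD; linear_combination (tA τ ^ 3 * tB τ ^ 3 * (tA τ ^ 4 - tB τ ^ 4) ^ 3 / 96) * h')
  unfold dX; rw [div_eq_one_iff_eq h]; change _ * tA τ + _ * tB τ = _; ring
lemma dF_zero (τ : ℂ) : dF τ 0 = 0 := by
  unfold dF; change _ * (_ * tB τ - _ * tA τ) = _; ring
lemma GJ_Dz (n : ℤ) : ∃ f, GJ (12 * n) 0 n 0 f := by
  rcases le_total 0 n with h | h
  · obtain ⟨k, rfl⟩ := eq_ofNat_of_zero_le h
    exact ⟨_, by simpa [mul_comm] using GJ_D.pow k⟩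
  · obtain ⟨k, hk⟩ := eq_ofNat_of_zero_le (neg_nonneg.2 h)
    obtain rfl : n = -(k : ℤ) := by omega
    exact ⟨_, by simpa [mul_comm] using GJ_Di.pow k⟩
lemma GJ_scalar (w n : ℤ) (h0 : 0 ≤ w) (h2 : w ≠ 2) (he : Even w) : ∃ f, GJ (w + 12 * n) 0 n 0 f := by
  obtain ⟨f, hf⟩ := GJ_Dz n
  obtain ⟨x, y, hxy⟩ : ∃ x y : ℕ, (x : ℤ) * 4 + y * 6 = w := by
    obtain ⟨k, rfl⟩ := he
    obtain ⟨j, hj | hj⟩ := even_or_odd' k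
    · exact ⟨j.toNat, 0, by rw [toNat_of_nonneg (by omega)]; push_cast; omega⟩
    · exact ⟨(j - 1).toNat, 1, by rw [toNat_of_nonneg (by omega)]; push_cast; omega⟩
  have := ((GJ_E4.pow x).mul (GJ_E6.pow y)).mul hf
  rw [hxy] at this
  exact ⟨_, by simpa using this⟩
lemma LF_all (m : ℕ) : LF m := by
  refine ⟨m + 1, fun n hn r h0 hr => ?_⟩
  obtain ⟨f, hf⟩ := GJ_scalar (2 + 12 * n + 2 * r - 4 * (m - r)) (-(n + r)) (by omega) (by omega) ⟨1 + 6 * n + r - 2 * (m - r), by ring⟩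
  obtain ⟨k, rfl⟩ := eq_ofNat_of_zero_le h0
  have h1 := (hf.mul (GJ_F.pow k)).mul (GJ_EE.pow (m - k))
  obtain ⟨c, i1, i2, i3, -⟩ := h1.ex
  have hk : k ≤ m := by exact_mod_cast hr
  refine ⟨c, ?_, i2, ?_⟩
  · convert i1 using 1
    · push_cast [cast_sub hk]; simp; ring
    · simp; omega
  · convert i3 using 1 <;> simp
lemma row_hasSum (hc : SymC 0 c) (hτ : 0 < τ.im) :
    HasSum (fun k : ℤ => c (k, 0) * ee (k * τ)) (fser c τ 0) := by
  have := hc.conv.hasSum hτ 0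
  rw [← (show Injective (fun k : ℤ => (k, (0 : ℤ))) from fun a b h => by simpa using h).hasSum_iff] at this
  · refine this.congr_fun fun k => by simp [mon]
  · rintro ⟨n, r⟩ hp
    rw [hc.z0 n (by rintro rfl; exact hp ⟨n, rfl⟩), zero_mul]
lemma ball_mem : τ ∈ ball (2 * I) (√3) ↔ τ.re ^ 2 + τ.im ^ 2 + 1 < 4 * τ.im := by
  rw [mem_ball_iff_norm, lt_sqrt (norm_nonneg _), Complex.sq_norm, normSq_apply]
  simp; constructor <;> intro h <;> nlinarith
lemma CT0 (hc : IsJ 2 0 c) : c (0, 0) = 0 := by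
  set B := ball (2 * I) (√3) with hB
  have hpos : ∀ τ ∈ B, 0 < τ.im := fun τ hτ => by rw [hB, ball_mem] at hτ; nlinarith [sq_nonneg τ.re, sq_nonneg τ.im]
  have hd : ∀ τ : ℂ, 0 < τ.im → DifferentiableAt ℂ (fun τ => fser c τ 0) τ := fun τ hτ =>
    (hc.conv.differentiableAt hτ 0).comp (f := fun τ : ℂ => (τ, (0 : ℂ))) τ (by fun_prop)
  obtain ⟨H, hH⟩ := DifferentiableOn.isExactOn_ball (f := fun τ => fser c τ 0) (c := 2 * I) (r := √3)
    fun τ hτ => (hd τ (hpos τ hτ)).differentiableWithinAt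
  have hSB : ∀ τ ∈ B, -1 / τ ∈ B := by
    intro τ hτ
    have h0 := hpos τ hτ
    rw [hB, ball_mem] at hτ ⊢
    have hn : 0 < normSq τ := normSq_pos.2 (ne_of_im h0)
    have e1 : (-1 / τ).re = -τ.re / normSq τ := by simp [Complex.div_re, normSq_apply]
    have e2 : (-1 / τ).im = τ.im / normSq τ := by simp [div_im, normSq_apply]; ring
    rw [e1, e2, div_pow, div_pow, neg_sq, ← add_div, show τ.re ^ 2 + τ.im ^ 2 = normSq τ by rw [normSq_apply]; ring]
    rw [show τ.re ^ 2 + τ.im ^ 2 = normSq τ by rw [normSq_apply]; ring] at hτ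
    rw [show normSq τ / normSq τ ^ 2 + 1 = (1 + normSq τ) / normSq τ by field_simp, ← mul_div_assoc]
    gcongr; linarith
  have hK : ∀ τ ∈ B, HasDerivAt (fun τ => H (-1 / τ) - H τ) 0 τ := by
    intro τ hτ
    have h0 := ne_of_im (hpos τ hτ)
    have h1 : HasDerivAt (fun τ : ℂ => -1 / τ) (1 / τ ^ 2) τ := by
      have := (hasDerivAt_inv h0).neg
      simpa [neg_div, Pi.neg_def] using this
    have h2 := ((hH _ (hSB τ hτ)).comp τ h1).sub (hH τ hτ)
    refine h2.congr_deriv ?_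
    have h3 := hc.S τ (hpos τ hτ) 0
    simp only [zero_div] at h3
    beta_reduce
    rw [h3]; simp [ee_zero]; field_simp; simp
  have hconst : ∀ τ ∈ B, H (-1 / τ) - H τ = 0 := by
    intro τ hτ
    have hI : I ∈ B := by rw [hB, ball_mem]; norm_num
    have := (convex_ball (2 * I) (√3)).is_const_of_fderivWithin_eq_zero (𝕜 := ℂ) (f := fun τ => H (-1 / τ) - H τ)
      (fun x hx => (hK x hx).differentiableAt.differentiableWithinAt)
      (fun x hx => by
        rw [fderivWithin_of_isOpen isOpen_ball hx]
        ext; simpa using (hK x hx).deriv) hτ hI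
    rw [this, show -1 / I = I by field_simp; simp, sub_self]
  let ρ : ℂ := ⟨-1 / 2, √3 / 2⟩
  have h3 : √3 ^ 2 = 3 := Real.sq_sqrt (by norm_num)
  have h3' : (1.5 : ℝ) < √3 := by rw [lt_sqrt (by norm_num)]; norm_num
  have hρ : ∀ u : ℝ, u ∈ uIcc (0 : ℝ) 1 → ρ + u ∈ B := by
    intro u hu
    rw [Set.uIcc_of_le zero_le_one] at hu
    rw [hB, ball_mem]; simp [ρ]; nlinarith [hu.1, hu.2]
  have hρpos : 0 < ρ.im := by simp [ρ]
  have hint := coeff_integral (c := fun k => c (k, 0)) (w := ρ) (F := fun u => fser c (ρ + u) 0)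
    (fun u => row_hasSum hc.toSymC (by simpa using hρpos)) 0
  have hder : ∀ u ∈ uIcc (0 : ℝ) 1, HasDerivAt (fun u : ℝ => H (ρ + u)) (fser c (ρ + u) 0) u := by
    intro u hu
    have h1 := hH _ (hρ u hu)
    have h2 : HasDerivAt (fun u : ℂ => ρ + u) 1 (u : ℂ) := (hasDerivAt_id _).const_add _
    have h3 := (h1.comp (u : ℂ) h2).comp_ofReal
    simpa [comp_def] using h3
  have hftc := intervalIntegral.integral_eq_sub_of_hasDerivAt hder (by
    apply ContinuousOn.intervalIntegrable
    intro u hu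
    have h1 := (hd _ (hpos _ (hρ u hu))).continuousAt
    exact (ContinuousAt.comp (f := fun u : ℝ => ρ + u) h1 (by fun_prop)).continuousWithinAt)
  rw [hint]
  simp only [Int.cast_zero, neg_zero, zero_mul, ee_zero, mul_one]
  rw [hftc]
  have hmem : ρ ∈ B := by simpa using hρ 0 (by simp)
  have := hconst ρ hmem
  have e : -1 / ρ = ρ + 1 := by
    have hne : ρ ≠ 0 := ne_of_im hρpos
    rw [div_eq_iff hne]; apply Complex.ext <;> simp [ρ] <;> nlinarith
  rw [e] at this; simpa using this
lemma cmul_row {f : ℤ × ℤ → ℂ} (hf : SymC 0 f) (n r : ℤ) : cmul f c (n, r) = ∑' k : ℤ, f (-k, 0) * c (k + n, r) := by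
  unfold cmul
  have hi : Injective (fun k : ℤ => (-k, (0 : ℤ))) := fun a b h => by simpa using h
  rw [← hi.tsum_eq]
  · refine tsum_congr fun k => ?_
    simp; left; congr 2; ring
  · rintro ⟨a, b⟩ hp
    by_contra h
    apply hp
    have : b ≠ 0 := by rintro rfl; exact h ⟨-a, by simp⟩
    simp only [hf.z0 a this, zero_mul]
lemma summable_pair {f : ℤ × ℤ → ℂ} (hf : SymC 0 f) {F : ℤ → ℂ} {M : ℤ} (hF : ∀ k < M, F k = 0) :
    Summable (fun k : ℤ => f (-k, 0) * F k) := by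
  obtain ⟨n0, h0⟩ := hf.low
  refine summable_of_ne_finset_zero (s := Icc M (-n0)) fun k hk => ?_
  rw [mem_Icc, not_and_or, not_le, not_le] at hk
  rcases hk with h | h
  · rw [hF k h, mul_zero]
  · rw [h0 _ _ (by omega), zero_mul]
lemma dual {w : ℤ} (hw : Even w) {F : ℤ → ℂ} {M : ℤ} (hF : ∀ k < M, F k = 0)
    (hp : ∀ c, IsJ (2 - w) 0 c → ∑' k : ℤ, c (-k, 0) * F k = 0) : ∃ W, IsJ w 0 W ∧ ∀ k, W (k, 0) = F k := by
  obtain ⟨n1, hn1, hn2⟩ : ∃ n1 : ℤ, (∀ k ≤ n1, 0 ≤ w - 12 * k ∧ w - 12 * k ≠ 2) ∧ ∀ e > n1, 0 ≤ 2 - w + 12 * e ∧ 2 - w + 12 * e ≠ 2 := by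
    obtain ⟨x, rfl⟩ := hw
    by_cases h : (x + x) % 12 = 2
    · exact ⟨(x + x) / 12 - 1, fun k hk => by omega, fun e he => by omega⟩
    · exact ⟨(x + x) / 12, fun k hk => by omega, fun e he => by omega⟩
  have step1 : ∀ j : ℕ, ∀ s : ℤ, s = min M n1 - 1 + j → s ≤ n1 → ∃ W, IsJ w 0 W ∧ ∀ k ≤ s, W (k, 0) = F k := by
    intro j
    induction j with
    | zero => intro s hs _; exact ⟨0, IsJ.zero _ _, fun k hk => by simp [hF k (by simp at hs; omega)]⟩
    | succ j ih =>
      intro s hs hs1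
      obtain ⟨W, hW, hWF⟩ := ih (s - 1) (by push_cast at hs; omega) (by omega)
      obtain ⟨f, hf⟩ := GJ_scalar (w - 12 * s) s (hn1 s hs1).1 (hn1 s hs1).2 (hw.sub ⟨6 * s, by ring⟩)
      obtain ⟨g, hg, -, hl, -⟩ := hf.ex
      rw [show w - 12 * s + 12 * s = w by ring] at hg
      refine ⟨W + (F s - W (s, 0)) • g, hW.add (hg.smul _), fun k hk => ?_⟩
      rcases lt_or_eq_of_le hk with h | rfl
      · simp [hl.z1 k 0 h, hWF k (by omega)]
      · simp [hl.one]
  obtain ⟨W, hW, hWF⟩ := step1 (n1 - min M n1 + 1).toNat n1 (by rw [toNat_of_nonneg (by omega)]; ring) le_rfl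
  refine ⟨W, hW, fun k => ?_⟩
  have hp' : ∀ c, IsJ (2 - w) 0 c → ∑' k : ℤ, c (-k, 0) * (F k - W (k, 0)) = 0 := by
    intro c hc
    obtain ⟨n0, h0⟩ := hW.low
    have h2 := CT0 (c := cmul c W) (by simpa using hc.mul hW)
    rw [cmul_row hc.toSymC] at h2
    simp only [add_zero] at h2
    simp only [mul_sub]
    rw [(summable_pair hc.toSymC hF).tsum_sub (summable_pair hc.toSymC (F := fun k => W (k, 0)) fun k hk => h0 k 0 hk), hp c hc, h2, sub_zero]
  have key : ∀ j : ℕ, F (n1 + j) - W (n1 + j, 0) = 0 := by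
    intro j
    induction j using strong_induction_on with
    | _ j ih =>
      rcases Nat.eq_zero_or_pos j with rfl | hj
      · simp [hWF n1 le_rfl]
      · set e := n1 + j with he
        obtain ⟨f, hf⟩ := GJ_scalar (2 - w + 12 * e) (-e) (hn2 e (by omega)).1 (hn2 e (by omega)).2
          (((even_two).sub hw).add ⟨6 * e, by ring⟩)
        obtain ⟨g, hg, -, hl, -⟩ := hf.ex
        rw [show 2 - w + 12 * e + 12 * -e = 2 - w by ring] at hg
        have := hp' g hg
        rw [tsum_eq_single e] at this
        · rwa [hl.one, one_mul] at this
        · intro k hk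
          rcases lt_or_gt_of_ne hk with h | h
          · rcases le_or_gt k n1 with h1 | h1
            · rw [hWF k h1, sub_self, mul_zero]
            · have := ih (k - n1).toNat (by omega)
              rw [toNat_of_nonneg (by omega), show n1 + (k - n1) = k by ring] at this
              rw [this, mul_zero]
          · rw [hl.z1 _ _ (by omega), zero_mul]
  rcases le_or_gt k n1 with h | h
  · exact hWF k h
  · have := key (k - n1).toNat
    rw [toNat_of_nonneg (by omega), show n1 + (k - n1) = k by ring] at this
    exact (sub_eq_zero.1 this).symm
lemma PS.mul_hasSum {f g : PowerSeries ℂ} (hf : PS fun n => f.coeff n) (hg : PS fun n => g.coeff n) {q : ℂ} (hq : ‖q‖ < 1) :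
    HasSum (fun n => (f * g).coeff n * q ^ n) (psv (fun n => f.coeff n) q * psv (fun n => g.coeff n) q) := by
  have e : (fun n => (f * g).coeff n * q ^ n) = fun n => ∑ kl ∈ HasAntidiagonal.antidiagonal n, (f.coeff kl.1 * q ^ kl.1) * (g.coeff kl.2 * q ^ kl.2) := by
    ext n; rw [coeff_mul, sum_mul]
    refine sum_congr rfl fun x hx => ?_
    rw [← HasAntidiagonal.mem_antidiagonal.1 hx, pow_add]; ring
  rw [e]
  have := (summable_norm_sum_mul_antidiagonal_of_summable_norm (hf q hq).norm (hg q hq).norm).of_norm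
  unfold psv
  rw [tsum_mul_tsum_eq_tsum_sum_antidiagonal_of_summable_norm (hf q hq).norm (hg q hq).norm]
  exact this.hasSum
lemma one_ps_hasSum (q : ℂ) : HasSum (fun n => (1 : PowerSeries ℂ).coeff n * q ^ n) 1 := by
  simpa using hasSum_single (f := fun n => (1 : PowerSeries ℂ).coeff n * q ^ n) 0 (by intro n hn; simp [PowerSeries.coeff_one, hn])
def CR : Subring (PowerSeries ℂ) where
  carrier := {f | PS fun n => f.coeff n}
  mul_mem' hf hg q hq := (PS.mul_hasSum hf hg hq).summable
  one_mem' q _ := (one_ps_hasSum q).summable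
  add_mem' hf hg q hq := ((hf q hq).add (hg q hq)).congr fun n => by simp [add_mul]
  zero_mem' q _ := by simp
  neg_mem' hf q hq := (hf q hq).neg.congr fun n => by simp
lemma mem_CR {f : PowerSeries ℂ} : f ∈ CR ↔ PS fun n => f.coeff n := Iff.rfl
def evq (q : ℂ) (hq : ‖q‖ < 1) : CR →+* ℂ where
  toFun f := psv (fun n => f.1.coeff n) q
  map_mul' f g := (PS.mul_hasSum f.2 g.2 hq).tsum_eq
  map_one' := (one_ps_hasSum q).tsum_eq
  map_add' f g := by
    unfold psv; rw [← (f.2 q hq).tsum_add (g.2 q hq)]; refine tsum_congr fun n => by simp [add_mul]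
  map_zero' := by simp [psv]
lemma ps_unique {a b : ℕ → ℂ} (ha : PS a) (hb : PS b) (h : ∀ τ : ℂ, 0 < τ.im → psv a (ee τ) = psv b (ee τ)) : a = b := by
  have := coeff_unique2 (cN_symm ha) (cN_symm hb) fun τ hτ => by rw [cN_fser ha hτ, cN_fser hb hτ, h τ hτ]
  ext n; rw [← cN_on a, this, cN_on]
lemma CR_shift {f : PowerSeries ℂ} {k : ℕ} (h : PowerSeries.X ^ k * f ∈ CR) : f ∈ CR ∧ ∀ q : ℂ, ‖q‖ < 1 →
    psv (fun n => (PowerSeries.X ^ k * f).coeff n) q = q ^ k * psv (fun n => f.coeff n) q := by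
  have hf : f ∈ CR := by
    intro q hq
    by_cases h0 : q = 0
    · subst h0
      exact summable_of_ne_finset_zero (s := {0}) fun n hn => by simp at hn; simp [hn]
    have := ((summable_nat_add_iff k).2 (h q hq)).mul_left (q ^ k)⁻¹
    refine this.congr fun n => ?_
    beta_reduce
    rw [coeff_X_pow_mul, pow_add]; field_simp
  refine ⟨hf, fun q hq => ?_⟩
  rw [psv, ← (h q hq).sum_add_tsum_nat_add k, sum_eq_zero, zero_add, psv, ← tsum_mul_left]
  · refine tsum_congr fun n => ?_
    beta_reduce
    rw [coeff_X_pow_mul, pow_add]; ring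
  · intro i hi
    beta_reduce
    rw [PowerSeries.coeff_X_pow_mul', if_neg (by simpa using hi), zero_mul]
lemma CR_div {d g : PowerSeries ℂ} (hd : d ∈ CR) (hk : d * g ∈ CR) (h0 : ∀ q : ℂ, ‖q‖ < 1 → q ≠ 0 → psv (fun n => d.coeff n) q ≠ 0) : g ∈ CR := by
  have hne : d ≠ 0 := by
    rintro rfl; exact h0 (1/2) (by norm_num) (by norm_num) (by simp [psv])
  set n := d.order.toNat
  set u := d.divXPowOrder
  have hdu : PowerSeries.X ^ n * u = d := PowerSeries.X_pow_order_mul_divXPowOrder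
  have hu0 : u.coeff 0 ≠ 0 := by
    rw [PowerSeries.coeff_zero_eq_constantCoeff]; exact fun h => hne (PowerSeries.constantCoeff_divXPowOrder_eq_zero_iff.1 h)
  obtain ⟨hu, hue⟩ := CR_shift (hdu ▸ hd)
  have huv : ∀ q : ℂ, ‖q‖ < 1 → psv (fun n => u.coeff n) q ≠ 0 := by
    intro q hq
    by_cases hq0 : q = 0
    · rw [hq0, psv_zero]; exact hu0
    · have := hue q hq
      rw [hdu] at this
      exact right_ne_zero_of_mul (this ▸ h0 q hq hq0)
  have hk' : u * g ∈ CR := (CR_shift (k := n) (by rw [← mul_assoc, hdu]; exact hk)).1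
  obtain ⟨a, ha, hav⟩ := ps_of_diff (F := fun q => (psv (fun n => u.coeff n) q)⁻¹) (PS.hasFP hu |>.inv fun q hq => huv q (by simpa using hq))
  have haC : PowerSeries.mk a ∈ CR := by simpa [mem_CR] using ha
  have h1 : PowerSeries.mk a * u = 1 := by
    ext k
    refine congrFun (ps_unique (CR.mul_mem haC hu) CR.one_mem fun τ hτ => ?_) k
    have hq := norm_q_lt hτ
    have e1 := (evq (ee τ) hq).map_mul ⟨_, haC⟩ ⟨_, hu⟩
    have e2 := (evq (ee τ) hq).map_one
    change psv (fun n => (1 : PowerSeries ℂ).coeff n) _ = 1 at e2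
    change psv _ _ = psv _ _ * psv _ _ at e1
    rw [e2]; refine e1.trans ?_
    simp only [coeff_mk]
    rw [hav _ hq, inv_mul_cancel₀ (huv _ hq)]
  have : g = PowerSeries.mk a * (u * g) := by rw [← mul_assoc, h1, one_mul]
  rw [this]; exact CR.mul_mem haC hk'
def gr (c : ℤ × ℤ → ℂ) (τ : ℂ) (r : ℤ) : ℂ := ∑' n : ℤ, c (n, r) * ee (n * τ)
lemma rowInj (r : ℤ) : Injective (fun n : ℤ => (n, r)) := fun a b h => by simpa using h
lemma gr_hasSum (hc : Conv c) (hτ : 0 < τ.im) (r : ℤ) :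
    HasSum (fun n : ℤ => c (n, r) * ee (n * τ)) (gr c τ r) := by
  have := (hc.hasSum hτ 0).summable.comp_injective (rowInj r)
  refine (this.congr fun n => ?_).hasSum
  simp [mon]
lemma fser_row (hc : Conv c) (hτ : 0 < τ.im) (z : ℂ) :
    HasSum (fun r : ℤ => gr c τ r * ee (r * z)) (fser c τ z) := by
  have h := (Equiv.prodComm ℤ ℤ).hasSum_iff.2 (hc.hasSum hτ z)
  refine h.prod_fiberwise fun r => ?_
  have := (gr_hasSum hc hτ r).mul_right (ee (r * z))
  refine this.congr_fun fun n => ?_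
  simp [mon, ee_add]; ring
def hh (m : ℕ) (c : ℤ × ℤ → ℂ) (τ : ℂ) (r : ℤ) : ℂ := gr c τ r * ee (-(r ^ 2 / (4 * m) * τ))
lemma hh_neg (hc : SymC m c) (τ : ℂ) (r : ℤ) : hh m c τ (-r) = hh m c τ r := by
  unfold hh gr; simp [hc.even]
lemma gr_per (hc : SymC m c) (τ : ℂ) (r t : ℤ) :
    gr c τ (r + 2 * m * t) = ee ((t * r + m * t ^ 2 : ℤ) * τ) * gr c τ r := by
  unfold gr
  rw [← tsum_mul_left, ← (Equiv.addRight (t * r + m * t ^ 2 : ℤ)).tsum_eq]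
  refine tsum_congr fun n => ?_
  simp only [Equiv.coe_addRight]
  rw [← add_assoc, ell_gen hc.ell t n r]; push_cast
  rw [add_mul, add_mul, ee_add, ee_add, add_mul, ee_add]; ring
lemma hh_per (hm : 0 < m) (hc : SymC m c) (τ : ℂ) (r t : ℤ) : hh m c τ (r + 2 * m * t) = hh m c τ r := by
  have : (m : ℂ) ≠ 0 := by exact_mod_cast hm.ne'
  unfold hh; rw [gr_per hc, mul_right_comm, ← ee_add, mul_comm]
  congr 2; push_cast; field_simp; ring
lemma fser_theta (hm : 0 < m) (hc : SymC m c) (hτ : 0 < τ.im) (z : ℂ) :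
    fser c τ z = ∑ l ∈ range (2 * m), hh m c τ l * jTheta m l τ z := by
  refine split_hasSum (by omega) (fser_row hc.conv hτ z) fun k => ?_
  refine ((jTheta_hasSum hm k hτ z).mul_left (hh m c τ k)).congr_fun fun n => ?_
  rw [← hh_per hm hc τ k n]; unfold hh
  rw [mul_assoc, ← ee_add]; push_cast; congr 2; ring
lemma theta_indep (hm : 0 < m) {x : ℕ → ℂ} (hτ : 0 < τ.im)
    (h : ∀ z, ∑ k ∈ range (2 * m), x k * jTheta m k τ z = 0) (k : ℕ) (hk : k < 2 * m) : x k = 0 := by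
  have key : ∀ u : ℝ, HasSum (fun r : ℤ => (∑ k ∈ range (2 * m), x k * if (2 * m : ℤ) ∣ r - k then ee ((r : ℂ) ^ 2 / (4 * m) * τ) else 0) *
      ee (r * ((0 : ℂ) + u))) 0 := by
    intro u
    refine Eq.subst (motive := fun y => HasSum _ y) (h (0 + u)) ?_
    simp_rw [sum_mul]
    refine hasSum_sum fun k _ => ?_
    simp_rw [mul_assoc]
    refine HasSum.mul_left _ ?_
    have hi : Injective (fun n : ℤ => (k : ℤ) + 2 * m * n) := fun a b h => by
      have : (2 * m : ℤ) ≠ 0 := by positivity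
      simpa [this] using h
    rw [← hi.hasSum_iff]
    · refine (jTheta_hasSum hm k hτ _).congr_fun fun n => ?_
      simp [comp_def, ee_add]
    · intro r hr
      rw [if_neg, zero_mul]
      rintro ⟨t, ht⟩; exact hr ⟨t, by simp only []; omega⟩
  have h0 := congrFun (coeff_unique key (d := 0) (fun u => by simp)) k
  simp only [Pi.zero_apply] at h0
  rw [sum_eq_single k] at h0
  · simpa [ee_ne] using h0
  · intro b hb hbk
    rw [if_neg, mul_zero]
    intro hd
    have := eq_zero_of_abs_lt_dvd hd (by have := mem_range.1 hb; rw [abs_lt]; constructor <;> push_cast <;> omega)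
    omega
  · intro h; exact absurd (mem_range.2 hk) h
lemma hh_S {w : ℤ} (hm : 0 < m) (hc : IsJ w m c) (hτ : 0 < τ.im) (k : ℕ) (hk : k < 2 * m) :
    τ ^ w * hh m c τ k = tfac m τ * ∑ l ∈ range (2 * m), ee (-((l : ℤ) * k) / (2 * m)) * hh m c (-1 / τ) l := by
  rw [← sub_eq_zero]
  refine theta_indep hm (x := fun k : ℕ => τ ^ w * hh m c τ k - tfac m τ * ∑ l ∈ range (2 * m), ee (-((l : ℤ) * k) / (2 * m)) * hh m c (-1 / τ) l) hτ (fun z => ?_) k hk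
  have h1 := hc.S τ hτ z
  rw [fser_theta hm hc.toSymC hτ, fser_theta hm hc.toSymC (neg_inv_im hτ)] at h1
  simp_rw [jTheta_S hm _ hτ] at h1
  rw [show ∑ l ∈ range (2 * m), hh m c (-1 / τ) l * (tfac m τ * ee (m * z ^ 2 / τ) * ∑ k ∈ range (2 * m), ee (-((l : ℤ) * k) / (2 * m)) * jTheta m k τ z)
    = ee (m * z ^ 2 / τ) * ∑ k ∈ range (2 * m), (tfac m τ * ∑ l ∈ range (2 * m), ee (-((l : ℤ) * k) / (2 * m)) * hh m c (-1 / τ) l) * jTheta m k τ z by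
      simp_rw [mul_sum, sum_mul]
      rw [sum_comm]
      simp_rw [mul_sum]
      refine sum_congr rfl fun _ _ => sum_congr rfl fun _ _ => by ring] at h1
  rw [mul_comm (τ ^ w), mul_assoc] at h1
  have h2 := mul_left_cancel₀ (ee_ne _) h1
  simp_rw [sub_mul]
  rw [sum_sub_distrib, h2, mul_sum, sub_eq_zero]
  refine sum_congr rfl fun _ _ => by ring
def ww (m r : ℕ) : ℂ := if r = 0 ∨ r = m then 1 else 2
lemma ww_ne (m r : ℕ) : ww m r ≠ 0 := by unfold ww; split_ifs <;> norm_num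
lemma fold (hm : 0 < m) (f : ℤ → ℂ) (hp : ∀ l, f (l + 2 * m) = f l) (he : ∀ l, f (-l) = f l) :
    ∑ l ∈ range (2 * m), f l = ∑ r ∈ range (m + 1), ww m r * f r := by
  have e : ∀ r ∈ range (m + 1), ww m r * f r = (if r < m then f r else 0) + (if r = 0 then 0 else f r) := by
    intro r hr
    have := mem_range.1 hr
    unfold ww; split_ifs <;> first | omega | ring
  rw [sum_congr rfl e, sum_add_distrib, sum_range_succ, if_neg (lt_irrefl m), add_zero,
    sum_congr rfl (fun r hr => if_pos (mem_range.1 hr)), sum_range_succ', if_pos rfl, add_zero,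
    show 2 * m = m + m by ring, Finset.sum_range_add]
  congr 1
  rw [← sum_range_reflect]
  refine sum_congr rfl fun r hr => ?_
  have := mem_range.1 hr
  rw [if_neg (by omega), ← he, ← hp]; congr 1; push_cast; omega
lemma X_pow_ex (j : ℕ) : ∃ c, IsJ 0 j c ∧ Low 0 c ∧ ∀ τ : ℂ, 0 < τ.im → ∀ z, fser c τ z = dX τ z ^ j := by
  induction j with
  | zero =>
    obtain ⟨c, h1, -, h3, h4⟩ := (GJ_F.pow 0).ex
    simp only [cast_zero, zero_mul] at h1 h3
    exact ⟨c, h1, fun n r h => h3.z1 n r h, by simpa using h4⟩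
  | succ j ih =>
    obtain ⟨c, h1, h2, h3⟩ := ih
    obtain ⟨d, k1, k2, k3⟩ := dX_ex
    exact ⟨cmul c d, by simpa using h1.mul k1, by simpa using h2.mul k2, fun τ hτ z => by
      rw [fser_mul h1.conv k1.conv hτ, h3 τ hτ, k3 τ hτ, pow_succ]⟩
lemma Xa_ex (m a : ℕ) (ha : a ≤ m) : ∃ c, IsJ (10 * a) m c ∧ Low 0 c ∧
    ∀ τ : ℂ, 0 < τ.im → ∀ z, fser c τ z = dF τ z ^ a * dX τ z ^ (m - a) := by
  obtain ⟨c, h1, -, h3, h4⟩ := (GJ_F.pow a).ex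
  obtain ⟨d, k1, k2, k3⟩ := X_pow_ex (m - a)
  refine ⟨cmul c d, ?_, ?_, fun τ hτ z => by rw [fser_mul h1.conv k1.conv hτ, h4 τ hτ, k3 τ hτ]⟩
  · have := h1.mul k1
    rwa [mul_one, Nat.add_sub_cancel' ha, add_zero, mul_comm] at this
  · have hl : Low 0 c := fun n r h => h3.z1 n r (by have : (0 : ℤ) ≤ a := by positivity
                                                    omega)
    simpa using hl.mul k2
lemma z_diff (hc : Conv c) (hτ : 0 < τ.im) : Differentiable ℂ (fun z => fser c τ z) := fun z =>
  (hc.differentiableAt hτ z).comp (f := fun z : ℂ => (τ, z)) z (by fun_prop)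
lemma dF_half (hτ : 0 < τ.im) : dF τ (1 / 2) ≠ 0 := by
  have h1 : tX τ (1 / 2) = tA τ := by
    unfold tA tX jTheta
    refine tsum_congr fun n => ee_congr n (by push_cast; ring)
  have h2 : tY τ (1 / 2) = -tB τ := by
    unfold tB tY jTheta
    rw [← tsum_neg]
    refine tsum_congr fun n => ?_
    rw [neg_eq_neg_one_mul, show (-1 : ℂ) = ee (1 / 2) by
      unfold ee; rw [show 2 * (Real.pi : ℂ) * I * (1 / 2) = Real.pi * I by ring, exp_pi_mul_I], ← ee_add]
    exact ee_congr n (by push_cast; ring)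
  intro h
  apply dD_ne hτ
  unfold dF at h; rw [h1, h2] at h
  have h3 : (tA τ * tB τ * (tA τ ^ 4 - tB τ ^ 4)) ^ 4 = 0 := by
    linear_combination (-4 * (tA τ ^ 4 - tB τ ^ 4)) * h
  have h4 := pow_eq_zero_iff (n := 4) (by norm_num) |>.1 h3
  unfold dD; linear_combination (tA τ ^ 3 * tB τ ^ 3 * (tA τ ^ 4 - tB τ ^ 4) ^ 3 / 16) * h4
lemma gr_rel {n : ℕ} (hm : 0 < m) {c : Fin n → ℤ × ℤ → ℂ} (hc : ∀ a, SymC m (c a)) (hτ : 0 < τ.im) (lam : Fin n → ℂ)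
    (h : ∀ r : Fin (m + 1), ∑ a, lam a * gr (c a) τ (r : ℕ) = 0) (z : ℂ) : ∑ a, lam a * fser (c a) τ z = 0 := by
  have hh0 : ∀ l : ℤ, ∑ a, lam a * hh m (c a) τ l = 0 := by
    intro l
    obtain ⟨r, h0, h1, h2⟩ := rep_exists (m := (m : ℤ)) (by exact_mod_cast hm) l
    have e : ∀ a, hh m (c a) τ l = hh m (c a) τ r := by
      intro a
      rcases h2 with ⟨t, ht⟩ | ⟨t, ht⟩
      · rw [show l = r + 2 * m * t by linarith, hh_per hm (hc a)]
      · rw [show l = -r + 2 * m * t by linarith, hh_per hm (hc a), hh_neg (hc a)]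
    lift r to ℕ using h0
    have := h ⟨r, by omega⟩
    simp only [e]; unfold hh
    simp_rw [← mul_assoc]; rw [← sum_mul, this, zero_mul]
  simp_rw [fser_theta hm (hc _) hτ z, mul_sum]
  rw [sum_comm]
  refine sum_eq_zero fun l _ => ?_
  simp_rw [← mul_assoc]; rw [← sum_mul, hh0, zero_mul]
lemma nonsing (hm : 0 < m) {c : Fin (m + 1) → ℤ × ℤ → ℂ} (hc : ∀ a, SymC m (c a)) (hτ : 0 < τ.im)
    (hf : ∀ a z, fser (c a) τ z = dF τ z ^ (a : ℕ) * dX τ z ^ (m - a)) (lam : Fin (m + 1) → ℂ)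
    (h : ∀ r : Fin (m + 1), ∑ a, lam a * gr (c a) τ (r : ℕ) = 0) : lam = 0 := by
  by_contra hne
  set P : Polynomial ℂ := ∑ a : Fin (m + 1), Polynomial.C (lam a) * Polynomial.X ^ (a : ℕ) with hP
  have hP0 : P ≠ 0 := by
    intro h0
    apply hne; funext a
    have := congrArg (fun p => Polynomial.coeff p a) h0
    simp only [hP, Polynomial.finset_sum_coeff, Polynomial.coeff_C_mul, Polynomial.coeff_X_pow, Polynomial.coeff_zero] at this
    rw [sum_eq_single a (fun b _ hb => by rw [if_neg (fun h => hb (Fin.ext h.symm)), mul_zero]) (by simp)] at this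
    simpa using this
  obtain ⟨cF, hF1, -, -, hF2⟩ := GJ_F.ex
  obtain ⟨cX, hX1, -, hX2⟩ := dX_ex
  have dFd : Differentiable ℂ (dF τ) := by have := z_diff hF1.conv hτ; rwa [show (fun z => fser cF τ z) = dF τ from funext (hF2 τ hτ)] at this
  have dXd : Differentiable ℂ (dX τ) := by have := z_diff hX1.conv hτ; rwa [show (fun z => fser cX τ z) = dX τ from funext (hX2 τ hτ)] at this
  have hXn : ∀ᶠ z in 𝓝 (0 : ℂ), dX τ z ≠ 0 := dXd.continuous.continuousAt.eventually_ne (by rw [dX_zero hτ]; norm_num)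
  have hroot : ∀ᶠ z in 𝓝 (0 : ℂ), P.eval (dF τ z / dX τ z) = 0 := by
    filter_upwards [hXn] with z hz
    have h1 := gr_rel hm hc hτ lam h z
    have h2 : P.eval (dF τ z / dX τ z) * dX τ z ^ m = 0 := by
      rw [← h1, hP, Polynomial.eval_finset_sum, sum_mul]
      refine sum_congr rfl fun a _ => ?_
      rw [hf a z]; simp only [Polynomial.eval_mul, Polynomial.eval_C, Polynomial.eval_pow, Polynomial.eval_X, div_pow]
      rw [show dX τ z ^ m = dX τ z ^ (a : ℕ) * dX τ z ^ (m - a) by rw [← pow_add]; congr 1; omega]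
      field_simp
    exact (mul_eq_zero.1 h2).resolve_right (pow_ne_zero _ hz)
  have hlim : Tendsto (fun z => dF τ z / dX τ z) (𝓝 0) (𝓝 0) := by
    have := (dFd.continuous.continuousAt (x := 0)).div dXd.continuous.continuousAt (by rw [dX_zero hτ]; norm_num)
    unfold ContinuousAt at this
    simpa [dF_zero, Pi.div_def] using this
  have hfin : ((P.roots.toFinset.erase 0 : Finset ℂ) : Set ℂ)ᶜ ∈ 𝓝 (0 : ℂ) := (finite_toSet _).isClosed.isOpen_compl.mem_nhds (by simp)
  have hz : ∀ᶠ z in 𝓝 (0 : ℂ), dF τ z = 0 := by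
    filter_upwards [hXn, hroot, hlim hfin] with z h1 h2 h3
    by_contra h4
    exact h3 (by simp [hP0, h1, h4]; exact h2)
  have := (dFd.differentiableOn.analyticOnNhd isOpen_univ).eqOn_zero_of_preconnected_of_eventuallyEq_zero isPreconnected_univ (mem_univ 0) hz
  exact dF_half hτ (this (mem_univ _))
def aN (m r j : ℕ) : ℤ := (r : ℤ) ^ 2 + 4 * m * (j - m)
def aG (m : ℕ) (Gf : (ℤ → ℤ → ℂ) →ₗ[ℂ] ℂ) (r j : ℕ) : ℂ := Gf (hat m (aN m r j) r)
lemma aN_dvd (m r j : ℕ) : (4 * m : ℤ) ∣ aN m r j - (r : ℤ) ^ 2 := ⟨j - m, by unfold aN; ring⟩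
lemma decomp2 (hm : 0 < m) {d : ℤ × ℤ → ℂ} (hd : SymC m d) {K : ℕ} (hK : Low (-K) d) :
    toC m d - ∑ r ∈ range (m + 1), ∑ j ∈ range (K + m + 1), d (m - j, r) • hat m (aN m r j) r ∈ M0 m := by
  have hm' : (0 : ℤ) < m := by exact_mod_cast hm
  have hC := toC_mem hm hd
  refine ⟨sub_mem hC (Submodule.sum_mem _ fun r _ => Submodule.sum_mem _ fun j _ => smul_mem _ _ (hat_mem (aN_dvd m r j))), 0, zero_mem _, fun D l hD => ?_⟩
  obtain ⟨r, hr0, hr1, hr⟩ := rep_exists hm' l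
  lift r to ℕ using hr0
  simp only [Pi.sub_apply, Finset.sum_apply, Pi.smul_apply, smul_eq_mul, Pi.zero_apply]
  rw [poly_rep hC hr, sum_eq_single r]
  · unfold toC
    split_ifs with h
    · obtain ⟨n, hn⟩ := h
      rw [hn, mul_ediv_cancel_left _ (by positivity)]
      have hnm : n ≤ m := by
        by_contra h'; push Not at h'
        nlinarith
      by_cases hj : n < -K
      · rw [hK n r hj, zero_sub, neg_eq_zero]
        refine sum_eq_zero fun j hj' => ?_
        simp only [hat]; rw [if_neg, mul_zero]
        rintro ⟨h1, -⟩
        have : 4 * (m : ℤ) * n = 4 * m * (m - j) := by rw [← hn, h1]; unfold aN; ring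
        have := mul_left_cancel₀ (by positivity) this
        have := mem_range.1 hj'
        omega
      · obtain ⟨j, hj'⟩ := eq_ofNat_of_zero_le (show 0 ≤ m - n by omega)
        rw [sum_eq_single j]
        · simp only [hat]; rw [if_pos ⟨by unfold aN; rw [← hj']; linarith, hr⟩, mul_one, ← hj']; simp
        · intro i hi hij
          simp only [hat]; rw [if_neg, mul_zero]
          rintro ⟨h1, -⟩
          have : 4 * (m : ℤ) * n = 4 * m * (m - i) := by rw [← hn, h1]; unfold aN; ring
          have := mul_left_cancel₀ (by positivity) this
          omega
        · intro h; exact absurd (mem_range.2 (by omega)) h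
    · rw [zero_sub, neg_eq_zero]
      refine sum_eq_zero fun j hj' => ?_
      simp only [hat]; rw [if_neg, mul_zero]
      rintro ⟨h1, -⟩
      exact h ⟨m - j, by rw [h1]; unfold aN; ring⟩
  · intro s hs hsr
    refine sum_eq_zero fun j hj' => ?_
    simp only [hat]; rw [if_neg, mul_zero]
    rintro ⟨h1, h2⟩
    have := mem_range.1 hs
    exact hsr (by exact_mod_cast (rep_unique hm' (by positivity) (by omega) (by positivity) hr1 h2 hr))
  · intro h; exact absurd (mem_range.2 (by omega)) h
def aS (m : ℕ) (Gf : (ℤ → ℤ → ℂ) →ₗ[ℂ] ℂ) (r : ℕ) : PowerSeries ℂ := PowerSeries.mk (aG m Gf r)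
def cS (c : ℤ × ℤ → ℂ) (r : ℕ) : PowerSeries ℂ := PowerSeries.mk (fun n => c (n, r))
lemma pairing {w : ℤ} (hw : Even w) (hm : 0 < m) (hc : IsJ w m c) (hl : Low 0 c)
    (hG : ∀ x ∈ M0 m, Gf x = 0) :
    ∃ W, IsJ w 0 W ∧ Low (-m) W ∧ ∀ n : ℕ, W (n - m, 0) = (∑ r ∈ range (m + 1), cS c r * aS m Gf r).coeff n := by
  let F : ℤ → ℂ := fun k => ∑ r ∈ range (m + 1), ∑ j ∈ range (k + m + 1).toNat, c (k + m - j, r) * aG m Gf r j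
  have hF0 : ∀ k < -(m : ℤ), F k = 0 := fun k hk => by
    simp only [F]; rw [show (k + m + 1).toNat = 0 by omega]; simp
  obtain ⟨W, hW, hWF⟩ := dual hw hF0 (fun f hf => by
    obtain ⟨n0, hn0⟩ := hf.low
    set K := (-n0).toNat with hKd
    have hfl : Low (-K) f := fun n r h => hn0 n r (by omega)
    have hd : IsJ 2 m (cmul f c) := by simpa using hf.mul hc
    have hdl : Low (-K) (cmul f c) := by simpa using hfl.mul hl
    have h1 := hG _ (decomp2 hm hd.toSymC hdl)
    rw [map_sub, hG _ ⟨(toC_Jm hm hd).1, _, toC_Jm hm hd, fun _ _ _ => rfl⟩, zero_sub, neg_eq_zero, map_sum] at h1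
    simp_rw [map_sum, map_smul, smul_eq_mul] at h1
    have hs : ∀ r j : ℕ, Summable (fun k : ℤ => f (-k, 0) * c (k + (m - j), r) * aG m Gf r j) := fun r j =>
      (summable_pair hf.toSymC (F := fun k => c (k + (m - j), r)) (M := j - m) (fun k hk => hl _ _ (by omega))).mul_right _
    have h2 : ∀ k : ℤ, f (-k, 0) * F k = ∑ r ∈ range (m + 1), ∑ j ∈ range (K + m + 1), f (-k, 0) * c (k + (m - j), r) * aG m Gf r j := by
      intro k
      by_cases hk : k ≤ K
      · simp only [F, mul_sum]
        refine sum_congr rfl fun r _ => ?_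
        rw [← Finset.sum_subset (Finset.range_mono (show (k + m + 1).toNat ≤ K + m + 1 by omega))]
        · refine sum_congr rfl fun j _ => ?_
          rw [add_sub_assoc, mul_assoc]
        · intro j _ hj
          rw [hl, mul_zero, zero_mul]
          simp at hj; omega
      · rw [hfl (-k) 0 (by omega)]; simp
    simp_rw [h2]
    rw [Summable.tsum_finsetSum (fun r _ => summable_sum fun j _ => hs r j), ← h1]
    refine sum_congr rfl fun r _ => ?_
    rw [Summable.tsum_finsetSum (fun j _ => hs r j)]
    refine sum_congr rfl fun j _ => ?_
    rw [tsum_mul_right, cmul_row hf.toSymC]; rfl)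
  refine ⟨W, hW, fun n r h => ?_, fun n => ?_⟩
  · by_cases hr : r = 0
    · rw [hr, hWF, hF0 n h]
    · exact hW.toSymC.z0 n hr
  · rw [hWF, map_sum]
    refine sum_congr rfl fun r _ => ?_
    rw [coeff_mul, Finset.Nat.sum_antidiagonal_eq_sum_range_succ (fun i j => (cS c r).coeff i * (aS m Gf r).coeff j),
      ← sum_range_reflect, show ((n : ℤ) - m + m + 1).toNat = n + 1 by omega]
    refine sum_congr rfl fun j hj => ?_
    have := mem_range.1 hj
    simp only [cS, aS, coeff_mk]
    rw [show n + 1 - 1 - j = n - j by omega]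
    congr 3
    · omega
lemma row_ps {c : ℤ → ℂ} (M : ℤ) (h0 : ∀ k < M, c k = 0) (hs : ∀ τ : ℂ, 0 < τ.im → Summable (fun k : ℤ => c k * ee (k * τ))) :
    PS (fun n => c (n + M)) ∧ ∀ τ : ℂ, 0 < τ.im → HasSum (fun n : ℕ => c (n + M) * ee τ ^ n) (ee (-(M * τ)) * ∑' k : ℤ, c k * ee (k * τ)) := by
  have key : ∀ τ : ℂ, 0 < τ.im → HasSum (fun n : ℕ => c (n + M) * ee τ ^ n) (ee (-(M * τ)) * ∑' k : ℤ, c k * ee (k * τ)) := by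
    intro τ hτ
    have hi : Injective (fun n : ℕ => (n : ℤ) + M) := fun a b h => by simpa using h
    have := (hi.hasSum_iff (f := fun k : ℤ => c k * ee (k * τ)) (fun k hk => by
      rw [h0 k, zero_mul]; by_contra h
      exact hk ⟨(k - M).toNat, by simp only []; omega⟩)).2 (hs τ hτ).hasSum
    refine (this.mul_left (ee (-(M * τ)))).congr_fun fun n => ?_
    simp only [comp_def]
    rw [mul_left_comm, ← ee_add, ee_pow]; congr 2; push_cast; ring
  refine ⟨fun q hq => ?_, key⟩
  by_cases hq0 : q = 0
  · exact summable_of_ne_finset_zero (s := {0}) fun n hn => by simp at hn; simp [hn, hq0]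
  obtain ⟨τ, hτ, rfl⟩ := ee_surj hq0 hq
  exact (key τ hτ).summable
lemma cS_CR (hc : SymC m c) (hl : Low 0 c) (r : ℕ) : cS c r ∈ CR ∧
    ∀ τ : ℂ, 0 < τ.im → psv (fun n => (cS c r).coeff n) (ee τ) = gr c τ r := by
  obtain ⟨h1, h2⟩ := row_ps (c := fun n => c (n, r)) 0 (fun k hk => hl _ _ hk) (fun τ hτ => (gr_hasSum hc.conv hτ r).summable)
  simp only [add_zero] at h1 h2
  refine ⟨by simpa [mem_CR, cS] using h1, fun τ hτ => ?_⟩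
  have := (h2 τ hτ).tsum_eq
  simp only [cS, coeff_mk, psv]
  rw [this]; simp [ee_zero, gr]
lemma W_CR {w : ℤ} {W : ℤ × ℤ → ℂ} (hW : IsJ w 0 W) (hl : Low (-m) W) {f : PowerSeries ℂ} (hf : ∀ n : ℕ, W (n - m, 0) = f.coeff n) :
    f ∈ CR ∧ ∀ τ : ℂ, 0 < τ.im → psv (fun n => f.coeff n) (ee τ) = ee (m * τ) * fser W τ 0 := by
  obtain ⟨h1, h2⟩ := row_ps (c := fun n => W (n, 0)) (-m) (fun k hk => hl _ _ hk) (fun τ hτ => (row_hasSum hW.toSymC hτ).summable)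
  simp only [← sub_eq_add_neg, hf] at h1 h2
  refine ⟨h1, fun τ hτ => ?_⟩
  rw [psv, (h2 τ hτ).tsum_eq, (row_hasSum hW.toSymC hτ).tsum_eq]; simp
def sh (m : ℕ) (N l : ℤ) : ℤ → ℤ → ℂ := fun D x =>
  if D = -N then ((if (2 * m : ℤ) ∣ x - l then 1 else 0) + (if (2 * m : ℤ) ∣ x + l then 1 else 0)) / 2 else 0
lemma hat_sh (N : ℤ) {r : ℕ} (hr : r ≤ m) (hm : 0 < m) : hat m N r = ww m r • sh m N r := by
  funext D x
  simp only [hat, sh, Pi.smul_apply, smul_eq_mul, ww]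
  by_cases hD : D = -N
  · simp only [hD, true_and, if_true]
    by_cases hr0 : r = 0 ∨ r = m
    · have e : (2 * m : ℤ) ∣ x - r ↔ (2 * m : ℤ) ∣ x + r := by
        rcases hr0 with rfl | rfl
        · simp
        · constructor <;> intro h
          · exact dvd_of_eq_z (dvd_add h (dvd_refl _)) (by ring)
          · exact dvd_of_eq_z (dvd_sub h (dvd_refl _)) (by ring)
      rw [if_pos hr0]
      by_cases h : (2 * m : ℤ) ∣ x + r <;> simp [e, h]
    · rw [if_neg hr0]
      by_cases h1 : (2 * m : ℤ) ∣ x - r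
      · have h2 : ¬ (2 * m : ℤ) ∣ x + r := fun h2 => by
          have h3 : (2 * m : ℤ) ∣ 2 * r := dvd_of_eq_z (dvd_sub h2 h1) (by ring)
          have h4 : m ∣ r := by
            have := (mul_dvd_mul_iff_left (two_ne_zero)).1 h3
            exact_mod_cast this
          exact hr0 (by rcases Nat.eq_zero_or_pos r with h | h; exact Or.inl h; exact Or.inr (le_antisymm hr (le_of_dvd h h4)))
        simp [h1, h2]
      · by_cases h2 : (2 * m : ℤ) ∣ x + r <;> simp [h1, h2]
  · simp [hD]
lemma sh_per (m : ℕ) (N l t : ℤ) : sh m N (l + 2 * m * t) = sh m N l := by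
  funext D x; simp only [sh]
  have e1 : (2 * m : ℤ) ∣ x - (l + 2 * m * t) ↔ (2 * m : ℤ) ∣ x - l := by
    rw [show x - l = (x - (l + 2 * m * t)) + 2 * m * t by ring, dvd_add_left (dvd_mul_right _ _)]
  have e2 : (2 * m : ℤ) ∣ x + (l + 2 * m * t) ↔ (2 * m : ℤ) ∣ x + l := by
    rw [← add_assoc, dvd_add_left (dvd_mul_right _ _)]
  simp only [e1, e2]
lemma sh_neg (m : ℕ) (N l : ℤ) : sh m N (-l) = sh m N l := by
  funext D x; simp only [sh, sub_neg_eq_add, ← sub_eq_add_neg]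
  rw [add_comm (ite _ _ _)]
lemma sh_rep (hm : 0 < m) (l : ℤ) : ∃ r : ℕ, r ≤ m ∧ (4 * m : ℤ) ∣ l ^ 2 - r ^ 2 ∧ (∃ s : ℤ, IsUnit s ∧ (2 * m : ℤ) ∣ l - s * r) ∧ ∀ N, sh m N l = sh m N r := by
  obtain ⟨r, h0, h1, h2⟩ := rep_exists (m := (m : ℤ)) (by exact_mod_cast hm) l
  lift r to ℕ using h0
  refine ⟨r, by exact_mod_cast h1, ?_⟩
  rcases h2 with ⟨t, ht⟩ | ⟨t, ht⟩
  · obtain rfl : l = r + 2 * m * t := by linarith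
    exact ⟨⟨t * r + m * t ^ 2, by ring⟩, ⟨1, isUnit_one, t, by ring⟩, fun N => sh_per _ _ _ _⟩
  · obtain rfl : l = -r + 2 * m * t := by linarith
    exact ⟨⟨-t * r + m * t ^ 2, by ring⟩, ⟨-1, isUnit_one.neg, t, by ring⟩, fun N => by rw [sh_per, sh_neg]⟩
structure Kill (m : ℕ) (Gf : (ℤ → ℤ → ℂ) →ₗ[ℂ] ℂ) : Prop where
  m0 : ∀ x ∈ M0 m, Gf x = 0
  unit : ∀ N l : ℤ, (4 * m : ℤ) ∣ N - l ^ 2 → IsCoprime l (2 * m : ℤ) → Gf (hat m N l) = 0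
  prim : ∀ p : ℕ, p.Prime → p ^ 2 ∣ m → ∀ x ∈ PolyC m, Gf (Ep m p x) = 0
def AA (m : ℕ) (Gf : (ℤ → ℤ → ℂ) →ₗ[ℂ] ℂ) (l N : ℤ) : ℂ := if (4 * m : ℤ) ∣ N - l ^ 2 then Gf (sh m N l) else 0
def vv (m : ℕ) (Gf : (ℤ → ℤ → ℂ) →ₗ[ℂ] ℂ) (τ : ℂ) (l : ℤ) : ℂ := ∑' N : ℤ, AA m Gf l N * ee (N / (4 * m) * τ)
lemma AA_rep (Gf : (ℤ → ℤ → ℂ) →ₗ[ℂ] ℂ) (h : (4 * m : ℤ) ∣ l ^ 2 - r ^ 2) (hs : ∀ N, sh m N l = sh m N r) : AA m Gf l = AA m Gf r := by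
  funext N; unfold AA
  rw [hs, show N - r ^ 2 = (N - l ^ 2) + (l ^ 2 - r ^ 2) by ring]
  simp only [dvd_add_left h]
lemma vv_per (m : ℕ) (Gf : (ℤ → ℤ → ℂ) →ₗ[ℂ] ℂ) (τ : ℂ) (l : ℤ) : vv m Gf τ (l + 2 * m) = vv m Gf τ l := by
  unfold vv; rw [AA_rep Gf (l := l + 2 * m) (r := l) ⟨l + m, by ring⟩ fun N => by simpa using sh_per m N l 1]
lemma vv_neg (m : ℕ) (Gf : (ℤ → ℤ → ℂ) →ₗ[ℂ] ℂ) (τ : ℂ) (l : ℤ) : vv m Gf τ (-l) = vv m Gf τ l := by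
  unfold vv; rw [AA_rep Gf (l := -l) (r := l) ⟨0, by ring⟩ fun N => sh_neg m N l]
lemma AA_r (hm : 0 < m) {r : ℕ} (hr : r ≤ m) (hN : (4 * m : ℤ) ∣ N - r ^ 2) :
    ww m r * AA m Gf r N = Gf (hat m N r) := by
  unfold AA; rw [if_pos hN, hat_sh N hr hm, map_smul, smul_eq_mul]
lemma vv_r (hm : 0 < m) (hG : Kill m Gf) {r : ℕ} (hr : r ≤ m) (hC : aS m Gf r ∈ CR) (hτ : 0 < τ.im) :
    HasSum (fun N : ℤ => AA m Gf r N * ee (N / (4 * m) * τ)) (vv m Gf τ r) ∧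
    ww m r * vv m Gf τ r = ee ((r ^ 2 / (4 * m) - m) * τ) * psv (fun n => (aS m Gf r).coeff n) (ee τ) := by
  have hmc : (m : ℂ) ≠ 0 := by exact_mod_cast hm.ne'
  have hi : Injective (aN m r) := fun a b h => by
    have : (4 * (m : ℤ)) ≠ 0 := by positivity
    simpa [aN, this, hm.ne'] using h
  have key : HasSum (fun N : ℤ => AA m Gf r N * ee (N / (4 * m) * τ)) ((ww m r)⁻¹ * (ee ((r ^ 2 / (4 * m) - m) * τ) * psv (fun n => (aS m Gf r).coeff n) (ee τ))) := by
    rw [← hi.hasSum_iff]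
    · refine (((hC _ (norm_q_lt hτ)).hasSum.mul_left (ee ((r ^ 2 / (4 * m) - m) * τ))).mul_left (ww m r)⁻¹).congr_fun fun j => ?_
      simp only [comp_def, aS, coeff_mk]
      rw [aG, ← AA_r hm hr (aN_dvd m r j), ee_pow, mul_left_comm (ee _), ← ee_add, ← mul_assoc, inv_mul_cancel_left₀ (ww_ne m r)]
      congr 2; unfold aN; push_cast; field_simp; ring
    · intro N hN
      by_cases hd : (4 * m : ℤ) ∣ N - r ^ 2
      · rw [(mul_eq_zero.1 ((AA_r hm hr hd).trans ?_)).resolve_left (ww_ne m r), zero_mul]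
        have hN0 : N ≤ 0 := by
          by_contra h; push Not at h
          obtain ⟨t, ht⟩ := hd
          apply hN
          refine ⟨(t + m).toNat, ?_⟩
          have : 0 ≤ t + m := by
            by_contra h'; push Not at h'
            have : (r : ℤ) ≤ m := by exact_mod_cast hr
            nlinarith
          unfold aN; rw [toNat_of_nonneg this]; linarith
        exact hG.m0 _ ((Submodule.Quotient.mk_eq_zero _).1 (hq_zero hd hN0))
      · unfold AA; rw [if_neg hd, zero_mul]
  have h2 : vv m Gf τ r = _ := key.tsum_eq
  exact ⟨h2 ▸ key, by rw [h2, mul_inv_cancel_left₀ (ww_ne m r)]⟩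
lemma aS_CR (hm : 0 < m) (hG : Kill m Gf) : ∃ c : Fin (m + 1) → ℤ × ℤ → ℂ,
    (∀ a : Fin (m + 1), IsJ (10 * ((a : ℕ) : ℤ)) m (c a)) ∧
    (∀ r ≤ m, aS m Gf r ∈ CR) ∧
    (∀ τ : ℂ, 0 < τ.im → ∀ x : Fin (m + 1) → ℂ, (∀ a : Fin (m + 1), ∑ r : Fin (m + 1), gr (c a) τ ((r : ℕ) : ℤ) * x r = 0) → x = 0) ∧
    (∀ a : Fin (m + 1), ∃ W, IsJ (10 * ((a : ℕ) : ℤ)) 0 W ∧ ∀ τ : ℂ, 0 < τ.im → ∑ l ∈ range (2 * m), hh m (c a) τ l * vv m Gf τ l = fser W τ 0) := by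
  choose c h1 h2 h3 using fun a : Fin (m + 1) => Xa_ex m a (by omega)
  have hcS := fun a r => cS_CR (h1 a).toSymC (h2 a) r
  have hns : ∀ τ : ℂ, 0 < τ.im → (Matrix.of fun a r : Fin (m + 1) => gr (c a) τ ((r : ℕ) : ℤ)).det ≠ 0 := by
    intro τ hτ h0
    obtain ⟨lam, hne, hl⟩ := Matrix.exists_vecMul_eq_zero_iff.2 h0
    exact hne (nonsing hm (fun a => (h1 a).toSymC) hτ (fun a z => h3 a τ hτ z) lam fun r => by
      simpa [Matrix.vecMul, dotProduct] using congrFun hl r)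
  choose W hW1 hW2 hW3 using fun a : Fin (m + 1) => pairing (show Even (10 * ((a : ℕ) : ℤ)) from ⟨5 * a, by ring⟩) hm (h1 a) (h2 a) hG.m0
  have hWC := fun a => W_CR (hW1 a) (hW2 a) (hW3 a)
  let H : Matrix (Fin (m + 1)) (Fin (m + 1)) CR := Matrix.of fun a r => ⟨cS (c a) r, (hcS a r).1⟩
  let G : Fin (m + 1) → PowerSeries ℂ := fun r => aS m Gf r
  have hdet : ∀ τ (hτ : 0 < τ.im), evq (ee τ) (norm_q_lt hτ) H.det ≠ 0 := by
    intro τ hτ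
    rw [RingHom.map_det]
    have := hns τ hτ
    convert this using 2
    ext a r
    exact (hcS a r).2 τ hτ
  let H' : Matrix (Fin (m + 1)) (Fin (m + 1)) (PowerSeries ℂ) := CR.subtype.mapMatrix H
  have hHG : ∀ a, H'.mulVec G a ∈ CR := by
    intro a
    have : H'.mulVec G a = ∑ r ∈ range (m + 1), cS (c a) r * aS m Gf r := by
      rw [sum_range]; rfl
    rw [this]; exact (hWC a).1
  have hGC : ∀ r ≤ m, aS m Gf r ∈ CR := by
    intro r hr
    refine CR_div (d := H'.det) (by rw [← RingHom.map_det]; exact H.det.2) ?_ ?_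
    · have : H'.det * G ⟨r, by omega⟩ = H'.adjugate.mulVec (H'.mulVec G) ⟨r, by omega⟩ := by
        rw [Matrix.mulVec_mulVec, Matrix.adjugate_mul, Matrix.smul_mulVec, Matrix.one_mulVec]; rfl
      change H'.det * G ⟨r, by omega⟩ ∈ CR
      rw [this]
      refine CR.sum_mem fun i _ => CR.mul_mem ?_ (hHG i)
      rw [← RingHom.map_adjugate]; exact (H.adjugate _ _).2
    · intro q hq hq0
      obtain ⟨τ, hτ, rfl⟩ := ee_surj hq0 hq
      rw [← RingHom.map_det]; exact hdet τ hτ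
  refine ⟨c, h1, hGC, fun τ hτ x hx => ?_, fun a => ⟨W a, hW1 a, fun τ hτ => ?_⟩⟩
  · exact Matrix.eq_zero_of_mulVec_eq_zero (hns τ hτ) (funext fun a => by simpa [Matrix.mulVec, dotProduct] using hx a)
  · have hp := (h1 a).toSymC
    rw [fold hm (fun l => hh m (c a) τ l * vv m Gf τ l) (fun l => by
      have := hh_per hm hp τ l 1
      simp only [mul_one] at this
      rw [this, vv_per]) (fun l => by rw [hh_neg hp, vv_neg])]
    have h5 := (hWC a).2 τ hτ
    have h6 : psv (fun n => (∑ r ∈ range (m + 1), cS (c a) r * aS m Gf r).coeff n) (ee τ) =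
        ∑ r ∈ range (m + 1), gr (c a) τ r * psv (fun n => (aS m Gf r).coeff n) (ee τ) := by
      have hsum : ∀ n ≤ m + 1, (∑ r ∈ range n, cS (c a) r * aS m Gf r) ∈ CR ∧ psv (fun k => (∑ r ∈ range n, cS (c a) r * aS m Gf r).coeff k) (ee τ) =
          ∑ r ∈ range n, gr (c a) τ r * psv (fun n => (aS m Gf r).coeff n) (ee τ) := by
        intro n
        induction n with
        | zero => intro _; exact ⟨by simp, by simp [psv]⟩
        | succ n ih =>
          intro hn
          obtain ⟨i1, i2⟩ := ih (by omega)
          have i3 := CR.mul_mem (hcS a n).1 (hGC n (by omega))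
          rw [sum_range_succ, sum_range_succ]
          refine ⟨CR.add_mem i1 i3, ?_⟩
          rw [← i2, ← (hcS a n).2 τ hτ]
          exact ((evq _ (norm_q_lt hτ)).map_add ⟨_, i1⟩ ⟨_, i3⟩).trans (congrArg _ ((evq _ (norm_q_lt hτ)).map_mul ⟨_, (hcS a n).1⟩ ⟨_, hGC n (by omega)⟩))
      exact (hsum _ le_rfl).2
    have h7 : ee (m * τ) ≠ 0 := ee_ne _
    refine mul_left_cancel₀ h7 ?_
    rw [← h5, h6, mul_sum]
    refine sum_congr rfl fun r hr => ?_
    rw [mul_left_comm (ww m r), (vv_r hm hG (by have := mem_range.1 hr; omega) (hGC r (by have := mem_range.1 hr; omega)) hτ).2]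
    unfold hh
    rw [show ee (m * τ) * (gr (c a) τ r * ee (-(((r : ℤ) : ℂ) ^ 2 / (4 * m) * τ)) * (ee ((r ^ 2 / (4 * m) - m) * τ) * psv (fun n => (aS m Gf r).coeff n) (ee τ)))
      = (ee (m * τ) * (ee (-(((r : ℤ) : ℂ) ^ 2 / (4 * m) * τ)) * ee ((r ^ 2 / (4 * m) - m) * τ))) * (gr (c a) τ r * psv (fun n => (aS m Gf r).coeff n) (ee τ)) by ring,
      ← ee_add, ← ee_add]
    rw [show (m * τ + (-(((r : ℤ) : ℂ) ^ 2 / (4 * m) * τ) + (r ^ 2 / (4 * m) - m) * τ)) = 0 by push_cast; ring, ee_zero, one_mul]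
lemma sh_mem (hm : 0 < m) (h : (4 * m : ℤ) ∣ N - l ^ 2) : sh m N l ∈ PolyC m := by
  obtain ⟨r, hr, h1, -, h2⟩ := sh_rep hm l
  have : sh m N r = (ww m r)⁻¹ • hat m N r := by rw [hat_sh N hr hm, inv_smul_smul₀ (ww_ne m r)]
  rw [h2, this]
  refine smul_mem _ _ (hat_mem ?_)
  rw [show N - (r : ℤ) ^ 2 = (N - l ^ 2) + (l ^ 2 - r ^ 2) by ring]; exact dvd_add h h1
lemma sh_prim {k : ℕ} (hp : p.Prime) (hm : 0 < m) (hk : m = k * p ^ 2) (N : ℤ) (hl : (p : ℤ) ∣ l) :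
    ∑ j ∈ range p, sh m N (l + 2 * k * p * j) = (p : ℂ) • Ep m p (sh m N l) := by
  have hpc : (p : ℂ) ≠ 0 := by exact_mod_cast hp.ne_zero
  have hpz : (p : ℤ) ≠ 0 := by exact_mod_cast hp.ne_zero
  have e2 : (2 * m / p : ℤ) = 2 * k * p := by
    rw [hk]; push_cast; rw [show (2 : ℤ) * (k * p ^ 2) = (2 * k * p) * p by ring, mul_ediv_cancel _ hpz]
  have hpm : (p : ℤ) ∣ 2 * m := ⟨2 * k * p, by rw [hk]; push_cast; ring⟩
  have hmz : (2 * m : ℤ) = 2 * k * p * p := by rw [hk]; push_cast; ring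
  funext D x
  rw [Finset.sum_apply, Finset.sum_apply, Pi.smul_apply, Pi.smul_apply, Ep_apply, e2]
  by_cases hx : (p : ℤ) ∣ x
  · rw [if_pos hx, smul_eq_mul, ← mul_assoc, mul_one_div_cancel hpc, one_mul]
    simp only [sh]
    by_cases hD : D = -N
    · simp only [if_pos hD, ← Finset.sum_div, sum_add_distrib]
      have := sum_per_neg (d := p) (fun j => if (2 * m : ℤ) ∣ x + 2 * k * p * j - l then (1 : ℂ) else 0) (fun j => by
        rw [show x + 2 * (k : ℤ) * p * (j + p) - l = (x + 2 * k * p * j - l) + 2 * m by rw [hmz]; ring]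
        simp)
      rw [← this]
      congr 2
      · refine sum_congr rfl fun j _ => ?_
        rw [show x - (l + 2 * (k : ℤ) * p * j) = x + 2 * k * p * (-j) - l by ring]
      · refine sum_congr rfl fun j _ => ?_
        rw [show x + (l + 2 * (k : ℤ) * p * j) = x + 2 * k * p * j + l by ring]
    · simp [if_neg hD]
  · rw [if_neg hx, smul_zero]
    refine sum_eq_zero fun j _ => ?_
    have hd : (p : ℤ) ∣ l + 2 * k * p * j := dvd_add hl ⟨2 * k * j, by ring⟩
    simp only [sh]
    rw [if_neg (fun h => hx ((dvd_sub_left hd).1 (hpm.trans h))), if_neg (fun h => hx ((dvd_add_left hd).1 (hpm.trans h)))]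
    simp
lemma Sv_neg' (hm : 0 < m) (hp : ∀ l, v (l + 2 * m) = v l) (he : ∀ l, v (-l) = v l) (x : ℤ) : Sv m v (-x) = Sv m v x := by
  have := sum_per_neg (d := 2 * m) (fun y => er (4 * m) (2 * x * y) * v y) (fun y => by
    push_cast; rw [hp]; congr 1; exact er_congr (by omega) ⟨x, by push_cast; ring⟩)
  unfold Sv; rw [← this]
  refine sum_congr rfl fun y _ => ?_
  rw [he]; congr 2; ring
lemma Sv_per (hm : 0 < m) (v : ℤ → ℂ) (x : ℤ) : Sv m v (x + 2 * m) = Sv m v x := by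
  unfold Sv
  refine sum_congr rfl fun y _ => ?_
  congr 1; exact er_congr (by omega) ⟨y, by push_cast; ring⟩
lemma vv_S (hm : 0 < m) (hG : Kill m Gf) (hτ : 0 < τ.im) (l : ℤ) :
    vv m Gf τ l = tfac m (-1 / τ) * Sv m (vv m Gf (-1 / τ)) l := by
  have hmc : (m : ℂ) ≠ 0 := by exact_mod_cast hm.ne'
  obtain ⟨c, h1, -, h3, h4⟩ := aS_CR hm hG
  have hσ := neg_inv_im hτ
  have hτ0 := ne_of_im hτ
  have ess : -1 / (-1 / τ) = τ := by field_simp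
  have hxp : ∀ l, Sv m (vv m Gf (-1 / τ)) (l + 2 * m) = Sv m (vv m Gf (-1 / τ)) l := Sv_per hm _
  have hxe := Sv_neg' hm (vv_per m Gf (-1 / τ)) (vv_neg m Gf (-1 / τ))
  set x : ℤ → ℂ := fun l => vv m Gf τ l - tfac m (-1 / τ) * Sv m (vv m Gf (-1 / τ)) l with hx
  have xp : ∀ l, x (l + 2 * m) = x l := fun l => by simp only [hx, vv_per, hxp]
  have xe : ∀ l, x (-l) = x l := fun l => by simp only [hx, vv_neg, hxe]
  have key : ∀ a : Fin (m + 1), ∑ l ∈ range (2 * m), hh m (c a) τ l * x l = 0 := by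
    intro a
    obtain ⟨W, hW, hW2⟩ := h4 a
    have e1 := hW.S τ hτ 0
    simp only [zero_div, ne_eq, OfNat.ofNat_ne_zero, not_false_eq_true, zero_pow, mul_zero, ee_zero, mul_one] at e1
    have hw : (-1 / τ) ^ (10 * ((a : ℕ) : ℤ)) * τ ^ (10 * ((a : ℕ) : ℤ)) = 1 := by
      rw [← mul_zpow, div_mul_cancel₀ _ hτ0, Even.neg_one_zpow ⟨5 * (a : ℕ), by ring⟩]
    have e2 : fser W τ 0 = (-1 / τ) ^ (10 * ((a : ℕ) : ℤ)) * fser W (-1 / τ) 0 := by rw [e1, ← mul_assoc, hw, one_mul]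
    rw [← hW2 τ hτ, ← hW2 _ hσ, mul_sum] at e2
    simp only [hx, mul_sub, sum_sub_distrib]
    rw [e2, sub_eq_zero]
    have e3 : ∀ k ∈ range (2 * m), (-1 / τ) ^ (10 * ((a : ℕ) : ℤ)) * (hh m (c a) (-1 / τ) k * vv m Gf (-1 / τ) k) =
        ∑ l ∈ range (2 * m), hh m (c a) τ l * (tfac m (-1 / τ) * (er (4 * m) (2 * (-l) * k) * vv m Gf (-1 / τ) k)) := by
      intro k hk
      rw [← mul_assoc, hh_S hm (h1 a) hσ k (mem_range.1 hk), ess, mul_sum, sum_mul]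
      refine sum_congr rfl fun l _ => ?_
      have : ee (-((l : ℤ) * k) / (2 * m)) = er (4 * m) (2 * (-l) * k) := by
        unfold er; congr 1; push_cast; field_simp; ring
      rw [this]; ring
    rw [sum_congr rfl e3, sum_comm]
    refine sum_congr rfl fun l _ => ?_
    rw [← hxe]; unfold Sv
    simp only [mul_sum]
  have k2 : ∀ r ≤ m, x r = 0 := by
    have := h3 τ hτ (fun r => ww m r * ee (-((r : ℕ) ^ 2 / (4 * m) * τ)) * x (r : ℕ)) fun a => by
      have k := key a
      rw [fold hm (fun l => hh m (c a) τ l * x l) (fun l => by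
        have := hh_per hm (h1 a).toSymC τ l 1
        simp only [mul_one] at this
        rw [this, xp]) (fun l => by rw [hh_neg (h1 a).toSymC, xe]), sum_range] at k
      rw [← k]
      refine sum_congr rfl fun r _ => ?_
      unfold hh; push_cast; ring
    intro r hr
    have := congrFun this ⟨r, by omega⟩
    simpa [ww_ne, ee_ne] using this
  obtain ⟨r, h0, h1', h2⟩ := rep_exists (m := (m : ℤ)) (by exact_mod_cast hm) l
  lift r to ℕ using h0
  have xpt : ∀ (t l : ℤ), x (l + 2 * m * t) = x l := by
    intro t
    induction t using induction_on with
    | zero => intro l; simp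
    | succ n ih => intro l; rw [show l + 2 * (m : ℤ) * (n + 1) = (l + 2 * m * n) + 2 * m by ring, xp, ih]
    | pred n ih => intro l; rw [← ih l, ← xp]; congr 1; ring
  have : x l = 0 := by
    rcases h2 with ⟨t, ht⟩ | ⟨t, ht⟩
    · rw [show l = r + 2 * m * t by linarith, xpt]; exact k2 r (by exact_mod_cast h1')
    · rw [show l = -r + 2 * m * t by linarith, xpt, xe]; exact k2 r (by exact_mod_cast h1')
  exact sub_eq_zero.1 this
lemma vv_sum (hm : 0 < m) (hG : Kill m Gf) (hτ : 0 < τ.im) (l : ℤ) :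
    HasSum (fun N : ℤ => AA m Gf l N * ee (N / (4 * m) * τ)) (vv m Gf τ l) := by
  obtain ⟨c, -, h2, -⟩ := aS_CR hm hG
  obtain ⟨r, hr, h1, -, hs⟩ := sh_rep hm l
  have := (vv_r hm hG hr (h2 r hr) hτ).1
  unfold vv; rw [AA_rep Gf h1 hs]; exact this.summable.hasSum
lemma vv_rep (hm : 0 < m) (hG : Kill m Gf) :
    RepSet m {v | ∃ (c τ : ℂ), 0 < τ.im ∧ v = fun l => c * vv m Gf τ l} where
  per := by rintro _ ⟨c, τ, hτ, rfl⟩ l; simp only [vv_per]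
  even := by rintro _ ⟨c, τ, hτ, rfl⟩ l; simp only [vv_neg]
  hT := by
    rintro _ ⟨c, τ, hτ, rfl⟩
    refine ⟨c, τ + 1, by simpa using hτ, ?_⟩
    funext l
    have hmc : (m : ℂ) ≠ 0 := by exact_mod_cast hm.ne'
    have h1 := vv_sum hm hG (τ := τ + 1) (by simpa using hτ) l
    have h2 := (vv_sum hm hG hτ l).mul_left (er (4 * m) (1 * l ^ 2))
    have : vv m Gf (τ + 1) l = er (4 * m) (1 * l ^ 2) * vv m Gf τ l := by
      refine h1.unique (h2.congr_fun fun N => ?_)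
      unfold AA
      split_ifs with h
      · rw [mul_left_comm]; congr 1
        obtain ⟨t, ht⟩ := h
        unfold er; rw [← ee_add]
        refine ee_congr t ?_
        rw [show N = l ^ 2 + 4 * m * t by linarith]; push_cast; field_simp; ring
      · simp
    rw [this]; unfold Tv; ring
  hS := by
    rintro _ ⟨c, τ, hτ, rfl⟩
    have hτ0 := ne_of_im hτ
    have ess : -1 / (-1 / τ) = τ := by field_simp
    refine ⟨c * (tfac m τ)⁻¹, -1 / τ, neg_inv_im hτ, ?_⟩
    funext l
    rw [vv_S hm hG (neg_inv_im hτ), ess, mul_assoc, inv_mul_cancel_left₀ (tfac_ne hm hτ)]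
    unfold Sv; rw [mul_sum]
    exact sum_congr rfl fun y _ => by ring
  unit := by
    rintro _ ⟨c, τ, hτ, rfl⟩ l hl
    obtain ⟨r, hr, h1, ⟨s, hs, t, ht⟩, h2⟩ := sh_rep hm l
    have hA : AA m Gf l = 0 := by
      funext N; unfold AA
      split_ifs with h
      · have h3 : sh m N r = (ww m r)⁻¹ • hat m N r := by rw [hat_sh N hr hm, inv_smul_smul₀ (ww_ne m r)]
        rw [h2, h3, map_smul, hG.unit, smul_zero]; · rfl
        · rw [show N - (r : ℤ) ^ 2 = (N - l ^ 2) + (l ^ 2 - r ^ 2) by ring]; exact dvd_add h h1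
        · have h4 : l = s * r + 2 * m * t := by linarith
          rw [h4] at hl
          have := (IsCoprime.add_mul_left_left_iff (x := s * r) (y := 2 * (m : ℤ)) (z := t)).1 hl
          exact this.of_mul_left_right
      · rfl
    simp [vv, hA]
  prim := by
    rintro _ ⟨c, τ, hτ, rfl⟩ p hp k hk l hl
    rw [← mul_sum]
    have h0 := hasSum_sum (s := range p) (fun j _ => vv_sum hm hG hτ (l + 2 * k * p * (j : ℕ)))
    have : ∑ j ∈ range p, vv m Gf τ (l + 2 * k * p * (j : ℕ)) = 0 := by
      refine h0.unique (hasSum_zero.congr_fun fun N => ?_)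
      rw [← sum_mul]
      refine mul_eq_zero_of_left ?_ _
      have hc : ∀ j : ℕ, (4 * m : ℤ) ∣ N - (l + 2 * k * p * j) ^ 2 ↔ (4 * m : ℤ) ∣ N - l ^ 2 := by
        intro j
        obtain ⟨t, rfl⟩ := hl
        rw [show N - (p * t + 2 * (k : ℤ) * p * j) ^ 2 = (N - (p * t) ^ 2) + 4 * m * (-(t * j + k * j ^ 2)) by rw [hk]; push_cast; ring]
        exact dvd_add_left (dvd_mul_right _ _)
      unfold AA
      simp only [hc]
      split_ifs with h
      · rw [← map_sum, sh_prim hp hm hk N hl, map_smul, hG.prim p hp ⟨k, by rw [hk]; ring⟩ _ (sh_mem hm h), smul_zero]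
      · simp
    rw [this, mul_zero]
lemma Kill.zero (hm : 0 < m) (hG : Kill m Gf) (hC : C ∈ PolyC m) : Gf C = 0 := by
  obtain ⟨c, -, h2, -⟩ := aS_CR hm hG
  have hv : ∀ τ : ℂ, 0 < τ.im → ∀ l, vv m Gf τ l = 0 := fun τ hτ l => by
    simpa using (vv_rep hm hG).zero hm _ ⟨1, τ, hτ, rfl⟩ l
  have ha : ∀ r ≤ m, ∀ j, aG m Gf r j = 0 := by
    intro r hr j
    have hp : PS (fun n => (aS m Gf r).coeff n) := h2 r hr
    have := ps_unique (b := fun _ => 0) hp (CR.zero_mem) fun τ hτ => by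
      have := (vv_r hm hG hr (h2 r hr) hτ).2
      rw [hv τ hτ, mul_zero] at this
      rw [(mul_eq_zero.1 this.symm).resolve_left (ee_ne _)]; simp [psv]
    simpa [aS] using congrFun this j
  obtain ⟨B, hB⟩ := hC.2.2.2
  have hd := hG.m0 _ (decomp hm hC (B := -B) (fun D l h => hB D l (by omega)))
  rw [map_sub, sub_eq_zero] at hd
  rw [hd, map_sum]
  refine sum_eq_zero fun x hx => ?_
  simp only [mem_product, mem_Icc] at hx
  obtain ⟨⟨n1, -⟩, r0, r1⟩ := hx
  obtain ⟨N, r⟩ := x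
  dsimp only at *
  lift r to ℕ using r0
  rw [map_smul, smul_eq_mul]
  by_cases h : (4 * m : ℤ) ∣ N - r ^ 2
  · refine mul_eq_zero_of_right _ ?_
    obtain ⟨t, ht⟩ := h
    have ht0 : 0 ≤ t + m := by
      by_contra h'; push Not at h'
      nlinarith
    have := ha r (by exact_mod_cast r1) (t + m).toNat
    unfold aG aN at this
    rw [toNat_of_nonneg ht0] at this
    convert this using 3; linarith
  · rw [hC.2.2.1 _ _ (fun h' => h (by obtain ⟨t, ht⟩ := h'; exact ⟨-t, by linarith⟩)), zero_mul]
lemma claimA (hm : 0 < m) : PolyC m ≤ M0 m ⊔ (span ℂ {x | ∃ N l : ℤ, (4 * m : ℤ) ∣ N - l ^ 2 ∧ IsCoprime l (2 * m : ℤ) ∧ x = hat m N l}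
    ⊔ ⨆ p : {p : ℕ // p.Prime ∧ p ^ 2 ∣ m}, (PolyC m).map (Ep m p)) := by
  intro C hC
  by_contra h
  obtain ⟨f, hf, hf2⟩ := Submodule.exists_le_ker_of_notMem h
  have hk : Kill m f := by
    refine ⟨fun x hx => ?_, fun N l h1 h2 => ?_, fun p hp hpm x hx => ?_⟩
    · exact LinearMap.mem_ker.1 (hf2 (mem_sup_left hx))
    · exact LinearMap.mem_ker.1 (hf2 (mem_sup_right (mem_sup_left (subset_span ⟨N, l, h1, h2, rfl⟩))))
    · exact LinearMap.mem_ker.1 (hf2 (mem_sup_right (mem_sup_right (Submodule.mem_iSup_of_mem (⟨p, hp, hpm⟩ : {p : ℕ // p.Prime ∧ p ^ 2 ∣ m}) ⟨x, hx, rfl⟩))))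
  exact hf (hk.zero hm hC)
def Zm (m : ℕ) (L : List ℕ) : Submodule ℂ (ℤ → ℤ → ℂ) where
  carrier := {C | ∃ j ∈ Jm m, ∀ D l : ℤ, D < -1 → piE m L (C - j) D l = 0}
  add_mem' := by
    rintro C C' ⟨j, hj, e⟩ ⟨j', hj', e'⟩
    exact ⟨j + j', add_mem hj hj', fun D l hD => by
      rw [show C + C' - (j + j') = (C - j) + (C' - j') by abel, map_add]; rw [Pi.add_apply, Pi.add_apply, e D l hD, e' D l hD, add_zero]⟩
  zero_mem' := ⟨0, zero_mem _, fun D l hD => by simp⟩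
  smul_mem' := by
    rintro a C ⟨j, hj, e⟩
    exact ⟨a • j, smul_mem _ _ hj, fun D l hD => by rw [← smul_sub, map_smul, Pi.smul_apply, Pi.smul_apply, e D l hD, smul_zero]⟩
lemma Zm_M0 (L : List ℕ) : M0 m ≤ Zm m L := by
  rintro C ⟨-, j, hj, e⟩
  exact ⟨j, hj, fun D l hD => piE_van (B := 0) (fun D l hD => by simp [e D l hD]) D l (by omega)⟩
lemma growth (hm : 0 < m) (hL : GoodL m L) (hL2 : ∀ p : ℕ, p.Prime → p ^ 2 ∣ m → p ∈ L) (hC : C ∈ PolyC m) :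
    ∃ j ∈ Jm m, ∀ D l : ℤ, D < -1 → piE m L (C - j) D l = 0 := by
  refine (claimA hm).trans (sup_le (Zm_M0 L) (sup_le (span_le.2 ?_) (iSup_le ?_))) hC
  · rintro x ⟨N, l, h1, h2, rfl⟩
    have h := hq_unit hm (LF_all m) (N + 1).toNat N l (by omega) h1 h2
    have h3 : unitSpan m ≤ (Zm m L).map (M0 m).mkQ := by
      refine span_le.2 ?_
      rintro x ⟨l, h1, h2, rfl⟩
      refine ⟨hat m 1 l, ⟨0, zero_mem _, fun D x hD => ?_⟩, rfl⟩
      rw [sub_zero]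
      exact piE_van (B := -1) (fun D x hD => by unfold hat; rw [if_neg]; rintro ⟨h, -⟩; omega) D x hD
    obtain ⟨y, hy, e⟩ := h3 h
    have h4 : hat m N l - y ∈ M0 m := (Submodule.Quotient.eq _).1 e.symm
    have := add_mem (Zm_M0 L h4) hy
    simpa using this
  · rintro ⟨p, hp, hpm⟩ x ⟨y, hy, rfl⟩
    refine ⟨0, zero_mem _, fun D l _ => ?_⟩
    rw [sub_zero, ← piE_comm hp hpm hL, Ep_piE hL hy (hL2 p hp hpm)]; rfl
def Bf (w : ℂ) : ℂ := ee w / (1 - ee w) ^ 2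
lemma ee_eq_one (h : ee w = 1) : ∃ n : ℤ, w = n := by
  unfold ee at h
  rw [exp_eq_one_iff] at h
  obtain ⟨n, hn⟩ := h
  refine ⟨n, ?_⟩
  have h0 : 2 * (Real.pi : ℂ) * I ≠ 0 := two_pi_I_ne_zero
  exact mul_left_cancel₀ h0 (by rw [hn]; ring)
lemma Bf_neg (w : ℂ) : Bf (-w) = Bf w := by
  unfold Bf
  rw [ee_neg]
  have h := ee_ne w
  rcases eq_or_ne (1 - ee w) 0 with h1 | h1
  · have : ee w = 1 := by linear_combination -h1
    rw [this]; simp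
  · have : 1 - (ee w)⁻¹ ≠ 0 := by
      intro h2; apply h1; field_simp at h2; linear_combination -h2
    rw [div_eq_div_iff (pow_ne_zero 2 this) (pow_ne_zero 2 h1)]
    field_simp; ring
lemma Bf_int (w : ℂ) (n : ℤ) : Bf (w + n) = Bf w := by unfold Bf; rw [ee_add_int]
lemma Bf_diff (h : ∀ n : ℤ, w ≠ n) : DifferentiableAt ℂ Bf w := by
  unfold Bf
  have h1 : 1 - ee w ≠ 0 := fun e => by
    obtain ⟨n, hn⟩ := ee_eq_one (w := w) (by linear_combination -e)
    exact h n hn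
  have := differentiable_ee w
  fun_prop (disch := exact pow_ne_zero 2 h1)
lemma Bf_series (h : 0 < w.im) : HasSum (fun n : ℕ => (n : ℂ) * ee w ^ n) (Bf w) := by
  unfold Bf
  exact hasSum_coe_mul_geometric_of_norm_lt_one (norm_q_lt h)
lemma inv_summable (w : ℂ) : Summable (fun n : ℤ => 1 / (w + n) ^ 2) := by
  have := EisensteinSeries.linear_right_summable w 1 (k := 2) le_rfl
  simpa [one_div] using this
lemma inv_cont (h : ∀ n : ℤ, w ≠ n) : ContinuousAt (fun w : ℂ => ∑' n : ℤ, 1 / (w + n) ^ 2) w := by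
  have ho := Complex.isOpen_compl_range_intCast.mem_nhds (x := w) (by rintro ⟨n, hn⟩; exact h n hn.symm)
  obtain ⟨δ, hδ, hb⟩ := Metric.mem_nhds_iff.1 ho
  have hd : ∀ n : ℤ, δ ≤ ‖w + n‖ := by
    intro n
    by_contra hc
    push Not at hc
    have : ((-n : ℤ) : ℂ) ∈ ball w δ := by
      rw [mem_ball, dist_eq_norm, ← norm_neg]
      push_cast; rwa [show -(-(n:ℂ) - w) = w + n by ring]
    exact hb this ⟨_, rfl⟩
  have key : ∀ n : ℤ, ∀ x ∈ ball w (δ / 2), ‖w + n‖ / 2 ≤ ‖x + n‖ := by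
    intro n x hx
    rw [mem_ball, dist_eq_norm] at hx
    have h1 := norm_sub_norm_le (w + n) (w - x)
    rw [show w + n - (w - x) = x + n by ring, norm_sub_rev w x] at h1
    have := hd n
    linarith
  have hc : ContinuousOn (fun w : ℂ => ∑' n : ℤ, 1 / (w + n) ^ 2) (ball w (δ / 2)) := by
    refine continuousOn_tsum (u := fun n : ℤ => 4 * ‖1 / (w + n) ^ 2‖) ?_ ((inv_summable w).norm.mul_left 4) ?_
    · intro n x hx
      have h1 := key n x hx
      have h2 := hd n
      have h3 : x + n ≠ 0 := norm_pos_iff.1 (by linarith)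
      have : ContinuousAt (fun w : ℂ => 1 / (w + n) ^ 2) x := by
        fun_prop (disch := exact pow_ne_zero 2 h3)
      exact this.continuousWithinAt
    · intro n x hx
      have h1 := key n x hx
      have h2 := hd n
      rw [norm_div, norm_div, norm_pow, norm_pow, norm_one, ← mul_div_assoc, mul_one,
        div_le_div_iff₀ (by have : 0 < ‖x + n‖ := by linarith
                            positivity) (by have : 0 < ‖w + n‖ := by linarith
                                            positivity)]
      have : (0:ℝ) ≤ ‖w + n‖ := norm_nonneg _
      nlinarith
  exact hc.continuousAt (ball_mem_nhds _ (by linarith))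
lemma lip (h : ∀ n : ℤ, w ≠ n) : HasSum (fun n : ℤ => 1 / (w + n) ^ 2) ((2 * Real.pi * I) ^ 2 * Bf w) := by
  have up : ∀ w : ℂ, 0 < w.im → ∑' n : ℤ, 1 / (w + n) ^ 2 = (2 * Real.pi * I) ^ 2 * Bf w := by
    intro w hw
    have h1 := EisensteinSeries.qExpansion_identity (k := 1) le_rfl ⟨w, hw⟩
    have h2 := (Bf_series hw).tsum_eq
    unfold ee at h2
    simp only [pow_one, Nat.factorial_one, cast_one, div_one] at h1
    rw [← h2]
    rw [show (2 * (Real.pi : ℂ) * I) ^ 2 = (-2 * (Real.pi : ℂ) * I) ^ (1 + 1) by ring]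
    exact h1
  suffices hs : ∑' n : ℤ, 1 / (w + n) ^ 2 = (2 * Real.pi * I) ^ 2 * Bf w by
    rw [← hs]; exact (inv_summable w).hasSum
  rcases lt_trichotomy w.im 0 with h1 | h1 | h1
  · have h2 := up (-w) (by simpa using h1)
    rw [Bf_neg] at h2
    rw [← h2, ← (Equiv.neg ℤ).tsum_eq]
    refine tsum_congr fun n => ?_
    simp only [Equiv.neg_apply]; push_cast
    rw [show (w + -(n:ℂ)) ^ 2 = (-w + n) ^ 2 by ring]
  · have c1 := inv_cont h
    have c2 : ContinuousAt (fun w => (2 * Real.pi * I) ^ 2 * Bf w) w := continuousAt_const.mul (Bf_diff h).continuousAt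
    have : (𝓝[{z : ℂ | 0 < z.im}] w).NeBot := by
      rw [← mem_closure_iff_nhdsWithin_neBot]
      have := Complex.closure_setOfPred_lt_im 0
      rw [this]; exact h1.ge
    refine tendsto_nhds_unique (c1.tendsto.mono_left (nhdsWithin_le_nhds (s := {z : ℂ | 0 < z.im})))
      ((c2.tendsto.mono_left nhdsWithin_le_nhds).congr' ?_)
    filter_upwards [self_mem_nhdsWithin] with x hx
    exact (up x hx).symm
  · exact up w h1
lemma Bf_dist (hp : 0 < p) (h : ∀ n : ℤ, w ≠ n) :
    ∑ j ∈ range p, Bf ((w + j) / p) = p ^ 2 * Bf w := by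
  have hp0 : (p : ℂ) ≠ 0 := by exact_mod_cast hp.ne'
  have : NeZero p := ⟨hp.ne'⟩
  have h1 := lip h
  rw [← (divModEquiv p).symm.hasSum_iff] at h1
  have h2 : ∀ j : Fin p, HasSum (fun k : ℤ => 1 / (w + ((p * k + j : ℤ) : ℂ)) ^ 2)
      (1 / p ^ 2 * ((2 * Real.pi * I) ^ 2 * Bf ((w + (j : ℕ)) / p))) := by
    intro j
    have := (lip (w := (w + (j : ℕ)) / p) ?_).mul_left (1 / (p : ℂ) ^ 2)
    · refine this.congr_fun fun k => ?_
      rw [div_mul_div_comm, one_mul, ← mul_pow, mul_add, mul_div_cancel₀ _ hp0]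
      push_cast; congr 2; ring
    · intro n hn
      rw [div_eq_iff hp0] at hn
      exact h (n * p - j) (by push_cast; linear_combination hn)
  have h3 : HasSum (fun x : ℤ × Fin p => 1 / (w + ((p * x.1 + (x.2 : ℕ) : ℤ) : ℂ)) ^ 2) ((2 * Real.pi * I) ^ 2 * Bf w) := by
    refine h1.congr_fun fun x => ?_
    simp [divModEquiv]
    ring_nf
  have h4 := (Equiv.prodComm _ _).hasSum_iff.2 h3
  have h5 := h4.prod_fiberwise h2
  have h6 := h5.unique (hasSum_fintype _)
  rw [← sum_range (fun j => 1 / (p : ℂ) ^ 2 * ((2 * Real.pi * I) ^ 2 * Bf ((w + (j : ℕ)) / p))),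
    ← mul_sum, ← mul_sum] at h6
  have h0 : (2 * (Real.pi : ℂ) * I) ^ 2 ≠ 0 := pow_ne_zero 2 two_pi_I_ne_zero
  apply mul_left_cancel₀ h0
  field_simp at h6 ⊢
  linear_combination -h6
lemma Bf_bound (h : 1 ≤ |w.im|) : (∀ n : ℤ, w ≠ n) ∧ ‖Bf w‖ ≤ 100 * Real.exp (-(2 * Real.pi * |w.im|)) ∧
    ‖deriv Bf w‖ ≤ 100 * Real.exp (-(2 * Real.pi * |w.im|)) := by
  have hn : ∀ w : ℂ, 1 ≤ |w.im| → ∀ n : ℤ, w ≠ n := by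
    rintro w h n rfl; simp at h; linarith
  have hp : ∀ w : ℂ, 1 ≤ w.im → ‖Bf w‖ ≤ 100 * Real.exp (-(2 * Real.pi * w.im)) ∧
    ‖deriv Bf w‖ ≤ 100 * Real.exp (-(2 * Real.pi * w.im)) := by
    intro w hw
    have hq : ‖ee w‖ ≤ 1 / 7 := by
      rw [norm_ee]
      have h1 := Real.pi_gt_three
      have h2 : (7:ℝ) ≤ Real.exp (2 * Real.pi * w.im) := by
        have := add_one_le_exp (2 * Real.pi * w.im); nlinarith
      rw [Real.exp_neg, inv_eq_one_div]
      exact one_div_le_one_div_of_le (by norm_num) h2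
    have h1 : 6 / 7 ≤ ‖1 - ee w‖ := by
      have := norm_sub_norm_le (1:ℂ) (ee w); rw [norm_one] at this; linarith
    have h0 : 1 - ee w ≠ 0 := norm_pos_iff.1 (by linarith)
    have e0 := norm_nonneg (ee w)
    rw [← norm_ee]
    constructor
    · unfold Bf
      rw [norm_div, norm_pow, div_le_iff₀ (by positivity)]
      nlinarith [mul_le_mul h1 h1 (by norm_num) (norm_nonneg _)]
    · have hd : HasDerivAt Bf (2 * Real.pi * I * (ee w * (1 + ee w)) / (1 - ee w) ^ 3) w := by
        have h3 := hasDerivAt_ee w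
        have := h3.div ((h3.const_sub 1).pow 2) (pow_ne_zero 2 h0)
        refine this.congr_deriv ?_
        simp only [Pi.pow_apply]
        field_simp
        push_cast; ring
      rw [hd.deriv, norm_div, norm_pow, div_le_iff₀ (by positivity)]
      simp only [norm_mul, Complex.norm_I, Complex.norm_real, norm_eq_abs, abs_of_pos pi_pos, Complex.norm_ofNat, mul_one]
      have h4 : ‖1 + ee w‖ ≤ 8 / 7 := by
        have := norm_add_le (1:ℂ) (ee w); rw [norm_one] at this; linarith
      have h5 : (6 / 7 : ℝ) ^ 3 ≤ ‖1 - ee w‖ ^ 3 := pow_le_pow_left₀ (by norm_num) h1 3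
      have h6 := Real.pi_lt_four
      have h7 : 2 * Real.pi * ‖1 + ee w‖ ≤ 100 * ‖1 - ee w‖ ^ 3 := by
        have : 2 * Real.pi * ‖1 + ee w‖ ≤ 2 * 4 * (8 / 7) := by
          have := norm_nonneg (1 + ee w)
          have := pi_pos
          gcongr
        norm_num at h5 this ⊢; linarith
      nlinarith
  refine ⟨hn w h, ?_⟩
  rcases le_total 0 w.im with h1 | h1
  · rw [abs_of_nonneg h1] at h ⊢; exact hp w h
  · rw [abs_of_nonpos h1] at h ⊢
    have := hp (-w) (by simpa using h)
    rw [Bf_neg, Complex.neg_im] at this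
    refine ⟨this.1, ?_⟩
    have h2 := this.2
    have h3 : deriv Bf w = - deriv Bf (-w) := by
      have h4 := deriv_comp_neg Bf w
      rw [show (fun x => Bf (-x)) = Bf from funext Bf_neg] at h4
      exact h4
    rwa [h3, norm_neg]
lemma exp_summable {a : ℝ} (ha : 0 < a) : Summable (fun s : ℤ => (1 + |(s:ℝ)|) * Real.exp (-(a * |(s:ℝ)|))) := by
  have h1 : Summable (fun n : ℕ => (1 + (n:ℝ)) * Real.exp (-(a * n))) := by
    have hr : ‖Real.exp (-a)‖ < 1 := by rw [norm_eq_abs, abs_of_pos (exp_pos _)]; simpa using ha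
    have h2 := (summable_pow_mul_geometric_of_norm_lt_one 0 hr).add (summable_pow_mul_geometric_of_norm_lt_one 1 hr)
    refine h2.congr fun n => ?_
    rw [show -(a * n) = n * -a by ring, Real.exp_nat_mul]; ring
  refine Summable.of_nat_of_neg ?_ ?_ <;> simpa using h1
lemma im_lower {τ₀ z₀ : ℂ} (hτ : 0 < τ₀.im) {w : ℂ × ℂ} (hw : dist w (τ₀, z₀) < τ₀.im / 2) (s : ℤ) :
    |(s:ℝ)| * (τ₀.im / 2) - (|z₀.im| + τ₀.im / 2) ≤ |(w.2 + s * w.1).im| := by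
  have h1 : dist w.1 τ₀ < τ₀.im / 2 := lt_of_le_of_lt (le_max_left _ _) hw
  have h1' : dist w.2 z₀ < τ₀.im / 2 := lt_of_le_of_lt (le_max_right _ _) hw
  have h2 : |w.1.im - τ₀.im| ≤ τ₀.im / 2 := by
    rw [dist_eq_norm] at h1; exact (abs_im_le_norm (w.1 - τ₀)).trans h1.le
  have h2' : |w.2.im - z₀.im| ≤ τ₀.im / 2 := by
    rw [dist_eq_norm] at h1'; exact (abs_im_le_norm (w.2 - z₀)).trans h1'.le
  have e : (w.2 + s * w.1).im = s * w.1.im - (-w.2.im) := by simp; ring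
  rw [e]
  have h3 := abs_sub_abs_le_abs_sub (s * w.1.im) (-w.2.im)
  rw [abs_mul, abs_neg] at h3
  have h4 : τ₀.im / 2 ≤ |w.1.im| := by
    have := (abs_le.1 h2).1; have := le_abs_self w.1.im; linarith
  have h5 : |w.2.im| ≤ |z₀.im| + τ₀.im / 2 := by
    have := abs_sub_abs_le_abs_sub w.2.im z₀.im; linarith
  have := mul_le_mul_of_nonneg_left h4 (abs_nonneg (s:ℝ))
  linarith
lemma fin_exc {t y : ℝ} (ht : 0 < t) : ∃ S : Finset ℤ, ∀ s ∉ S, 1 ≤ |(s:ℝ)| * t - y := by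
  obtain ⟨N, hN⟩ := exists_nat_gt ((1 + y) / t)
  refine ⟨Icc (-N) N, fun s hs => ?_⟩
  have : (N:ℤ) ≤ |s| := by
    simp only [mem_Icc, not_and_or, not_le] at hs
    rcases hs with h | h
    · have := neg_le_abs s; omega
    · have := le_abs_self s; omega
  have h2 : (N:ℝ) ≤ |(s:ℝ)| := by exact_mod_cast this
  rw [div_lt_iff₀ ht] at hN
  nlinarith
def Pp (τ z : ℂ) : ℂ := ∑' s : ℤ, Bf (z + s * τ)
lemma Pp_summable (hτ : 0 < τ.im) (z : ℂ) : Summable (fun s : ℤ => Bf (z + s * τ)) := by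
  obtain ⟨S, hS⟩ := fin_exc (t := τ.im / 2) (y := |z.im| + τ.im / 2) (by linarith)
  have hpi := pi_pos
  refine Summable.of_norm_bounded_eventually (g := fun s : ℤ => (100 * Real.exp (2 * Real.pi * (|z.im| + τ.im / 2))) *
    ((1 + |(s:ℝ)|) * Real.exp (-(Real.pi * τ.im * |(s:ℝ)|)))) ((exp_summable (by positivity)).mul_left _) ?_
  filter_upwards [S.finite_toSet.compl_mem_cofinite] with s hs
  have h1 := im_lower (z₀ := z) hτ (w := (τ, z)) (by simp; linarith) s
  have h2 := (Bf_bound ((hS s (by simpa using hs)).trans h1)).2.1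
  simp only at h1 h2
  refine h2.trans ?_
  rw [show ∀ b d : ℝ, 100 * b * ((1 + |(s:ℝ)|) * d) = (1 + |(s:ℝ)|) * (100 * (b * d)) by intros; ring, ← Real.exp_add]
  refine le_trans ?_ (le_mul_of_one_le_left (by positivity) (by linarith [abs_nonneg (s:ℝ)]))
  gcongr
  nlinarith
lemma Pp_diff (hτ : 0 < τ.im) (hz : ∀ a b : ℤ, z ≠ a * τ + b) :
    DifferentiableAt ℂ (fun w : ℂ × ℂ => Pp w.1 w.2) (τ, z) := by
  obtain ⟨S, hS⟩ := fin_exc (t := τ.im / 2) (y := |z.im| + τ.im / 2) (by linarith)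
  have hpi := pi_pos
  have hU : ∀ w ∈ ball (τ, z) (τ.im / 2), 0 < w.1.im := by
    intro w hw
    have h1 : dist w.1 τ < τ.im / 2 := lt_of_le_of_lt (le_max_left _ _) hw
    rw [dist_eq_norm] at h1
    have := (abs_le.1 ((abs_im_le_norm (w.1 - τ)).trans h1.le)).1
    rw [sub_im] at this; linarith
  let f' : (↑S : Set ℤ)ᶜ.Elem → ℂ × ℂ → (ℂ × ℂ →L[ℂ] ℂ) := fun s w =>
    deriv Bf (w.2 + (s : ℤ) * w.1) • (ContinuousLinearMap.snd ℂ ℂ ℂ + ((s : ℤ) : ℂ) • ContinuousLinearMap.fst ℂ ℂ ℂ)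
  have key := hasFDerivAt_tsum_of_isPreconnected (𝕜 := ℂ) (E := ℂ × ℂ) (F := ℂ)
    (f := fun (s : (↑S : Set ℤ)ᶜ.Elem) (w : ℂ × ℂ) => Bf (w.2 + (s : ℤ) * w.1)) (f' := f')
    (u := fun s : (↑S : Set ℤ)ᶜ.Elem => (100 * Real.exp (2 * Real.pi * (|z.im| + τ.im / 2))) *
    ((1 + |((s : ℤ):ℝ)|) * Real.exp (-(Real.pi * τ.im * |((s : ℤ):ℝ)|)))) (s := ball (τ, z) (τ.im / 2)) (x₀ := (τ, z))
    (x := (τ, z)) (((exp_summable (by positivity)).mul_left _).subtype _) isOpen_ball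
    ((convex_ball (τ, z) _).isPreconnected) ?_ ?_ (mem_ball_self (by linarith))
    ((Pp_summable hτ z).subtype _) (mem_ball_self (by linarith))
  · have h2 : DifferentiableAt ℂ (fun w : ℂ × ℂ => ∑ s ∈ S, Bf (w.2 + s * w.1)) (τ, z) := by
      refine DifferentiableAt.fun_sum fun s _ => ?_
      refine DifferentiableAt.comp (τ, z) (g := Bf) (f := fun w : ℂ × ℂ => w.2 + s * w.1) (Bf_diff fun n hn => ?_) (by fun_prop)
      exact hz (-s) n (by push_cast; linear_combination hn)
    refine (h2.add key.differentiableAt).congr_of_eventuallyEq ?_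
    filter_upwards [ball_mem_nhds (τ, z) (show 0 < τ.im / 2 by linarith)] with w hw
    exact ((Pp_summable (hU w hw) w.2).sum_add_tsum_compl).symm
  · intro s w hw
    have h1 := im_lower hτ hw s
    have h2 := (Bf_bound ((hS s s.2).trans h1)).1
    have h3 : HasFDerivAt (fun w : ℂ × ℂ => w.2 + (s : ℤ) * w.1) (ContinuousLinearMap.snd ℂ ℂ ℂ + ((s : ℤ) : ℂ) • ContinuousLinearMap.fst ℂ ℂ ℂ) w :=
      hasFDerivAt_snd.add (hasFDerivAt_fst.const_mul _)
    exact (Bf_diff h2).hasDerivAt.comp_hasFDerivAt w h3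
  · intro s w hw
    have h1 := im_lower hτ hw s
    have h2 := (Bf_bound ((hS s s.2).trans h1)).2.2
    have h3 : ‖ContinuousLinearMap.snd ℂ ℂ ℂ + ((s : ℤ) : ℂ) • ContinuousLinearMap.fst ℂ ℂ ℂ‖ ≤ 1 + |((s : ℤ):ℝ)| := by
      refine (norm_add_le _ _).trans (add_le_add (ContinuousLinearMap.norm_snd_le _ _ _) ?_)
      rw [norm_smul, norm_intCast]
      exact mul_le_of_le_one_right (abs_nonneg _) (ContinuousLinearMap.norm_fst_le _ _ _)
    simp only [f']
    rw [norm_smul]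
    refine (mul_le_mul h2 h3 (norm_nonneg _) (by positivity)).trans ?_
    rw [show ∀ b d : ℝ, 100 * b * ((1 + |((s : ℤ):ℝ)|) * d) = (100 * (b * d)) * (1 + |((s : ℤ):ℝ)|) by intros; ring, ← Real.exp_add]
    gcongr
    nlinarith
def pushc {ι : Type} (f : ι → ℂ) (g : ι → ℤ × ℤ) : ℤ × ℤ → ℂ := fun p => ∑' x, if g x = p then f x else 0
lemma push_hasSum {ι : Type} {f : ι → ℂ} {g : ι → ℤ × ℤ} {a : ℂ} (h : HasSum (fun x => f x * mon (g x) τ z) a) :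
    HasSum (fun p => pushc f g p * mon p τ z) a := by
  refine (h.tsum_fiberwise g).congr_fun fun p => ?_
  rw [tsum_subtype (g ⁻¹' {p}) (fun x => f x * mon (g x) τ z), pushc, ← tsum_mul_right]
  refine tsum_congr fun x => ?_
  rw [Set.indicator_apply]
  simp only [Set.mem_preimage, Set.mem_singleton_iff]
  split_ifs with hx
  · rw [hx]
  · simp
def lat (τ : ℂ) (hτ : 0 < τ.im) : PeriodPair where
  ω₁ := τ
  ω₂ := 1
  indep := by
    rw [LinearIndependent.pair_iff]
    intro s t h
    have h1 := congrArg im h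
    simp at h1
    have h2 : s = 0 := h1.resolve_right hτ.ne'
    subst h2
    have h3 := congrArg re h
    simp at h3
    exact ⟨rfl, h3⟩
def wpt (τ z : ℂ) (x : ℤ × ℤ) : ℂ := 1 / (z + (x.1 * τ + x.2)) ^ 2 - 1 / (x.1 * τ + x.2) ^ 2
def wp (τ z : ℂ) : ℂ := ∑' x : ℤ × ℤ, wpt τ z x
lemma wp_hasSum' (hτ : 0 < τ.im) (z : ℂ) : HasSum (wpt τ z) ((lat τ hτ).weierstrassP z) := by
  have h := (lat τ hτ).hasSum_weierstrassP z
  rw [← (lat τ hτ).latticeEquivProd.symm.toEquiv.hasSum_iff, ← (Equiv.neg (ℤ × ℤ)).hasSum_iff] at h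
  refine h.congr_fun fun x => ?_
  simp only [comp, LinearEquiv.coe_toEquiv, Equiv.neg_apply]
  rw [PeriodPair.latticeEquiv_symm_apply]
  simp only [lat, Prod.fst_neg, Prod.snd_neg, wpt]
  push_cast
  congr 2 <;> ring
lemma wp_hasSum (hτ : 0 < τ.im) (z : ℂ) : HasSum (wpt τ z) (wp τ z) := (wp_hasSum' hτ z).summable.hasSum
lemma wp_pole (hτ : 0 < τ.im) : ∃ g : ℂ → ℂ, AnalyticAt ℂ g 0 ∧ ∀ z, wp τ z = 1 / z ^ 2 + g z := by
  refine ⟨(lat τ hτ).weierstrassPExcept 0, ?_, fun z => ?_⟩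
  · rw [Complex.analyticAt_iff_eventually_differentiableAt]
    have h0 := (lat τ hτ).compl_lattice_sdiff_singleton_mem_nhds 0
    filter_upwards [eventually_eventually_nhds.2 h0] with z hz
    exact ((lat τ hτ).differentiableOn_weierstrassPExcept 0).differentiableAt hz
  · rw [(wp_hasSum hτ z).unique (wp_hasSum' hτ z), ← (lat τ hτ).weierstrassPExcept_add 0]
    simp; ring
lemma wp_S (hτ : 0 < τ.im) (z : ℂ) : wp (-1 / τ) (z / τ) = τ ^ 2 * wp τ z := by
  have h0 := ne_of_im hτ
  unfold wp
  rw [← tsum_mul_left, ← ((Equiv.prodComm ℤ ℤ).trans ((Equiv.neg ℤ).prodCongr (Equiv.refl ℤ))).tsum_eq]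
  refine tsum_congr fun x => ?_
  simp only [wpt, Equiv.trans_apply, Equiv.prodComm_apply, Equiv.prodCongr_apply, Prod.map, Prod.fst_swap, Prod.snd_swap, Equiv.neg_apply, Equiv.refl_apply]
  push_cast
  rw [show z / τ + (-(x.2:ℂ) * (-1 / τ) + x.1) = (z + (x.1 * τ + x.2)) / τ by field_simp; ring,
    show (-(x.2:ℂ) * (-1 / τ) + x.1) = (x.1 * τ + x.2) / τ by field_simp; ring, div_pow, div_pow, one_div_div, one_div_div]
  ring
def e0 : ℂ := -(1 / (2 * Real.pi * I) ^ 2 * ∑' n : ℤ, 1 / ((0:ℂ) + n) ^ 2)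
def eta2 (τ : ℂ) : ℂ := e0 - ∑' s : ℤ, if s = 0 then 0 else Bf (s * τ)
lemma sT_ne (hτ : 0 < τ.im) {s : ℤ} (hs : s ≠ 0) (n : ℤ) : (s : ℂ) * τ ≠ n := by
  intro h
  have := congrArg im h
  simp at this
  rcases this with h | h
  · exact hs h
  · exact hτ.ne' h
lemma eta_summable (hτ : 0 < τ.im) : Summable (fun s : ℤ => if s = 0 then 0 else Bf (s * τ)) := by
  have h := Pp_summable hτ 0
  refine h.congr_cofinite ?_
  filter_upwards [(Set.finite_singleton (0:ℤ)).compl_mem_cofinite] with s hs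
  rw [if_neg (by simpa using hs), zero_add]
lemma wp_eq (hτ : 0 < τ.im) (hz : ∀ a b : ℤ, z ≠ a * τ + b) :
    wp τ z = (2 * Real.pi * I) ^ 2 * (Pp τ z + eta2 τ) := by
  have hpi : (2 * (Real.pi : ℂ) * I) ^ 2 ≠ 0 := pow_ne_zero 2 two_pi_I_ne_zero
  have h1 := (wp_hasSum hτ z).prod_fiberwise (g := fun s : ℤ => (2 * Real.pi * I) ^ 2 * (Bf (z + s * τ) - (if s = 0 then 0 else Bf (s * τ))
    + if s = 0 then e0 else 0)) ?_
  · have h2 := ((((Pp_summable hτ z).hasSum).sub (eta_summable hτ).hasSum).add (hasSum_ite_eq (0:ℤ) e0)).mul_left ((2 * (Real.pi:ℂ) * I) ^ 2)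
    rw [h1.unique h2]
    unfold Pp eta2; ring
  · intro s
    have h3 := lip (w := z + s * τ) (fun n hn => hz (-s) n (by push_cast; linear_combination hn))
    split_ifs with hs
    · have h4 := (inv_summable 0).hasSum
      rw [show (2 * (Real.pi:ℂ) * I) ^ 2 * (Bf (z + s * τ) - 0 + e0) = (2 * Real.pi * I) ^ 2 * Bf (z + s * τ) - ∑' n : ℤ, 1 / ((0:ℂ) + n) ^ 2 by
        unfold e0; field_simp; ring]
      refine (h3.sub h4).congr_fun fun n => ?_
      simp only [wpt]; subst hs; simp
    · have h4 := lip (w := s * τ) (sT_ne hτ hs)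
      rw [add_zero, mul_sub]
      refine (h3.sub h4).congr_fun fun n => ?_
      simp only [wpt]; congr 3; ring
lemma eta_ex : ∃ c, SymC 0 c ∧ ∀ τ : ℂ, 0 < τ.im → ∀ z, fser c τ z = eta2 τ := by
  let f : ℕ+ × ℕ+ → ℂ := fun x => (x.2 : ℂ)
  let g : ℕ+ × ℕ+ → ℤ × ℤ := fun x => ((x.1 : ℤ) * (x.2 : ℤ), 0)
  have key : ∀ τ : ℂ, 0 < τ.im → ∀ z, HasSum (fun x => f x * mon (g x) τ z) (∑' s : ℕ+, Bf ((s : ℕ) * τ)) := by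
    intro τ hτ z
    have hs : Summable (fun x : ℕ+ × ℕ+ => f x * mon (g x) τ z) := by
      have := summable_prod_mul_pow (𝕜 := ℂ) 1 (norm_q_lt hτ)
      refine this.congr fun x => ?_
      simp only [f, g, mon]
      rw [ee_pow]; push_cast; simp
    have h2 := hs.hasSum.prod_fiberwise (g := fun s : ℕ+ => Bf ((s : ℕ) * τ)) ?_
    · rw [h2.tsum_eq]; exact hs.hasSum
    · intro s
      have h3 := Bf_series (w := (s : ℕ) * τ) (by simp; exact hτ)
      rw [← Injective.hasSum_iff PNat.coe_injective] at h3
      · refine h3.congr_fun fun n => ?_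
        simp only [f, g, mon, comp]
        rw [ee_pow]; push_cast; congr 2; ring
      · intro n hn
        rcases Nat.eq_zero_or_pos n with rfl | h
        · simp
        · exact absurd ⟨⟨n, h⟩, rfl⟩ hn
  let c1 : ℤ × ℤ → ℂ := fun p => if p = 0 then e0 else 0
  have h1 : ∀ τ z, HasSum (fun p => c1 p * mon p τ z) e0 := by
    intro τ z
    refine (hasSum_ite_eq (0 : ℤ × ℤ) e0).congr_fun fun p => ?_
    simp only [c1]; split_ifs with h
    · rw [h]; simp [mon, ee_zero]
    · simp
  have h2 : ∀ τ : ℂ, 0 < τ.im → ∀ z, HasSum (fun p => (c1 + (-2 : ℂ) • pushc f g) p * mon p τ z) (eta2 τ) := by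
    intro τ hτ z
    have h3 := (h1 τ z).add ((push_hasSum (key τ hτ z)).mul_left (-2))
    have h4 : eta2 τ = e0 + -2 * ∑' s : ℕ+, Bf ((s : ℕ) * τ) := by
      unfold eta2
      rw [tsum_int_eq_zero_add_two_mul_tsum_pnat (fun n => ?_) (eta_summable hτ)]
      · simp; ring
      · simp only [neg_eq_zero]
        split_ifs
        · rfl
        · push_cast; rw [neg_mul, Bf_neg]
    rw [h4]
    refine h3.congr_fun fun p => ?_
    simp; ring
  have h0 : ∀ n r : ℤ, (n < 0 ∨ r ≠ 0) → (c1 + (-2 : ℂ) • pushc f g) (n, r) = 0 := by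
    intro n r h
    have e1 : c1 (n, r) = 0 := if_neg (by rintro ⟨⟩; simp at h)
    have e2 : pushc f g (n, r) = 0 := by
      unfold pushc
      refine (tsum_congr fun x => if_neg ?_).trans tsum_zero
      rintro ⟨⟩
      rcases h with h | h
      · have : (0:ℤ) ≤ (x.1 : ℤ) * (x.2 : ℤ) := by positivity
        omega
      · exact h rfl
    simp [e1, e2]
  refine ⟨_, ⟨fun τ hτ z => (h2 τ hτ z).summable, fun n r => ?_, fun n r => ?_, 0, fun n r h => h0 n r (.inl h)⟩, fun τ hτ z => (h2 τ hτ z).tsum_eq⟩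
  · rcases eq_or_ne r 0 with rfl | h
    · simp
    · rw [h0 _ _ (.inr (by simpa using h)), h0 _ _ (.inr h)]
  · rcases eq_or_ne r 0 with rfl | h
    · simp
    · rw [h0 _ _ (.inr (by simpa using h)), h0 _ _ (.inr h)]
def kk (r j : ℤ) : ℕ := (|r| - |j|).toNat
lemma ker {y : ℂ} (h0 : y ≠ 0) (h1 : 1 - y ≠ 0) (N : ℕ) :
    HasSum (fun j : ℤ => (kk N j : ℂ) * y ^ j) (y / (1 - y) ^ 2 * (y ^ N + (y ^ N)⁻¹ - 2)) := by
  suffices H : ∀ N : ℕ, HasSum (fun j : ℤ => (kk N j : ℂ) * y ^ j) (y / (1 - y) ^ 2 * (y ^ N + (y ^ N)⁻¹ - 2)) ∧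
      HasSum (fun j : ℤ => (kk (N + 1 : ℕ) j : ℂ) * y ^ j) (y / (1 - y) ^ 2 * (y ^ (N + 1) + (y ^ (N + 1))⁻¹ - 2)) from (H N).1
  intro N
  induction N with
  | zero =>
    constructor
    · convert hasSum_zero (α := ℂ) using 1
      · funext j; have : kk 0 j = 0 := by unfold kk; have := abs_nonneg j; simp
        simp [this]
      · simp; right; norm_num
    · rw [show y / (1 - y) ^ 2 * (y ^ (0 + 1) + (y ^ (0 + 1))⁻¹ - 2) = 1 by field_simp; ring]
      refine (hasSum_ite_eq (0 : ℤ) (1:ℂ)).congr_fun fun j => ?_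
      split_ifs with h
      · subst h; simp [kk]
      · have : kk (0 + 1 : ℕ) j = 0 := by
          unfold kk; have := abs_pos.2 h; simp; omega
        rw [this]; simp
  | succ N ih =>
    refine ⟨ih.2, ?_⟩
    have h := ((ih.2.mul_left 2).sub ih.1).add ((hasSum_ite_eq (N + 1 : ℤ) (y ^ (N + 1 : ℤ))).add (hasSum_ite_eq (-(N + 1) : ℤ) (y ^ (-(N + 1 : ℤ)))))
    rw [show y / (1 - y) ^ 2 * (y ^ (N + 1 + 1) + (y ^ (N + 1 + 1))⁻¹ - 2) = 2 * (y / (1 - y) ^ 2 * (y ^ (N + 1) + (y ^ (N + 1))⁻¹ - 2)) -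
      y / (1 - y) ^ 2 * (y ^ N + (y ^ N)⁻¹ - 2) + (y ^ (N + 1 : ℤ) + y ^ (-(N + 1 : ℤ))) by
        rw [zpow_neg, show ((N:ℤ) + 1) = ((N + 1 : ℕ) : ℤ) by push_cast; rfl, zpow_natCast]; field_simp; ring]
    refine h.congr_fun fun j => ?_
    have e : (kk (N + 1 + 1 : ℕ) j : ℤ) = 2 * kk (N + 1 : ℕ) j - kk N j + (if j = N + 1 then 1 else 0) + (if j = -(N + 1) then 1 else 0) := by
      unfold kk
      rw [abs_cast, abs_cast, abs_cast]
      rcases abs_cases j with ⟨h, _⟩ | ⟨h, _⟩ <;> rw [h] <;> split_ifs <;> omega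
    have e' : (kk (N + 1 + 1 : ℕ) j : ℂ) = 2 * kk (N + 1 : ℕ) j - kk N j + (if j = N + 1 then 1 else 0) + (if j = -(N + 1) then 1 else 0) := by
      exact_mod_cast congrArg (fun t : ℤ => (t : ℂ)) e
    rw [e']
    rw [add_mul, add_mul, ite_mul, ite_mul, zero_mul, one_mul,
      show (if j = (N:ℤ) + 1 then y ^ j else 0) = if j = (N:ℤ) + 1 then y ^ ((N:ℤ) + 1) else 0 by split_ifs with a <;> simp [a],
      show (if j = -((N:ℤ) + 1) then y ^ j else 0) = if j = -((N:ℤ) + 1) then y ^ (-((N:ℤ) + 1)) else 0 by split_ifs with a <;> simp [a]]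
    ring
def sgE (m s : ℤ) : ℤ × ℤ ≃ ℤ × ℤ where
  toFun p := (p.1 + s * p.2 + m * s ^ 2, p.2 + 2 * m * s)
  invFun p := (p.1 - s * p.2 + m * s ^ 2, p.2 - 2 * m * s)
  left_inv p := by ext <;> simp <;> ring
  right_inv p := by ext <;> simp <;> ring
abbrev I4 := ℤ × ((ℤ × ℤ) × ℤ)
lemma sum4 {E h : ℤ → ℝ} {u : ℤ × ℤ → ℝ} (hE : Summable E) (hh : Summable h) (hu : Summable u) (E0 : 0 ≤ E) (h0 : 0 ≤ h) (u0 : 0 ≤ u)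
    (σ : ℤ → (ℤ × ℤ ≃ ℤ × ℤ)) (θ : ℤ × ℤ → (ℤ ≃ ℤ)) : Summable (fun x : I4 => E x.1 * (u (σ x.1 x.2.1) * h (θ x.2.1 x.2.2))) := by
  have h1 := hE.mul_of_nonneg (hu.mul_of_nonneg hh u0 h0) E0 (fun x => mul_nonneg (u0 _) (h0 _))
  exact h1.comp_injective (i := Equiv.prodShear (Equiv.refl ℤ) (fun s => Equiv.prodShear (σ s) θ)) (Equiv.injective _)
def fk (c : ℤ × ℤ → ℂ) (x : I4) : ℂ := 1 / 2 * c x.2.1 * kk x.2.1.2 x.2.2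
def gk (m : ℤ) (x : I4) : ℤ × ℤ := sgE m x.1 (x.2.1.1, x.2.2)
lemma mon_sg (m s n j : ℤ) (τ z : ℂ) : mon (sgE m s (n, j)) τ z = ee (m * (s ^ 2 * τ + 2 * s * z)) * mon (n, j) τ (z + s * τ) := by
  unfold mon sgE; rw [← ee_add]; congr 1; simp; ring
lemma fk_gen (hc : SymC m c) (hτ : 0 < τ.im) (h1 : k * τ.im < z.im) (h2 : z.im < (k + 1) * τ.im) :
    Summable (fun x : I4 => fk c x * mon (gk m x) τ z) := by
  have hpi := pi_pos
  let a : ℤ → ℝ := fun s => 2 * Real.pi * (z.im + s * τ.im)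
  obtain ⟨δ, hδ, ha⟩ : ∃ δ : ℝ, 0 < δ ∧ ∀ s, δ ≤ |a s| := by
    refine ⟨2 * Real.pi * min (z.im - k * τ.im) ((k + 1) * τ.im - z.im), by have := lt_min (sub_pos.2 h1) (sub_pos.2 h2); positivity, fun s => ?_⟩
    simp only [a]
    rw [abs_mul, abs_of_pos (by positivity : 0 < 2 * Real.pi)]
    gcongr
    rcases le_or_gt (-k) s with h | h
    · have : (-k : ℝ) ≤ s := by exact_mod_cast h
      exact (min_le_left _ _).trans ((by nlinarith : z.im - k * τ.im ≤ z.im + s * τ.im).trans (le_abs_self _))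
    · have : (s:ℝ) ≤ -k - 1 := by exact_mod_cast (by omega : s ≤ -k - 1)
      exact (min_le_right _ _).trans ((by nlinarith : (k + 1) * τ.im - z.im ≤ -(z.im + s * τ.im)).trans (neg_le_abs _))
  let E : ℤ → ℝ := fun s => Real.exp (-|a s|)
  let h : ℤ → ℝ := fun i => Real.exp δ * ((1 + |(i:ℝ)|) * Real.exp (-(δ * |(i:ℝ)|)))
  let u : ℤ × ℤ → ℝ := fun p => ‖c p * mon p τ z‖
  have hE : Summable E := by
    refine Summable.of_nonneg_of_le (fun s => (exp_pos _).le) (fun s => ?_) ((exp_summable (a := 2 * Real.pi * τ.im) (by positivity)).mul_left (Real.exp (2 * Real.pi * |z.im|)))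
    rw [show ∀ b d : ℝ, b * ((1 + |(s:ℝ)|) * d) = (1 + |(s:ℝ)|) * (b * d) by intros; ring, ← Real.exp_add]
    refine le_trans ?_ (le_mul_of_one_le_left (by positivity) (by linarith [abs_nonneg (s:ℝ)]))
    apply exp_le_exp.2
    simp only [a]
    rw [abs_mul, abs_of_pos (by positivity : 0 < 2 * Real.pi)]
    have := abs_sub_abs_le_abs_sub (s * τ.im) (-z.im)
    rw [abs_mul, abs_neg, abs_of_pos hτ, sub_neg_eq_add, add_comm (s * τ.im)] at this
    nlinarith
  have hh : Summable h := (exp_summable hδ).mul_left _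
  have hu : Summable u := (hc.conv τ hτ z).norm
  have E0 : 0 ≤ E := fun s => (exp_pos _).le
  have h0 : 0 ≤ h := fun s => by simp only [h, Pi.zero_apply]; positivity
  have u0 : 0 ≤ u := fun s => norm_nonneg _
  let σ : ℤ → (ℤ × ℤ ≃ ℤ × ℤ) := fun s => sgE m s
  let σ' : ℤ → (ℤ × ℤ ≃ ℤ × ℤ) := fun s => ((Equiv.refl ℤ).prodCongr (Equiv.neg ℤ)).trans (sgE m s)
  let θ : ℤ × ℤ → (ℤ ≃ ℤ) := fun p => Equiv.subLeft |p.2|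
  let θ' : ℤ × ℤ → (ℤ ≃ ℤ) := fun p => Equiv.addLeft |p.2|
  have S4 := ((sum4 hE hh hu E0 h0 u0 σ θ).add (sum4 hE hh hu E0 h0 u0 σ θ')).add ((sum4 hE hh hu E0 h0 u0 σ' θ).add (sum4 hE hh hu E0 h0 u0 σ' θ'))
  refine Summable.of_norm_bounded S4 ?_
  rintro ⟨s, ⟨n, r⟩, j⟩
  have hcs : ∀ r, c (sgE m s (n, r)) = c (n, r) := fun r => by
    have := ell_gen hc.ell s n r
    rw [← this]; congr 1
  have us : ∀ r, u (sgE m s (n, r)) = ‖c (n, r)‖ * (‖ee (m * (s ^ 2 * τ + 2 * s * z))‖ * (Real.exp (-(2 * Real.pi * (n * τ.im))) * Real.exp (-(a s * r)))) := by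
    intro r
    simp only [u]
    rw [hcs, norm_mul, mon_sg, norm_mul, norm_mon, ← Real.exp_add]
    simp [a]; ring_nf; simp
  simp only [σ, σ', θ, θ', fk, gk, Equiv.trans_apply, Equiv.prodCongr_apply, Prod.map, Equiv.refl_apply, Equiv.neg_apply, Equiv.subLeft_apply, Equiv.coe_addLeft]
  rw [us, us, hc.even]
  set W : ℝ := ‖ee (m * (s ^ 2 * τ + 2 * s * z))‖
  set Q : ℝ := Real.exp (-(2 * Real.pi * (n * τ.im)))
  have e1 : ‖mon (sgE m s (n, j)) τ z‖ = W * (Q * Real.exp (-(a s * j))) := by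
    rw [mon_sg, norm_mul, norm_mon, ← Real.exp_add]
    simp [a, W]; left; ring_nf
  rw [norm_mul, e1, norm_mul, norm_mul]
  have hpos : 0 ≤ ‖c (n, r)‖ * (W * Q) := by positivity
  rcases Nat.eq_zero_or_pos (kk r j) with hk | hk
  · rw [hk]; simp only [cast_zero, norm_zero, mul_zero, zero_mul]
    have := E0 s; have := h0 (|r| - j); have := h0 (|r| + j)
    simp only [Pi.zero_apply] at *
    positivity
  · have hk1 : (kk r j : ℤ) = |r| - |j| := by unfold kk at *; omega
    have hk2 : (kk r j : ℝ) = |(r:ℝ)| - |(j:ℝ)| := by exact_mod_cast congrArg (fun t : ℤ => (t : ℝ)) hk1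
    have hk3 : (1:ℝ) ≤ kk r j := by exact_mod_cast hk
    have h3 : (kk r j : ℝ) * Real.exp (-(a s * j)) ≤ E s * ((Real.exp (-(a s * r)) + Real.exp (-(a s * (-r : ℤ)))) * (h (|r| - j) + h (|r| + j))) := by
      have b1 : Real.exp (-(a s * j)) ≤ Real.exp (|a s| * |(r:ℝ)|) * Real.exp (-(|a s| * kk r j)) := by
        rw [← Real.exp_add, hk2]; apply exp_le_exp.2
        have := neg_le_abs (a s * j); rw [abs_mul] at this; linarith
      have b2 : Real.exp (|a s| * |(r:ℝ)|) ≤ Real.exp (-(a s * r)) + Real.exp (-(a s * (-r : ℤ))) := by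
        rw [← abs_mul]; push_cast
        have := exp_pos (-(a s * r)); have := exp_pos (-(a s * -r))
        rcases abs_cases (a s * r) with ⟨h, _⟩ | ⟨h, _⟩ <;> rw [h]
        · rw [show -(a s * -(r:ℝ)) = a s * r by ring] at *; linarith
        · linarith
      have b3 : (kk r j : ℝ) * Real.exp (-(|a s| * kk r j)) ≤ E s * h (kk r j) := by
        simp only [E, h]
        rw [show ∀ x b d e : ℝ, x * (b * ((1 + e) * d)) = (1 + e) * (x * (b * d)) by intros; ring, ← Real.exp_add, ← Real.exp_add]
        have : |((kk r j : ℤ) : ℝ)| = kk r j := by rw [cast_natCast, abs_of_nonneg (by linarith)]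
        rw [this]
        refine mul_le_mul (by linarith) (exp_le_exp.2 ?_) (exp_pos _).le (by linarith)
        nlinarith [ha s]
      have b4 : h (kk r j) ≤ h (|r| - j) + h (|r| + j) := by
        have := h0 (|r| - j); have := h0 (|r| + j)
        simp only [Pi.zero_apply] at *
        rw [hk1]
        rcases abs_cases j with ⟨e, _⟩ | ⟨e, _⟩ <;> rw [e]
        · linarith
        · rw [sub_neg_eq_add]; linarith
      calc (kk r j : ℝ) * Real.exp (-(a s * j)) ≤ kk r j * (Real.exp (|a s| * |(r:ℝ)|) * Real.exp (-(|a s| * kk r j))) := by gcongr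
        _ = Real.exp (|a s| * |(r:ℝ)|) * (kk r j * Real.exp (-(|a s| * kk r j))) := by ring
        _ ≤ (Real.exp (-(a s * r)) + Real.exp (-(a s * (-r : ℤ)))) * (E s * (h (|r| - j) + h (|r| + j))) := by
            refine mul_le_mul b2 (b3.trans (mul_le_mul_of_nonneg_left b4 (E0 s))) (by positivity) (by positivity)
        _ = _ := by ring
    have h4 := mul_le_mul_of_nonneg_left h3 hpos
    have h5 : 0 ≤ ‖c (n, r)‖ * (W * Q) * (kk r j * Real.exp (-(a s * j))) := by positivity
    rw [RCLike.norm_natCast]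
    rw [show ‖(1 / 2 : ℂ)‖ = 1 / 2 by norm_num]
    linarith
lemma fk_summable (hc : SymC m c) (hτ : 0 < τ.im) (z : ℂ) :
    Summable (fun x : I4 => fk c x * mon (gk m x) τ z) := by
  let k := ⌊z.im / τ.im⌋
  have h1 : k * τ.im ≤ z.im := by rw [← le_div_iff₀ hτ]; exact Int.floor_le _
  have h2 : z.im < (k + 1) * τ.im := by rw [← div_lt_iff₀ hτ]; exact Int.lt_floor_add_one _
  rcases h1.lt_or_eq with h1 | h1
  · exact fk_gen hc hτ h1 h2
  · have s1 := fk_gen hc hτ (z := z + (τ.im / 4 : ℝ) * I) (k := k) (by simp; linarith) (by simp; linarith)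
    have s2 := fk_gen hc hτ (z := z - (τ.im / 4 : ℝ) * I) (k := k - 1) (by simp; linarith) (by simp; linarith)
    refine Summable.of_norm_bounded (s1.norm.add s2.norm) fun x => ?_
    rw [norm_mul, norm_mul, norm_mul, ← mul_add]
    refine mul_le_mul_of_nonneg_left ?_ (norm_nonneg _)
    simp only [norm_mon]
    set p := gk m x
    have e1 : ∀ w : ℝ, Real.exp (-(2 * Real.pi * (p.1 * τ.im + p.2 * (z.im + w)))) = Real.exp (-(2 * Real.pi * (p.1 * τ.im + p.2 * z.im))) * Real.exp (-(2 * Real.pi * p.2 * w)) := by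
      intro w; rw [← Real.exp_add]; ring_nf
    have i1 : (z + (τ.im / 4 : ℝ) * I).im = z.im + τ.im / 4 := by simp
    have i2 : (z - (τ.im / 4 : ℝ) * I).im = z.im + -(τ.im / 4) := by simp; ring
    rw [i1, i2, e1, e1, ← mul_add]
    refine le_mul_of_one_le_right (exp_pos _).le ?_
    rw [show -(2 * Real.pi * p.2 * -(τ.im / 4)) = -(-(2 * Real.pi * p.2 * (τ.im / 4))) by ring]
    set X := -(2 * Real.pi * p.2 * (τ.im / 4))
    rcases le_total 0 X with h | h
    · have := one_le_exp h; have := exp_pos (-X); linarith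
    · have := one_le_exp (neg_nonneg.2 h); have := exp_pos X; linarith
def OffL (τ z : ℂ) : Prop := ∀ a b : ℤ, z ≠ a * τ + b
lemma fser_even (hc : SymC m c) (τ z : ℂ) : fser c τ (-z) = fser c τ z := by
  unfold fser
  rw [← ((Equiv.refl ℤ).prodCongr (Equiv.neg ℤ)).tsum_eq]
  refine tsum_congr fun p => ?_
  simp only [Equiv.prodCongr_apply, Prod.map, Equiv.refl_apply, Equiv.neg_apply]
  rw [hc.even]; unfold mon; congr 2; push_cast; ring
def Aterm (m : ℕ) (τ z : ℂ) (s : ℤ) : ℂ := ee (m * (s ^ 2 * τ + 2 * s * z)) * Bf (z + s * τ)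
lemma A2_eq (m : ℕ) (τ z : ℂ) : A2sum m τ z = ∑' s, Aterm m τ z s := by
  refine tsum_congr fun s => ?_
  unfold Aterm Bf
  rw [mul_div, ← ee_add, add_comm z]; congr 2; ring
lemma off_ne (hz : OffL τ z) (s : ℤ) : 1 - ee (z + s * τ) ≠ 0 := by
  intro h
  obtain ⟨n, hn⟩ := ee_eq_one (sub_eq_zero.1 h).symm
  exact hz (-s) n (by push_cast; linear_combination hn)
lemma cst0_A (hc : SymC m c) (hτ : 0 < τ.im) (hz : OffL τ z) (h1 : fser c τ 0 = 1) :
    HasSum (Aterm m τ z) (Pp τ z * fser c τ z - fser (pushc (fk c) (gk m)) τ z) := by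
  have hS := (fk_summable hc hτ z).hasSum
  have e0 : fser (pushc (fk c) (gk m)) τ z = ∑' x : I4, fk c x * mon (gk m x) τ z := (push_hasSum hS).tsum_eq
  rw [← e0] at hS
  have key : ∀ s : ℤ, HasSum (fun x : (ℤ × ℤ) × ℤ => fk c (s, x) * mon (gk m (s, x)) τ z) (Bf (z + s * τ) * fser c τ z - Aterm m τ z s) := by
    intro s
    have hs := (hS.summable.comp_injective (i := fun x : (ℤ × ℤ) × ℤ => ((s, x) : I4)) (Prod.mk_right_injective s)).hasSum
    have hj : ∀ p : ℤ × ℤ, HasSum (fun j : ℤ => fk c (s, (p, j)) * mon (gk m (s, (p, j))) τ z)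
        (1 / 2 * ee (m * (s ^ 2 * τ + 2 * s * z)) * Bf (z + s * τ) * (c p * mon p τ (z + s * τ) + c p * mon p τ (-(z + s * τ)) - 2 * (c p * mon p τ 0))) := by
      rintro ⟨n, r⟩
      have hk := (ker (ee_ne (z + s * τ)) (off_ne hz s) r.natAbs).mul_left (1 / 2 * c (n, r) * ee (m * (s ^ 2 * τ + 2 * s * z)) * ee (n * τ))
      have v : ee (z + s * τ) ^ r.natAbs + (ee (z + s * τ) ^ r.natAbs)⁻¹ = ee (r * (z + s * τ)) + ee (r * -(z + s * τ)) := by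
        rw [ee_pow, ← ee_neg]
        rcases Int.natAbs_eq r with h | h
        · have : (r:ℂ) = (r.natAbs : ℂ) := by
            have := congrArg (fun t : ℤ => (t:ℂ)) h
            simp only [cast_natCast] at this; exact this
          rw [this, mul_neg]
        · have : (r:ℂ) = -(r.natAbs : ℂ) := by exact_mod_cast congrArg (fun t : ℤ => (t:ℂ)) h
          rw [this, neg_mul_neg, neg_mul, add_comm]
      have v2 : ∀ w, mon (n, r) τ w = ee (n * τ) * ee (r * w) := fun w => by unfold mon; rw [← ee_add]
      rw [v2, v2, v2, mul_zero, ee_zero]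
      rw [v, show ee (z + s * τ) / (1 - ee (z + s * τ)) ^ 2 = Bf (z + s * τ) from rfl] at hk
      rw [show ∀ a b x d e f : ℂ, 1 / 2 * a * b * (x * (d * e) + x * (d * f) - 2 * (x * (d * 1))) = 1 / 2 * x * a * d * (b * (e + f - 2)) by intros; ring]
      refine hk.congr_fun fun j => ?_
      simp only [fk, gk]
      rw [mon_sg]
      have : kk r j = kk r.natAbs j := by simp [kk]
      rw [← this, ee_zpow, cast_natCast]
      unfold mon; simp only [ee_add]; ring
    have hp := hs.prod_fiberwise hj
    have hv := (((hc.conv.hasSum hτ (z + s * τ)).add (hc.conv.hasSum hτ (-(z + s * τ)))).sub ((hc.conv.hasSum hτ 0).mul_left 2)).mul_left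
      (1 / 2 * ee (m * (s ^ 2 * τ + 2 * s * z)) * Bf (z + s * τ))
    have := hp.unique hv
    rw [fser_even hc, h1] at this
    have el := fser_elliptic hc.ell τ hτ z s 0
    rw [Int.cast_zero, add_zero, neg_mul, ee_neg] at el
    have ne := ee_ne (m * (s ^ 2 * τ + 2 * s * z))
    rw [show Bf (z + s * τ) * fser c τ z - Aterm m τ z s = _ from ?_]
    · exact hs
    · rw [this, el, Aterm]
      generalize ee (m * (s ^ 2 * τ + 2 * s * z)) = E at ne ⊢
      field_simp; ring
  have h2 := hS.prod_fiberwise key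
  have h3 := ((Pp_summable hτ z).hasSum.mul_right (fser c τ z)).sub h2
  refine h3.congr_fun fun s => by ring
lemma cst0_S (hm : 0 < m) (hc : SymC m c) : SymC m (pushc (fk c) (gk m)) where
  conv := fun τ hτ z => (push_hasSum (fk_summable hc hτ z).hasSum).summable
  ell := fun n r => by
    unfold pushc
    rw [← ((Equiv.addRight (1:ℤ)).prodCongr (Equiv.refl ((ℤ × ℤ) × ℤ))).tsum_eq]
    refine tsum_congr fun x => ?_
    simp only [Equiv.prodCongr_apply, Prod.map, Equiv.refl_apply, Equiv.coe_addRight, fk]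
    congr 1
    simp only [gk, sgE, Equiv.coe_fn_mk, Prod.mk.injEq, eq_iff_iff]
    constructor <;> rintro ⟨a, b⟩ <;> constructor <;> linarith
  even := fun n r => by
    unfold pushc
    rw [← ((Equiv.neg ℤ).prodCongr ((Equiv.refl (ℤ × ℤ)).prodCongr (Equiv.neg ℤ))).tsum_eq]
    refine tsum_congr fun x => ?_
    simp only [Equiv.prodCongr_apply, Prod.map, Equiv.refl_apply, Equiv.neg_apply, fk, kk, abs_neg]
    congr 1
    simp only [gk, sgE, Equiv.coe_fn_mk, Prod.mk.injEq, eq_iff_iff]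
    constructor <;> rintro ⟨a, b⟩ <;> constructor <;> linarith
  low := by
    obtain ⟨B, hB⟩ := hc.disc hm
    have hm' : (0:ℤ) < m := by exact_mod_cast hm
    refine ⟨-|B|, fun a b hab => ?_⟩
    unfold pushc
    convert tsum_zero with x
    split_ifs with hx
    · obtain ⟨s, ⟨n, r⟩, j⟩ := x
      simp only [gk, sgE, Equiv.coe_fn_mk, Prod.mk.injEq] at hx
      simp only [fk]
      by_cases hk : kk r j = 0
      · rw [hk]; simp
      · rw [hB n r, mul_zero, zero_mul]
        have h1 : |j| < |r| := by unfold kk at hk; omega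
        have h2 : j ^ 2 < r ^ 2 := sq_lt_sq.2 h1
        have h3 : 4 * m * n - j ^ 2 = 4 * m * a - b ^ 2 := by rw [← hx.1, ← hx.2]; ring
        have h4 : m * a ≤ a := by nlinarith [abs_nonneg B]
        nlinarith [neg_abs_le B, sq_nonneg b, abs_nonneg B]
    · rfl
def cX (m : ℕ) : ℤ × ℤ → ℂ := (X_pow_ex m).choose
lemma cX_J (m : ℕ) : IsJ 0 m (cX m) := (X_pow_ex m).choose_spec.1
lemma cX_eq (m : ℕ) (hτ : 0 < τ.im) (z : ℂ) : fser (cX m) τ z = dX τ z ^ m := (X_pow_ex m).choose_spec.2.2 τ hτ z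
lemma cX_zero (m : ℕ) (hτ : 0 < τ.im) : fser (cX m) τ 0 = 1 := by rw [cX_eq m hτ, dX_zero hτ, one_pow]
def etaC : ℤ × ℤ → ℂ := eta_ex.choose
lemma etaC_S : SymC 0 etaC := eta_ex.choose_spec.1
lemma etaC_eq (hτ : 0 < τ.im) (z : ℂ) : fser etaC τ z = eta2 τ := eta_ex.choose_spec.2 τ hτ z
def cst (m : ℕ) : ℤ × ℤ → ℂ := pushc (fk (cX m)) (gk m) + cmul etaC (cX m)
lemma eX_S (m : ℕ) : SymC m (cmul etaC (cX m)) := by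
  have := etaC_S.mul (cX_J m).toSymC
  rwa [zero_add] at this
lemma cst_S (hm : 0 < m) : SymC m (cst m) := (cst0_S hm (cX_J m).toSymC).add (eX_S m)
lemma A_hasSum (m : ℕ) (hτ : 0 < τ.im) (hz : OffL τ z) : HasSum (Aterm m τ z) (A2sum m τ z) := by
  rw [A2_eq]; exact (cst0_A (cX_J m).toSymC hτ hz (cX_zero m hτ)).summable.hasSum
lemma cst_eq (hm : 0 < m) (hτ : 0 < τ.im) (hz : OffL τ z) :
    fser (cst m) τ z + A2sum m τ z = wp τ z / (2 * Real.pi * I) ^ 2 * fser (cX m) τ z := by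
  have hpi : (2 * (Real.pi : ℂ) * I) ^ 2 ≠ 0 := pow_ne_zero 2 two_pi_I_ne_zero
  have h := (A_hasSum m hτ hz).unique (cst0_A (cX_J m).toSymC hτ hz (cX_zero m hτ))
  rw [h, wp_eq hτ hz, cst, fser_add (cst0_S hm (cX_J m).toSymC).conv (eX_S m).conv hτ,
    fser_mul etaC_S.conv (cX_J m).conv hτ, etaC_eq hτ]
  field_simp; ring
def Phi (m : ℕ) (c : ℤ × ℤ → ℂ) (τ z : ℂ) : ℂ := if OffL τ z then fser c τ z + A2sum m τ z else 0
def Std (m : ℕ) (c : ℤ × ℤ → ℂ) : Prop := IsJ 2 m (c - cst m)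
lemma Std.symC (hm : 0 < m) (h : Std m c) : SymC m c := by
  have := h.toSymC.add (cst_S hm); rwa [sub_add_cancel] at this
lemma OffL_S (hτ : 0 < τ.im) (z : ℂ) : OffL (-1 / τ) (z / τ) ↔ OffL τ z := by
  have h0 := ne_of_im hτ
  constructor
  · intro h a b e
    exact h (-b) a (by rw [e]; push_cast; field_simp; ring)
  · intro h a b e
    exact h b (-a) (by rw [div_eq_iff h0] at e; rw [e]; push_cast; field_simp; ring)
lemma OffL_ell (τ z : ℂ) (x y : ℤ) : OffL τ (z + x * τ + y) ↔ OffL τ z := by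
  constructor
  · intro h a b e; exact h (a + x) (b + y) (by rw [e]; push_cast; ring)
  · intro h a b e; exact h (a - x) (b - y) (by push_cast; linear_combination e)
lemma OffL_T (τ z : ℂ) : OffL (τ + 1) z ↔ OffL τ z := by
  constructor
  · intro h a b e; exact h a (b - a) (by rw [e]; push_cast; ring)
  · intro h a b e; exact h a (b + a) (by rw [e]; push_cast; ring)
lemma OffL_dense (τ : ℂ) : Dense {z | OffL τ z} := by
  have h : (Set.range (fun p : ℤ × ℤ => (p.1 : ℂ) * τ + p.2)).Countable := Set.countable_range _
  refine (h.dense_compl ℂ).mono ?_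
  intro z hz a b e
  exact hz ⟨(a, b), e.symm⟩
lemma OffL_open (hτ : 0 < τ.im) (hz : OffL τ z) : ∀ᶠ w : ℂ × ℂ in 𝓝 (τ, z), 0 < w.1.im ∧ OffL w.1 w.2 := by
  have hR : IsClosed (Set.range ((↑) : ℤ → ℝ)) := Int.isClosedEmbedding_coe_real.isClosed_range
  have c0 : ContinuousAt (fun w : ℂ × ℂ => w.1.im) (τ, z) := by fun_prop
  have c1 : ContinuousAt (fun w : ℂ × ℂ => w.2.im / w.1.im) (τ, z) := by
    refine ContinuousAt.div (by fun_prop) (by fun_prop) hτ.ne'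
  have c2 : ContinuousAt (fun w : ℂ × ℂ => w.2.re - w.2.im / w.1.im * w.1.re) (τ, z) := by fun_prop
  have i1 : ∀ᶠ w : ℂ × ℂ in 𝓝 (τ, z), 0 < w.1.im := c0.eventually (lt_mem_nhds hτ)
  have key : ∀ w : ℂ × ℂ, 0 < w.1.im → ∀ a b : ℤ, w.2 = a * w.1 + b → w.2.im / w.1.im = a ∧ w.2.re - w.2.im / w.1.im * w.1.re = b := by
    intro w hw a b e
    have e1 : w.2.im / w.1.im = a := by rw [e]; simp; field_simp
    refine ⟨e1, ?_⟩
    rw [e1, e]; simp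
  by_cases hv : z.im / τ.im ∈ Set.range ((↑) : ℤ → ℝ)
  · have hu : z.re - z.im / τ.im * τ.re ∉ Set.range ((↑) : ℤ → ℝ) := by
      rintro ⟨b, hb⟩
      obtain ⟨a, ha⟩ := hv
      refine hz a b (Complex.ext ?_ ?_)
      · simp; rw [hb, ha]; ring
      · simp; rw [ha]; field_simp
    filter_upwards [i1, c2.eventually (hR.isOpen_compl.mem_nhds hu)] with w h1 h2
    exact ⟨h1, fun a b e => h2 ⟨b, (key w h1 a b e).2.symm⟩⟩
  · filter_upwards [i1, c1.eventually (hR.isOpen_compl.mem_nhds hv)] with w h1 h2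
    exact ⟨h1, fun a b e => h2 ⟨a, (key w h1 a b e).1.symm⟩⟩
lemma OffL_zero (hτ : 0 < τ.im) : ∀ᶠ z in 𝓝[≠] (0:ℂ), OffL τ z := by
  have h1 : ∀ᶠ z in 𝓝[≠] (0:ℂ), ‖z‖ < min 1 τ.im :=
    (continuous_norm.tendsto' (0:ℂ) 0 norm_zero |>.mono_left nhdsWithin_le_nhds).eventually (gt_mem_nhds (lt_min one_pos hτ))
  filter_upwards [h1, self_mem_nhdsWithin] with z hz h0 a b e
  have ha : a = 0 := by
    have h2 := (abs_im_le_norm z).trans_lt (hz.trans_le (min_le_right _ _))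
    rw [e] at h2; simp [abs_mul, abs_of_pos hτ] at h2
    have : |(a:ℝ)| < 1 := by by_contra h; push Not at h; nlinarith
    exact abs_lt_one_iff.1 (by exact_mod_cast this)
  subst ha
  have h2 := hz.trans_le (min_le_left _ _)
  rw [e] at h2; simp at h2
  have hb : b = 0 := abs_lt_one_iff.1 (by exact_mod_cast h2)
  exact h0 (by rw [e, hb]; simp)
lemma Phi_eq (hm : 0 < m) (h : Std m c) (hτ : 0 < τ.im) (hz : OffL τ z) :
    Phi m c τ z = wp τ z / (2 * Real.pi * I) ^ 2 * fser (cX m) τ z + fser (c - cst m) τ z := by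
  rw [Phi, if_pos hz, ← cst_eq hm hτ hz]
  have := fser_add h.conv (cst_S hm).conv hτ z
  rw [sub_add_cancel] at this
  rw [this]; ring
lemma W_S (m : ℕ) : SLaw 2 m (fun τ z => wp τ z / (2 * Real.pi * I) ^ 2 * fser (cX m) τ z) := fun τ hτ z => by
  simp only
  rw [wp_S hτ, (cX_J m).S τ hτ z, zpow_zero, show τ ^ (2:ℤ) = τ ^ 2 by norm_cast]; ring
lemma Phi_S (hm : 0 < m) (h : Std m c) : SLaw 2 m (Phi m c) := fun τ hτ z => by
  by_cases hz : OffL τ z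
  · have w := W_S m τ hτ z
    simp only at w
    rw [Phi_eq hm h hτ hz, Phi_eq hm h (neg_inv_im hτ) ((OffL_S hτ z).2 hz), h.S τ hτ z, w]; ring
  · rw [Phi, Phi, if_neg hz, if_neg (fun h => hz ((OffL_S hτ z).1 h)), mul_zero]
lemma Std_of (hm : 0 < m) (hc : SymC m c)
    (h : ∀ τ : ℂ, 0 < τ.im → ∀ z, OffL τ z → Phi m c (-1 / τ) (z / τ) = τ ^ (2:ℤ) * ee (m * z ^ 2 / τ) * Phi m c τ z) : Std m c := by
  have hs : SymC m (c - cst m) := by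
    have := hc.add ((cst_S hm).smul (-1)); rwa [neg_one_smul, ← sub_eq_add_neg] at this
  refine ⟨hs, fun τ hτ => ?_⟩
  have c1 := (z_diff hs.conv hτ).continuous
  have c2 := (z_diff hs.conv (neg_inv_im hτ)).continuous
  have ce : Continuous ee := differentiable_ee.continuous
  have key : ∀ {τ z : ℂ}, 0 < τ.im → OffL τ z → fser (c - cst m) τ z = Phi m c τ z - wp τ z / (2 * Real.pi * I) ^ 2 * fser (cX m) τ z := by
    intro τ z hτ hz
    rw [Phi, if_pos hz, ← cst_eq hm hτ hz]
    have := fser_add hs.conv (cst_S hm).conv hτ z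
    rw [sub_add_cancel] at this
    rw [this]; ring
  refine congrFun (Continuous.ext_on (OffL_dense τ) (f := fun z => fser (c - cst m) (-1 / τ) (z / τ)) (g := fun z => τ ^ (2:ℤ) * ee (m * z ^ 2 / τ) * fser (c - cst m) τ z)
    (c2.comp (continuous_id.div_const τ)) (by fun_prop) fun z hz => ?_)
  have w := W_S m τ hτ z
  simp only at w ⊢
  rw [key hτ hz, key (neg_inv_im hτ) ((OffL_S hτ z).2 hz), h τ hτ z hz, w]; ring
lemma A_ell (m : ℕ) : EllipticLaw m (A2sum m) := fun τ _ z x y => by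
  rw [A2_eq, A2_eq, ← (Equiv.addRight x).tsum_eq (Aterm m τ z), ← tsum_mul_left]
  refine tsum_congr fun s => ?_
  unfold Aterm
  simp only [Equiv.coe_addRight]
  rw [← mul_assoc, ← ee_add, show z + x * τ + y + s * τ = z + ((s + x : ℤ) : ℂ) * τ + (y:ℤ) by push_cast; ring, Bf_int]
  congr 1
  refine ee_congr (2 * m * s * y) ?_
  push_cast; ring
lemma A_T (m : ℕ) : TLaw (A2sum m) := fun τ _ z => by
  rw [A2_eq, A2_eq]
  refine tsum_congr fun s => ?_
  unfold Aterm
  rw [show z + s * (τ + 1) = z + s * τ + (s:ℤ) by ring, Bf_int]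
  congr 1
  refine ee_congr (m * s ^ 2) ?_
  push_cast; ring
lemma Phi_ell (h : SymC m c) : EllipticLaw m (Phi m c) := fun τ hτ z x y => by
  unfold Phi
  rw [if_congr (OffL_ell τ z x y) rfl rfl, A_ell m τ hτ z, fser_elliptic h.ell τ hτ z]
  split_ifs <;> ring
lemma Phi_std (hm : 0 < m) (h : Std m c) : IsStandardForm m (Phi m c) := by
  refine ⟨modular_of_ST (Phi_S hm h) fun τ hτ z => ?_, Phi_ell (h.symC hm), fun τ hτ z hz => ?_, fun τ hτ => ?_⟩
  · unfold Phi
    rw [if_congr (OffL_T τ z) rfl rfl, A_T m τ hτ z, fser_T τ hτ z]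
  · have e : (fun w : ℂ × ℂ => Phi m c w.1 w.2) =ᶠ[𝓝 (τ, z)] fun w => Pp w.1 w.2 * fser (cX m) w.1 w.2 + fser (cmul etaC (cX m)) w.1 w.2 + fser (c - cst m) w.1 w.2 := by
      filter_upwards [OffL_open hτ hz] with w hw
      have hpi : (2 * (Real.pi : ℂ) * I) ^ 2 ≠ 0 := pow_ne_zero 2 two_pi_I_ne_zero
      rw [Phi_eq hm h hw.1 hw.2, wp_eq hw.1 hw.2, fser_mul etaC_S.conv (cX_J m).conv hw.1, etaC_eq hw.1]
      field_simp
    refine DifferentiableAt.congr_of_eventuallyEq ?_ e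
    exact (((Pp_diff hτ hz).mul ((cX_J m).conv.differentiableAt hτ z)).add ((eX_S m).conv.differentiableAt hτ z)).add (h.conv.differentiableAt hτ z)
  · obtain ⟨g, hg, hw⟩ := wp_pole hτ
    have F1 := z_diff (cX_J m).conv hτ
    set F : ℂ → ℂ := fun z => fser (cX m) τ z with hF
    have F0 : F 0 = 1 := cX_zero m hτ
    have Fe : ∀ z, F (-z) = F z := fun z => fser_even (cX_J m).toSymC τ z
    have Fd : deriv F 0 = 0 := by
      have h1 := deriv_comp_neg F 0
      rw [funext Fe, neg_zero] at h1
      exact self_eq_neg.1 h1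
    have d1 : Differentiable ℂ (dslope F 0) := by
      rw [← differentiableOn_univ, differentiableOn_dslope univ_mem, differentiableOn_univ]; exact F1
    have d2 : Differentiable ℂ (dslope (dslope F 0) 0) := by
      rw [← differentiableOn_univ, differentiableOn_dslope univ_mem, differentiableOn_univ]; exact d1
    refine ⟨fun z => (dslope (dslope F 0) 0 z + g z * F z) / (2 * Real.pi * I) ^ 2 + fser (c - cst m) τ z, ?_, ?_⟩
    · exact (((d2.analyticAt 0).add (hg.mul (F1.analyticAt 0))).div_const).add ((z_diff h.conv hτ).analyticAt 0)
    · filter_upwards [OffL_zero hτ, self_mem_nhdsWithin] with z hz h0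
      have h0' : z ≠ 0 := h0
      have e : F z = 1 + z ^ 2 * dslope (dslope F 0) 0 z := by
        rw [dslope_of_ne _ h0', slope_def_field, dslope_of_ne _ h0', slope_def_field, dslope_same, Fd, F0]
        field_simp; ring
      have hpi : (2 * (Real.pi : ℂ) * I) ≠ 0 := two_pi_I_ne_zero
      rw [Phi_eq hm h hτ hz, hw, show fser (cX m) τ z = F z from rfl]
      generalize hD : dslope (dslope F 0) 0 z = D at e ⊢
      rw [e, mul_pow (2 * (Real.pi : ℂ) * I) z]
      generalize (2 * (Real.pi : ℂ) * I) = P at hpi ⊢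
      field_simp
      ring
lemma OffL_u (hz : OffL τ z) (hp : 0 < p) (l : ℤ) (μ : ℕ) : OffL τ ((z - l * τ + μ) / p) := by
  intro a b e
  have hp' : (p : ℂ) ≠ 0 := by exact_mod_cast hp.ne'
  rw [div_eq_iff hp'] at e
  exact hz (p * a + l) (p * b - μ) (by push_cast; linear_combination e)
lemma A_u {k : ℕ} (hp : 0 < p) (hτ : 0 < τ.im) (hz : OffL τ z) :
    ∑ l ∈ range p, ∑ μ ∈ range p,
      1 / p * (ee (k * ((l : ℤ) ^ 2 * τ - 2 * (l : ℤ) * z)) * A2sum (k * p ^ 2) τ ((z - (l : ℤ) * τ + μ) / p)) = p * A2sum k τ z := by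
  have hp' : (p : ℂ) ≠ 0 := by exact_mod_cast hp.ne'
  have : NeZero p := ⟨hp.ne'⟩
  let V : ℕ → ℂ := fun l => ∑ μ ∈ range p,
      1 / p * (ee (k * ((l : ℤ) ^ 2 * τ - 2 * (l : ℤ) * z)) * A2sum (k * p ^ 2) τ ((z - (l : ℤ) * τ + μ) / p))
  have h1 : ∀ l : ℕ, HasSum (fun s : ℤ => p * Aterm k τ z (-(s * p + l))) (V l) := by
    intro l
    have h := hasSum_sum (s := range p) fun μ _ => ((A_hasSum (k * p ^ 2) hτ (OffL_u hz hp l μ)).mul_left (ee (k * ((l : ℤ) ^ 2 * τ - 2 * (l : ℤ) * z)))).mul_left (1 / p : ℂ)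
    rw [← (Equiv.neg ℤ).hasSum_iff] at h
    refine h.congr_fun fun s => ?_
    simp only [comp, Equiv.neg_apply, Aterm]
    have e1 : ∀ μ : ℕ, 1 / (p:ℂ) * (ee (k * ((l : ℤ) ^ 2 * τ - 2 * (l : ℤ) * z)) * (ee ((k * p ^ 2 : ℕ) * (((-s : ℤ) : ℂ) ^ 2 * τ + 2 * ((-s : ℤ) : ℂ) * ((z - (l : ℤ) * τ + μ) / p))) * Bf ((z - (l : ℤ) * τ + μ) / p + ((-s : ℤ) : ℂ) * τ))) =
        1 / p * ee (k * (((-(s * p + l) : ℤ) : ℂ) ^ 2 * τ + 2 * ((-(s * p + l) : ℤ) : ℂ) * z)) * Bf ((z + ((-(s * p + l) : ℤ) : ℂ) * τ + μ) / p) := by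
      intro μ
      rw [mul_assoc (1 / (p:ℂ)) (ee _), ← mul_assoc (ee _) (ee _), ← ee_add]
      refine congrArg₂ _ rfl (congrArg₂ _ ?_ ?_)
      · refine ee_congr (-2 * k * p * s * μ) ?_
        push_cast; field_simp; ring
      · congr 1; push_cast; field_simp; ring
    simp_rw [e1]
    rw [← mul_sum, Bf_dist hp]
    · field_simp
    · intro n e
      exact hz (s * p + l) n (by push_cast at e ⊢; linear_combination e)
  have hA := (A_hasSum k hτ hz).mul_left (p : ℂ)
  rw [← (((Equiv.prodComm (Fin p) ℤ).trans (divModEquiv p).symm).trans (Equiv.neg ℤ)).hasSum_iff] at hA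
  have h2 := hA.prod_fiberwise (g := fun r : Fin p => V r) fun r => by
    refine (h1 r).congr_fun fun s => ?_
    simp [divModEquiv]
  rw [← (hasSum_fintype _).unique h2, ← sum_range]
lemma Std_u {k : ℕ} (hk : 0 < k) (hp : 0 < p) (h : Std (k * p ^ 2) c) : Std k ((1 / p : ℂ) • uc k p c) := by
  have hp' : (p : ℂ) ≠ 0 := by exact_mod_cast hp.ne'
  have hm : 0 < k * p ^ 2 := by positivity
  have hc := h.symC hm
  have key : ∀ {τ z : ℂ}, 0 < τ.im → OffL τ z → Phi k ((1 / p : ℂ) • uc k p c) τ z = 1 / p * ∑ l ∈ range p, ∑ μ ∈ range p,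
      1 / p * (ee (k * ((l : ℤ) ^ 2 * τ - 2 * (l : ℤ) * z)) * Phi (k * p ^ 2) c τ ((z - (l : ℤ) * τ + μ) / p)) := by
    intro τ z hτ hz
    rw [Phi, if_pos hz, fser_smul, show A2sum k τ z = 1 / p * (p * A2sum k τ z) by field_simp, ← A_u hp hτ hz, ← mul_add,
      show fser (uc k p c) τ z = _ from (uc_hasSum hp k hc.conv hτ z).tsum_eq]
    simp only [← sum_add_distrib]
    congr 1
    refine sum_congr rfl fun l _ => sum_congr rfl fun μ _ => ?_
    rw [Phi, if_pos (OffL_u hz hp l μ)]; ring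
  refine Std_of hk ((hc.u hk hp).smul _) fun τ hτ z hz => ?_
  rw [key hτ hz, key (neg_inv_im hτ) ((OffL_S hτ z).2 hz)]
  have := SLaw_u hp (Phi_S hm h) (Phi_ell hc) τ hτ z
  simp only at this
  rw [this]; ring
def UC (d : ℕ) : (ℤ → ℤ → ℂ) →ₗ[ℂ] (ℤ → ℤ → ℂ) where
  toFun C D l := if (d : ℤ) ∣ l ∧ (d : ℤ) ^ 2 ∣ D then C (D / (d : ℤ) ^ 2) (l / d) else 0
  map_add' C C' := by funext D l; simp only [Pi.add_apply]; split_ifs <;> simp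
  map_smul' a C := by funext D l; simp only [Pi.smul_apply, RingHom.id_apply]; split_ifs <;> simp
lemma UC_apply (d : ℕ) (C : ℤ → ℤ → ℂ) (D l : ℤ) : UC d C D l =
    if (d : ℤ) ∣ l ∧ (d : ℤ) ^ 2 ∣ D then C (D / (d : ℤ) ^ 2) (l / d) else 0 := rfl
lemma UC_mul (hd : 0 < d) (C : ℤ → ℤ → ℂ) (D l : ℤ) : UC d C ((d : ℤ) ^ 2 * D) (d * l) = C D l := by
  have h : (d : ℤ) ≠ 0 := by positivity
  rw [UC_apply, if_pos ⟨dvd_mul_right _ _, dvd_mul_right _ _⟩, mul_ediv_cancel_left _ h,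
    mul_ediv_cancel_left _ (pow_ne_zero 2 h)]
lemma UC_neg (C : ℤ → ℤ → ℂ) {D : ℤ} (h : ¬ ((d : ℤ) ∣ l ∧ (d : ℤ) ^ 2 ∣ D)) : UC d C D l = 0 := by
  rw [UC_apply, if_neg h]
lemma UC_ofC {k : ℕ} (hd : 0 < d) (C : ℤ → ℤ → ℂ) : ofC (k * d ^ 2) (UC d C) = Uc d (ofC k C) := by
  funext ⟨n, r⟩
  simp only [ofC, Uc]
  by_cases h : (d : ℤ) ∣ r
  · obtain ⟨s, rfl⟩ := h
    have h : (d : ℤ) ≠ 0 := by positivity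
    rw [if_pos (dvd_mul_right _ _), mul_ediv_cancel_left _ h, ← UC_mul hd C]
    congr 1; push_cast; ring
  · rw [if_neg h, UC_neg _ (fun h' => h h'.1)]
lemma UC_Poly {k : ℕ} (hd : 0 < d) (hC : C ∈ PolyC k) : UC d C ∈ PolyC (k * d ^ 2) := by
  have hd0 : (d : ℤ) ≠ 0 := by positivity
  obtain ⟨h1, h2, h3, B, h4⟩ := hC
  refine ⟨fun D l => ?_, fun D l => ?_, fun D l h => ?_, B * d ^ 2, fun D l h => ?_⟩
  all_goals by_cases hh : (d : ℤ) ∣ l ∧ (d : ℤ) ^ 2 ∣ D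
  · obtain ⟨⟨l, rfl⟩, D, rfl⟩ := hh
    rw [show (d : ℤ) * l + 2 * ((k * d ^ 2 : ℕ) : ℤ) = d * (l + 2 * k * d) by push_cast; ring, UC_mul hd, UC_mul hd,
      per_gen h1]
  · rw [UC_neg _ hh, UC_neg]
    rintro ⟨h, h'⟩
    refine hh ⟨(Int.dvd_add_left ?_).1 h, h'⟩
    exact ⟨2 * k * d, by push_cast; ring⟩
  · obtain ⟨⟨l, rfl⟩, D, rfl⟩ := hh
    rw [← mul_neg, UC_mul hd, UC_mul hd, h2]
  · rw [UC_neg _ hh, UC_neg]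
    rwa [dvd_neg]
  · obtain ⟨⟨l, rfl⟩, D, rfl⟩ := hh
    rw [UC_mul hd]
    apply h3
    rintro ⟨t, ht⟩
    exact h ⟨t, by push_cast; linear_combination (d : ℤ) ^ 2 * ht⟩
  · exact UC_neg _ hh
  · obtain ⟨⟨l, rfl⟩, D, rfl⟩ := hh
    rw [UC_mul hd]
    apply h4
    have : (0 : ℤ) < (d : ℤ) ^ 2 := by positivity
    nlinarith
  · exact UC_neg _ hh
lemma UC_Jm {k : ℕ} (hd : 0 < d) (hC : C ∈ Jm k) : UC d C ∈ Jm (k * d ^ 2) := by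
  refine ⟨UC_Poly hd hC.1, ?_⟩
  rw [UC_ofC hd]
  exact hC.2.U hd
lemma UC_UC {e : ℕ} (hp : 0 < p) (he : 0 < e) (C : ℤ → ℤ → ℂ) : UC (p * e) C = UC e (UC p C) := by
  have he0 : (e : ℤ) ≠ 0 := by positivity
  funext D l
  by_cases h : ((p * e : ℕ) : ℤ) ∣ l ∧ ((p * e : ℕ) : ℤ) ^ 2 ∣ D
  · obtain ⟨⟨l, rfl⟩, D, rfl⟩ := h
    rw [UC_mul (Nat.mul_pos hp he), show ((p * e : ℕ) : ℤ) ^ 2 * D = (e : ℤ) ^ 2 * ((p : ℤ) ^ 2 * D) by push_cast; ring,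
      show ((p * e : ℕ) : ℤ) * l = e * (p * l) by push_cast; ring, UC_mul he, UC_mul hp]
  · rw [UC_neg _ h]
    by_cases h' : (e : ℤ) ∣ l ∧ (e : ℤ) ^ 2 ∣ D
    · obtain ⟨⟨l, rfl⟩, D, rfl⟩ := h'
      rw [UC_mul he, UC_neg]
      rintro ⟨⟨l, rfl⟩, D, rfl⟩
      exact h ⟨⟨l, by push_cast; ring⟩, D, by push_cast; ring⟩
    · rw [UC_neg _ h']
lemma UC_one (C : ℤ → ℤ → ℂ) : UC 1 C = C := by funext D l; simp [UC_apply]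
lemma reidx (hp : 0 < p) (hd : Coprime d p) {g : ℤ → ℂ} (hg : ∀ x t : ℤ, g (x + p * t) = g x) :
    ∑ j ∈ range p, g (d * j) = ∑ j ∈ range p, g j := by
  have hi : ∀ j ∈ range p, d * j % p ∈ range p := fun j _ => mem_range.2 (Nat.mod_lt _ hp)
  have hj : Set.InjOn (fun j => d * j % p) (range p : Set ℕ) := by
    intro a ha b hb h
    have h1 : a ≡ b [MOD p] := ModEq.cancel_left_of_coprime (by rw [Nat.gcd_comm]; exact hd) h
    have ha := mem_range.1 (mem_coe.1 ha)
    have hb := mem_range.1 (mem_coe.1 hb)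
    rwa [ModEq, mod_eq_of_lt ha, mod_eq_of_lt hb] at h1
  refine Finset.sum_nbij (fun j => d * j % p) hi hj
    (Finset.surjOn_of_injOn_of_card_le _ (fun j hj => by simpa using hi j (by simpa using hj)) hj le_rfl) ?_
  intro j _
  have := Nat.mod_add_div (d * j) p
  rw [← hg (((d * j % p : ℕ) : ℤ)) ((d * j / p : ℕ) : ℤ)]
  congr 1; exact_mod_cast this.symm
lemma Ep_UC_dvd {k : ℕ} (hp : p.Prime) (hd : 0 < d) (h : p ∣ d) (hC : C ∈ PolyC k) :
    Ep (k * d ^ 2) p (UC d C) = UC d C := by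
  obtain ⟨e, rfl⟩ := h
  have hp0 : (p : ℤ) ≠ 0 := by exact_mod_cast hp.ne_zero
  have hpc : (p : ℂ) ≠ 0 := by exact_mod_cast hp.ne_zero
  have e1 : (2 * ((k * (p * e) ^ 2 : ℕ) : ℤ) / p : ℤ) = 2 * k * p * e ^ 2 := by
    rw [show (2 * ((k * (p * e) ^ 2 : ℕ) : ℤ) : ℤ) = p * (2 * k * p * e ^ 2) by push_cast; ring,
      mul_ediv_cancel_left _ hp0]
  funext D l
  rw [Ep_apply, e1]
  split_ifs with hl
  · rw [sum_congr rfl (g := fun _ => UC (p * e) C D l), sum_const, card_range, nsmul_eq_mul]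
    · field_simp
    intro j _
    by_cases h : ((p * e : ℕ) : ℤ) ∣ l ∧ ((p * e : ℕ) : ℤ) ^ 2 ∣ D
    · obtain ⟨⟨l, rfl⟩, D, rfl⟩ := h
      rw [UC_mul hd, show ((p * e : ℕ) : ℤ) * l + 2 * k * p * e ^ 2 * j = (p * e : ℕ) * (l + 2 * k * (e * j)) by
        push_cast; ring, UC_mul hd, per_gen hC.1]
    · rw [UC_neg _ h, UC_neg]
      rintro ⟨h1, h2⟩
      exact h ⟨(Int.dvd_add_left ⟨2 * k * e * j, by push_cast; ring⟩).1 h1, h2⟩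
  · rw [UC_neg]
    rintro ⟨h1, -⟩
    exact hl (dvd_trans ⟨e, by push_cast; ring⟩ h1)
lemma Ep_UC_cop {k : ℕ} (hp : p.Prime) (hd : 0 < d) (h : ¬ p ∣ d) (hk : p ^ 2 ∣ k) (hC : C ∈ PolyC k) :
    Ep (k * d ^ 2) p (UC d C) = UC d (Ep k p C) := by
  obtain ⟨k, rfl⟩ := hk
  have hp0 : (p : ℤ) ≠ 0 := by exact_mod_cast hp.ne_zero
  have hcop : Coprime d p := ((Nat.Prime.coprime_iff_not_dvd hp).2 h).symm
  have e1 : (2 * ((p ^ 2 * k * d ^ 2 : ℕ) : ℤ) / p : ℤ) = 2 * k * p * d ^ 2 := by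
    rw [show (2 * ((p ^ 2 * k * d ^ 2 : ℕ) : ℤ) : ℤ) = p * (2 * k * p * d ^ 2) by push_cast; ring,
      mul_ediv_cancel_left _ hp0]
  have e2 : (2 * ((p ^ 2 * k : ℕ) : ℤ) / p : ℤ) = 2 * k * p := by
    rw [show (2 * ((p ^ 2 * k : ℕ) : ℤ) : ℤ) = p * (2 * k * p) by push_cast; ring,
      mul_ediv_cancel_left _ hp0]
  funext D l
  rw [Ep_apply, e1]
  by_cases hh : (d : ℤ) ∣ l ∧ (d : ℤ) ^ 2 ∣ D
  · obtain ⟨⟨l, rfl⟩, D, rfl⟩ := hh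
    rw [UC_mul hd, Ep_apply, e2]
    have e3 : (p : ℤ) ∣ d * l ↔ (p : ℤ) ∣ l :=
      ⟨fun w => (IsCoprime.dvd_of_dvd_mul_left (isCoprime_iff_coprime.2 hcop.symm) w), fun w => dvd_mul_of_dvd_right w _⟩
    rw [if_congr e3 rfl rfl]
    congr 2
    have := reidx (g := fun x => C D (l + 2 * k * p * x)) hp.pos hcop (fun x t => by
      have := per_gen hC.1 D (l + 2 * k * p * x) t
      rw [← this]; congr 1; push_cast; ring)
    rw [← this]
    refine sum_congr rfl fun j _ => ?_
    rw [← UC_mul hd C]; congr 1; ring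
  · rw [UC_neg _ hh]
    split_ifs with hl
    · rw [sum_eq_zero, mul_zero]
      intro j _
      apply UC_neg
      rintro ⟨h1, h2⟩
      exact hh ⟨(Int.dvd_add_left ⟨2 * k * p * d * j, by ring⟩).1 h1, h2⟩
    · rfl
def StdC (m : ℕ) (C : ℤ → ℤ → ℂ) : Prop := C ∈ PolyC m ∧ Std m (ofC m C)
lemma StdC.add {j : ℤ → ℤ → ℂ} (h : StdC m C) (hj : j ∈ Jm m) : StdC m (C + j) := by
  refine ⟨add_mem h.1 hj.1, ?_⟩
  have := IsJ.add h.2 hj.2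
  unfold Std; rw [ofC_add]
  convert this using 1; abel
lemma StdC_cst (hm : 0 < m) : StdC m (toC m (cst m)) := by
  refine ⟨toC_mem hm (cst_S hm), ?_⟩
  unfold Std; rw [ofC_toC hm, sub_self]
  exact IsJ.zero 2 m
lemma Std_sub {c' : ℤ × ℤ → ℂ} (h : Std m c) (h' : Std m c') : IsJ 2 m (c - c') := by
  have := IsJ.add h (IsJ.smul h' (-1))
  convert this using 1; module
lemma Ep_Std {k : ℕ} (hk : 0 < k) (hp : p.Prime) {C' : ℤ → ℤ → ℂ} (h : StdC (k * p ^ 2) C) (h' : StdC k C') :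
    Ep (k * p ^ 2) p C - UC p C' ∈ Jm (k * p ^ 2) := by
  refine ⟨sub_mem (Ep_Poly hp (dvd_mul_left _ _) h.1) (UC_Poly hp.pos h'.1), ?_⟩
  have := (Std_sub (Std_u hk hp.pos h.2) h'.2).U hp.pos
  convert this using 1
  change ofC _ (Ep _ _ _) - ofC _ (UC _ _) = _
  rw [ofC_Ep hp rfl, UC_ofC hp.pos]
  funext x
  simp only [Uc, Pi.sub_apply, Pi.smul_apply]
  split_ifs <;> simp
lemma prim_eq (F : ℕ → ℤ → ℤ → ℂ) : primC0 m F =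
    ∑ d ∈ m.divisors.filter (fun d => d ^ 2 ∣ m), ((moebius d : ℤ) : ℂ) • UC d (F (m / d ^ 2)) := by
  funext D l
  rw [sum_filter, Finset.sum_apply, Finset.sum_apply]
  unfold primC0
  refine sum_congr rfl fun d _ => ?_
  by_cases h : d ^ 2 ∣ m
  · simp only [h, true_and, if_true, Pi.smul_apply, UC_apply, smul_eq_mul, mul_ite, mul_zero]
  · simp [h]
lemma cancel (hm : 0 < m) (hp : p.Prime) (h : p ^ 2 ∣ m) 
    (hF : ∀ x, 0 < x → x ≤ m → StdC x (F x)) : Ep m p (primC0 m F) ∈ Jm m := by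
  have hF' : ∀ d, d ^ 2 ∣ m → 0 < d ∧ StdC (m / d ^ 2) (F (m / d ^ 2)) := fun d hd => by
    have := pos_of_dvd_of_pos hd hm
    exact ⟨Nat.pos_of_ne_zero (by rintro rfl; simp at this), hF _ (Nat.div_pos (le_of_dvd hm hd) this) (Nat.div_le_self _ _)⟩
  have key : ∀ d, d ^ 2 ∣ m → ¬ p ∣ d → (p * d) ^ 2 ∣ m := fun d hd hpd => by
    rw [mul_pow]
    exact Coprime.mul_dvd_of_dvd_of_dvd (((Nat.Prime.coprime_iff_not_dvd hp).2 hpd).pow 2 2) h hd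
  set T : ℕ → ℤ → ℤ → ℂ := fun d => Ep m p (UC d (F (m / d ^ 2))) with hT
  have hTT : ∀ d, d ^ 2 ∣ m → ¬ p ∣ d → T d - T (p * d) ∈ Jm m := fun d hd hpd => by
    obtain ⟨hd0, hs⟩ := hF' d hd
    obtain ⟨hd1, hs1⟩ := hF' (p * d) (key d hd hpd)
    obtain ⟨k, hk⟩ := key d hd hpd
    have hk0 : 0 < k := Nat.pos_of_ne_zero (by rintro rfl; omega)
    have e1 : m / d ^ 2 = k * p ^ 2 := by
      rw [hk]; apply div_eq_of_eq_mul_left (by positivity); ring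
    have e2 : m / (p * d) ^ 2 = k := by
      rw [hk]; apply div_eq_of_eq_mul_left (by positivity); ring
    have e3 : m = (k * p ^ 2) * d ^ 2 := by rw [hk]; ring
    have e4 : m = k * (p * d) ^ 2 := by rw [hk]; ring
    rw [e1] at hs; rw [e2] at hs1
    have t1 : T d = UC d (Ep (k * p ^ 2) p (F (k * p ^ 2))) := by
      simp only [hT]; rw [e1]
      conv_lhs => rw [e3]
      exact Ep_UC_cop hp hd0 hpd (dvd_mul_left _ _) hs.1
    have t2 : T (p * d) = UC d (UC p (F k)) := by
      simp only [hT]; rw [e2]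
      conv_lhs => rw [e4]
      rw [Ep_UC_dvd hp hd1 (dvd_mul_right _ _) hs1.1, UC_UC hp.pos hd0]
    rw [t1, t2, ← map_sub, e3]
    exact UC_Jm hd0 (Ep_Std hk0 hp hs hs1)
  rw [prim_eq, map_sum]
  simp only [map_smul]
  change ∑ d ∈ _, ((moebius d : ℤ) : ℂ) • T d ∈ _
  rw [← Finset.sum_filter_add_sum_filter_not _ (fun d => ¬ p ∣ d)]
  rw [← Finset.sum_of_injOn (s := (m.divisors.filter (fun d => d ^ 2 ∣ m)).filter (fun d => ¬ p ∣ d))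
    (t := (m.divisors.filter (fun d => d ^ 2 ∣ m)).filter (fun d => ¬ ¬ p ∣ d))
    (f := fun d => ((moebius (p * d) : ℤ) : ℂ) • T (p * d))
    (g := fun d => ((moebius d : ℤ) : ℂ) • T d) (fun d => p * d),
    ← sum_add_distrib]
  · refine Submodule.sum_mem _ fun d hd => ?_
    simp only [mem_filter] at hd
    have hc := (Nat.Prime.coprime_iff_not_dvd hp).2 hd.2
    rw [ArithmeticFunction.isMultiplicative_moebius.map_mul_of_coprime hc, ArithmeticFunction.moebius_apply_prime hp]
    have := smul_mem _ ((moebius d : ℤ) : ℂ) (hTT d hd.1.2 hd.2)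
    convert this using 1
    push_cast; module
  · intro a _ b _ hab
    exact eq_of_mul_eq_mul_left hp.pos hab
  · intro d hd
    simp only [coe_filter, mem_filter, mem_setOf_eq, mem_divisors] at hd ⊢
    have := key d hd.1.2 hd.2
    exact ⟨⟨⟨(dvd_pow_self _ two_ne_zero).trans this, hm.ne'⟩, this⟩, by simp⟩
  · intro d hd hn
    simp only [mem_filter, not_not, mem_divisors] at hd
    obtain ⟨⟨⟨h1, -⟩, h2⟩, e, rfl⟩ := hd
    by_cases he : p ∣ e
    · rw [ArithmeticFunction.moebius_eq_zero_of_not_squarefree, Int.cast_zero, zero_smul]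
      intro hs
      obtain ⟨f, rfl⟩ := he
      exact hp.not_isUnit (hs p ⟨f, by ring⟩)
    · exfalso
      apply hn
      refine ⟨e, ?_, rfl⟩
      simp only [coe_filter, mem_filter, mem_setOf_eq, mem_divisors]
      exact ⟨⟨⟨(dvd_mul_left _ _).trans h1, hm.ne'⟩, (pow_dvd_pow_of_dvd (dvd_mul_left _ _) 2).trans h2⟩, he⟩
  · intro d _; rfl
lemma prim_Poly (hm : 0 < m) 
    (hF : ∀ x, 0 < x → x ≤ m → StdC x (F x)) : primC0 m F ∈ PolyC m := by
  rw [prim_eq]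
  refine Submodule.sum_mem _ fun d hd => smul_mem _ _ ?_
  obtain ⟨-, k, hk⟩ := mem_filter.1 hd
  have hd0 : 0 < d := Nat.pos_of_ne_zero (by rintro rfl; simp at hk; omega)
  have hk0 : 0 < k := Nat.pos_of_ne_zero (by rintro rfl; omega)
  have e2 : m / d ^ 2 = k := by
    rw [hk]; apply div_eq_of_eq_mul_left (by positivity); ring
  have := UC_Poly hd0 (hF k hk0 (by rw [← e2]; exact Nat.div_le_self _ _)).1
  rw [e2]; convert this using 1; rw [hk, mul_comm]
lemma prim_congr {G : ℕ → ℤ → ℤ → ℂ} (h : ∀ x, x ≤ m → F x = G x) : primC0 m F = primC0 m G := by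
  rw [prim_eq, prim_eq]
  exact sum_congr rfl fun d _ => by rw [h _ (Nat.div_le_self _ _)]
lemma prim_update (hm : 0 < m) (F : ℕ → ℤ → ℤ → ℂ) (C C' : ℤ → ℤ → ℂ) :
    primC0 m (fun x => if x = m then C + C' else F x) = primC0 m (fun x => if x = m then C else F x) + C' := by
  have h1 : 1 ∈ m.divisors.filter (fun d => d ^ 2 ∣ m) := by simp [hm.ne']
  rw [prim_eq, prim_eq, ← add_sum_erase _ _ h1, ← add_sum_erase _ _ h1]
  have : ∀ d ∈ (m.divisors.filter (fun d => d ^ 2 ∣ m)).erase 1, m / d ^ 2 ≠ m := by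
    intro d hd
    simp only [mem_erase, mem_filter, mem_divisors] at hd
    have : 0 < d := pos_of_dvd_of_pos hd.2.1.1 hm
    apply (Nat.div_lt_self hm _).ne
    have : 1 < d := by omega
    nlinarith
  rw [sum_congr rfl (g := fun d => ((moebius d : ℤ) : ℂ) • UC d (F (m / d ^ 2))) (fun d hd => by
    rw [if_neg (this d hd)])]
  conv_rhs => rw [sum_congr rfl (g := fun d => ((moebius d : ℤ) : ℂ) • UC d (F (m / d ^ 2))) (fun d hd => by
    rw [if_neg (this d hd)])]
  simp only [ArithmeticFunction.moebius_apply_one, Int.cast_one, one_smul, one_pow, Nat.div_one, if_true, UC_one]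
  abel
def Good (m : ℕ) (C : ℤ → ℤ → ℂ) : Prop :=
  (∀ D l : ℤ, D < -1 → C D l = 0) ∧ ∀ q : ℕ, q.Prime → q ^ 2 ∣ m → Ep m q C = 0
lemma step (hm : 0 < m) (hF : ∀ x, 0 < x → x < m → StdC x (F x)) :
    ∃ C, StdC m C ∧ Good m (primC0 m (fun x => if x = m then C else F x)) := by
  have hF0 : ∀ x, 0 < x → x ≤ m → StdC x ((fun x => if x = m then toC m (cst m) else F x) x) := fun x h0 h1 => by
    simp only
    split_ifs with h
    · subst h; exact StdC_cst hm
    · exact hF x h0 (by omega)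
  set B := primC0 m (fun x => if x = m then toC m (cst m) else F x) with hB
  have hBP : B ∈ PolyC m := prim_Poly hm hF0
  set L := (m.primeFactors.filter (fun p => p ^ 2 ∣ m)).toList with hLd
  have hL : GoodL m L := fun p hp => by
    rw [hLd, mem_toList, mem_filter] at hp
    exact ⟨Nat.prime_of_mem_primeFactors hp.1, hp.2⟩
  have hL2 : ∀ p, p.Prime → p ^ 2 ∣ m → p ∈ L := fun p hp h => by
    rw [hLd, mem_toList, mem_filter, mem_primeFactors]
    exact ⟨⟨hp, (dvd_pow_self _ two_ne_zero).trans h, hm.ne'⟩, h⟩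
  obtain ⟨j, hj, hg⟩ := growth hm hL hL2 hBP
  have hC0 : piE m L (B - j) - B ∈ Jm m := by
    have := sub_mem (piE_sub hm hL (C := B - j) (fun p hp => by
      rw [map_sub]
      exact sub_mem (cancel hm (hL p hp).1 (hL p hp).2 hF0) (Ep_Jm hm (hL p hp).1 (hL p hp).2 hj))) hj
    convert this using 1; abel
  refine ⟨toC m (cst m) + (piE m L (B - j) - B), (StdC_cst hm).add hC0, ?_⟩
  rw [prim_update hm, ← hB, add_sub_cancel]
  exact ⟨hg, fun q hq h => Ep_piE hL (sub_mem hBP hj.1) (hL2 q hq h)⟩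
def Fam (m : ℕ) : ℤ → ℤ → ℂ :=
  Classical.epsilon (fun C => StdC m C ∧ Good m (primC0 m (fun x => if x = m then C else if x < m then Fam x else 0)))
termination_by m
lemma Fam_spec (m : ℕ) : 0 < m → StdC m (Fam m) ∧ Good m (primC0 m Fam) := by
  induction m using strong_induction_on with
  | _ m ih =>
    intro hm
    have := Classical.epsilon_spec (step hm (F := fun x => if x < m then Fam x else 0) (fun x h0 h1 => by
      simp only [h1, if_true]; exact (ih x h1 h0).1))
    rw [← Fam] at this
    refine ⟨this.1, ?_⟩
    rw [prim_congr (G := fun x => if x = m then Fam m else if x < m then Fam x else 0)]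
    · exact this.2
    intro x hx
    rcases hx.eq_or_lt with h | h
    · simp [h]
    · simp [h, h.ne]

/-- Theorem: the standard index-`m` forms `φ_{2,m}` (with finite parts `Φ_{2,m}`) can be
chosen for all `m ≥ 1` so that every primitive form `Φ⁰_{2,m} = ∑_{d²∣m} μ(d)·Φ_{2,m/d²}|U_d`
has optimal growth (`C(Δ,ℓ) = 0` for `Δ < -1`) and is primitive (`Φ⁰_{2,m}|u_q = 0` for
every prime `q` with `q² ∣ m`). -/
theorem exists_primitive_optimal_growth_choice :
    ∃ (φfam : ℕ → ℂ → ℂ → ℂ) (Cfam : ℕ → ℤ → ℤ → ℂ),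
      (∀ m : ℕ, 0 < m → IsStandardForm m (φfam m) ∧ IsFinitePartCoeffs m (φfam m) (Cfam m)) ∧
      (∀ m : ℕ, 0 < m → ∀ Δ l : ℤ, Δ < -1 → primC0 m Cfam Δ l = 0) ∧
      (∀ m : ℕ, 0 < m → ∀ q : ℕ, q.Prime → q ^ 2 ∣ m → ∀ Δ l : ℤ,
        ∑ j ∈ Finset.range q,
          primC0 m Cfam (Δ * (q : ℤ) ^ 2)
            ((l + 2 * (m : ℤ) / (q : ℤ) ^ 2 * (j : ℤ)) * (q : ℤ)) = 0) := by
  refine ⟨fun m => Phi m (ofC m (Fam m)), Fam, fun m hm => ⟨Phi_std hm (Fam_spec m hm).1.2, ?_⟩,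
    fun m hm => (Fam_spec m hm).2.1, fun m hm q hq h Δ l => ?_⟩
  · have hs := (Fam_spec m hm).1
    refine ⟨hs.1.1, hs.1.2.2.1, fun τ hτ z hz => ?_⟩
    have h1 : Phi m (ofC m (Fam m)) τ z - A2sum m τ z = fser (ofC m (Fam m)) τ z := by
      have : OffL τ z := hz
      simp only [Phi, this, if_true, add_sub_cancel_right]
    simp only [h1]
    exact (hs.2.symC hm).conv.hasSum hτ z
  · have h0 := congrFun (congrFun ((Fam_spec m hm).2.2 q hq h) (Δ * (q : ℤ) ^ 2)) (l * q)
    obtain ⟨k, hk, h2⟩ := two_div hq h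
    have hq0 : (q : ℤ) ≠ 0 := by exact_mod_cast hq.ne_zero
    have hqc : (q : ℂ) ≠ 0 := by exact_mod_cast hq.ne_zero
    rw [Ep_apply, if_pos (dvd_mul_left _ _), h2] at h0
    have h3 : (2 * (m : ℤ) / (q : ℤ) ^ 2) = 2 * k := by
      rw [hk]; push_cast
      rw [← mul_assoc, mul_ediv_cancel _ (pow_ne_zero 2 hq0)]
    rw [h3]
    have h4 := (mul_eq_zero.1 h0).resolve_left (one_div_ne_zero hqc)
    rw [← h4]
    refine sum_congr rfl fun j _ => ?_
    congr 1; ring
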